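/- Let A^{αβ}, for |α| = |β| = m, be simple coefficients (depending only on t), measurable, bounded by K, satisfying the Legendre–Hadamard condition with constant λ > 0. Let u ∈ C^∞(ℝ^{d+1}; ℝⁿ) satisfy ∂_t u + (−1)^m Σ_{|α|=|β|=m} A^{αβ}(t) D^{α+β} u = 0 for almost every (t,x) ∈ Q₂⁺, with u = D_d u = ⋯ = D_d^{m−1} u = 0 on {x_d = 0} ∩ Q₂. Then for every p ∈ (2,∞) there exists a constant C depending only on d, n, m, λ, K, p such that ‖∂_t u‖_{L_p(Q₁⁺)} + Σ_{|γ|≤2m} ‖D^γ u‖_{L_p(Q₁⁺)} ≤ C ‖u‖_{L₂(Q₂⁺)}. -/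

import Mathlib

open MeasureTheory Metric Set Topology

noncomputable section

/-- The parabolic cylinder `Q_r(t₀,x₀) = (t₀ - r^{2m}, t₀) × B_r(x₀)`. -/
def QCyl (d m : ℕ) (r : ℝ) (X : ℝ × EuclideanSpace ℝ (Fin d)) :
    Set (ℝ × EuclideanSpace ℝ (Fin d)) :=
  Set.Ioo (X.1 - r ^ (2 * m)) X.1 ×ˢ Metric.ball X.2 r

/-- The upper-half parabolic cylinder, `i` being the index of the normal direction. -/
def QCylP (d m : ℕ) (i : Fin d) (r : ℝ) (X : ℝ × EuclideanSpace ℝ (Fin d)) :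
    Set (ℝ × EuclideanSpace ℝ (Fin d)) :=
  {p ∈ QCyl d m r X | 0 < p.2 i}

/-- Multi-indices of order exactly `k`. -/
def MIdx (d k : ℕ) : Finset (Fin d → ℕ) :=
  (Fintype.piFinset fun _ : Fin d => Finset.range (k + 1)).filter fun γ => ∑ i, γ i = k

/-- Multi-indices of order at most `k`. -/
def MIdxLe (d k : ℕ) : Finset (Fin d → ℕ) :=
  (Fintype.piFinset fun _ : Fin d => Finset.range (k + 1)).filter fun γ => ∑ i, γ i ≤ k

/-- Multi-indices of order strictly less than `k`. -/
def MIdxLt (d k : ℕ) : Finset (Fin d → ℕ) :=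
  (Fintype.piFinset fun _ : Fin d => Finset.range (k + 1)).filter fun γ => ∑ i, γ i < k

variable {d n : ℕ} {F : Type*} [NormedAddCommGroup F] [NormedSpace ℝ F]

/-- Spatial partial derivative in the `i`-th coordinate direction. -/
def pder (i : Fin d) (u : ℝ × EuclideanSpace ℝ (Fin d) → F) :
    ℝ × EuclideanSpace ℝ (Fin d) → F :=
  fun p => fderiv ℝ (fun y => u (p.1, y)) p.2 (EuclideanSpace.single i 1)

/-- Multi-index spatial derivative `D^γ`. -/
def Dmul (γ : Fin d → ℕ) (u : ℝ × EuclideanSpace ℝ (Fin d) → F) :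
    ℝ × EuclideanSpace ℝ (Fin d) → F :=
  (List.finRange d).foldr (fun i v => (pder i)^[γ i] v) u

/-- Time derivative `∂_t`. -/
def tder (u : ℝ × EuclideanSpace ℝ (Fin d) → F) : ℝ × EuclideanSpace ℝ (Fin d) → F :=
  fun p => deriv (fun s => u (s, p.2)) p.1

/-- The set of difference quotients entering the spatial Hölder seminorm `[f]*_{a,D}`. -/
def sHolderSet (a : ℝ) (D : Set (ℝ × EuclideanSpace ℝ (Fin d)))
    (f : ℝ × EuclideanSpace ℝ (Fin d) → F) : Set ℝ :=
  {c | ∃ p ∈ D, ∃ q ∈ D, p.1 = q.1 ∧ p.2 ≠ q.2 ∧ c = ‖f p - f q‖ / dist p.2 q.2 ^ a}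

/-- The spatial Hölder seminorm `[f]*_{a,D}`. -/
def sHolder (a : ℝ) (D : Set (ℝ × EuclideanSpace ℝ (Fin d)))
    (f : ℝ × EuclideanSpace ℝ (Fin d) → F) : ℝ :=
  sSup (sHolderSet a D f)

/-- The set of difference quotients entering the parabolic Hölder seminorm `[f]_{σ,a,D}`. -/
def pHolderSet (σ a : ℝ) (D : Set (ℝ × EuclideanSpace ℝ (Fin d)))
    (f : ℝ × EuclideanSpace ℝ (Fin d) → F) : Set ℝ :=
  {c | ∃ p ∈ D, ∃ q ∈ D, p ≠ q ∧ c = ‖f p - f q‖ / (|p.1 - q.1| ^ σ + dist p.2 q.2 ^ a)}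

/-- The parabolic Hölder seminorm `[f]_{σ,a,D}`. -/
def pHolder (σ a : ℝ) (D : Set (ℝ × EuclideanSpace ℝ (Fin d)))
    (f : ℝ × EuclideanSpace ℝ (Fin d) → F) : ℝ :=
  sSup (pHolderSet σ a D f)

/-- The set of difference quotients entering the time Hölder seminorm `⟨f⟩_{σ,D}`. -/
def tHolderSet (σ : ℝ) (D : Set (ℝ × EuclideanSpace ℝ (Fin d)))
    (f : ℝ × EuclideanSpace ℝ (Fin d) → F) : Set ℝ :=
  {c | ∃ p ∈ D, ∃ q ∈ D, p.2 = q.2 ∧ p.1 ≠ q.1 ∧ c = ‖f p - f q‖ / |p.1 - q.1| ^ σ}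

/-- The time Hölder seminorm `⟨f⟩_{σ,D}`. -/
def tHolder (σ : ℝ) (D : Set (ℝ × EuclideanSpace ℝ (Fin d)))
    (f : ℝ × EuclideanSpace ℝ (Fin d) → F) : ℝ :=
  sSup (tHolderSet σ D f)

/-- The `L^∞` norm over a set. -/
def LpInf (D : Set (ℝ × EuclideanSpace ℝ (Fin d)))
    (f : ℝ × EuclideanSpace ℝ (Fin d) → F) : ℝ :=
  (eLpNorm f ⊤ (volume.restrict D)).toReal

/-- The `L²` norm over a set. -/
def L2Norm (D : Set (ℝ × EuclideanSpace ℝ (Fin d)))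
    (f : ℝ × EuclideanSpace ℝ (Fin d) → F) : ℝ :=
  (eLpNorm f 2 (volume.restrict D)).toReal

/-- The Legendre–Hadamard ellipticity condition with constant `lam`. -/
def LegHad (d n m : ℕ) (lam : ℝ)
    (B : (Fin d → ℕ) → (Fin d → ℕ) → Fin n → Fin n → ℝ) : Prop :=
  ∀ (ξ : Fin n → ℝ) (η : Fin d → ℝ),
    lam * (∑ i, ξ i ^ 2) * (∑ k, η k ^ 2) ^ m ≤
      ∑ α ∈ MIdx d m, ∑ β ∈ MIdx d m, ∑ i, ∑ j,
        B α β i j * ξ i * ξ j * ((∏ k, η k ^ α k) * ∏ k, η k ^ β k)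

end

section PartialDerivatives

variable {d : ℕ} {F : Type*} [NormedAddCommGroup F] [NormedSpace ℝ F]

/-- Partial derivative in the `i`-th coordinate direction on `ℝ^d`. -/
noncomputable def pd (i : Fin d) (f : (Fin d → ℝ) → F) : (Fin d → ℝ) → F :=
  fun x => fderiv ℝ f x (Pi.single i 1)

/-- Iterated partial derivatives along a list of directions. -/
noncomputable def pdl (l : List (Fin d)) (f : (Fin d → ℝ) → F) : (Fin d → ℝ) → F :=
  l.foldr pd f

@[simp] lemma pdl_nil (f : (Fin d → ℝ) → F) : pdl [] f = f := rfl

@[simp] lemma pdl_cons (i : Fin d) (l : List (Fin d)) (f : (Fin d → ℝ) → F) :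
    pdl (i :: l) f = pd i (pdl l f) := rfl

lemma pdl_append (l l' : List (Fin d)) (f : (Fin d → ℝ) → F) :
    pdl (l ++ l') f = pdl l (pdl l' f) := by
  simp [pdl, List.foldr_append]

lemma ContDiff.pd {f : (Fin d → ℝ) → F} (hf : ContDiff ℝ (⊤ : ℕ∞) f) (i : Fin d) :
    ContDiff ℝ (⊤ : ℕ∞) (pd i f) :=
  (hf.fderiv_right (m := (⊤ : ℕ∞)) (by simp)).clm_apply contDiff_const

lemma ContDiff.pdl {f : (Fin d → ℝ) → F} (hf : ContDiff ℝ (⊤ : ℕ∞) f) (l : List (Fin d)) :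
    ContDiff ℝ (⊤ : ℕ∞) (pdl l f) := by
  induction l with
  | nil => exact hf
  | cons i l ih => exact ih.pd i

lemma HasCompactSupport.pd {f : (Fin d → ℝ) → F} (hf : HasCompactSupport f) (i : Fin d) :
    HasCompactSupport (pd i f) :=
  hf.fderiv_apply ℝ _

lemma pd_add {f g : (Fin d → ℝ) → F} (hf : ContDiff ℝ (⊤ : ℕ∞) f)
    (hg : ContDiff ℝ (⊤ : ℕ∞) g) (i : Fin d) : pd i (f + g) = pd i f + pd i g := by
  ext x
  simp [pd, fderiv_add (hf.differentiable (by simp) x) (hg.differentiable (by simp) x)]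

lemma pd_mul {f g : (Fin d → ℝ) → ℝ} (hf : ContDiff ℝ (⊤ : ℕ∞) f)
    (hg : ContDiff ℝ (⊤ : ℕ∞) g) (i : Fin d) : pd i (f * g) = pd i f * g + f * pd i g := by
  ext x
  simp only [pd, Pi.add_apply, Pi.mul_apply]
  rw [fderiv_mul (hf.differentiable (by simp) x) (hg.differentiable (by simp) x)]
  simp
  ring

lemma pd_smul {f : (Fin d → ℝ) → ℝ} {g : (Fin d → ℝ) → F} (hf : ContDiff ℝ (⊤ : ℕ∞) f)
    (hg : ContDiff ℝ (⊤ : ℕ∞) g) (i : Fin d) :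
    pd i (fun x => f x • g x) = fun x => f x • pd i g x + pd i f x • g x := by
  ext x
  simp only [pd]
  rw [fderiv_fun_smul (hf.differentiable (by simp) x) (hg.differentiable (by simp) x)]
  simp

lemma pd_pow {f : (Fin d → ℝ) → ℝ} (hf : ContDiff ℝ (⊤ : ℕ∞) f) (k : ℕ) (i : Fin d) :
    pd i (fun x => f x ^ k) = fun x => k * f x ^ (k - 1) * pd i f x := by
  ext x
  simp only [pd]
  rw [fderiv_fun_pow k (hf.differentiable (by simp) x)]
  simp [nsmul_eq_mul]

lemma pd_const_mul {f : (Fin d → ℝ) → ℝ} (hf : ContDiff ℝ (⊤ : ℕ∞) f) (c : ℝ) (i : Fin d) :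
    pd i (fun x => c * f x) = fun x => c * pd i f x := by
  ext x
  simp only [pd]
  rw [fderiv_const_mul (hf.differentiable (by simp) x)]
  simp

lemma pd_sum {ι : Type*} (s : Finset ι) {f : ι → (Fin d → ℝ) → F}
    (hf : ∀ k ∈ s, ContDiff ℝ (⊤ : ℕ∞) (f k)) (i : Fin d) :
    pd i (fun x => ∑ k ∈ s, f k x) = fun x => ∑ k ∈ s, pd i (f k) x := by
  ext x
  simp only [pd]
  rw [fderiv_fun_sum fun k hk => (hf k hk).differentiable (by simp) x]
  simp

lemma pd_comm {f : (Fin d → ℝ) → F} (hf : ContDiff ℝ (⊤ : ℕ∞) f) (i j : Fin d) :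
    pd i (pd j f) = pd j (pd i f) := by
  ext x
  have hd : DifferentiableAt ℝ (fderiv ℝ f) x :=
    (hf.fderiv_right (m := (⊤ : ℕ∞)) (by simp)).differentiable (by simp) x
  have key : ∀ v w : Fin d → ℝ, fderiv ℝ (fun y => fderiv ℝ f y v) x w
      = fderiv ℝ (fderiv ℝ f) x w v := by
    intro v w
    rw [fderiv_clm_apply hd (differentiableAt_const _)]
    simp
  have hs : IsSymmSndFDerivAt ℝ f x :=
    hf.contDiffAt.isSymmSndFDerivAt (by simpa using WithTop.coe_le_coe.2 (le_top : (2 : ℕ∞) ≤ ⊤))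
  refine (key _ _).trans ((hs _ _).trans (key _ _).symm)

lemma pd_pdl_comm {f : (Fin d → ℝ) → F} (hf : ContDiff ℝ (⊤ : ℕ∞) f) (i : Fin d)
    (l : List (Fin d)) : pd i (pdl l f) = pdl l (pd i f) := by
  induction l with
  | nil => rfl
  | cons j l ih => rw [pdl_cons, pd_comm (hf.pdl l), ih, pdl_cons]

lemma pdl_perm {f : (Fin d → ℝ) → F} (hf : ContDiff ℝ (⊤ : ℕ∞) f) {l l' : List (Fin d)}
    (h : l.Perm l') : pdl l f = pdl l' f := by
  induction h with
  | nil => rfl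
  | cons x h ih => simp [ih]
  | swap x y l => simp only [pdl_cons]; exact pd_comm (hf.pdl l) _ _
  | trans h h' ih ih' => rw [ih, ih']

end PartialDerivatives

section HalfSpace

variable {d : ℕ} {F : Type*} [NormedAddCommGroup F] [NormedSpace ℝ F]

/-- The open half space `{x_N > 0}` of `ℝ^d`. -/
def halfSp (N : Fin d) : Set (Fin d → ℝ) := {x | 0 < x N}

lemma measurableSet_halfSp (N : Fin d) : MeasurableSet (halfSp N) :=
  (isOpen_lt continuous_const (continuous_apply N)).measurableSet

theorem integral_halfSp_pd [CompleteSpace F] (N i : Fin d) {f : (Fin d → ℝ) → F}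
    (hf : ContDiff ℝ (⊤ : ℕ∞) f)
    (hc : HasCompactSupport f) (h0 : i = N → ∀ x, x N = 0 → f x = 0) :
    ∫ x in halfSp N, pd i f x = 0 := by
  obtain ⟨n, rfl⟩ : ∃ n, d = n + 1 := ⟨d - 1, by have := i.pos; omega⟩
  obtain ⟨R, hR0, hR⟩ : ∃ R : ℝ, 0 < R ∧ ∀ x, f x ≠ 0 → ‖x‖ < R := by
    obtain ⟨R, hR⟩ := hc.isCompact.isBounded.subset_ball 0
    refine ⟨max R 1, by positivity, fun x hx => ?_⟩
    have := hR (subset_tsupport f hx)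
    rw [mem_ball_zero_iff] at this
    exact this.trans_le (le_max_left _ _)
  have hz : ∀ x, R ≤ ‖x‖ → f x = 0 := fun x hx => by
    by_contra h
    exact (hR x h).not_ge hx
  set a : Fin (n + 1) → ℝ := Function.update (fun _ => -R) N 0 with ha
  set b : Fin (n + 1) → ℝ := fun _ => R with hb
  have hle : a ≤ b := by
    intro k
    by_cases hk : k = N
    · subst hk; simp [ha, hb, hR0.le]
    · simp [ha, hb, hk]; linarith
  have hpd : ∀ x, R < ‖x‖ → pd i f x = 0 := by
    intro x hx
    have : f =ᶠ[𝓝 x] fun _ => 0 := by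
      filter_upwards [(isOpen_lt continuous_const continuous_norm).mem_nhds hx] with y hy
      exact hz y (le_of_lt hy)
    simp [pd, this.fderiv_eq]
  have h1 : ∫ x in halfSp N, pd i f x = ∫ x in Icc a b, pd i f x := by
    have e1 : ∫ x in halfSp N, pd i f x = ∫ x in {x : Fin (n+1) → ℝ | 0 ≤ x N}, pd i f x := by
      refine setIntegral_congr_set ?_
      have hnull : volume ({x : Fin (n+1) → ℝ | x N = 0}) = 0 := by
        have := Measure.addHaar_affineSubspace (volume : Measure (Fin (n+1) → ℝ))
          ((LinearMap.ker (LinearMap.proj (R := ℝ) (φ := fun _ : Fin (n+1) => ℝ) N)).toAffineSubspace) (by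
            intro h
            have : (Pi.single N (1:ℝ) : Fin (n+1) → ℝ) ∈ ((LinearMap.ker (LinearMap.proj (R := ℝ) (φ := fun _ : Fin (n+1) => ℝ) N)).toAffineSubspace) := by
              rw [h]; trivial
            simp at this)
        refine (measure_mono_null ?_ this)
        intro x hx
        simpa using hx
      have h2 : ∀ᵐ x : Fin (n+1) → ℝ, x N ≠ 0 := by
        rw [ae_iff]; simpa using hnull
      filter_upwards [h2] with x hx
      apply propext
      show 0 < x N ↔ 0 ≤ x N
      exact ⟨le_of_lt, fun h => lt_of_le_of_ne h (Ne.symm hx)⟩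
    rw [e1]
    refine setIntegral_eq_of_subset_of_forall_sdiff_eq_zero ?_ ?_ ?_
    · exact (isClosed_le (continuous_const (y := (0 : ℝ))) (continuous_apply N)).measurableSet
    · intro x hx
      have := hx.1 N
      simpa [ha] using this
    · rintro x ⟨hx, hx2⟩
      apply hpd
      by_contra hle'
      apply hx2
      rw [not_lt] at hle'
      constructor
      · intro k
        by_cases hk : k = N
        · subst hk; simpa [ha] using hx
        · simp [ha, hk]
          have := (norm_le_pi_norm x k).trans hle'
          rw [Real.norm_eq_abs, abs_le] at this
          exact this.1
      · intro k
        have := (norm_le_pi_norm x k).trans hle'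
        rw [Real.norm_eq_abs, abs_le] at this
        exact this.2
  rw [h1]
  have hdiv := integral_divergence_of_hasFDerivAt_off_countable (E := F) a b hle
    (fun x => Pi.single i (f x))
    (fun x => (ContinuousLinearMap.single ℝ (fun _ : Fin (n+1) => F) i).comp (fderiv ℝ f x)) ∅ countable_empty
    ((ContinuousLinearMap.single ℝ (fun _ : Fin (n+1) => F) i).continuous.comp hf.continuous).continuousOn
    (fun x _ => (ContinuousLinearMap.single ℝ (fun _ : Fin (n+1) => F) i).hasFDerivAt.comp x
      (hf.differentiable (by simp) x).hasFDerivAt)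
    (by
      refine ContinuousOn.integrableOn_Icc ?_
      refine Continuous.continuousOn ?_
      refine continuous_finsetSum _ fun k _ => ?_
      have : Continuous (pd k f) := (hf.pd k).continuous
      exact (continuous_apply k).comp ((ContinuousLinearMap.single ℝ (fun _ : Fin (n+1) => F) i).continuous.comp this))
  have e2 : ∀ x, ∑ k, ((ContinuousLinearMap.single ℝ (fun _ : Fin (n+1) => F) i).comp (fderiv ℝ f x)) (Pi.single k 1) k
      = pd i f x := by
    intro x
    rw [Finset.sum_eq_single i]
    · simp [pd]
    · intro k _ hk
      simp [hk]
    · simp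
  simp only [e2] at hdiv
  rw [hdiv]
  apply Finset.sum_eq_zero
  intro k _
  by_cases hk : k = i
  · subst hk
    have z1 : ∀ x : Fin n → ℝ, f (k.insertNth (b k) x) = 0 := by
      intro x
      apply hz
      have := norm_le_pi_norm (k.insertNth (b k) x : Fin (n+1) → ℝ) k
      simp only [Fin.insertNth_apply_same, hb, Real.norm_eq_abs] at this
      exact (le_abs_self _).trans this
    have z2 : ∀ x : Fin n → ℝ, f (k.insertNth (a k) x) = 0 := by
      intro x
      by_cases hkN : k = N
      · apply h0 hkN
        subst hkN
        simp [ha]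
      · apply hz
        have := norm_le_pi_norm (k.insertNth (a k) x : Fin (n+1) → ℝ) k
        rw [Fin.insertNth_apply_same, Real.norm_eq_abs] at this
        have hak : |a k| = |R| := by simp [ha, hkN]
        rw [hak] at this
        exact (le_abs_self _).trans this
    simp [z1, z2]
  · simp [hk]

end HalfSpace

section FourierCoefficients

attribute [local instance] instMeasureSpaceUnitAddCircle
  instIsAddHaarMeasureUnitAddCircleVolume instIsProbabilityMeasureUnitAddCircleVolume

variable {d : ℕ}

/-- The half-open unit cube centred at the origin. -/
def unitBox (d : ℕ) : Set (Fin d → ℝ) := {x | ∀ i, x i ∈ Ioc (-(1/2) : ℝ) (-(1/2) + 1)}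

/-- The Fourier character `exp(-2πi k·x)` on `ℝ^d`. -/
noncomputable def fchar (k : Fin d → ℤ) (x : Fin d → ℝ) : ℂ :=
  UnitAddTorus.mFourier (-k) (fun i => (x i : UnitAddCircle))

/-- The Fourier coefficient over a set `s` of a real function. -/
noncomputable def fcoef (s : Set (Fin d → ℝ)) (f : (Fin d → ℝ) → ℝ) (k : Fin d → ℤ) : ℂ :=
  ∫ x in s, f x • fchar k x

lemma measurableSet_unitBox : MeasurableSet (unitBox d) :=
  MeasurableSet.univ_pi' (fun _ => measurableSet_Ioc)

lemma hasSum_fcoef_unitBox {f g : (Fin d → ℝ) → ℝ} (hf : Measurable f) (hg : Measurable g)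
    {C : ℝ} (hfC : ∀ x, |f x| ≤ C) (hgC : ∀ x, |g x| ≤ C) :
    HasSum (fun k => (starRingEnd ℂ) (fcoef (unitBox d) f k) * fcoef (unitBox d) g k)
      (((∫ x in unitBox d, f x * g x : ℝ) : ℂ)) := by
  set a : Fin d → ℝ := fun _ => -(1/2) with ha
  have hbox : unitBox d = {x : Fin d → ℝ | ∀ i, x i ∈ Ioc (a i) (a i + 1)} := rfl
  set T : ((Fin d → ℝ) → ℝ) → UnitAddTorus (Fin d) → ℂ :=
    fun f τ => ((f (UnitAddTorus.measurableEquivPiIoc a τ).1 : ℝ) : ℂ) with hT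
  have hTm : ∀ f : (Fin d → ℝ) → ℝ, Measurable f → Measurable (T f) := fun f hf =>
    Complex.measurable_ofReal.comp (hf.comp (measurable_subtype_coe.comp
      (UnitAddTorus.measurableEquivPiIoc a).measurable))
  have hTL : ∀ f : (Fin d → ℝ) → ℝ, Measurable f → (∀ x, |f x| ≤ C) → MemLp (T f) 2 volume :=
    fun f hf hb => MemLp.of_bound (hTm f hf).aestronglyMeasurable C
      (Filter.Eventually.of_forall fun τ => by simpa [hT] using hb _)
  have hTx : ∀ f : (Fin d → ℝ) → ℝ, ∀ x ∈ unitBox d, T f (fun i => (x i : UnitAddCircle)) = f x := by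
    intro f x hx
    have := (UnitAddTorus.measurableEquivPiIoc a).apply_symm_apply ⟨x, hx⟩
    rw [UnitAddTorus.coe_symm_measurableEquivPiIoc_apply] at this
    simp only [hT]
    rw [this]
  have hcoef : ∀ (f : (Fin d → ℝ) → ℝ) (hf : MemLp (T f) 2 volume) (k : Fin d → ℤ),
      UnitAddTorus.mFourierCoeff (hf.toLp (T f)) k = fcoef (unitBox d) f k := by
    intro f hf k
    have : UnitAddTorus.mFourierCoeff (hf.toLp (T f)) k = UnitAddTorus.mFourierCoeff (T f) k := by
      refine integral_congr_ae ?_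
      filter_upwards [hf.coeFn_toLp] with τ hτ
      rw [hτ]
    rw [this, UnitAddTorus.mFourierCoeff_eq_integral _ _ a, ← hbox]
    refine setIntegral_congr_fun measurableSet_unitBox fun x hx => ?_
    simp only [smul_eq_mul]
    rw [hTx f x hx, mul_comm]
    simp [fchar]
  have h := UnitAddTorus.hasSum_prod_mFourierCoeff ((hTL f hf hfC).toLp _) ((hTL g hg hgC).toLp _)
  simp only [hcoef] at h
  convert h using 1
  have e1 : ∫ t, (starRingEnd ℂ) ((hTL f hf hfC).toLp _ t) * ((hTL g hg hgC).toLp _ t)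
      = ∫ t, (starRingEnd ℂ) (T f t) * T g t := by
    refine integral_congr_ae ?_
    filter_upwards [(hTL f hf hfC).coeFn_toLp, (hTL g hg hgC).coeFn_toLp] with τ h1 h2
    rw [h1, h2]
  rw [e1, UnitAddTorus.integral_preimage _ a, ← hbox, ← integral_complex_ofReal]
  refine setIntegral_congr_fun measurableSet_unitBox fun x hx => ?_
  rw [hTx f x hx, hTx g x hx]
  simp

lemma fchar_eq (k : Fin d → ℤ) (x : Fin d → ℝ) :
    fchar k x = Complex.exp (∑ i, (-(2 * Real.pi * k i) * Complex.I) * (x i : ℂ)) := by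
  rw [Complex.exp_sum]
  simp only [fchar, UnitAddTorus.mFourier, ContinuousMap.coe_mk]
  refine Finset.prod_congr rfl fun i _ => ?_
  rw [fourier_coe_apply]
  congr 1
  push_cast [Pi.neg_apply]
  ring

lemma contDiff_fchar (k : Fin d → ℤ) : ContDiff ℝ (⊤ : ℕ∞) (fchar k) := by
  have : fchar k = fun x => Complex.exp (∑ i, (-(2 * Real.pi * k i) * Complex.I) * (x i : ℂ)) :=
    funext (fchar_eq k)
  rw [this]
  refine ContDiff.cexp (ContDiff.sum fun i _ => contDiff_const.mul ?_)
  exact Complex.ofRealCLM.contDiff.comp (contDiff_apply ℝ ℝ i)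

lemma pd_fchar (k : Fin d → ℤ) (i : Fin d) :
    pd i (fchar k) = fun x => -(2 * Real.pi * k i * Complex.I) * fchar k x := by
  ext x
  have h1 : HasFDerivAt (fun x : Fin d → ℝ => ∑ i, (-(2 * Real.pi * k i) * Complex.I) * (x i : ℂ))
      (∑ i, (-(2 * Real.pi * k i) * Complex.I) •
        (Complex.ofRealCLM.comp (ContinuousLinearMap.proj (R := ℝ) (φ := fun _ : Fin d => ℝ) i))) x := by
    refine HasFDerivAt.fun_sum fun i _ => ?_
    exact ((Complex.ofRealCLM.comp (ContinuousLinearMap.proj (R := ℝ) (φ := fun _ : Fin d => ℝ) i)).hasFDerivAt).const_mul _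
  have h2 := h1.cexp
  have : fchar k = fun x => Complex.exp (∑ i, (-(2 * Real.pi * k i) * Complex.I) * (x i : ℂ)) :=
    funext (fchar_eq k)
  simp only [pd]
  rw [this, h2.fderiv]
  simp only [smul_eq_mul, smul_apply, sum_apply,
    ContinuousLinearMap.comp_apply, ContinuousLinearMap.proj_apply, Pi.single_apply,
    Complex.ofRealCLM_apply]
  have e : ∑ j, (-(2 * (Real.pi : ℂ) * (k j : ℂ)) * Complex.I) • (((if j = i then 1 else 0 : ℝ)) : ℂ)
      = -(2 * Real.pi * k i) * Complex.I := by
    rw [Finset.sum_eq_single i (fun j _ hj => by simp [hj]) (by simp)]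
    simp
  simp only [smul_eq_mul] at e
  rw [e]
  ring

lemma fcoef_pd (N i : Fin d) {w : (Fin d → ℝ) → ℝ} (hw : ContDiff ℝ (⊤ : ℕ∞) w)
    (hc : HasCompactSupport w) (h0 : i = N → ∀ x, x N = 0 → w x = 0) (k : Fin d → ℤ) :
    fcoef (halfSp N) (pd i w) k = 2 * Real.pi * k i * Complex.I * fcoef (halfSp N) w k := by
  have hs : ContDiff ℝ (⊤ : ℕ∞) (fun x => w x • fchar k x) := hw.smul (contDiff_fchar k)
  have h := integral_halfSp_pd N i hs hc.smul_right (fun hi x hx => by simp [h0 hi x hx])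
  rw [pd_smul hw (contDiff_fchar k), pd_fchar] at h
  rw [integral_add] at h
  · simp only [fcoef]
    have e : ∫ x in halfSp N, w x • (-(2 * Real.pi * k i * Complex.I) * fchar k x)
        = -(2 * Real.pi * k i * Complex.I) * ∫ x in halfSp N, w x • fchar k x := by
      rw [← integral_const_mul]
      congr 1
      ext x
      simp
      ring
    rw [e] at h
    linear_combination h
  · refine (Continuous.integrable_of_hasCompactSupport ?_ ?_).integrableOn
    · exact hw.continuous.smul (continuous_const.mul (contDiff_fchar k).continuous)
    · exact hc.smul_right
  · refine (Continuous.integrable_of_hasCompactSupport ?_ ?_).integrableOn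
    · exact (hw.pd i).continuous.smul (contDiff_fchar k).continuous
    · exact (hc.pd i).smul_right

lemma HasCompactSupport.pdl {w : (Fin d → ℝ) → ℝ} (hc : HasCompactSupport w) (l : List (Fin d)) :
    HasCompactSupport (pdl l w) := by
  induction l with
  | nil => exact hc
  | cons i l ih => exact ih.pd i

lemma fcoef_pdl (N : Fin d) {w : (Fin d → ℝ) → ℝ} (hw : ContDiff ℝ (⊤ : ℕ∞) w)
    (hc : HasCompactSupport w) {m : ℕ}
    (h0 : ∀ l : List (Fin d), l.length < m → ∀ x, x N = 0 → pdl l w x = 0)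
    (k : Fin d → ℤ) (l : List (Fin d)) (hl : l.length ≤ m) :
    fcoef (halfSp N) (pdl l w) k
      = Complex.I ^ l.length * ((l.map fun i => 2 * Real.pi * (k i : ℝ)).prod : ℝ)
        * fcoef (halfSp N) w k := by
  induction l with
  | nil => simp
  | cons i l ih =>
    rw [pdl_cons, fcoef_pd N i (hw.pdl l) (hc.pdl l) (fun _ x hx => h0 l (by simpa using hl) x hx),
      ih (by simp at hl; omega)]
    simp
    ring

lemma tsupport_pd_subset {F : Type*} [NormedAddCommGroup F] [NormedSpace ℝ F]
    (i : Fin d) (w : (Fin d → ℝ) → F) : tsupport (pd i w) ⊆ tsupport w :=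
  tsupport_fderiv_apply_subset ℝ _

lemma tsupport_pdl_subset {F : Type*} [NormedAddCommGroup F] [NormedSpace ℝ F]
    (l : List (Fin d)) (w : (Fin d → ℝ) → F) : tsupport (pdl l w) ⊆ tsupport w := by
  induction l with
  | nil => exact subset_rfl
  | cons i l ih => exact (tsupport_pd_subset i _).trans ih

lemma hasSum_fcoef_halfSp (N : Fin d) {f g : (Fin d → ℝ) → ℝ} (hf : Continuous f)
    (hg : Continuous g) (hfc : HasCompactSupport f) (hgc : HasCompactSupport g)
    (hfb : tsupport f ⊆ unitBox d) (hgb : tsupport g ⊆ unitBox d) :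
    HasSum (fun k => (starRingEnd ℂ) (fcoef (halfSp N) f k) * fcoef (halfSp N) g k)
      (((∫ x in halfSp N, f x * g x : ℝ) : ℂ)) := by
  obtain ⟨C1, hC1⟩ := hfc.exists_bound_of_continuous hf
  obtain ⟨C2, hC2⟩ := hgc.exists_bound_of_continuous hg
  have hC : ∀ x, |f x| ≤ max C1 C2 := fun x => (hC1 x).trans (le_max_left _ _)
  have hC' : ∀ x, |g x| ≤ max C1 C2 := fun x => (hC2 x).trans (le_max_right _ _)
  have hC0 : 0 ≤ max C1 C2 := (abs_nonneg _).trans (hC 0)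
  have h := hasSum_fcoef_unitBox (hf.measurable.indicator (measurableSet_halfSp N))
    (hg.measurable.indicator (measurableSet_halfSp N)) (C := max C1 C2)
    (fun x => by by_cases hx : x ∈ halfSp N <;> simp [hx, hC, hC0])
    (fun x => by by_cases hx : x ∈ halfSp N <;> simp [hx, hC', hC0])
  have key : ∀ {F : Type} [NormedAddCommGroup F] [NormedSpace ℝ F] (h : (Fin d → ℝ) → F),
      (∀ x, x ∉ unitBox d → h x = 0) →
      ∫ x in unitBox d, (halfSp N).indicator h x = ∫ x in halfSp N, h x := by
    intro F _ _ h hz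
    rw [setIntegral_indicator (measurableSet_halfSp N), inter_comm,
      ← setIntegral_indicator measurableSet_unitBox]
    congr 1
    ext x
    by_cases hx : x ∈ unitBox d
    · simp [hx]
    · simp [hx, hz x hx]
  have hf0 : ∀ x, x ∉ unitBox d → f x = 0 := fun x hx => by
    by_contra hne
    exact hx (hfb (subset_tsupport f hne))
  have hg0 : ∀ x, x ∉ unitBox d → g x = 0 := fun x hx => by
    by_contra hne
    exact hx (hgb (subset_tsupport g hne))
  have e1 : ∀ (f : (Fin d → ℝ) → ℝ), (∀ x, x ∉ unitBox d → f x = 0) → ∀ k,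
      fcoef (unitBox d) ((halfSp N).indicator f) k = fcoef (halfSp N) f k := by
    intro f hf0 k
    simp only [fcoef]
    rw [← key _ (fun x hx => by simp [hf0 x hx])]
    congr 1
    ext x
    by_cases hx : x ∈ halfSp N <;> simp [hx]
  simp only [e1 f hf0, e1 g hg0] at h
  convert h using 2
  rw [← key _ (fun x hx => by simp [hf0 x hx])]
  congr 1
  ext x
  by_cases hx : x ∈ halfSp N <;> simp [hx]

end FourierCoefficients

section Garding

open scoped Pointwise

variable {d n : ℕ} {ι : Type*}

/-- Legendre–Hadamard condition for a form whose derivatives are indexed by lists of directions. -/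
def LHForm (s : Finset ι) (L : ι → List (Fin d)) (m : ℕ) (lam : ℝ)
    (B : ι → ι → Fin n → Fin n → ℝ) : Prop :=
  ∀ (ξ : Fin n → ℝ) (η : Fin d → ℝ),
    lam * (∑ i, ξ i ^ 2) * (∑ k, η k ^ 2) ^ m ≤
      ∑ a ∈ s, ∑ b ∈ s, ∑ i, ∑ j,
        B a b i j * ξ i * ξ j * (((L a).map η).prod * ((L b).map η).prod)

lemma sum_prod_ofFn_sq (η : Fin d → ℝ) (m : ℕ) :
    ∑ f : Fin m → Fin d, (((List.ofFn f).map η).prod) ^ 2 = (∑ k, η k ^ 2) ^ m := by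
  rw [Fintype.sum_pow]
  refine Finset.sum_congr rfl fun f _ => ?_
  rw [List.map_ofFn, List.prod_ofFn, ← Finset.prod_pow]
  rfl

lemma hasSum_pdl_halfSp (N : Fin d) {m : ℕ} {v w : (Fin d → ℝ) → ℝ}
    (hv : ContDiff ℝ (⊤ : ℕ∞) v) (hw : ContDiff ℝ (⊤ : ℕ∞) w)
    (hvc : HasCompactSupport v) (hwc : HasCompactSupport w)
    (hvb : tsupport v ⊆ unitBox d) (hwb : tsupport w ⊆ unitBox d)
    (hv0 : ∀ l : List (Fin d), l.length < m → ∀ x, x N = 0 → pdl l v x = 0)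
    (hw0 : ∀ l : List (Fin d), l.length < m → ∀ x, x N = 0 → pdl l w x = 0)
    {l l' : List (Fin d)} (hl : l.length = m) (hl' : l'.length = m) :
    HasSum (fun k : Fin d → ℤ =>
      ((l.map fun i => 2 * Real.pi * (k i : ℝ)).prod * (l'.map fun i => 2 * Real.pi * (k i : ℝ)).prod)
        * ((fcoef (halfSp N) v k).re * (fcoef (halfSp N) w k).re
          + (fcoef (halfSp N) v k).im * (fcoef (halfSp N) w k).im))
      (∫ x in halfSp N, pdl l v x * pdl l' w x) := by
  have h := hasSum_fcoef_halfSp N (hv.pdl l).continuous (hw.pdl l').continuous (hvc.pdl l)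
    (hwc.pdl l') ((tsupport_pdl_subset _ _).trans hvb) ((tsupport_pdl_subset _ _).trans hwb)
  have h2 := Complex.hasSum_re h
  rw [Complex.ofReal_re] at h2
  convert h2 using 1
  ext k
  rw [fcoef_pdl N hv hvc hv0 k l hl.le, fcoef_pdl N hw hwc hw0 k l' hl'.le, hl, hl']
  have hI : (starRingEnd ℂ) (Complex.I ^ m) * Complex.I ^ m = 1 := by
    rw [← Complex.normSq_eq_conj_mul_self]
    simp
  set p := (l.map fun i => 2 * Real.pi * (k i : ℝ)).prod
  set q := (l'.map fun i => 2 * Real.pi * (k i : ℝ)).prod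
  set a := fcoef (halfSp N) v k
  set b := fcoef (halfSp N) w k
  have : (starRingEnd ℂ) (Complex.I ^ m * (p : ℂ) * a) * (Complex.I ^ m * (q : ℂ) * b)
      = ((p * q : ℝ) : ℂ) * ((starRingEnd ℂ) a * b) := by
    simp only [map_mul, Complex.conj_ofReal]
    push_cast
    linear_combination (p * q * (starRingEnd ℂ) a * b : ℂ) * hI
  rw [this, Complex.re_ofReal_mul]
  simp

lemma garding_unitBox (N : Fin d) {m : ℕ} {lam : ℝ} {s : Finset ι} {L : ι → List (Fin d)}
    (hL : ∀ a ∈ s, (L a).length = m) {B : ι → ι → Fin n → Fin n → ℝ}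
    (hB : LHForm s L m lam B) {w : Fin n → (Fin d → ℝ) → ℝ}
    (hw : ∀ i, ContDiff ℝ (⊤ : ℕ∞) (w i)) (hc : ∀ i, HasCompactSupport (w i))
    (hb : ∀ i, tsupport (w i) ⊆ unitBox d)
    (h0 : ∀ i, ∀ l : List (Fin d), l.length < m → ∀ x, x N = 0 → pdl l (w i) x = 0) :
    lam * ∑ i, ∑ f : Fin m → Fin d, ∫ x in halfSp N, pdl (List.ofFn f) (w i) x ^ 2 ≤
      ∑ a ∈ s, ∑ b ∈ s, ∑ i, ∑ j,
        B a b i j * ∫ x in halfSp N, pdl (L a) (w i) x * pdl (L b) (w j) x := by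
  have key := fun (i j : Fin n) {l l' : List (Fin d)} (hl : l.length = m) (hl' : l'.length = m) =>
    hasSum_pdl_halfSp N (hw i) (hw j) (hc i) (hc j) (hb i) (hb j) (h0 i) (h0 j) hl hl'
  have h1 : HasSum _ (lam * ∑ i, ∑ f : Fin m → Fin d,
      ∫ x in halfSp N, pdl (List.ofFn f) (w i) x * pdl (List.ofFn f) (w i) x) :=
    (hasSum_sum fun i _ => hasSum_sum fun f _ =>
      key i i (List.length_ofFn (f := f)) (List.length_ofFn (f := f))).mul_left lam
  have h2 : HasSum _ (∑ a ∈ s, ∑ b ∈ s, ∑ i, ∑ j,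
        B a b i j * ∫ x in halfSp N, pdl (L a) (w i) x * pdl (L b) (w j) x) :=
    hasSum_sum fun a ha => hasSum_sum fun b hb => hasSum_sum fun i _ => hasSum_sum fun j _ =>
      (key i j (hL a ha) (hL b hb)).mul_left (B a b i j)
  simp only [pow_two]
  refine hasSum_le (fun k => ?_) h1 h2
  set η : Fin d → ℝ := fun i => 2 * Real.pi * (k i : ℝ)
  set r : Fin n → ℝ := fun i => (fcoef (halfSp N) (w i) k).re
  set q : Fin n → ℝ := fun i => (fcoef (halfSp N) (w i) k).im
  have hr := hB r η
  have hq := hB q η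
  have e1 : lam * ∑ i, ∑ f : Fin m → Fin d, ((List.ofFn f).map η).prod * ((List.ofFn f).map η).prod
      * (r i * r i + q i * q i) = lam * (∑ i, r i ^ 2) * (∑ k, η k ^ 2) ^ m
        + lam * (∑ i, q i ^ 2) * (∑ k, η k ^ 2) ^ m := by
    rw [← sum_prod_ofFn_sq]
    simp only [Finset.mul_sum, Finset.sum_mul]
    rw [← Finset.sum_add_distrib, Finset.sum_comm]
    refine Finset.sum_congr rfl fun f _ => ?_
    rw [← Finset.sum_add_distrib]
    refine Finset.sum_congr rfl fun i _ => ?_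
    ring
  refine e1.le.trans ((add_le_add hr hq).trans (le_of_eq ?_))
  simp only [← Finset.sum_add_distrib]
  refine Finset.sum_congr rfl fun a _ => Finset.sum_congr rfl fun b _ =>
    Finset.sum_congr rfl fun i _ => Finset.sum_congr rfl fun j _ => ?_
  simp only [r, q, η]
  ring

lemma pd_comp_smul {w : (Fin d → ℝ) → ℝ} (hw : ContDiff ℝ (⊤ : ℕ∞) w) (c : ℝ) (i : Fin d) :
    pd i (fun x => w (c • x)) = fun x => c * pd i w (c • x) := by
  ext x
  simp only [pd]
  have h : HasFDerivAt (fun x : Fin d → ℝ => w (c • x))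
      ((fderiv ℝ w (c • x)).comp (c • ContinuousLinearMap.id ℝ (Fin d → ℝ))) x :=
    (hw.differentiable (by simp) (c • x)).hasFDerivAt.comp x
      ((hasFDerivAt_id x).const_smul c)
  rw [h.fderiv]
  simp

lemma pdl_comp_smul {w : (Fin d → ℝ) → ℝ} (hw : ContDiff ℝ (⊤ : ℕ∞) w) (c : ℝ)
    (l : List (Fin d)) :
    pdl l (fun x => w (c • x)) = fun x => c ^ l.length * pdl l w (c • x) := by
  induction l with
  | nil => simp
  | cons i l ih =>
    have h : ContDiff ℝ (⊤ : ℕ∞) fun x : Fin d → ℝ => pdl l w (c • x) :=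
      (hw.pdl l).comp (contDiff_const_smul c)
    rw [pdl_cons, ih, pd_const_mul h, pd_comp_smul (hw.pdl l)]
    ext x
    simp
    ring

lemma smul_halfSp (N : Fin d) {c : ℝ} (hc : 0 < c) : c • halfSp N = halfSp N := by
  ext x
  rw [Set.mem_smul_set_iff_inv_smul_mem₀ hc.ne']
  simp [halfSp, hc]

/-- Gårding's inequality on the half space, for constant coefficients and functions supported in
the cube `(-2,2)^d`. -/
lemma garding (N : Fin d) {m : ℕ} {lam : ℝ} {s : Finset ι} {L : ι → List (Fin d)}
    (hL : ∀ a ∈ s, (L a).length = m) {B : ι → ι → Fin n → Fin n → ℝ}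
    (hB : LHForm s L m lam B) {w : Fin n → (Fin d → ℝ) → ℝ}
    (hw : ∀ i, ContDiff ℝ (⊤ : ℕ∞) (w i)) (hc : ∀ i, HasCompactSupport (w i))
    (hb : ∀ i, ∀ x ∈ tsupport (w i), ∀ j, |x j| < 2)
    (h0 : ∀ i, ∀ l : List (Fin d), l.length < m → ∀ x, x N = 0 → pdl l (w i) x = 0) :
    lam * ∑ i, ∑ f : Fin m → Fin d, ∫ x in halfSp N, pdl (List.ofFn f) (w i) x ^ 2 ≤
      ∑ a ∈ s, ∑ b ∈ s, ∑ i, ∑ j,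
        B a b i j * ∫ x in halfSp N, pdl (L a) (w i) x * pdl (L b) (w j) x := by
  have h := garding_unitBox (w := fun i x => w i ((4 : ℝ) • x)) N hL hB
    (fun i => (hw i).comp (contDiff_const_smul (4 : ℝ)))
    (fun i => (hc i).comp_smul (by norm_num))
    (fun i x hx => by
      have h1 : (4 : ℝ) • x ∈ tsupport (w i) :=
        tsupport_comp_subset_preimage (w i) (f := fun x : Fin d → ℝ => (4 : ℝ) • x)
          (by fun_prop) hx
      intro j
      have h2 := abs_lt.1 (hb i _ h1 j)
      simp only [Pi.smul_apply, smul_eq_mul] at h2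
      constructor <;> linarith [h2.1, h2.2])
    (fun i l hl x hx => by
      rw [pdl_comp_smul (hw i)]
      simp [h0 i l hl ((4 : ℝ) • x) (by simp [hx])])
  have key : ∀ g : (Fin d → ℝ) → ℝ, ∫ x in halfSp N, g ((4 : ℝ) • x)
      = ((4 : ℝ) ^ d)⁻¹ * ∫ x in halfSp N, g x := by
    intro g
    have := Measure.setIntegral_comp_smul_of_pos volume g (halfSp N) (R := (4 : ℝ)) (by norm_num)
    rw [this, smul_halfSp N (c := (4 : ℝ)) (by norm_num)]
    simp
  have e1 : ∀ i (f : Fin m → Fin d),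
      ∫ x in halfSp N, pdl (List.ofFn f) (fun x => w i ((4 : ℝ) • x)) x ^ 2
      = (4 ^ m * 4 ^ m * ((4 : ℝ) ^ d)⁻¹) * ∫ x in halfSp N, pdl (List.ofFn f) (w i) x ^ 2 := by
    intro i f
    rw [pdl_comp_smul (hw i), List.length_ofFn, mul_assoc, ← key, ← integral_const_mul]
    congr 1
    ext x
    ring
  have e2 : ∀ a ∈ s, ∀ b ∈ s, ∀ i j,
      ∫ x in halfSp N, pdl (L a) (fun x => w i ((4 : ℝ) • x)) x
        * pdl (L b) (fun x => w j ((4 : ℝ) • x)) x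
      = (4 ^ m * 4 ^ m * ((4 : ℝ) ^ d)⁻¹) * ∫ x in halfSp N, pdl (L a) (w i) x * pdl (L b) (w j) x := by
    intro a ha b hb i j
    rw [pdl_comp_smul (hw i), pdl_comp_smul (hw j), hL a ha, hL b hb, mul_assoc,
      ← key fun x => pdl (L a) (w i) x * pdl (L b) (w j) x, ← integral_const_mul]
    congr 1
    ext x
    ring
  have e3 : ∑ a ∈ s, ∑ b ∈ s, ∑ i, ∑ j,
        B a b i j * ∫ x in halfSp N, pdl (L a) (fun x => w i ((4 : ℝ) • x)) x
        * pdl (L b) (fun x => w j ((4 : ℝ) • x)) x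
      = (4 ^ m * 4 ^ m * ((4 : ℝ) ^ d)⁻¹) * ∑ a ∈ s, ∑ b ∈ s, ∑ i, ∑ j,
        B a b i j * ∫ x in halfSp N, pdl (L a) (w i) x * pdl (L b) (w j) x := by
    simp only [Finset.mul_sum]
    refine Finset.sum_congr rfl fun a ha => Finset.sum_congr rfl fun b hb =>
      Finset.sum_congr rfl fun i _ => Finset.sum_congr rfl fun j _ => ?_
    rw [e2 a ha b hb]
    ring
  rw [e3] at h
  simp only [e1, ← Finset.mul_sum] at h
  have hpos : (0 : ℝ) < 4 ^ m * 4 ^ m * ((4 : ℝ) ^ d)⁻¹ := by positivity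
  refine le_of_mul_le_mul_left ?_ hpos
  linarith

end Garding

section Leibniz

variable {d : ℕ}

lemma pdl_add {f g : (Fin d → ℝ) → ℝ} (hf : ContDiff ℝ (⊤ : ℕ∞) f)
    (hg : ContDiff ℝ (⊤ : ℕ∞) g) (l : List (Fin d)) : pdl l (f + g) = pdl l f + pdl l g := by
  induction l with
  | nil => rfl
  | cons i l ih => rw [pdl_cons, ih, pd_add (hf.pdl l) (hg.pdl l), pdl_cons, pdl_cons]

/-- Sum of the absolute values of all partial derivatives of order `k`. -/
noncomputable def derivSum (k : ℕ) (V : (Fin d → ℝ) → ℝ) (x : Fin d → ℝ) : ℝ :=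
  ∑ f : Fin k → Fin d, |pdl (List.ofFn f) V x|

/-- Sum of the squares of all partial derivatives of order `k`. -/
noncomputable def derivSq (k : ℕ) (V : (Fin d → ℝ) → ℝ) (x : Fin d → ℝ) : ℝ :=
  ∑ f : Fin k → Fin d, pdl (List.ofFn f) V x ^ 2

lemma derivSum_nonneg (k : ℕ) (V : (Fin d → ℝ) → ℝ) (x : Fin d → ℝ) : 0 ≤ derivSum k V x :=
  Finset.sum_nonneg fun _ _ => abs_nonneg _

lemma derivSq_nonneg (k : ℕ) (V : (Fin d → ℝ) → ℝ) (x : Fin d → ℝ) : 0 ≤ derivSq k V x :=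
  Finset.sum_nonneg fun _ _ => sq_nonneg _

lemma abs_pdl_le_derivSum (l : List (Fin d)) (V : (Fin d → ℝ) → ℝ) (x : Fin d → ℝ) :
    |pdl l V x| ≤ derivSum l.length V x := by
  have := Finset.single_le_sum (f := fun f : Fin l.length → Fin d => |pdl (List.ofFn f) V x|)
    (fun _ _ => abs_nonneg _) (Finset.mem_univ l.get)
  simpa [derivSum, List.ofFn_get] using this

lemma sq_pdl_le_derivSq (l : List (Fin d)) (V : (Fin d → ℝ) → ℝ) (x : Fin d → ℝ) :
    pdl l V x ^ 2 ≤ derivSq l.length V x := by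
  have := Finset.single_le_sum (f := fun f : Fin l.length → Fin d => pdl (List.ofFn f) V x ^ 2)
    (fun _ _ => sq_nonneg _) (Finset.mem_univ l.get)
  simpa [derivSq, List.ofFn_get] using this

lemma derivSum_sq_le (k : ℕ) (V : (Fin d → ℝ) → ℝ) (x : Fin d → ℝ) :
    derivSum k V x ^ 2 ≤ (d : ℝ) ^ k * derivSq k V x := by
  have := sq_sum_le_card_mul_sum_sq (s := (Finset.univ : Finset (Fin k → Fin d)))
    (f := fun f => |pdl (List.ofFn f) V x|)
  simpa [derivSum, derivSq] using this

lemma derivSum_pd_le {V : (Fin d → ℝ) → ℝ} (hV : ContDiff ℝ (⊤ : ℕ∞) V) (k : ℕ) (i : Fin d)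
    (x : Fin d → ℝ) : derivSum k (pd i V) x ≤ derivSum (k + 1) V x := by
  have e : ∀ f : Fin k → Fin d, pdl (List.ofFn f) (pd i V) x
      = pdl (List.ofFn (Fin.cons i f : Fin (k + 1) → Fin d)) V x := by
    intro f
    rw [List.ofFn_succ]
    simp [pd_pdl_comm hV]
  simp only [derivSum, e]
  have hinj : Function.Injective fun f : Fin k → Fin d => (Fin.cons i f : Fin (k + 1) → Fin d) :=
    fun f g h => Fin.cons_right_injective (α := fun _ => Fin d) i h
  rw [← Finset.sum_image (s := Finset.univ) (f := fun g : Fin (k + 1) → Fin d => |pdl (List.ofFn g) V x|)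
    (fun a _ b _ h => hinj h)]
  exact Finset.sum_le_sum_of_subset_of_nonneg (Finset.subset_univ _) fun _ _ _ => abs_nonneg _

/-- The weighted sums of derivatives appearing in the Leibniz rule. -/
noncomputable def lowSum (ψ V : (Fin d → ℝ) → ℝ) (e l : ℕ) (x : Fin d → ℝ) : ℝ :=
  ∑ k ∈ Finset.range l, |ψ x| ^ (e + k) * derivSum k V x

lemma lowSum_nonneg (ψ V : (Fin d → ℝ) → ℝ) (e l : ℕ) (x : Fin d → ℝ) : 0 ≤ lowSum ψ V e l x :=
  Finset.sum_nonneg fun k _ => mul_nonneg (by positivity) (derivSum_nonneg _ _ _)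

lemma lowSum_pd_le {ψ V : (Fin d → ℝ) → ℝ} (hV : ContDiff ℝ (⊤ : ℕ∞) V) (e l : ℕ) (i : Fin d)
    (x : Fin d → ℝ) : lowSum ψ (pd i V) (e + 1) l x ≤ lowSum ψ V e (l + 1) x := by
  have h1 : lowSum ψ (pd i V) (e + 1) l x
      ≤ ∑ k ∈ Finset.range l, |ψ x| ^ (e + (k + 1)) * derivSum (k + 1) V x := by
    refine Finset.sum_le_sum fun k _ => ?_
    rw [show e + 1 + k = e + (k + 1) by ring]
    exact mul_le_mul_of_nonneg_left (derivSum_pd_le hV k i x) (by positivity)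
  refine h1.trans ?_
  rw [lowSum, Finset.sum_range_succ' _ l]
  have : 0 ≤ |ψ x| ^ (e + 0) * derivSum 0 V x := mul_nonneg (by positivity) (derivSum_nonneg _ _ _)
  linarith

lemma abs_pdl_mul_pow_le {ψ : (Fin d → ℝ) → ℝ} (hψ : ContDiff ℝ (⊤ : ℕ∞) ψ)
    {S : Set (Fin d → ℝ)} (hS : IsCompact S) (α : List (Fin d)) :
    ∀ (e : ℕ) (c : (Fin d → ℝ) → ℝ), ContDiff ℝ (⊤ : ℕ∞) c → ∃ C, 0 ≤ C ∧
      ∀ V : (Fin d → ℝ) → ℝ, ContDiff ℝ (⊤ : ℕ∞) V → ∀ x ∈ S,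
        |pdl α (fun x => c x * (ψ x ^ (e + α.length) * V x)) x|
          ≤ C * lowSum ψ V e (α.length + 1) x := by
  induction α with
  | nil =>
    intro e c hc
    obtain ⟨C, hC⟩ := hS.exists_bound_of_continuousOn hc.continuous.continuousOn
    refine ⟨max C 0, le_max_right _ _, fun V hV x hx => ?_⟩
    simp only [pdl_nil, lowSum, derivSum, List.length_nil, zero_add, Finset.sum_range_one, add_zero]
    rw [abs_mul, abs_mul, abs_pow]
    simp only [Finset.univ_unique, Finset.sum_singleton, List.ofFn_zero, pdl_nil]
    exact mul_le_mul_of_nonneg_right ((hC x hx).trans (le_max_left _ _)) (by positivity)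
  | cons i α ih =>
    intro e c hc
    set c1 : (Fin d → ℝ) → ℝ := pd i c * ψ + (fun x => ((e + α.length + 1 : ℕ) : ℝ) * c x) * pd i ψ
      with hc1
    have hc1s : ContDiff ℝ (⊤ : ℕ∞) c1 :=
      ((hc.pd i).mul hψ).add ((contDiff_const.mul hc).mul (hψ.pd i))
    obtain ⟨C1, hC1, h1⟩ := ih e c1 hc1s
    obtain ⟨C2, hC2, h2⟩ := ih (e + 1) c hc
    refine ⟨C1 + C2, by positivity, fun V hV x hx => ?_⟩
    have hp : ∀ k, ContDiff ℝ (⊤ : ℕ∞) fun x => ψ x ^ k := fun k => hψ.pow k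
    have e1 : pd i (fun x => c x * (ψ x ^ (e + (i :: α).length) * V x))
        = (fun x => c1 x * (ψ x ^ (e + α.length) * V x))
          + fun x => c x * (ψ x ^ (e + 1 + α.length) * pd i V x) := by
      have a1 : (fun x => c x * (ψ x ^ (e + (i :: α).length) * V x))
          = c * ((fun x => ψ x ^ (e + α.length + 1)) * V) := by
        ext x; simp [add_assoc]
      have sV : ContDiff ℝ (⊤ : ℕ∞) ((fun x => ψ x ^ (e + α.length + 1)) * V) := (hp _).mul hV
      rw [a1, pd_mul hc sV, pd_mul (hp _) hV, pd_pow hψ]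
      ext x
      simp only [Pi.add_apply, Pi.mul_apply, hc1, Nat.add_sub_cancel]
      ring
    have s1 : ContDiff ℝ (⊤ : ℕ∞) (fun x => c1 x * (ψ x ^ (e + α.length) * V x)) :=
      hc1s.mul ((hp _).mul hV)
    have s2 : ContDiff ℝ (⊤ : ℕ∞) (fun x => c x * (ψ x ^ (e + 1 + α.length) * pd i V x)) :=
      hc.mul ((hp _).mul (hV.pd i))
    have s0 : ContDiff ℝ (⊤ : ℕ∞) (fun x => c x * (ψ x ^ (e + (i :: α).length) * V x)) :=
      hc.mul ((hp _).mul hV)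
    rw [pdl_cons, pd_pdl_comm s0, e1, pdl_add s1 s2]
    refine (abs_add_le _ _).trans ?_
    have b1 := h1 V hV x hx
    have b2 := (h2 (pd i V) (hV.pd i) x hx).trans
      (mul_le_mul_of_nonneg_left (lowSum_pd_le hV e (α.length + 1) i x) hC2)
    have b3 : lowSum ψ V e (α.length + 1) x ≤ lowSum ψ V e (α.length + 1 + 1) x :=
      Finset.sum_le_sum_of_subset_of_nonneg (by simp) fun k _ _ =>
        mul_nonneg (by positivity) (derivSum_nonneg _ _ _)
    have b4 := mul_le_mul_of_nonneg_left b3 hC1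
    simp only [List.length_cons]
    linarith

lemma abs_pdl_pow_mul_sub_le {ψ : (Fin d → ℝ) → ℝ} (hψ : ContDiff ℝ (⊤ : ℕ∞) ψ)
    {S : Set (Fin d → ℝ)} (hS : IsCompact S) (α : List (Fin d)) :
    ∀ (e : ℕ), ∃ C, 0 ≤ C ∧
      ∀ V : (Fin d → ℝ) → ℝ, ContDiff ℝ (⊤ : ℕ∞) V → ∀ x ∈ S,
        |pdl α (fun x => ψ x ^ (e + α.length) * V x) x - ψ x ^ (e + α.length) * pdl α V x|
          ≤ C * lowSum ψ V e α.length x := by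
  induction α with
  | nil => exact fun e => ⟨0, le_rfl, fun V hV x hx => by simp⟩
  | cons i α ih =>
    intro e
    obtain ⟨C1, hC1, h1⟩ := abs_pdl_mul_pow_le hψ hS α e
      (fun x => ((e + α.length + 1 : ℕ) : ℝ) * pd i ψ x) (contDiff_const.mul (hψ.pd i))
    obtain ⟨C2, hC2, h2⟩ := ih (e + 1)
    refine ⟨C1 + C2, by positivity, fun V hV x hx => ?_⟩
    have hp : ∀ k, ContDiff ℝ (⊤ : ℕ∞) fun x => ψ x ^ k := fun k => hψ.pow k
    have e1 : pd i (fun x => ψ x ^ (e + (i :: α).length) * V x)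
        = (fun x => (((e + α.length + 1 : ℕ) : ℝ) * pd i ψ x) * (ψ x ^ (e + α.length) * V x))
          + fun x => ψ x ^ (e + 1 + α.length) * pd i V x := by
      have a1 : (fun x => ψ x ^ (e + (i :: α).length) * V x)
          = (fun x => ψ x ^ (e + α.length + 1)) * V := by
        ext x; simp [add_assoc]
      rw [a1, pd_mul (hp _) hV, pd_pow hψ]
      ext x
      simp only [Pi.add_apply, Pi.mul_apply, Nat.add_sub_cancel]
      ring
    have s1 : ContDiff ℝ (⊤ : ℕ∞)
        (fun x => (((e + α.length + 1 : ℕ) : ℝ) * pd i ψ x) * (ψ x ^ (e + α.length) * V x)) :=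
      (contDiff_const.mul (hψ.pd i)).mul ((hp _).mul hV)
    have s2 : ContDiff ℝ (⊤ : ℕ∞) (fun x => ψ x ^ (e + 1 + α.length) * pd i V x) :=
      (hp _).mul (hV.pd i)
    have s0 : ContDiff ℝ (⊤ : ℕ∞) (fun x => ψ x ^ (e + (i :: α).length) * V x) :=
      (hp _).mul hV
    rw [pdl_cons, pd_pdl_comm s0, e1, pdl_add s1 s2, pdl_cons, pd_pdl_comm hV, Pi.add_apply,
      add_sub_assoc]
    refine (abs_add_le _ _).trans ?_
    have b1 := h1 V hV x hx
    have b2 := (h2 (pd i V) (hV.pd i) x hx).trans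
      (mul_le_mul_of_nonneg_left (lowSum_pd_le hV e α.length i x) hC2)
    simp only [List.length_cons]
    rw [show e + (α.length + 1) = e + 1 + α.length by ring]
    linarith

end Leibniz

section EnergyForm

variable {d n : ℕ}

lemma exists_ofFn_eq {m : ℕ} {l : List (Fin d)} (hl : l.length = m) :
    ∃ f : Fin m → Fin d, List.ofFn f = l := by
  subst hl
  exact ⟨l.get, List.ofFn_get l⟩

lemma integral_halfSp_mul_pdl (N : Fin d) (l : List (Fin d)) {f g : (Fin d → ℝ) → ℝ}
    (hf : ContDiff ℝ (⊤ : ℕ∞) f) (hc : HasCompactSupport f) (hg : ContDiff ℝ (⊤ : ℕ∞) g)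
    (h0 : ∀ l' : List (Fin d), l'.length < l.length → ∀ x, x N = 0 → pdl l' f x = 0) :
    ∫ x in halfSp N, f x * pdl l g x = (-1) ^ l.length * ∫ x in halfSp N, pdl l f x * g x := by
  induction l generalizing f with
  | nil => simp
  | cons i l ih =>
    have h := integral_halfSp_pd N i (hf.mul (hg.pdl l)) hc.mul_right
      (fun _ x hx => by
        have := h0 [] (by simp) x hx
        rw [pdl_nil] at this
        simp [this])
    have e := pd_mul hf (hg.pdl l) i
    have e' : pd i (fun x => f x * pdl l g x) = pd i f * pdl l g + f * pd i (pdl l g) := e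
    have i1 : IntegrableOn (fun x => pd i f x * pdl l g x) (halfSp N) :=
      (((hf.pd i).continuous.mul (hg.pdl l).continuous).integrable_of_hasCompactSupport
        (hc.pd i).mul_right).integrableOn
    have i2 : IntegrableOn (fun x => f x * pd i (pdl l g) x) (halfSp N) :=
      ((hf.continuous.mul ((hg.pdl l).pd i).continuous).integrable_of_hasCompactSupport
        hc.mul_right).integrableOn
    rw [e'] at h
    simp only [Pi.add_apply, Pi.mul_apply] at h
    rw [integral_add i1 i2] at h
    have h2 := ih (hf.pd i) (hc.pd i) (fun l' hl' x hx => by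
      rw [← pd_pdl_comm hf, ← pdl_cons]
      exact h0 (i :: l') (by simpa using hl') x hx)
    rw [h2, ← pd_pdl_comm hf] at h
    simp only [pdl_cons, List.length_cons, pow_succ]
    linarith

lemma exists_pdl_pow_mul_bound {ψ : (Fin d → ℝ) → ℝ} (hψ : ContDiff ℝ (⊤ : ℕ∞) ψ)
    {S : Set (Fin d → ℝ)} (hS : IsCompact S) (m e : ℕ) :
    ∃ C, 0 ≤ C ∧ ∀ l : List (Fin d), l.length = m →
      ∀ V : (Fin d → ℝ) → ℝ, ContDiff ℝ (⊤ : ℕ∞) V → ∀ x ∈ S,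
        |pdl l (fun x => ψ x ^ (e + m) * V x) x - ψ x ^ (e + m) * pdl l V x|
          ≤ C * (|ψ x| ^ e * lowSum ψ V 0 m x) := by
  choose C hC h using fun f : Fin m → Fin d => abs_pdl_pow_mul_sub_le hψ hS (List.ofFn f) e
  refine ⟨∑ f, C f, Finset.sum_nonneg fun f _ => hC f, fun l hl V hV x hx => ?_⟩
  obtain ⟨f, rfl⟩ := exists_ofFn_eq hl
  have h1 := h f V hV x hx
  simp only [List.length_ofFn] at h1
  have e1 : lowSum ψ V e m x = |ψ x| ^ e * lowSum ψ V 0 m x := by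
    simp only [lowSum, Finset.mul_sum]
    refine Finset.sum_congr rfl fun k _ => ?_
    rw [zero_add, pow_add]
    ring
  rw [e1] at h1
  refine h1.trans (mul_le_mul_of_nonneg_right ?_
    (mul_nonneg (by positivity) (lowSum_nonneg _ _ _ _ _)))
  exact Finset.single_le_sum (f := C) (fun f _ => hC f) (Finset.mem_univ f)

lemma lowSum_sq_le (ψ V : (Fin d → ℝ) → ℝ) (m : ℕ) (x : Fin d → ℝ) :
    lowSum ψ V 0 m x ^ 2
      ≤ (m * (d + 1 : ℝ) ^ m) * ∑ k ∈ Finset.range m, ψ x ^ (2 * k) * derivSq k V x := by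
  have h := sq_sum_le_card_mul_sum_sq (s := Finset.range m)
    (f := fun k => |ψ x| ^ (0 + k) * derivSum k V x)
  rw [lowSum]
  refine h.trans ?_
  rw [Finset.card_range, mul_assoc]
  refine mul_le_mul_of_nonneg_left ?_ (by positivity)
  rw [Finset.mul_sum]
  refine Finset.sum_le_sum fun k hk => ?_
  have hk' : k ≤ m := (Finset.mem_range.1 hk).le
  have e1 : (|ψ x| ^ (0 + k)) ^ 2 = ψ x ^ (2 * k) := by
    rw [zero_add, ← pow_mul, mul_comm k 2, pow_mul, sq_abs, ← pow_mul]
  rw [mul_pow, e1]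
  have h1 : derivSum k V x ^ 2 ≤ (d + 1 : ℝ) ^ m * derivSq k V x := by
    refine (derivSum_sq_le k V x).trans (mul_le_mul_of_nonneg_right ?_ (derivSq_nonneg _ _ _))
    calc (d : ℝ) ^ k ≤ (d + 1 : ℝ) ^ k := pow_le_pow_left₀ (by positivity) (by linarith) k
      _ ≤ (d + 1 : ℝ) ^ m := pow_le_pow_right₀ (by linarith [Nat.cast_nonneg (α := ℝ) d]) hk'
  have h2 : 0 ≤ ψ x ^ (2 * k) := by rw [pow_mul]; positivity
  linarith [mul_le_mul_of_nonneg_left h1 h2]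

lemma absorb_products {C0 C1 k D ε lv lw hv hw LV LW HV HW : ℝ} (hC0 : 0 ≤ C0) (hC1 : 0 ≤ C1)
    (k0 : 0 ≤ k) (hD0 : 0 ≤ D) (hε : 0 < ε) (hε1 : ε ≤ 1) (hLV : 0 ≤ LV) (hLW : 0 ≤ LW) (hHV : 0 ≤ HV) (hHW : 0 ≤ HW)
    (lv2 : lv ^ 2 ≤ D * LV) (lw2 : lw ^ 2 ≤ D * LW) (hv2 : hv ^ 2 ≤ k * HV)
    (hw2 : hw ^ 2 ≤ k * HW) :
    (C0 * lv) * (C0 * lw) + (C0 * lv) * hw + hv * (C0 * lw) + C1 * lv * hw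
      ≤ (C0 + C1 + C0 ^ 2) * (k + D) * (ε * (HV + HW) + ε⁻¹ * (LV + LW)) := by
  have hε2 : 1 ≤ ε⁻¹ := (one_le_inv₀ hε).2 hε1
  have hε0 : 0 < ε⁻¹ := inv_pos.2 hε
  have young : ∀ p q : ℝ, p * q ≤ (ε * q ^ 2 + ε⁻¹ * p ^ 2) / 2 := by
    intro p q
    have : 0 ≤ ε * (q - ε⁻¹ * p) ^ 2 := by positivity
    have e : ε * (q - ε⁻¹ * p) ^ 2 = ε * q ^ 2 - 2 * (p * q) + ε⁻¹ * p ^ 2 := by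
      field_simp
      ring
    linarith
  set X := ε * (HV + HW) + ε⁻¹ * (LV + LW) with hX
  have hX0 : 0 ≤ X := by positivity
  have w1 : 0 ≤ ε * (HV + HW) := by positivity
  have w2 : 0 ≤ ε⁻¹ * (LV + LW) := by positivity
  have bound : ∀ p q P Q : ℝ, p ^ 2 ≤ D * P → q ^ 2 ≤ k * Q →
      P ≤ LV + LW → Q ≤ HV + HW → p * q ≤ (k + D) / 2 * X := by
    intro p q P Q h1 h2 hP' hQ'
    have y := young p q
    have z1 : ε * q ^ 2 ≤ k * X := by
      have a1 : ε * q ^ 2 ≤ ε * (k * Q) := mul_le_mul_of_nonneg_left h2 hε.le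
      have a2 : ε * Q ≤ X := by
        have := mul_le_mul_of_nonneg_left hQ' hε.le
        linarith
      have a3 := mul_le_mul_of_nonneg_left a2 k0
      linarith
    have z2 : ε⁻¹ * p ^ 2 ≤ D * X := by
      have a1 : ε⁻¹ * p ^ 2 ≤ ε⁻¹ * (D * P) := mul_le_mul_of_nonneg_left h1 hε0.le
      have a2 : ε⁻¹ * P ≤ X := by
        have := mul_le_mul_of_nonneg_left hP' hε0.le
        linarith
      have a3 := mul_le_mul_of_nonneg_left a2 hD0
      linarith
    linarith
  have b1 : lv * hw ≤ (k + D) / 2 * X := bound lv hw LV HW lv2 hw2 (by linarith) (by linarith)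
  have b2 : lw * hv ≤ (k + D) / 2 * X := bound lw hv LW HV lw2 hv2 (by linarith) (by linarith)
  have b3 : lv * lw ≤ (k + D) / 2 * X := by
    have y : lv * lw ≤ (lv ^ 2 + lw ^ 2) / 2 := by linarith [sq_nonneg (lv - lw)]
    have z : LV + LW ≤ X := by
      have : 1 * (LV + LW) ≤ ε⁻¹ * (LV + LW) :=
        mul_le_mul_of_nonneg_right hε2 (by linarith)
      linarith
    have z' : D * (LV + LW) ≤ D * X := mul_le_mul_of_nonneg_left z hD0
    have z'' : 0 ≤ k * X := by positivity
    linarith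
  set E := (k + D) / 2 * X with hE
  have hE0 : 0 ≤ E := by positivity
  have f1 := mul_le_mul_of_nonneg_left b3 (sq_nonneg C0)
  have f2 := mul_le_mul_of_nonneg_left b1 hC0
  have f3 := mul_le_mul_of_nonneg_left b2 hC0
  have f4 := mul_le_mul_of_nonneg_left b1 hC1
  have g1 : (C0 + C1 + C0 ^ 2) * (k + D) * X = 2 * (C0 + C1 + C0 ^ 2) * E := by
    rw [hE]; ring
  have g3 : 0 ≤ C0 ^ 2 * E := by positivity
  have g4 : 0 ≤ C1 * E := by positivity
  rw [g1]
  linarith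

/-- Pointwise comparison between derivatives of `ψ^m V` and of `V`. -/
lemma exists_weighted_derivSq_le {ψ : (Fin d → ℝ) → ℝ} (hψ : ContDiff ℝ (⊤ : ℕ∞) ψ)
    {S : Set (Fin d → ℝ)} (hS : IsCompact S) (m : ℕ) :
    ∃ C, 0 ≤ C ∧ ∀ V : (Fin d → ℝ) → ℝ, ContDiff ℝ (⊤ : ℕ∞) V → ∀ x ∈ S,
      ψ x ^ (2 * m) * derivSq m V x ≤ 2 * derivSq m (fun x => ψ x ^ m * V x) x
        + C * ∑ k ∈ Finset.range m, ψ x ^ (2 * k) * derivSq k V x := by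
  obtain ⟨C0, hC0, h0⟩ := exists_pdl_pow_mul_bound hψ hS m 0
  set D : ℝ := m * (d + 1 : ℝ) ^ m with hD
  have hD0 : 0 ≤ D := by positivity
  refine ⟨2 * (d : ℝ) ^ m * C0 ^ 2 * D, by positivity, fun V hV x hx => ?_⟩
  have hf : ∀ f : Fin m → Fin d, ψ x ^ (2 * m) * pdl (List.ofFn f) V x ^ 2
      ≤ 2 * pdl (List.ofFn f) (fun x => ψ x ^ m * V x) x ^ 2 + 2 * C0 ^ 2 * lowSum ψ V 0 m x ^ 2 := by
    intro f
    have h := h0 (List.ofFn f) (by simp) V hV x hx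
    simp only [zero_add, pow_zero, one_mul] at h
    set P := pdl (List.ofFn f) (fun x => ψ x ^ m * V x) x
    set Q := pdl (List.ofFn f) V x
    have h' := abs_le.1 h
    have h2 : (P - ψ x ^ m * Q) ^ 2 ≤ (C0 * lowSum ψ V 0 m x) ^ 2 := sq_le_sq' h'.1 h'.2
    have e : ψ x ^ (2 * m) = (ψ x ^ m) ^ 2 := by rw [← pow_mul, mul_comm]
    rw [e]
    linarith [sq_nonneg (P + (P - ψ x ^ m * Q))]
  have hs := Finset.sum_le_sum fun f (_ : f ∈ (Finset.univ : Finset (Fin m → Fin d))) => hf f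
  rw [← Finset.mul_sum, Finset.sum_add_distrib, ← Finset.mul_sum] at hs
  simp only [Finset.sum_const, Finset.card_univ, Fintype.card_pi, Fintype.card_fin,
    Finset.prod_const, nsmul_eq_mul] at hs
  have hl := lowSum_sq_le ψ V m x
  rw [← hD] at hl
  set Lo := ∑ k ∈ Finset.range m, ψ x ^ (2 * k) * derivSq k V x
  have hLo : 0 ≤ Lo := Finset.sum_nonneg fun k _ =>
    mul_nonneg (by rw [pow_mul]; positivity) (derivSq_nonneg _ _ _)
  have a1 : ((d ^ m : ℕ) : ℝ) * (2 * C0 ^ 2 * lowSum ψ V 0 m x ^ 2)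
      ≤ (d : ℝ) ^ m * (2 * C0 ^ 2 * (D * Lo)) := by
    push_cast
    gcongr
  simp only [derivSq] at hs ⊢
  linarith

/-- Pointwise comparison between the two bilinear expressions in the energy identity. -/
lemma exists_bilinear_sub_le {ψ : (Fin d → ℝ) → ℝ} (hψ : ContDiff ℝ (⊤ : ℕ∞) ψ)
    {S : Set (Fin d → ℝ)} (hS : IsCompact S) (m : ℕ) :
    ∃ C, 0 ≤ C ∧ ∀ V W : (Fin d → ℝ) → ℝ, ContDiff ℝ (⊤ : ℕ∞) V → ContDiff ℝ (⊤ : ℕ∞) W →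
      ∀ x ∈ S, ∀ ε, 0 < ε → ε ≤ 1 → ∀ l l' : List (Fin d), l.length = m → l'.length = m →
        |pdl l (fun x => ψ x ^ m * V x) x * pdl l' (fun x => ψ x ^ m * W x) x
          - pdl l (fun x => ψ x ^ (2 * m) * V x) x * pdl l' W x|
          ≤ C * (ε * (ψ x ^ (2 * m) * derivSq m V x + ψ x ^ (2 * m) * derivSq m W x)
            + ε⁻¹ * (∑ k ∈ Finset.range m, ψ x ^ (2 * k) * derivSq k V x
              + ∑ k ∈ Finset.range m, ψ x ^ (2 * k) * derivSq k W x)) := by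
  obtain ⟨C0, hC0, h0⟩ := exists_pdl_pow_mul_bound hψ hS m 0
  obtain ⟨C1, hC1, h1⟩ := exists_pdl_pow_mul_bound hψ hS m m
  set D : ℝ := m * (d + 1 : ℝ) ^ m with hD
  have hD0 : 0 ≤ D := by positivity
  refine ⟨(C0 + C1 + C0 ^ 2) * ((d : ℝ) ^ m + D), by positivity,
    fun V W hV hW x hx ε hε hε1 l l' hl hl' => ?_⟩
  have bV := h0 l hl V hV x hx
  have bW := h0 l' hl' W hW x hx
  have bV2 := h1 l hl V hV x hx
  simp only [zero_add, pow_zero, one_mul] at bV bW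
  rw [← two_mul] at bV2
  set P := pdl l (fun x => ψ x ^ m * V x) x
  set Q := pdl l' (fun x => ψ x ^ m * W x) x
  set R := pdl l (fun x => ψ x ^ (2 * m) * V x) x
  set a := pdl l V x
  set b := pdl l' W x
  set lv := lowSum ψ V 0 m x
  set lw := lowSum ψ W 0 m x
  have hlv : 0 ≤ lv := lowSum_nonneg _ _ _ _ _
  have hlw : 0 ≤ lw := lowSum_nonneg _ _ _ _ _
  have ha : |a| ≤ derivSum m V x := by
    have := abs_pdl_le_derivSum l V x
    rwa [hl] at this
  have hb : |b| ≤ derivSum m W x := by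
    have := abs_pdl_le_derivSum l' W x
    rwa [hl'] at this
  set hv := |ψ x| ^ m * derivSum m V x with hhv
  set hw := |ψ x| ^ m * derivSum m W x with hhw
  have e2 : ψ x ^ (2 * m) = ψ x ^ m * ψ x ^ m := by rw [two_mul, pow_add]
  have e3 : (|ψ x| ^ m) ^ 2 = ψ x ^ (2 * m) := by
    rw [← pow_mul, mul_comm m 2, pow_mul, sq_abs, ← pow_mul]
  have ha' : |ψ x ^ m * a| ≤ hv := by
    rw [abs_mul, abs_pow]; exact mul_le_mul_of_nonneg_left ha (by positivity)
  have hb' : |ψ x ^ m * b| ≤ hw := by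
    rw [abs_mul, abs_pow]; exact mul_le_mul_of_nonneg_left hb (by positivity)
  have hhv0 : 0 ≤ hv := (abs_nonneg _).trans ha'
  have hhw0 : 0 ≤ hw := (abs_nonneg _).trans hb'
  have hsplit : P * Q - R * b = (P - ψ x ^ m * a) * (Q - ψ x ^ m * b)
      + (P - ψ x ^ m * a) * (ψ x ^ m * b) + (ψ x ^ m * a) * (Q - ψ x ^ m * b)
      - (R - ψ x ^ (2 * m) * a) * b := by rw [e2]; ring
  have t1 : |(P - ψ x ^ m * a) * (Q - ψ x ^ m * b)| ≤ (C0 * lv) * (C0 * lw) := by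
    rw [abs_mul]; exact mul_le_mul bV bW (abs_nonneg _) (by positivity)
  have t2 : |(P - ψ x ^ m * a) * (ψ x ^ m * b)| ≤ (C0 * lv) * hw := by
    rw [abs_mul]; exact mul_le_mul bV hb' (abs_nonneg _) (by positivity)
  have t3 : |(ψ x ^ m * a) * (Q - ψ x ^ m * b)| ≤ hv * (C0 * lw) := by
    rw [abs_mul]; exact mul_le_mul ha' bW (abs_nonneg _) (by positivity)
  have t4 : |(R - ψ x ^ (2 * m) * a) * b| ≤ C1 * lv * hw := by
    rw [abs_mul]
    calc _ ≤ C1 * (|ψ x| ^ m * lv) * derivSum m W x :=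
          mul_le_mul bV2 hb (abs_nonneg _) (by positivity)
      _ = C1 * lv * hw := by rw [hhw]; ring
  have tot : |P * Q - R * b| ≤ (C0 * lv) * (C0 * lw) + (C0 * lv) * hw + hv * (C0 * lw)
      + C1 * lv * hw := by
    rw [hsplit]
    refine (abs_sub _ _).trans ?_
    have := abs_add_three ((P - ψ x ^ m * a) * (Q - ψ x ^ m * b))
      ((P - ψ x ^ m * a) * (ψ x ^ m * b)) ((ψ x ^ m * a) * (Q - ψ x ^ m * b))
    linarith
  have hv2 : hv ^ 2 ≤ (d : ℝ) ^ m * (ψ x ^ (2 * m) * derivSq m V x) := by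
    rw [hhv, mul_pow, e3]
    have h2 : 0 ≤ ψ x ^ (2 * m) := by rw [pow_mul]; positivity
    linarith [mul_le_mul_of_nonneg_left (derivSum_sq_le m V x) h2]
  have hw2 : hw ^ 2 ≤ (d : ℝ) ^ m * (ψ x ^ (2 * m) * derivSq m W x) := by
    rw [hhw, mul_pow, e3]
    have h2 : 0 ≤ ψ x ^ (2 * m) := by rw [pow_mul]; positivity
    linarith [mul_le_mul_of_nonneg_left (derivSum_sq_le m W x) h2]
  have lv2 := lowSum_sq_le ψ V m x
  have lw2 := lowSum_sq_le ψ W m x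
  rw [← hD] at lv2 lw2
  change lv ^ 2 ≤ _ at lv2
  change lw ^ 2 ≤ _ at lw2
  set LV := ∑ k ∈ Finset.range m, ψ x ^ (2 * k) * derivSq k V x
  set LW := ∑ k ∈ Finset.range m, ψ x ^ (2 * k) * derivSq k W x
  set HV := ψ x ^ (2 * m) * derivSq m V x
  set HW := ψ x ^ (2 * m) * derivSq m W x
  have hLV : 0 ≤ LV := Finset.sum_nonneg fun k _ =>
    mul_nonneg (by rw [pow_mul]; positivity) (derivSq_nonneg _ _ _)
  have hLW : 0 ≤ LW := Finset.sum_nonneg fun k _ =>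
    mul_nonneg (by rw [pow_mul]; positivity) (derivSq_nonneg _ _ _)
  have hHV : 0 ≤ HV := mul_nonneg (by rw [pow_mul]; positivity) (derivSq_nonneg _ _ _)
  have hHW : 0 ≤ HW := mul_nonneg (by rw [pow_mul]; positivity) (derivSq_nonneg _ _ _)
  have key := absorb_products hC0 hC1 (by positivity : 0 ≤ (d : ℝ) ^ m) hD0 hε hε1 hLV hLW hHV hHW lv2 lw2 hv2 hw2
  exact tot.trans key

end EnergyForm

section EnergyEstimate

variable {d n : ℕ}

/-- The part of the half space lying in the support of the cut-off `ψ`. -/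
def cutSet (N : Fin d) (ψ : (Fin d → ℝ) → ℝ) : Set (Fin d → ℝ) := halfSp N ∩ tsupport ψ

lemma measurableSet_cutSet (N : Fin d) (ψ : (Fin d → ℝ) → ℝ) : MeasurableSet (cutSet N ψ) :=
  (measurableSet_halfSp N).inter (isClosed_tsupport ψ).measurableSet

lemma integrableOn_cutSet (N : Fin d) {ψ : (Fin d → ℝ) → ℝ} (hc : HasCompactSupport ψ)
    {g : (Fin d → ℝ) → ℝ} (hg : Continuous g) : IntegrableOn g (cutSet N ψ) :=
  (hg.continuousOn.integrableOn_compact hc).mono_set inter_subset_right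

lemma integral_halfSp_eq_cutSet (N : Fin d) (ψ : (Fin d → ℝ) → ℝ)
    {g : (Fin d → ℝ) → ℝ} (hg : ∀ x, x ∉ tsupport ψ → g x = 0) :
    ∫ x in halfSp N, g x = ∫ x in cutSet N ψ, g x :=
  setIntegral_eq_of_subset_of_forall_sdiff_eq_zero (measurableSet_halfSp N) inter_subset_left
    (fun x hx => hg x fun h => hx.2 ⟨hx.1, h⟩)

/-- The weighted energy of order `k`. -/
noncomputable def wEnergy (N : Fin d) (ψ : (Fin d → ℝ) → ℝ) (k : ℕ) (V : (Fin d → ℝ) → ℝ) : ℝ :=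
  ∫ x in cutSet N ψ, ψ x ^ (2 * k) * derivSq k V x

lemma wEnergy_nonneg (N : Fin d) (ψ : (Fin d → ℝ) → ℝ) (k : ℕ) (V : (Fin d → ℝ) → ℝ) :
    0 ≤ wEnergy N ψ k V :=
  integral_nonneg fun x => mul_nonneg (by rw [pow_mul]; positivity) (derivSq_nonneg _ _ _)

lemma continuous_derivSq {V : (Fin d → ℝ) → ℝ} (hV : ContDiff ℝ (⊤ : ℕ∞) V) (k : ℕ) :
    Continuous (derivSq k V) :=
  continuous_finsetSum _ fun f _ => (hV.pdl _).continuous.pow 2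

lemma pdl_eq_zero_of_notMem_tsupport {f : (Fin d → ℝ) → ℝ} (l : List (Fin d)) {x : Fin d → ℝ}
    (hx : x ∉ tsupport f) : pdl l f x = 0 :=
  image_eq_zero_of_notMem_tsupport fun h => hx (tsupport_pdl_subset l f h)

lemma tsupport_pow_mul_subset {ψ V : (Fin d → ℝ) → ℝ} {k : ℕ} (hk : k ≠ 0) :
    tsupport (fun x => ψ x ^ k * V x) ⊆ tsupport ψ := by
  refine closure_mono fun x hx => ?_
  simp only [Function.mem_support] at hx ⊢
  intro h
  simp [h, hk] at hx

lemma pdl_pow_mul_eq_zero {ψ V : (Fin d → ℝ) → ℝ} (hψ : ContDiff ℝ (⊤ : ℕ∞) ψ)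
    (hV : ContDiff ℝ (⊤ : ℕ∞) V) {m e : ℕ} (he : m ≤ e) {x : Fin d → ℝ}
    (h0 : ∀ l : List (Fin d), l.length < m → pdl l V x = 0) (l : List (Fin d))
    (hl : l.length < m) : pdl l (fun x => ψ x ^ e * V x) x = 0 := by
  obtain ⟨C, hC, h⟩ := abs_pdl_mul_pow_le hψ (isCompact_singleton (x := x)) l (e - l.length)
    (fun _ => 1) contDiff_const
  have h1 := h V hV x rfl
  have e1 : e - l.length + l.length = e := by omega
  simp only [e1, one_mul] at h1
  have e2 : lowSum ψ V (e - l.length) (l.length + 1) x = 0 := by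
    refine Finset.sum_eq_zero fun k hk => ?_
    have : derivSum k V x = 0 := Finset.sum_eq_zero fun f _ => by
      rw [h0 _ (by simp at hk ⊢; omega), abs_zero]
    rw [this, mul_zero]
  rw [e2, mul_zero] at h1
  exact abs_eq_zero.1 (le_antisymm h1 (abs_nonneg _))

variable {ι : Type*}

/-- The elliptic form tested with `ψ^{2m} V`. -/
noncomputable def testForm (N : Fin d) (ψ : (Fin d → ℝ) → ℝ) (m : ℕ) (s : Finset ι)
    (L : ι → List (Fin d)) (B : ι → ι → Fin n → Fin n → ℝ) (V : Fin n → (Fin d → ℝ) → ℝ) : ℝ :=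
  ∑ a ∈ s, ∑ b ∈ s, ∑ i, ∑ j,
    B a b i j * ∫ x in halfSp N, ψ x ^ (2 * m) * V i x * pdl (L a ++ L b) (V j) x

lemma exists_energy_bound (N : Fin d) {ψ : (Fin d → ℝ) → ℝ} (hψ : ContDiff ℝ (⊤ : ℕ∞) ψ)
    (hψc : HasCompactSupport ψ) (hψb : ∀ x ∈ tsupport ψ, ∀ j, |x j| < 2)
    {m : ℕ} (hm : m ≠ 0) {lam K : ℝ} (hlam : 0 < lam) (hK : 0 ≤ K) (s : Finset ι)
    (L : ι → List (Fin d)) (hL : ∀ a ∈ s, (L a).length = m) :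
    ∃ C, 0 ≤ C ∧ ∀ B : ι → ι → Fin n → Fin n → ℝ, LHForm s L m lam B →
      (∀ a b i j, |B a b i j| ≤ K) → ∀ V : Fin n → (Fin d → ℝ) → ℝ,
      (∀ i, ContDiff ℝ (⊤ : ℕ∞) (V i)) →
      (∀ i, ∀ l : List (Fin d), l.length < m → ∀ x ∈ tsupport ψ, x N = 0 → pdl l (V i) x = 0) →
      lam / 4 * ∑ i, wEnergy N ψ m (V i) ≤ (-1) ^ m * testForm N ψ m s L B V
        + C * ∑ i, ∑ k ∈ Finset.range m, wEnergy N ψ k (V i) := by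
  obtain ⟨C1, hC1, h1⟩ := exists_weighted_derivSq_le hψ hψc m
  obtain ⟨C2, hC2, h2⟩ := exists_bilinear_sub_le hψ hψc m
  set M : ℝ := K * C2 * (2 * n) * s.card ^ 2 with hM
  have hM0 : 0 ≤ M := by positivity
  obtain ⟨ε, hε, hε1, hεM⟩ : ∃ ε : ℝ, 0 < ε ∧ ε ≤ 1 ∧ M * ε ≤ lam / 4 := by
    refine ⟨min 1 (lam / 4 / (M + 1)), by positivity, min_le_left _ _, ?_⟩
    have : M * min 1 (lam / 4 / (M + 1)) ≤ (M + 1) * (lam / 4 / (M + 1)) :=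
      mul_le_mul (by linarith) (min_le_right _ _) (by positivity) (by positivity)
    rwa [mul_div_cancel₀ _ (by positivity)] at this
  refine ⟨lam / 2 * C1 + M * ε⁻¹, by positivity, fun B hB hBK V hV h0 => ?_⟩
  set W : Fin n → (Fin d → ℝ) → ℝ := fun i x => ψ x ^ m * V i x with hW
  set Z : Fin n → (Fin d → ℝ) → ℝ := fun i x => ψ x ^ (2 * m) * V i x with hZ
  have hWs : ∀ i, ContDiff ℝ (⊤ : ℕ∞) (W i) := fun i => (hψ.pow m).mul (hV i)
  have hZs : ∀ i, ContDiff ℝ (⊤ : ℕ∞) (Z i) := fun i => (hψ.pow (2 * m)).mul (hV i)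
  have hWt : ∀ i, tsupport (W i) ⊆ tsupport ψ := fun i => tsupport_pow_mul_subset hm
  have hZt : ∀ i, tsupport (Z i) ⊆ tsupport ψ := fun i => tsupport_pow_mul_subset (by omega)
  have hWc : ∀ i, HasCompactSupport (W i) := fun i =>
    hψc.of_isClosed_subset (isClosed_tsupport _) (hWt i)
  have hZc : ∀ i, HasCompactSupport (Z i) := fun i =>
    hψc.of_isClosed_subset (isClosed_tsupport _) (hZt i)
  have hW0 : ∀ i, ∀ l : List (Fin d), l.length < m → ∀ x, x N = 0 → pdl l (W i) x = 0 := by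
    intro i l hl x hx
    by_cases hxt : x ∈ tsupport ψ
    · exact pdl_pow_mul_eq_zero hψ (hV i) le_rfl (fun l hl => h0 i l hl x hxt hx) l hl
    · exact pdl_eq_zero_of_notMem_tsupport l fun h => hxt (hWt i h)
  have hZ0 : ∀ i, ∀ l : List (Fin d), l.length < m → ∀ x, x N = 0 → pdl l (Z i) x = 0 := by
    intro i l hl x hx
    by_cases hxt : x ∈ tsupport ψ
    · exact pdl_pow_mul_eq_zero hψ (hV i) (by omega) (fun l hl => h0 i l hl x hxt hx) l hl
    · exact pdl_eq_zero_of_notMem_tsupport l fun h => hxt (hZt i h)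
  have hG := garding N hL hB hWs hWc (fun i x hx => hψb x (hWt i hx)) hW0
  -- rewrite everything as integrals over the support of the cut-off
  have t1 : (-1) ^ m * testForm N ψ m s L B V = ∑ a ∈ s, ∑ b ∈ s, ∑ i, ∑ j,
      B a b i j * ∫ x in cutSet N ψ, pdl (L a) (Z i) x * pdl (L b) (V j) x := by
    rw [testForm]
    simp only [Finset.mul_sum]
    refine Finset.sum_congr rfl fun a ha => Finset.sum_congr rfl fun b hb =>
      Finset.sum_congr rfl fun i _ => Finset.sum_congr rfl fun j _ => ?_
    have e := integral_halfSp_mul_pdl N (L a) (hZs i) (hZc i) ((hV j).pdl (L b))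
      (by rw [hL a ha]; exact hZ0 i)
    rw [pdl_append, e, hL a ha, integral_halfSp_eq_cutSet N ψ (fun x hx => by
      rw [pdl_eq_zero_of_notMem_tsupport _ fun h => hx (hZt i h), zero_mul])]
    have : ((-1 : ℝ) ^ m) * (-1) ^ m = 1 := by rw [← mul_pow]; simp
    linear_combination (B a b i j * ∫ x in cutSet N ψ, pdl (L a) (Z i) x * pdl (L b) (V j) x) * this
  have t2 : ∑ a ∈ s, ∑ b ∈ s, ∑ i, ∑ j,
        B a b i j * ∫ x in halfSp N, pdl (L a) (W i) x * pdl (L b) (W j) x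
      = ∑ a ∈ s, ∑ b ∈ s, ∑ i, ∑ j,
        B a b i j * ∫ x in cutSet N ψ, pdl (L a) (W i) x * pdl (L b) (W j) x := by
    refine Finset.sum_congr rfl fun a ha => Finset.sum_congr rfl fun b hb =>
      Finset.sum_congr rfl fun i _ => Finset.sum_congr rfl fun j _ => ?_
    rw [integral_halfSp_eq_cutSet N ψ (fun x hx => by
      rw [pdl_eq_zero_of_notMem_tsupport _ fun h => hx (hWt i h), zero_mul])]
  have hInt := fun {g : (Fin d → ℝ) → ℝ} (hg : Continuous g) => integrableOn_cutSet N hψc hg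
  have cP : ∀ {k} i, Continuous fun x => ψ x ^ (2 * k) * derivSq k (V i) x := fun i =>
    (hψ.continuous.pow _).mul (continuous_derivSq (hV i) _)
  have cW : ∀ i, Continuous (derivSq m (W i)) := fun i => continuous_derivSq (hWs i) m
  have t3 : ∑ i, ∑ f : Fin m → Fin d, ∫ x in halfSp N, pdl (List.ofFn f) (W i) x ^ 2
      = ∑ i, ∫ x in cutSet N ψ, derivSq m (W i) x := by
    refine Finset.sum_congr rfl fun i _ => ?_
    simp only [derivSq]
    rw [integral_finsetSum _ fun f _ => hInt (show Continuous fun x =>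
      pdl (List.ofFn f) (W i) x ^ 2 from ((hWs i).pdl _).continuous.pow 2)]
    refine Finset.sum_congr rfl fun f _ => integral_halfSp_eq_cutSet N ψ fun x hx => ?_
    rw [pdl_eq_zero_of_notMem_tsupport _ fun h => hx (hWt i h)]
    simp
  rw [t3, t2] at hG
  set lo : Fin n → ℝ := fun i => ∑ k ∈ Finset.range m, wEnergy N ψ k (V i) with hlo
  have elo : ∀ i, ∫ x in cutSet N ψ, ∑ k ∈ Finset.range m, ψ x ^ (2 * k) * derivSq k (V i) x
      = lo i := fun i => integral_finsetSum _ fun k _ => hInt (cP i)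
  have u1 : ∀ i, wEnergy N ψ m (V i) ≤ 2 * (∫ x in cutSet N ψ, derivSq m (W i) x) + C1 * lo i := by
    intro i
    have k1 : Continuous fun x => 2 * derivSq m (W i) x := continuous_const.mul (cW i)
    have k2 : Continuous fun x =>
        C1 * ∑ k ∈ Finset.range m, ψ x ^ (2 * k) * derivSq k (V i) x :=
      continuous_const.mul (continuous_finsetSum _ fun k _ => cP i)
    rw [← elo, ← integral_const_mul, ← integral_const_mul,
      ← integral_add (hInt k1) (hInt k2)]
    exact setIntegral_mono_on (hInt (cP i)) (hInt (k1.add k2))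
      (measurableSet_cutSet N ψ) fun x hx => h1 (V i) (hV i) x hx.2
  have u2 : ∀ a ∈ s, ∀ b ∈ s, ∀ i j,
      B a b i j * (∫ x in cutSet N ψ, pdl (L a) (W i) x * pdl (L b) (W j) x)
      ≤ B a b i j * (∫ x in cutSet N ψ, pdl (L a) (Z i) x * pdl (L b) (V j) x)
        + K * (C2 * (ε * (wEnergy N ψ m (V i) + wEnergy N ψ m (V j)) + ε⁻¹ * (lo i + lo j))) := by
    intro a ha b hb i j
    have i1 : IntegrableOn (fun x => pdl (L a) (W i) x * pdl (L b) (W j) x) (cutSet N ψ) :=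
      hInt (((hWs i).pdl (L a)).continuous.mul ((hWs j).pdl (L b)).continuous)
    have i2 : IntegrableOn (fun x => pdl (L a) (Z i) x * pdl (L b) (V j) x) (cutSet N ψ) :=
      hInt (((hZs i).pdl (L a)).continuous.mul ((hV j).pdl (L b)).continuous)
    have c3 : Continuous fun x => C2 * (ε * (ψ x ^ (2 * m) * derivSq m (V i) x
        + ψ x ^ (2 * m) * derivSq m (V j) x)
            + ε⁻¹ * (∑ k ∈ Finset.range m, ψ x ^ (2 * k) * derivSq k (V i) x
              + ∑ k ∈ Finset.range m, ψ x ^ (2 * k) * derivSq k (V j) x)) :=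
      continuous_const.mul ((continuous_const.mul ((cP i).add (cP j))).add
        (continuous_const.mul ((continuous_finsetSum _ fun k _ => cP i).add
          (continuous_finsetSum _ fun k _ => cP j))))
    have e3 : ∫ x in cutSet N ψ, C2 * (ε * (ψ x ^ (2 * m) * derivSq m (V i) x
        + ψ x ^ (2 * m) * derivSq m (V j) x)
            + ε⁻¹ * (∑ k ∈ Finset.range m, ψ x ^ (2 * k) * derivSq k (V i) x
              + ∑ k ∈ Finset.range m, ψ x ^ (2 * k) * derivSq k (V j) x))
        = C2 * (ε * (wEnergy N ψ m (V i) + wEnergy N ψ m (V j)) + ε⁻¹ * (lo i + lo j)) := by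
      rw [integral_const_mul, integral_add, integral_const_mul, integral_const_mul,
        integral_add, integral_add, elo, elo]
      · rfl
      · exact hInt (continuous_finsetSum _ fun k _ => cP i)
      · exact hInt (continuous_finsetSum _ fun k _ => cP j)
      · exact hInt (cP i)
      · exact hInt (cP j)
      · exact hInt (continuous_const.mul ((cP i).add (cP j)))
      · exact hInt (continuous_const.mul ((continuous_finsetSum _ fun k _ => cP i).add
          (continuous_finsetSum _ fun k _ => cP j)))
    have hd : |(∫ x in cutSet N ψ, pdl (L a) (W i) x * pdl (L b) (W j) x)
        - ∫ x in cutSet N ψ, pdl (L a) (Z i) x * pdl (L b) (V j) x|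
        ≤ C2 * (ε * (wEnergy N ψ m (V i) + wEnergy N ψ m (V j)) + ε⁻¹ * (lo i + lo j)) := by
      rw [← integral_sub i1 i2, ← e3]
      refine (abs_integral_le_integral_abs).trans ?_
      exact setIntegral_mono_on (i1.sub i2).abs (hInt c3) (measurableSet_cutSet N ψ) fun x hx =>
        h2 (V i) (V j) (hV i) (hV j) x hx.2 ε hε hε1 (L a) (L b) (hL a ha) (hL b hb)
    set p := ∫ x in cutSet N ψ, pdl (L a) (W i) x * pdl (L b) (W j) x
    set q := ∫ x in cutSet N ψ, pdl (L a) (Z i) x * pdl (L b) (V j) x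
    have : B a b i j * (p - q) ≤ K * (C2 * (ε * (wEnergy N ψ m (V i) + wEnergy N ψ m (V j))
        + ε⁻¹ * (lo i + lo j))) := by
      refine (le_abs_self _).trans ?_
      rw [abs_mul]
      exact mul_le_mul (hBK a b i j) hd (abs_nonneg _) hK
    linarith
  have e4 : ∑ i, ∑ j, K * (C2 * (ε * (wEnergy N ψ m (V i) + wEnergy N ψ m (V j))
      + ε⁻¹ * (lo i + lo j)))
      = K * C2 * (2 * n) * (ε * ∑ i, wEnergy N ψ m (V i) + ε⁻¹ * ∑ i, lo i) := by
    simp only [← Finset.mul_sum, Finset.sum_add_distrib, Finset.sum_const, Finset.card_univ,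
      Fintype.card_fin, nsmul_eq_mul]
    ring
  have u3 : ∑ a ∈ s, ∑ b ∈ s, ∑ i, ∑ j,
        B a b i j * (∫ x in cutSet N ψ, pdl (L a) (W i) x * pdl (L b) (W j) x)
      ≤ (-1) ^ m * testForm N ψ m s L B V + (s.card : ℝ) * (s.card *
        (K * C2 * (2 * n) * (ε * ∑ i, wEnergy N ψ m (V i) + ε⁻¹ * ∑ i, lo i))) := by
    rw [t1, ← e4, ← nsmul_eq_mul, ← nsmul_eq_mul, ← Finset.sum_const, ← Finset.sum_const]
    simp only [← Finset.sum_add_distrib]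
    exact Finset.sum_le_sum fun a ha => Finset.sum_le_sum fun b hb => Finset.sum_le_sum
      fun i _ => Finset.sum_le_sum fun j _ => u2 a ha b hb i j
  have u4 := Finset.sum_le_sum fun i (_ : i ∈ Finset.univ) => u1 i
  rw [Finset.sum_add_distrib, ← Finset.mul_sum, ← Finset.mul_sum] at u4
  set S1 := ∑ i, wEnergy N ψ m (V i) with hS1
  have hS10 : 0 ≤ S1 := Finset.sum_nonneg fun i _ => wEnergy_nonneg _ _ _ _
  set S0 := ∑ i, lo i with hS0
  set SW := ∑ i, ∫ x in cutSet N ψ, derivSq m (W i) x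
  have v1 : lam * S1 ≤ 2 * (lam * SW) + lam * (C1 * S0) := by
    have := mul_le_mul_of_nonneg_left u4 hlam.le
    linarith
  have v2 : M * ε * S1 ≤ lam / 4 * S1 := mul_le_mul_of_nonneg_right hεM hS10
  have v3 : (s.card : ℝ) * (s.card * (K * C2 * (2 * n) * (ε * S1 + ε⁻¹ * S0)))
      = M * ε * S1 + M * ε⁻¹ * S0 := by rw [hM]; ring
  rw [v3] at u3
  linarith

end EnergyEstimate

section Interpolation

lemma exists_interpolation_succ {D : ℝ → ℝ} (hD : ∀ ε, 0 < ε → 0 ≤ D ε) (k i : ℕ) :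
    ∀ ε, 0 < ε → ∃ C, 0 ≤ C ∧ ∀ β : ℕ → ℝ, (∀ j, 0 ≤ β j) →
      (∀ j, j + 2 ≤ k → ∀ ε, 0 < ε → β (j + 1) ≤ ε * β (j + 2) + D ε * β j) →
      i + 1 ≤ k → β i ≤ ε * β (i + 1) + C * β 0 := by
  induction i with
  | zero =>
    intro ε hε
    refine ⟨1, zero_le_one, fun β hβ h _ => ?_⟩
    have := mul_nonneg hε.le (hβ (0 + 1))
    linarith
  | succ i ih =>
    intro ε hε
    have h0 := hD (ε / 2) (by positivity)
    obtain ⟨C, hC, h1⟩ := ih (1 / (2 * (D (ε / 2) + 1))) (by positivity)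
    refine ⟨2 * (D (ε / 2) * C), by positivity, fun β hβ h hi => ?_⟩
    have h2 := h i (by omega) (ε / 2) (by positivity)
    have h3 := mul_le_mul_of_nonneg_left (h1 β hβ h (by omega)) h0
    have h4 : D (ε / 2) * (1 / (2 * (D (ε / 2) + 1)) * β (i + 1)) ≤ 1 / 2 * β (i + 1) := by
      rw [← mul_assoc]
      refine mul_le_mul_of_nonneg_right ?_ (hβ _)
      rw [mul_one_div, div_le_div_iff₀ (by positivity) (by norm_num)]
      linarith
    have e : i + 1 + 1 = i + 2 := rfl
    rw [e]
    linarith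

lemma exists_interpolation {D : ℝ → ℝ} (hD : ∀ ε, 0 < ε → 0 ≤ D ε) (k i : ℕ) (hi : i < k) :
    ∀ ε, 0 < ε → ∃ C, 0 ≤ C ∧ ∀ β : ℕ → ℝ, (∀ j, 0 ≤ β j) →
      (∀ j, j + 2 ≤ k → ∀ ε, 0 < ε → β (j + 1) ≤ ε * β (j + 2) + D ε * β j) →
      β i ≤ ε * β k + C * β 0 := by
  obtain ⟨r, rfl⟩ : ∃ r, k = i + 1 + r := ⟨k - (i + 1), by omega⟩
  suffices ∀ q, q ≤ r → ∀ ε, 0 < ε → ∃ C, 0 ≤ C ∧ ∀ β : ℕ → ℝ, (∀ j, 0 ≤ β j) →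
      (∀ j, j + 2 ≤ i + 1 + r → ∀ ε, 0 < ε → β (j + 1) ≤ ε * β (j + 2) + D ε * β j) →
      β i ≤ ε * β (i + 1 + q) + C * β 0 from this r le_rfl
  intro q
  induction q with
  | zero =>
    intro _ ε hε
    obtain ⟨C, hC, h⟩ := exists_interpolation_succ hD (i + 1 + r) i ε hε
    exact ⟨C, hC, fun β hβ hb => h β hβ hb (by omega)⟩
  | succ q ih =>
    intro hq ε hε
    obtain ⟨C, hC, h⟩ := ih (by omega) ε hε
    obtain ⟨C', hC', h'⟩ := exists_interpolation_succ hD (i + 1 + r) (i + 1 + q) 1 one_pos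
    refine ⟨ε * C' + C, by positivity, fun β hβ hb => ?_⟩
    have a1 := h β hβ hb
    have a2 := mul_le_mul_of_nonneg_left (h' β hβ hb (by omega)) hε.le
    have e : i + 1 + (q + 1) = i + 1 + q + 1 := rfl
    rw [e]
    linarith

variable {d n : ℕ}

lemma integral_weighted_sq_pd_le (N : Fin d) {ψ : (Fin d → ℝ) → ℝ} (hψ : ContDiff ℝ (⊤ : ℕ∞) ψ)
    (hψc : HasCompactSupport ψ) (k : ℕ) {S : ℝ} (i : Fin d)
    (hS : ∀ x ∈ tsupport ψ, pd i ψ x ^ 2 ≤ S) {g : (Fin d → ℝ) → ℝ}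
    (hg : ContDiff ℝ (⊤ : ℕ∞) g) (h0 : ∀ x ∈ tsupport ψ, x N = 0 → g x = 0)
    {ε : ℝ} (hε : 0 < ε) :
    ∫ x in cutSet N ψ, ψ x ^ (2 * (k + 1)) * pd i g x ^ 2 ≤
      ε * (∫ x in cutSet N ψ, ψ x ^ (2 * (k + 2)) * pd i (pd i g) x ^ 2)
      + (ε⁻¹ + 4 * (k + 1) ^ 2 * S) * ∫ x in cutSet N ψ, ψ x ^ (2 * k) * g x ^ 2 := by
  have hInt := fun {g : (Fin d → ℝ) → ℝ} (hg : Continuous g) => integrableOn_cutSet N hψc hg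
  have s1 : ContDiff ℝ (⊤ : ℕ∞) (fun x => g x * pd i g x) := hg.mul (hg.pd i)
  have s2 : ContDiff ℝ (⊤ : ℕ∞) (fun x => ψ x ^ (2 * (k + 1))) := hψ.pow _
  have s3 : ContDiff ℝ (⊤ : ℕ∞) (fun x => ψ x ^ (2 * (k + 1)) * (g x * pd i g x)) := s2.mul s1
  have hts : tsupport (fun x => ψ x ^ (2 * (k + 1)) * (g x * pd i g x)) ⊆ tsupport ψ :=
    tsupport_pow_mul_subset (by omega)
  have hz := integral_halfSp_pd N i s3 (hψc.of_isClosed_subset (isClosed_tsupport _) hts) (by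
    intro _ x hx
    by_cases h : x ∈ tsupport ψ
    · simp [h0 x h hx]
    · simp [image_eq_zero_of_notMem_tsupport h])
  rw [integral_halfSp_eq_cutSet N ψ (fun x hx => image_eq_zero_of_notMem_tsupport fun h =>
    hx (hts (tsupport_pd_subset i _ h)))] at hz
  have e1 : ∀ x, pd i (fun x => ψ x ^ (2 * (k + 1)) * (g x * pd i g x)) x
      = (2 * (k + 1) : ℝ) * ψ x ^ (2 * k + 1) * pd i ψ x * (g x * pd i g x)
        + ψ x ^ (2 * (k + 1)) * (pd i g x ^ 2 + g x * pd i (pd i g) x) := by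
    intro x
    have h1 : pd i ((fun x => ψ x ^ (2 * (k + 1))) * fun x => g x * pd i g x) x = _ :=
      congrFun (pd_mul s2 s1 i) x
    have h2 : pd i (fun x => g x * pd i g x) x = _ := congrFun (pd_mul hg (hg.pd i) i) x
    have h3 := congrFun (pd_pow hψ (2 * (k + 1)) i) x
    refine h1.trans ?_
    simp only [Pi.add_apply, Pi.mul_apply, h2, h3]
    have e : 2 * (k + 1) - 1 = 2 * k + 1 := by omega
    rw [e]
    push_cast
    ring
  have c0 : Continuous fun x => pd i (fun x => ψ x ^ (2 * (k + 1)) * (g x * pd i g x)) x :=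
    (s3.pd i).continuous
  have c1 : Continuous fun x => ψ x ^ (2 * (k + 1)) * pd i g x ^ 2 :=
    s2.continuous.mul ((hg.pd i).continuous.pow 2)
  have c2 : Continuous fun x => ψ x ^ (2 * (k + 2)) * pd i (pd i g) x ^ 2 :=
    (hψ.continuous.pow _).mul (((hg.pd i).pd i).continuous.pow 2)
  have c3 : Continuous fun x => ψ x ^ (2 * k) * g x ^ 2 :=
    (hψ.continuous.pow _).mul (hg.continuous.pow 2)
  have k0 : Continuous fun x => 2 * pd i (fun x => ψ x ^ (2 * (k + 1)) * (g x * pd i g x)) x :=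
    continuous_const.mul c0
  have k2 : Continuous fun x => ε * (ψ x ^ (2 * (k + 2)) * pd i (pd i g) x ^ 2) :=
    continuous_const.mul c2
  have k3 : Continuous fun x => (ε⁻¹ + 4 * (k + 1) ^ 2 * S) * (ψ x ^ (2 * k) * g x ^ 2) :=
    continuous_const.mul c3
  have k23 : Continuous fun x => ε * (ψ x ^ (2 * (k + 2)) * pd i (pd i g) x ^ 2)
    + (ε⁻¹ + 4 * (k + 1) ^ 2 * S) * (ψ x ^ (2 * k) * g x ^ 2) := k2.add k3
  have key : ∫ x in cutSet N ψ, ψ x ^ (2 * (k + 1)) * pd i g x ^ 2 ≤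
      ∫ x in cutSet N ψ, (2 * pd i (fun x => ψ x ^ (2 * (k + 1)) * (g x * pd i g x)) x
        + (ε * (ψ x ^ (2 * (k + 2)) * pd i (pd i g) x ^ 2)
          + (ε⁻¹ + 4 * (k + 1) ^ 2 * S) * (ψ x ^ (2 * k) * g x ^ 2))) := by
    refine setIntegral_mono_on (hInt c1) (hInt (k0.add k23)) (measurableSet_cutSet N ψ)
      fun x hx => ?_
    rw [e1]
    have hP : 0 ≤ ψ x ^ (2 * k) := by rw [pow_mul]; positivity
    have r1 := mul_nonneg hP (sq_nonneg (ψ x * pd i g x + 2 * (k + 1) * pd i ψ x * g x))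
    have r2 := mul_nonneg hP (mul_nonneg hε.le
      (sq_nonneg (ψ x ^ 2 * pd i (pd i g) x + ε⁻¹ * g x)))
    have r3 : 0 ≤ ψ x ^ (2 * k) * (4 * (k + 1) ^ 2 * g x ^ 2 * (S - pd i ψ x ^ 2)) :=
      mul_nonneg hP (mul_nonneg (by positivity) (by linarith [hS x hx.2]))
    have r4 : ε * (ψ x ^ 2 * pd i (pd i g) x + ε⁻¹ * g x) ^ 2
        = ε * ψ x ^ 4 * pd i (pd i g) x ^ 2 + 2 * ψ x ^ 2 * pd i (pd i g) x * g x
          + ε⁻¹ * g x ^ 2 := by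
      field_simp
      ring
    rw [r4] at r2
    have p1 : ψ x ^ (2 * (k + 1)) = ψ x ^ (2 * k) * ψ x ^ 2 := by ring
    have p2 : ψ x ^ (2 * (k + 2)) = ψ x ^ (2 * k) * ψ x ^ 4 := by ring
    have p3 : ψ x ^ (2 * k + 1) = ψ x ^ (2 * k) * ψ x := by ring
    rw [p1, p2, p3]
    linarith
  rw [integral_add (hInt k0) (hInt k23), integral_add (hInt k2) (hInt k3), integral_const_mul,
    integral_const_mul, integral_const_mul, hz] at key
  linarith

lemma exists_wEnergy_interpolation (N : Fin d) {ψ : (Fin d → ℝ) → ℝ}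
    (hψ : ContDiff ℝ (⊤ : ℕ∞) ψ) (hψc : HasCompactSupport ψ) (m : ℕ) :
    ∃ D : ℝ → ℝ, (∀ ε, 0 < ε → 0 ≤ D ε) ∧ ∀ V : (Fin d → ℝ) → ℝ, ContDiff ℝ (⊤ : ℕ∞) V →
      (∀ l : List (Fin d), l.length < m → ∀ x ∈ tsupport ψ, x N = 0 → pdl l V x = 0) →
      ∀ k, k + 2 ≤ m → ∀ ε, 0 < ε →
        wEnergy N ψ (k + 1) V ≤ ε * wEnergy N ψ (k + 2) V + D ε * wEnergy N ψ k V := by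
  have hS : ∃ S : ℝ, 0 ≤ S ∧ ∀ i, ∀ x ∈ tsupport ψ, pd i ψ x ^ 2 ≤ S := by
    have : ∀ i, ∃ S : ℝ, ∀ x ∈ tsupport ψ, pd i ψ x ^ 2 ≤ S := fun i => by
      obtain ⟨S, h⟩ := IsCompact.bddAbove_image hψc
        (((hψ.pd i).continuous.pow 2).continuousOn (s := tsupport ψ))
      exact ⟨S, fun x hx => h ⟨x, hx, rfl⟩⟩
    choose S hS using this
    refine ⟨∑ i, |S i|, Finset.sum_nonneg fun _ _ => abs_nonneg _, fun i x hx =>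
      (hS i x hx).trans ((le_abs_self _).trans ?_)⟩
    exact Finset.single_le_sum (f := fun i => |S i|) (fun _ _ => abs_nonneg _) (Finset.mem_univ i)
  obtain ⟨S, hS0, hS⟩ := hS
  set c : ℝ := ∑ k ∈ Finset.range m, (Fintype.card (Fin (k + 1) → Fin d) : ℝ) + 1 with hc
  have hc0 : 0 < c := by positivity
  refine ⟨fun ε => c * ((ε / c)⁻¹ + 4 * (m + 1) ^ 2 * S), fun ε hε => by positivity,
    fun V hV h0 k hk ε hε => ?_⟩
  have hInt := fun {g : (Fin d → ℝ) → ℝ} (hg : Continuous g) => integrableOn_cutSet N hψc hg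
  have cP : ∀ k, Continuous fun x => ψ x ^ (2 * k) * derivSq k V x := fun k =>
    (hψ.continuous.pow _).mul (continuous_derivSq hV _)
  have cQ : ∀ k l, Continuous fun x => ψ x ^ (2 * k) * pdl l V x ^ 2 := fun k l =>
    (hψ.continuous.pow _).mul ((hV.pdl _).continuous.pow 2)
  have hle : ∀ k (l : List (Fin d)), l.length = k →
      ∫ x in cutSet N ψ, ψ x ^ (2 * k) * pdl l V x ^ 2 ≤ wEnergy N ψ k V := by
    intro k l hl
    refine setIntegral_mono_on (hInt (cQ k l)) (hInt (cP k)) (measurableSet_cutSet N ψ)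
      fun x _ => mul_le_mul_of_nonneg_left ?_ (by rw [pow_mul]; positivity)
    subst hl
    exact sq_pdl_le_derivSq l V x
  have hE : wEnergy N ψ (k + 1) V = ∑ f : Fin (k + 1) → Fin d,
      ∫ x in cutSet N ψ, ψ x ^ (2 * (k + 1)) * pdl (List.ofFn f) V x ^ 2 := by
    rw [← integral_finsetSum _ fun f _ => hInt (cQ _ _)]
    simp only [wEnergy, derivSq, Finset.mul_sum]
  have hterm : ∀ f : Fin (k + 1) → Fin d,
      ∫ x in cutSet N ψ, ψ x ^ (2 * (k + 1)) * pdl (List.ofFn f) V x ^ 2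
      ≤ ε / c * wEnergy N ψ (k + 2) V
        + ((ε / c)⁻¹ + 4 * (m + 1) ^ 2 * S) * wEnergy N ψ k V := by
    intro f
    rw [List.ofFn_succ]
    set l := List.ofFn fun i : Fin k => f i.succ with hl
    have hll : l.length = k := by simp [hl]
    have := integral_weighted_sq_pd_le N hψ hψc k (f 0) (hS (f 0)) (hV.pdl l)
      (h0 l (by omega)) (ε := ε / c) (by positivity)
    refine this.trans (add_le_add ?_ ?_)
    · refine mul_le_mul_of_nonneg_left ?_ (by positivity)
      exact hle (k + 2) (f 0 :: f 0 :: l) (by simp [hll])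
    · refine mul_le_mul ?_ (hle k l hll) ?_ (by positivity)
      · have : (k : ℝ) ≤ m := by exact_mod_cast (by omega : k ≤ m)
        gcongr
      · exact integral_nonneg fun x => mul_nonneg (by rw [pow_mul]; positivity) (sq_nonneg _)
  have hcard : (Fintype.card (Fin (k + 1) → Fin d) : ℝ) ≤ c := by
    have := Finset.single_le_sum (f := fun k => (Fintype.card (Fin (k + 1) → Fin d) : ℝ))
      (fun _ _ => Nat.cast_nonneg _) (Finset.mem_range.2 (by omega : k < m))
    linarith
  rw [hE]
  refine (Finset.sum_le_sum fun f _ => hterm f).trans ?_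
  rw [Finset.sum_const, Finset.card_univ, nsmul_eq_mul]
  have hn1 := wEnergy_nonneg N ψ k V
  have hn2 := wEnergy_nonneg N ψ (k + 2) V
  refine (mul_le_mul_of_nonneg_right hcard (by positivity)).trans (le_of_eq ?_)
  field_simp

variable {ι : Type*}

/-- The elliptic form controls the gradient up to terms of order zero. -/
lemma exists_gradient_bound (N : Fin d) {ψ : (Fin d → ℝ) → ℝ} (hψ : ContDiff ℝ (⊤ : ℕ∞) ψ)
    (hψc : HasCompactSupport ψ) (hψb : ∀ x ∈ tsupport ψ, ∀ j, |x j| < 2)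
    {m : ℕ} (hm : m ≠ 0) {lam K : ℝ} (hlam : 0 < lam) (hK : 0 ≤ K) (s : Finset ι)
    (L : ι → List (Fin d)) (hL : ∀ a ∈ s, (L a).length = m) :
    ∃ c C, 0 < c ∧ 0 ≤ C ∧ ∀ B : ι → ι → Fin n → Fin n → ℝ, LHForm s L m lam B →
      (∀ a b i j, |B a b i j| ≤ K) → ∀ V : Fin n → (Fin d → ℝ) → ℝ,
      (∀ i, ContDiff ℝ (⊤ : ℕ∞) (V i)) →
      (∀ i, ∀ l : List (Fin d), l.length < m → ∀ x ∈ tsupport ψ, x N = 0 → pdl l (V i) x = 0) →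
      c * ∑ i, wEnergy N ψ 1 (V i) ≤ (-1) ^ m * testForm N ψ m s L B V
        + C * ∑ i, wEnergy N ψ 0 (V i) := by
  obtain ⟨C1, hC1, h1⟩ := exists_energy_bound (n := n) N hψ hψc hψb hm hlam hK s L hL
  obtain ⟨D, hD, h2⟩ := exists_wEnergy_interpolation N hψ hψc m
  have h3 : ∀ k : ℕ, ∃ C, 0 ≤ C ∧ (k < m → ∀ β : ℕ → ℝ, (∀ j, 0 ≤ β j) →
      (∀ j, j + 2 ≤ m → ∀ ε, 0 < ε → β (j + 1) ≤ ε * β (j + 2) + D ε * β j) →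
      β k ≤ lam / (8 * (m * C1 + 1)) * β m + C * β 0) := fun k => by
    by_cases hk : k < m
    · obtain ⟨C, hC, h⟩ := exists_interpolation hD m k hk (lam / (8 * (m * C1 + 1)))
        (by positivity)
      exact ⟨C, hC, fun _ => h⟩
    · exact ⟨0, le_rfl, fun h => absurd h hk⟩
  choose C3 hC3 h3 using h3
  have h4 : ∃ C, 0 ≤ C ∧ ∀ β : ℕ → ℝ, (∀ j, 0 ≤ β j) →
      (∀ j, j + 2 ≤ m → ∀ ε, 0 < ε → β (j + 1) ≤ ε * β (j + 2) + D ε * β j) →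
      β 1 ≤ β m + C * β 0 := by
    rcases Nat.lt_or_ge 1 m with h | h
    · simpa using exists_interpolation hD m 1 h 1 one_pos
    · refine ⟨0, le_rfl, fun β _ _ => ?_⟩
      have : m = 1 := by omega
      simp [this]
  obtain ⟨C4, hC4, h4⟩ := h4
  refine ⟨lam / 8, C1 * ∑ k ∈ Finset.range m, C3 k + lam / 8 * C4, by positivity,
    add_nonneg (mul_nonneg hC1 (Finset.sum_nonneg fun k _ => hC3 k)) (by positivity),
    fun B hB hBK V hV h0 => ?_⟩
  have e1 := h1 B hB hBK V hV h0
  have hi : ∀ i, C1 * ∑ k ∈ Finset.range m, wEnergy N ψ k (V i) ≤ lam / 8 * wEnergy N ψ m (V i)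
      + C1 * (∑ k ∈ Finset.range m, C3 k) * wEnergy N ψ 0 (V i) := fun i => by
    have a1 : ∑ k ∈ Finset.range m, wEnergy N ψ k (V i) ≤ ∑ k ∈ Finset.range m,
        (lam / (8 * (m * C1 + 1)) * wEnergy N ψ m (V i) + C3 k * wEnergy N ψ 0 (V i)) :=
      Finset.sum_le_sum fun k hk => h3 k (Finset.mem_range.1 hk) (fun k => wEnergy N ψ k (V i))
        (fun k => wEnergy_nonneg _ _ _ _) (fun j hj => h2 (V i) (hV i) (h0 i) j hj)
    rw [Finset.sum_add_distrib, Finset.sum_const, Finset.card_range, nsmul_eq_mul,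
      ← Finset.sum_mul] at a1
    have a2 := mul_le_mul_of_nonneg_left a1 hC1
    have a3 : C1 * (m * (lam / (8 * (m * C1 + 1)) * wEnergy N ψ m (V i)))
        ≤ lam / 8 * wEnergy N ψ m (V i) := by
      rw [← mul_assoc, ← mul_assoc]
      refine mul_le_mul_of_nonneg_right ?_ (wEnergy_nonneg _ _ _ _)
      rw [← mul_div_assoc, div_le_div_iff₀ (by positivity) (by norm_num)]
      nlinarith
    linarith
  have hsum := Finset.sum_le_sum fun i (_ : i ∈ Finset.univ) => hi i
  rw [Finset.sum_add_distrib, ← Finset.mul_sum, ← Finset.mul_sum, ← Finset.mul_sum] at hsum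
  have h1s : ∑ i, wEnergy N ψ 1 (V i) ≤ ∑ i, (wEnergy N ψ m (V i) + C4 * wEnergy N ψ 0 (V i)) :=
    Finset.sum_le_sum fun i _ => h4 (fun k => wEnergy N ψ k (V i))
        (fun k => wEnergy_nonneg _ _ _ _) (fun j hj => h2 (V i) (hV i) (h0 i) j hj)
  rw [Finset.sum_add_distrib, ← Finset.mul_sum] at h1s
  have h1t := mul_le_mul_of_nonneg_left h1s (by positivity : 0 ≤ lam / 8)
  linarith

end Interpolation

section SpaceTime

variable {d : ℕ}

/-- Joint smoothness of a function of time and space. -/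
def SmoothST (U : ℝ → (Fin d → ℝ) → ℝ) : Prop :=
  ContDiff ℝ (⊤ : ℕ∞) fun p : ℝ × (Fin d → ℝ) => U p.1 p.2

namespace SmoothST

variable {U : ℝ → (Fin d → ℝ) → ℝ}

lemma slice (hU : SmoothST U) (t : ℝ) : ContDiff ℝ (⊤ : ℕ∞) (U t) :=
  ContDiff.comp (g := fun p : ℝ × (Fin d → ℝ) => U p.1 p.2) hU
    (contDiff_const.prodMk contDiff_id : ContDiff ℝ _ fun x => (t, x))

lemma time (hU : SmoothST U) (x : Fin d → ℝ) : ContDiff ℝ (⊤ : ℕ∞) fun τ => U τ x :=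
  ContDiff.comp (g := fun p : ℝ × (Fin d → ℝ) => U p.1 p.2) hU
    (contDiff_id.prodMk contDiff_const : ContDiff ℝ _ fun t => (t, x))

lemma pd_eq (hU : SmoothST U) (i : Fin d) (t : ℝ) (x : Fin d → ℝ) :
    pd i (U t) x = fderiv ℝ (fun p : ℝ × (Fin d → ℝ) => U p.1 p.2) (t, x) (0, Pi.single i 1) := by
  have h := (ContDiff.differentiable hU (by simp) (t, x)).hasFDerivAt.comp x
    ((hasFDerivAt_const t x).prodMk (hasFDerivAt_id x))
  have h2 : HasFDerivAt (U t) _ x := h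
  rw [pd, h2.fderiv]
  simp

lemma deriv_eq (hU : SmoothST U) (t : ℝ) (x : Fin d → ℝ) :
    deriv (fun τ => U τ x) t
      = fderiv ℝ (fun p : ℝ × (Fin d → ℝ) => U p.1 p.2) (t, x) (1, 0) := by
  have h := (ContDiff.differentiable hU (by simp) (t, x)).hasFDerivAt.comp_hasDerivAt t
    ((hasDerivAt_id t).prodMk (hasDerivAt_const t x))
  exact h.deriv

lemma dir {f : ℝ × (Fin d → ℝ) → ℝ} (hf : ContDiff ℝ (⊤ : ℕ∞) f) (v : ℝ × (Fin d → ℝ)) :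
    ContDiff ℝ (⊤ : ℕ∞) fun p => fderiv ℝ f p v :=
  (hf.fderiv_right (m := (⊤ : ℕ∞)) (by simp)).clm_apply contDiff_const

protected lemma pd (hU : SmoothST U) (i : Fin d) : SmoothST fun t => pd i (U t) := by
  unfold SmoothST
  simp only [hU.pd_eq]
  exact dir hU _

protected lemma pdl (hU : SmoothST U) (l : List (Fin d)) : SmoothST fun t => pdl l (U t) := by
  induction l with
  | nil => exact hU
  | cons i l ih => exact ih.pd i

lemma dt (hU : SmoothST U) : SmoothST fun t x => deriv (fun τ => U τ x) t := by
  unfold SmoothST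
  simp only [hU.deriv_eq]
  exact dir hU _

lemma pd_deriv_comm (hU : SmoothST U) (i : Fin d) (t : ℝ) (x : Fin d → ℝ) :
    pd i (fun x => deriv (fun τ => U τ x) t) x = deriv (fun τ => pd i (U τ) x) t := by
  rw [hU.dt.pd_eq i t x, (hU.pd i).deriv_eq t x]
  simp only [hU.deriv_eq, hU.pd_eq]
  set f := fun p : ℝ × (Fin d → ℝ) => U p.1 p.2
  have hf : ContDiff ℝ (⊤ : ℕ∞) f := hU
  have hd : DifferentiableAt ℝ (fderiv ℝ f) (t, x) :=
    (hf.fderiv_right (m := (⊤ : ℕ∞)) (by simp)).differentiable (by simp) _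
  have key : ∀ v w : ℝ × (Fin d → ℝ), fderiv ℝ (fun y => fderiv ℝ f (y.1, y.2) v) (t, x) w
      = fderiv ℝ (fderiv ℝ f) (t, x) w v := by
    intro v w
    rw [show (fun y : ℝ × (Fin d → ℝ) => fderiv ℝ f (y.1, y.2) v) = fun y => fderiv ℝ f y v from rfl,
      fderiv_clm_apply hd (differentiableAt_const _)]
    simp
  have hs : IsSymmSndFDerivAt ℝ f (t, x) :=
    hf.contDiffAt.isSymmSndFDerivAt (by simpa using WithTop.coe_le_coe.2 (le_top : (2 : ℕ∞) ≤ ⊤))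
  rw [key, key]
  exact hs _ _

lemma continuous (hU : SmoothST U) : Continuous (Function.uncurry U) := ContDiff.continuous hU

lemma hasDerivAt (hU : SmoothST U) (t : ℝ) (x : Fin d → ℝ) :
    HasDerivAt (fun τ => U τ x) (deriv (fun τ => U τ x) t) t :=
  ((hU.time x).differentiable (by simp) t).hasDerivAt

end SmoothST

/-- Differentiation of an integral over a compact set with respect to a parameter. -/
lemma hasDerivAt_integral_compact {Y : Type*} [TopologicalSpace Y] [MeasurableSpace Y]
    [OpensMeasurableSpace Y] {ν : Measure Y} [IsFiniteMeasureOnCompacts ν] {S : Set Y}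
    (hS : IsCompact S) (hSm : MeasurableSet S) {G G' : ℝ → Y → ℝ}
    (hG : Continuous (Function.uncurry G))
    (hG' : Continuous (Function.uncurry G')) (hd : ∀ t y, HasDerivAt (fun τ => G τ y) (G' t y) t)
    (t : ℝ) : HasDerivAt (fun τ => ∫ y in S, G τ y ∂ν) (∫ y in S, G' t y ∂ν) t := by
  have hGc : ∀ t, Continuous (G t) := fun t => hG.comp (continuous_const.prodMk continuous_id)
  have hGc' : ∀ t, Continuous (G' t) := fun t => hG'.comp (continuous_const.prodMk continuous_id)
  obtain ⟨B, hB⟩ := IsCompact.exists_bound_of_continuousOn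
    ((isCompact_closedBall t 1).prod hS) hG'.continuousOn
  have hms : ∀ {g : Y → ℝ}, Continuous g → AEStronglyMeasurable g (ν.restrict S) := fun hg =>
    hg.continuousOn.aestronglyMeasurable_of_isCompact hS hSm
  exact (hasDerivAt_integral_of_dominated_loc_of_deriv_le (F := G) (F' := G')
    (bound := fun _ => B) (closedBall_mem_nhds t one_pos)
    (Filter.Eventually.of_forall fun τ => hms (hGc τ))
    ((hGc t).continuousOn.integrableOn_compact' hS hSm)
    (hms (hGc' t))
    (by
      filter_upwards [ae_restrict_mem hSm] with y hy τ hτ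
      exact hB (τ, y) ⟨hτ, hy⟩)
    (by
      have := hS.measure_lt_top (μ := ν)
      rw [integrable_const_iff]
      right
      constructor
      simpa using this)
    (Filter.Eventually.of_forall fun y τ _ => hd τ y)).2

lemma nonpos_of_ae_nonpos {f : ℝ → ℝ} (hf : Continuous f) {a b : ℝ}
    (h : ∀ᵐ t, t ∈ Ioo a b → f t ≤ 0) : ∀ t ∈ Ioo a b, f t ≤ 0 := by
  intro t ht
  by_contra hc
  have ho : IsOpen (Ioo a b ∩ f ⁻¹' Ioi 0) := isOpen_Ioo.inter (isOpen_Ioi.preimage hf)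
  have hp := ho.measure_pos volume ⟨t, ht, not_le.1 hc⟩
  refine hp.ne' (measure_mono_null (fun x hx => ?_) (ae_iff.1 h))
  simp only [mem_ofPred_eq, not_forall]
  exact ⟨hx.1, not_le.2 hx.2⟩

/-- The upper half ball. -/
def bHalf (N : Fin d) (r : ℝ) : Set (Fin d → ℝ) := {x | 0 < x N ∧ ∑ j, x j ^ 2 < r ^ 2}

lemma isOpen_bHalf (N : Fin d) (r : ℝ) : IsOpen (bHalf N r) :=
  (isOpen_lt continuous_const (continuous_apply N)).inter
    (isOpen_lt (f := fun x : Fin d → ℝ => ∑ j, x j ^ 2) (by fun_prop) continuous_const)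

lemma isCompact_sumSq_le (r : ℝ) : IsCompact {x : Fin d → ℝ | ∑ j, x j ^ 2 ≤ r} := by
  refine (isCompact_closedBall (0 : Fin d → ℝ) (|r| + 1)).of_isClosed_subset
    (isClosed_le (by fun_prop) continuous_const) fun x hx => ?_
  rw [mem_closedBall_zero_iff, pi_norm_le_iff_of_nonneg (by positivity)]
  intro j
  have h1 : x j ^ 2 ≤ r :=
    (Finset.single_le_sum (f := fun j => x j ^ 2) (fun _ _ => sq_nonneg _)
      (Finset.mem_univ j)).trans hx
  rw [Real.norm_eq_abs]
  have h2 := le_abs_self r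
  have h3 := sq_abs (x j)
  have h4 := abs_nonneg r
  by_contra h
  push Not at h
  have := mul_self_lt_mul_self (by positivity) h
  linarith [mul_nonneg h4 h4]

lemma bHalf_subset_sumSq (N : Fin d) (r : ℝ) :
    bHalf N r ⊆ {x : Fin d → ℝ | ∑ j, x j ^ 2 ≤ r ^ 2} := fun _ hx => hx.2.le

lemma integrableOn_bHalf (N : Fin d) (r : ℝ) {g : (Fin d → ℝ) → ℝ} (hg : Continuous g) :
    IntegrableOn g (bHalf N r) :=
  (hg.continuousOn.integrableOn_compact (isCompact_sumSq_le (r ^ 2))).mono_set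
    (bHalf_subset_sumSq N r)

lemma continuous_integral_bHalf (N : Fin d) (r : ℝ) {g : ℝ → (Fin d → ℝ) → ℝ}
    (hg : Continuous (Function.uncurry g)) : Continuous fun t => ∫ x in bHalf N r, g t x := by
  have := continuous_parametric_integral_of_continuous (μ := volume.restrict (bHalf N r)) hg
    (isCompact_sumSq_le (d := d) (r ^ 2))
  rwa [Measure.restrict_restrict (isCompact_sumSq_le (r ^ 2)).measurableSet,
    inter_eq_right.2 (bHalf_subset_sumSq N r)] at this

lemma cutSet_eq_restrict (N : Fin d) (ψ : (Fin d → ℝ) → ℝ) :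
    (volume.restrict (halfSp N)).restrict (tsupport ψ) = volume.restrict (cutSet N ψ) := by
  rw [Measure.restrict_restrict (isClosed_tsupport ψ).measurableSet, inter_comm, cutSet]

lemma continuous_integral_cutSet (N : Fin d) {ψ : (Fin d → ℝ) → ℝ} (hψ : HasCompactSupport ψ)
    {g : ℝ → (Fin d → ℝ) → ℝ}
    (hg : Continuous (Function.uncurry g)) : Continuous fun t => ∫ x in cutSet N ψ, g t x := by
  have := continuous_parametric_integral_of_continuous (μ := volume.restrict (halfSp N)) hg hψ
  rwa [cutSet_eq_restrict] at this

lemma hasDerivAt_integral_cutSet (N : Fin d) {ψ : (Fin d → ℝ) → ℝ} (hψ : HasCompactSupport ψ)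
    {G G' : ℝ → (Fin d → ℝ) → ℝ} (hG : Continuous (Function.uncurry G))
    (hG' : Continuous (Function.uncurry G')) (hd : ∀ t y, HasDerivAt (fun τ => G τ y) (G' t y) t)
    (t : ℝ) :
    HasDerivAt (fun τ => ∫ y in cutSet N ψ, G τ y) (∫ y in cutSet N ψ, G' t y) t := by
  have := hasDerivAt_integral_compact (ν := volume.restrict (halfSp N)) hψ
    (isClosed_tsupport ψ).measurableSet hG hG' hd t
  rwa [cutSet_eq_restrict] at this

lemma exists_cutoff {r R : ℝ} (hr : 0 ≤ r) (hR : r < R) : ∃ ψ : (Fin d → ℝ) → ℝ,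
    ContDiff ℝ (⊤ : ℕ∞) ψ ∧ HasCompactSupport ψ ∧ (∀ x ∈ tsupport ψ, ∑ j, x j ^ 2 < R ^ 2) ∧
      (∀ x, 0 ≤ ψ x) ∧ (∀ x, ψ x ≤ 1) ∧ ∀ x, ∑ j, x j ^ 2 ≤ r ^ 2 → ψ x = 1 := by
  obtain ⟨q, hq1, hq2⟩ := exists_between (pow_lt_pow_left₀ hR hr two_ne_zero)
  have hsub : tsupport (fun x : Fin d → ℝ => Real.smoothTransition
      ((q - ∑ j, x j ^ 2) / (q - r ^ 2))) ⊆ {x : Fin d → ℝ | ∑ j, x j ^ 2 ≤ q} := by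
    refine closure_minimal (fun x hx => ?_) (isCompact_sumSq_le q).isClosed
    by_contra h
    simp only [mem_ofPred_eq, not_le] at h
    exact hx (Real.smoothTransition.zero_of_nonpos
      (div_nonpos_of_nonpos_of_nonneg (by linarith) (by linarith)))
  refine ⟨fun x => Real.smoothTransition ((q - ∑ j, x j ^ 2) / (q - r ^ 2)), ?_,
    (isCompact_sumSq_le q).of_isClosed_subset (isClosed_tsupport _) hsub,
    fun x hx => (show _ ≤ q from hsub hx).trans_lt hq2,
    fun x => Real.smoothTransition.nonneg _, fun x => Real.smoothTransition.le_one _,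
    fun x hx => Real.smoothTransition.one_of_one_le ?_⟩
  · exact Real.smoothTransition.contDiff.comp
      ((contDiff_const.sub (ContDiff.sum fun j _ => (contDiff_apply ℝ ℝ j).pow 2)).div_const _)
  · rw [one_le_div (by linarith)]
    linarith

variable {n : ℕ} {ι : Type*}

/-- Smooth functions solving the parabolic system almost everywhere in the half cylinder with
homogeneous Dirichlet conditions on the flat part of its boundary. -/
structure IsSol (N : Fin d) (m : ℕ) (s : Finset ι) (L : ι → List (Fin d))
    (A : ι → ι → ℝ → Fin n → Fin n → ℝ) (U : Fin n → ℝ → (Fin d → ℝ) → ℝ) : Prop where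
  smooth : ∀ i, SmoothST (U i)
  eqn : ∀ᵐ t, t ∈ Ioo (-3 : ℝ) 0 → ∀ x ∈ bHalf N 2, ∀ i, deriv (fun τ => U i τ x) t
    = -((-1) ^ m * ∑ a ∈ s, ∑ b ∈ s, ∑ j, A a b t i j * pdl (L a ++ L b) (U j t) x)
  bc : ∀ t ∈ Ioo (-3 : ℝ) 0, ∀ x, x N = 0 → ∑ j, x j ^ 2 < 2 ^ 2 → ∀ i, ∀ l : List (Fin d),
    l.length < m → pdl l (U i t) x = 0

lemma IsSol.pd {N : Fin d} {m : ℕ} {s : Finset ι} {L : ι → List (Fin d)}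
    {A : ι → ι → ℝ → Fin n → Fin n → ℝ} {U : Fin n → ℝ → (Fin d → ℝ) → ℝ}
    (h : IsSol N m s L A U) {k : Fin d} (hk : k ≠ N) :
    IsSol N m s L A fun i t => pd k (U i t) where
  smooth i := (h.smooth i).pd k
  eqn := by
    filter_upwards [h.eqn] with t ht htm x hx i
    rw [← (h.smooth i).pd_deriv_comm k t x]
    have hev : (fun y => deriv (fun τ => U i τ y) t) =ᶠ[𝓝 x] fun y =>
        (-(-1) ^ m) * ∑ a ∈ s, ∑ b ∈ s, ∑ j, A a b t i j * pdl (L a ++ L b) (U j t) y := by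
      filter_upwards [(isOpen_bHalf N 2).mem_nhds hx] with y hy
      rw [ht htm y hy i]
      ring
    have hs : ∀ j l, ContDiff ℝ (⊤ : ℕ∞) (_root_.pdl l (U j t)) :=
      fun j l => ((h.smooth j).slice t).pdl l
    have hs1 : ∀ a b j, ContDiff ℝ (⊤ : ℕ∞) fun y => A a b t i j * pdl (L a ++ L b) (U j t) y :=
      fun a b j => contDiff_const.mul (hs _ _)
    have hs2 : ∀ a b, ContDiff ℝ (⊤ : ℕ∞) fun y =>
      ∑ j, A a b t i j * pdl (L a ++ L b) (U j t) y := fun a b => ContDiff.sum fun j _ => hs1 a b j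
    have hs3 : ∀ a, ContDiff ℝ (⊤ : ℕ∞) fun y =>
      ∑ b ∈ s, ∑ j, A a b t i j * pdl (L a ++ L b) (U j t) y := fun a =>
        ContDiff.sum fun b _ => hs2 a b
    have hs4 : ContDiff ℝ (⊤ : ℕ∞) fun y =>
      ∑ a ∈ s, ∑ b ∈ s, ∑ j, A a b t i j * pdl (L a ++ L b) (U j t) y :=
        ContDiff.sum fun a _ => hs3 a
    rw [_root_.pd, hev.fderiv_eq, ← _root_.pd, pd_const_mul hs4, pd_sum s fun a _ => hs3 a]
    simp only [pd_sum s fun b _ => hs2 _ b, pd_sum Finset.univ fun j _ => hs1 _ _ j,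
      pd_const_mul (hs _ _), pd_pdl_comm ((h.smooth _).slice t)]
    ring
  bc := by
    intro t ht x hx hxR i l hl
    rw [← pd_pdl_comm ((h.smooth i).slice t) k l]
    set g := pdl l (U i t)
    have hg : Differentiable ℝ g := (((h.smooth i).slice t).pdl l).differentiable (by simp)
    have hline : HasDerivAt (fun r : ℝ => x + r • (Pi.single k 1 : Fin d → ℝ))
        (Pi.single k 1) 0 := by
      simpa using ((hasDerivAt_id (0 : ℝ)).smul_const (Pi.single k 1 : Fin d → ℝ)).const_add x
    have hc : HasDerivAt (fun r : ℝ => g (x + r • Pi.single k 1)) (_root_.pd k g x) 0 := by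
      have hg0 : HasFDerivAt g (fderiv ℝ g x) (x + (0 : ℝ) • (Pi.single k 1 : Fin d → ℝ)) := by
        simpa using (hg x).hasFDerivAt
      exact hg0.comp_hasDerivAt 0 hline
    have hcont : Continuous fun r : ℝ => ∑ j, (x + r • (Pi.single k 1 : Fin d → ℝ)) j ^ 2 := by
      fun_prop
    have hev : (fun r : ℝ => g (x + r • Pi.single k 1)) =ᶠ[𝓝 0] fun _ => 0 := by
      have : ∀ᶠ r in 𝓝 (0 : ℝ), ∑ j, (x + r • (Pi.single k 1 : Fin d → ℝ)) j ^ 2 < 2 ^ 2 :=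
        hcont.continuousAt.eventually_lt continuousAt_const (by simpa using hxR)
      filter_upwards [this] with r hr
      refine h.bc t ht _ ?_ hr i l hl
      simp [hx, Pi.single_eq_of_ne hk.symm]
    exact hc.unique (((hasDerivAt_const (0 : ℝ) (0 : ℝ)).congr_of_eventuallyEq hev))

end SpaceTime

section Caccioppoli

variable {d n : ℕ} {ι : Type*}

/-- The energy of a family of functions over the upper half ball. -/
noncomputable def halfNorm (N : Fin d) (r : ℝ) (V : Fin n → (Fin d → ℝ) → ℝ) : ℝ :=
  ∫ x in bHalf N r, ∑ i, V i x ^ 2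

lemma halfNorm_nonneg (N : Fin d) (r : ℝ) (V : Fin n → (Fin d → ℝ) → ℝ) : 0 ≤ halfNorm N r V :=
  integral_nonneg fun _ => Finset.sum_nonneg fun _ _ => sq_nonneg _

lemma continuous_halfNorm (N : Fin d) (r : ℝ) {U : Fin n → ℝ → (Fin d → ℝ) → ℝ}
    (hU : ∀ i, SmoothST (U i)) : Continuous fun t => halfNorm N r fun i => U i t := by
  refine continuous_integral_bHalf N r (g := fun t x => ∑ i, U i t x ^ 2) ?_
  exact continuous_finsetSum _ fun i _ => (hU i).continuous.pow 2

lemma exists_differential_inequality (N : Fin d) {ψ : (Fin d → ℝ) → ℝ}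
    (hψ : ContDiff ℝ (⊤ : ℕ∞) ψ) (hψc : HasCompactSupport ψ)
    (hψ2 : ∀ x ∈ tsupport ψ, ∑ j, x j ^ 2 < 2 ^ 2)
    {m : ℕ} (hm : m ≠ 0) {lam K : ℝ} (hlam : 0 < lam) (hK : 0 ≤ K) (s : Finset ι)
    (L : ι → List (Fin d)) (hL : ∀ a ∈ s, (L a).length = m) :
    ∃ c C, 0 < c ∧ 0 ≤ C ∧ ∀ A : ι → ι → ℝ → Fin n → Fin n → ℝ,
      (∀ t, LHForm s L m lam fun a b => A a b t) → (∀ a b t i j, |A a b t i j| ≤ K) →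
      ∀ U, IsSol N m s L A U →
      ∃ Y' : ℝ → ℝ, Continuous Y' ∧
        (∀ t, HasDerivAt (fun t => ∫ x in cutSet N ψ, ψ x ^ (2 * m) * ∑ i, U i t x ^ 2) (Y' t) t) ∧
        ∀ t ∈ Ioo (-3 : ℝ) 0, Y' t ≤ -c * (∑ i, wEnergy N ψ 1 (U i t))
          + C * ∑ i, wEnergy N ψ 0 (U i t) := by
  have hψb : ∀ x ∈ tsupport ψ, ∀ j, |x j| < 2 := fun x hx j => by
    refine abs_lt_of_sq_lt_sq ((Finset.single_le_sum (f := fun j => x j ^ 2)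
      (fun _ _ => sq_nonneg _) (Finset.mem_univ j)).trans_lt (hψ2 x hx)) (by norm_num)
  obtain ⟨c, C, hc, hC, h1⟩ := exists_gradient_bound (n := n) N hψ hψc hψb hm hlam hK s L hL
  refine ⟨2 * c, 2 * C, by positivity, by positivity, fun A hA hAK U hU => ?_⟩
  set G' : ℝ → (Fin d → ℝ) → ℝ := fun t x =>
    ψ x ^ (2 * m) * ∑ i, 2 * U i t x * deriv (fun τ => U i τ x) t with hG'
  have cU : ∀ i, Continuous fun p : ℝ × (Fin d → ℝ) => U i p.1 p.2 :=
    fun i => (hU.smooth i).continuous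
  have cD : ∀ i, Continuous fun p : ℝ × (Fin d → ℝ) => deriv (fun τ => U i τ p.2) p.1 :=
    fun i => (hU.smooth i).dt.continuous
  have cψ : Continuous fun p : ℝ × (Fin d → ℝ) => ψ p.2 ^ (2 * m) :=
    (hψ.continuous.comp continuous_snd).pow _
  have cG : Continuous fun p : ℝ × (Fin d → ℝ) => ψ p.2 ^ (2 * m) * ∑ i, U i p.1 p.2 ^ 2 :=
    cψ.mul (continuous_finsetSum _ fun i _ => (cU i).pow 2)
  have cG' : Continuous (Function.uncurry G') :=
    cψ.mul (continuous_finsetSum _ fun i _ => (continuous_const.mul (cU i)).mul (cD i))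
  have cE : ∀ k i, Continuous fun t => wEnergy N ψ k (U i t) := fun k i => by
    refine continuous_integral_cutSet N hψc
      (g := fun t x => ψ x ^ (2 * k) * derivSq k (U i t) x) ?_
    exact ((hψ.continuous.comp continuous_snd).pow _).mul
      (continuous_finsetSum _ fun f _ => (((hU.smooth i).pdl _).continuous).pow 2)
  have hY' : Continuous fun t => ∫ x in cutSet N ψ, G' t x := continuous_integral_cutSet N hψc cG'
  refine ⟨fun t => ∫ x in cutSet N ψ, G' t x, hY',
    fun t => hasDerivAt_integral_cutSet N hψc
      (G := fun t x => ψ x ^ (2 * m) * ∑ i, U i t x ^ 2) (G' := G') cG cG' (fun t x => ?_) t, ?_⟩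
  · refine (HasDerivAt.fun_sum fun i _ => ?_).const_mul _
    simpa using ((hU.smooth i).hasDerivAt t x).fun_pow 2
  · suffices ∀ t ∈ Ioo (-3 : ℝ) 0, (∫ x in cutSet N ψ, G' t x) +
        (2 * c * (∑ i, wEnergy N ψ 1 (U i t)) - 2 * C * ∑ i, wEnergy N ψ 0 (U i t)) ≤ 0 from
      fun t ht => by linarith [this t ht]
    refine nonpos_of_ae_nonpos (hY'.add ((continuous_const.mul (continuous_finsetSum _ fun i _ =>
      cE 1 i)).sub (continuous_const.mul (continuous_finsetSum _ fun i _ => cE 0 i)))) ?_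
    filter_upwards [hU.eqn] with t ht htm
    have key := h1 (fun a b => A a b t) (hA t) (fun a b => hAK a b t) (fun i => U i t)
      (fun i => (hU.smooth i).slice t)
      (fun i l hl x hx hxN => hU.bc t htm x hxN (hψ2 x hx) i l hl)
    have e : ∫ x in cutSet N ψ, G' t x
        = -2 * ((-1) ^ m * testForm N ψ m s L (fun a b => A a b t) fun i => U i t) := by
      have hP : ∀ a b i j, Continuous fun x =>
          ψ x ^ (2 * m) * U i t x * pdl (L a ++ L b) (U j t) x := fun a b i j =>
        ((hψ.continuous.pow _).mul ((hU.smooth i).slice t).continuous).mul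
          (((hU.smooth j).slice t).pdl _).continuous
      have hPi := fun a b i j => integrableOn_cutSet N hψc (hP a b i j)
      have e1 : ∫ x in cutSet N ψ, G' t x = ∫ x in cutSet N ψ, (-2 * (-1) ^ m) *
          ∑ a ∈ s, ∑ b ∈ s, ∑ i, ∑ j, A a b t i j *
            (ψ x ^ (2 * m) * U i t x * pdl (L a ++ L b) (U j t) x) := by
        refine setIntegral_congr_fun (measurableSet_cutSet N ψ) fun x hx => ?_
        simp only [hG']
        have : ∀ i, 2 * U i t x * deriv (fun τ => U i τ x) t = (-2 * (-1) ^ m) *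
            ∑ a ∈ s, ∑ b ∈ s, ∑ j, A a b t i j * (U i t x * pdl (L a ++ L b) (U j t) x) := by
          intro i
          rw [ht htm x ⟨hx.1, hψ2 x hx.2⟩ i]
          have : ∀ a b j, A a b t i j * (U i t x * pdl (L a ++ L b) (U j t) x)
            = U i t x * (A a b t i j * pdl (L a ++ L b) (U j t) x) := fun a b j => by ring
          simp only [this, ← Finset.mul_sum]
          ring
        simp only [this]
        rw [← Finset.mul_sum, Finset.sum_comm]
        have h3 : ∀ a, ∑ i, ∑ b ∈ s, ∑ j, A a b t i j * (U i t x * pdl (L a ++ L b) (U j t) x)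
            = ∑ b ∈ s, ∑ i, ∑ j, A a b t i j * (U i t x * pdl (L a ++ L b) (U j t) x) :=
          fun a => Finset.sum_comm
        simp only [h3]
        rw [mul_left_comm]
        congr 1
        simp only [Finset.mul_sum]
        refine Finset.sum_congr rfl fun a _ => Finset.sum_congr rfl fun b _ =>
          Finset.sum_congr rfl fun i _ => Finset.sum_congr rfl fun j _ => by ring
      have i3 : ∀ a b i, Integrable (fun x => ∑ j, A a b t i j *
          (ψ x ^ (2 * m) * U i t x * pdl (L a ++ L b) (U j t) x))
          (volume.restrict (cutSet N ψ)) := fun a b i =>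
        integrable_finsetSum _ fun j _ => (hPi a b i j).const_mul _
      have i2 : ∀ a b, Integrable (fun x => ∑ i, ∑ j, A a b t i j *
          (ψ x ^ (2 * m) * U i t x * pdl (L a ++ L b) (U j t) x))
          (volume.restrict (cutSet N ψ)) := fun a b =>
        integrable_finsetSum _ fun i _ => i3 a b i
      have i1 : ∀ a, Integrable (fun x => ∑ b ∈ s, ∑ i, ∑ j, A a b t i j *
          (ψ x ^ (2 * m) * U i t x * pdl (L a ++ L b) (U j t) x))
          (volume.restrict (cutSet N ψ)) := fun a =>
        integrable_finsetSum _ fun b _ => i2 a b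
      rw [e1, integral_const_mul, ← mul_assoc, testForm, integral_finsetSum _ fun a _ => i1 a]
      congr 1
      refine Finset.sum_congr rfl fun a _ => ?_
      rw [integral_finsetSum _ fun b _ => i2 a b]
      refine Finset.sum_congr rfl fun b _ => ?_
      rw [integral_finsetSum _ fun i _ => i3 a b i]
      refine Finset.sum_congr rfl fun i _ => ?_
      rw [integral_finsetSum _ fun j _ => (hPi a b i j).const_mul _]
      refine Finset.sum_congr rfl fun j _ => ?_
      rw [integral_const_mul, integral_halfSp_eq_cutSet N ψ fun x hx => ?_]
      rw [image_eq_zero_of_notMem_tsupport hx, zero_pow (by omega)]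
      ring
    change (∫ x in cutSet N ψ, G' t x) +
        (2 * c * (∑ i, wEnergy N ψ 1 (U i t)) - 2 * C * ∑ i, wEnergy N ψ 0 (U i t)) ≤ 0
    rw [e]
    linarith

end Caccioppoli

section LocalEnergy

variable {d n : ℕ} {ι : Type*}

lemma bHalf_mono (N : Fin d) {r R : ℝ} (hr : 0 ≤ r) (h : r ≤ R) : bHalf N r ⊆ bHalf N R :=
  fun _ hx => ⟨hx.1, hx.2.trans_le (pow_le_pow_left₀ hr h 2)⟩

lemma setIntegral_le_of_subset {Y : Type*} [MeasurableSpace Y] {ν : Measure Y} {S S' : Set Y}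
    {f g : Y → ℝ} (hS : MeasurableSet S) (hSS : S ⊆ S')
    (hf : IntegrableOn f S ν) (hg : IntegrableOn g S' ν) (hS' : MeasurableSet S')
    (hfg : ∀ x ∈ S, f x ≤ g x) (hg0 : ∀ x ∈ S', 0 ≤ g x) :
    ∫ x in S, f x ∂ν ≤ ∫ x in S', g x ∂ν :=
  (setIntegral_mono_on hf (hg.mono_set hSS) hS hfg).trans
    (setIntegral_mono_set hg ((ae_restrict_iff' hS').2 (Filter.Eventually.of_forall hg0))
      (Filter.Eventually.of_forall hSS))

lemma exists_local_energy (N : Fin d) {m : ℕ} (hm : m ≠ 0) {lam K : ℝ} (hlam : 0 < lam)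
    (hK : 0 ≤ K) (s : Finset ι) (L : ι → List (Fin d)) (hL : ∀ a ∈ s, (L a).length = m)
    {r R T T' : ℝ} (hr : 0 < r) (hrR : r < R) (hR : R ≤ 2) (hT : -3 ≤ T) (hTT : T < T')
    (hT' : T' ≤ 0) :
    ∃ C, 0 ≤ C ∧ ∀ A : ι → ι → ℝ → Fin n → Fin n → ℝ,
      (∀ t, LHForm s L m lam fun a b => A a b t) → (∀ a b t i j, |A a b t i j| ≤ K) →
      ∀ U, IsSol N m s L A U →
        (∀ t ∈ Icc T' 0, halfNorm N r (fun i => U i t)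
          ≤ C * ∫ t in T..0, halfNorm N R fun i => U i t) ∧
        ∀ k, ∫ t in T'..0, halfNorm N r (fun i => pd k (U i t))
          ≤ C * ∫ t in T..0, halfNorm N R fun i => U i t := by
  obtain ⟨ψ, hψ, hψc, hψR, hψ0, hψ1, hψr⟩ := exists_cutoff (d := d) hr.le hrR
  have hR2 : R ^ 2 ≤ 2 ^ 2 := pow_le_pow_left₀ (hr.trans hrR).le hR 2
  obtain ⟨c, C, hc, hC, h1⟩ := exists_differential_inequality (n := n) N hψ hψc
    (fun x hx => (hψR x hx).trans_le hR2) hm hlam hK s L hL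
  have hd : 0 < T' - T := by linarith
  refine ⟨(1 + 3 * C) / (T' - T) * (1 + c⁻¹), by positivity, fun A hA hAK U hU => ?_⟩
  obtain ⟨Y', hY'c, hY', hY'le⟩ := h1 A hA hAK U hU
  set Y := fun t => ∫ x in cutSet N ψ, ψ x ^ (2 * m) * ∑ i, U i t x ^ 2 with hY
  set H := fun t => ∑ i, wEnergy N ψ 1 (U i t) with hH
  set e := fun t => halfNorm N R fun i => U i t with he
  have hsubR : cutSet N ψ ⊆ bHalf N R := fun x hx => ⟨hx.1, hψR x hx.2⟩
  have hsubr : bHalf N r ⊆ cutSet N ψ := fun x hx => ⟨hx.1, subset_tsupport _ (by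
    simp [hψr x hx.2.le])⟩
  have mR := (isOpen_bHalf N R).measurableSet
  have mr := (isOpen_bHalf N r).measurableSet
  have mc := measurableSet_cutSet N ψ
  have cU2 : ∀ t, Continuous fun x => ∑ i, U i t x ^ 2 := fun t =>
    continuous_finsetSum _ fun i _ => (((hU.smooth i).slice t).continuous).pow 2
  have cYi : ∀ t, Continuous fun x => ψ x ^ (2 * m) * ∑ i, U i t x ^ 2 := fun t =>
    (hψ.continuous.pow _).mul (cU2 t)
  have ce : Continuous e := continuous_halfNorm N R hU.smooth
  have e0 : ∀ t, 0 ≤ e t := fun t => halfNorm_nonneg _ _ _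
  have cH : Continuous H := continuous_finsetSum _ fun i _ => by
    refine continuous_integral_cutSet N hψc
      (g := fun t x => ψ x ^ (2 * 1) * derivSq 1 (U i t) x) ?_
    exact ((hψ.continuous.comp continuous_snd).pow _).mul
      (continuous_finsetSum _ fun f _ => (((hU.smooth i).pdl _).continuous).pow 2)
  have H0 : ∀ t, 0 ≤ H t := fun t => Finset.sum_nonneg fun i _ => wEnergy_nonneg _ _ _ _
  have sq0 : ∀ t x, 0 ≤ ∑ i, U i t x ^ 2 := fun t x => Finset.sum_nonneg fun i _ => sq_nonneg _
  have Yle : ∀ t, Y t ≤ e t := fun t => by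
    refine setIntegral_le_of_subset mc hsubR (integrableOn_cutSet N hψc (cYi t))
      (integrableOn_bHalf N R (cU2 t)) mR (fun x _ => ?_) fun x _ => sq0 t x
    exact mul_le_of_le_one_left (sq0 t x) (pow_le_one₀ (hψ0 x) (hψ1 x))
  have Yge : ∀ t, halfNorm N r (fun i => U i t) ≤ Y t := fun t => by
    refine setIntegral_le_of_subset mr hsubr (integrableOn_bHalf N r (cU2 t))
      (integrableOn_cutSet N hψc (cYi t)) mc (fun x hx => ?_) fun x _ => ?_
    · rw [hψr x hx.2.le]; simp
    · exact mul_nonneg (pow_nonneg (hψ0 x) _) (sq0 t x)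
  have W0 : ∀ t, ∑ i, wEnergy N ψ 0 (U i t) ≤ e t := fun t => by
    have c0 : ∀ i, Continuous fun x => ψ x ^ (2 * 0) * derivSq 0 (U i t) x := fun i =>
      (hψ.continuous.pow _).mul (continuous_derivSq ((hU.smooth i).slice t) 0)
    have : ∑ i, wEnergy N ψ 0 (U i t)
        = ∫ x in cutSet N ψ, ∑ i, ψ x ^ (2 * 0) * derivSq 0 (U i t) x := by
      rw [integral_finsetSum _ fun i _ => integrableOn_cutSet N hψc (c0 i)]; rfl
    rw [this]
    refine setIntegral_le_of_subset mc hsubR (integrableOn_cutSet N hψc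
      (continuous_finsetSum _ fun i _ => c0 i)) (integrableOn_bHalf N R (cU2 t)) mR
      (fun x _ => ?_) fun x _ => sq0 t x
    simp [derivSq, pdl]
  have H1 : ∀ k t, halfNorm N r (fun i => pd k (U i t)) ≤ H t := fun k t => by
    have c0 : ∀ i, Continuous fun x => ψ x ^ (2 * 1) * derivSq 1 (U i t) x := fun i =>
      (hψ.continuous.pow _).mul (continuous_derivSq ((hU.smooth i).slice t) 1)
    have d0 : ∀ i x, 0 ≤ derivSq 1 (U i t) x := fun i x => Finset.sum_nonneg fun _ _ => sq_nonneg _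
    have : H t = ∫ x in cutSet N ψ, ∑ i, ψ x ^ (2 * 1) * derivSq 1 (U i t) x := by
      rw [integral_finsetSum _ fun i _ => integrableOn_cutSet N hψc (c0 i)]; rfl
    rw [this]
    refine setIntegral_le_of_subset mr hsubr (integrableOn_bHalf N r
      (continuous_finsetSum _ fun i _ => (((hU.smooth i).slice t).pd k).continuous.pow 2))
      (integrableOn_cutSet N hψc (continuous_finsetSum _ fun i _ => c0 i)) mc
      (fun x hx => Finset.sum_le_sum fun i _ => ?_)
      fun x _ => Finset.sum_nonneg fun i _ => mul_nonneg (pow_nonneg (hψ0 x) _) (d0 i x)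
    have := sq_pdl_le_derivSq [k] (U i t) x
    rw [hψr x hx.2.le, one_pow, one_mul]
    exact this
  set g : ℝ → ℝ := fun τ => (1 + 3 * C) * e τ - c * ((τ - T) * H τ) with hg
  have cg : Continuous g := by fun_prop
  have hz : ∀ t, HasDerivAt (fun t => (t - T) * Y t - ∫ τ in T..t, g τ)
      ((1 * Y t + (t - T) * Y' t) - g t) t := fun t =>
    (((hasDerivAt_id t).sub_const T).mul (hY' t)).sub
      (intervalIntegral.integral_hasDerivAt_right (cg.intervalIntegrable _ _)
        (cg.stronglyMeasurableAtFilter _ _) cg.continuousAt)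
  have anti : AntitoneOn (fun t => (t - T) * Y t - ∫ τ in T..t, g τ) (Icc T 0) := by
    refine antitoneOn_of_deriv_nonpos (convex_Icc T 0)
      (fun t _ => (hz t).continuousAt.continuousWithinAt)
      (fun t _ => (hz t).differentiableAt.differentiableWithinAt) fun t ht => ?_
    rw [interior_Icc] at ht
    rw [(hz t).deriv]
    have a1 := hY'le t ⟨by linarith [ht.1], ht.2⟩
    have a2 : Y' t ≤ -c * H t + C * e t :=
      a1.trans (by have := mul_le_mul_of_nonneg_left (W0 t) hC; simp only [hH]; linarith)
    have a3 := mul_le_mul_of_nonneg_left a2 (by linarith [ht.1] : 0 ≤ t - T)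
    have a4 : (t - T) * (C * e t) ≤ 3 * (C * e t) :=
      mul_le_mul_of_nonneg_right (by linarith [ht.2]) (mul_nonneg hC (e0 t))
    have a5 := Yle t
    simp only [hg]
    linarith
  have intg : ∀ t ∈ Icc T 0, (t - T) * Y t + c * ∫ τ in T..t, (τ - T) * H τ
      ≤ (1 + 3 * C) * ∫ τ in T..0, e τ := fun t ht => by
    have h2 := anti ⟨le_rfl, ht.1.trans ht.2⟩ ht ht.1
    have i1 : Continuous fun τ => (1 + 3 * C) * e τ := by fun_prop
    have i2 : Continuous fun τ => c * ((τ - T) * H τ) := by fun_prop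
    simp only [sub_self, zero_mul, intervalIntegral.integral_same, hg] at h2
    rw [intervalIntegral.integral_sub (i1.intervalIntegrable _ _) (i2.intervalIntegrable _ _),
      intervalIntegral.integral_const_mul, intervalIntegral.integral_const_mul] at h2
    have h3 : ∫ τ in T..t, e τ ≤ ∫ τ in T..0, e τ :=
      intervalIntegral.integral_mono_interval le_rfl ht.1 ht.2
        (Filter.Eventually.of_forall e0) (ce.intervalIntegrable _ _)
    have := mul_le_mul_of_nonneg_left h3 (by positivity : 0 ≤ 1 + 3 * C)
    linarith
  have Hi0 : ∀ t ∈ Icc T 0, 0 ≤ ∫ τ in T..t, (τ - T) * H τ := fun t ht =>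
    intervalIntegral.integral_nonneg ht.1 fun τ hτ => mul_nonneg (by linarith [hτ.1]) (H0 τ)
  have E0 : 0 ≤ ∫ τ in T..0, e τ :=
    intervalIntegral.integral_nonneg (by linarith) fun τ _ => e0 τ
  have hq : 0 ≤ (1 + 3 * C) / (T' - T) * ∫ τ in T..0, e τ := by positivity
  have Y0 : ∀ t, 0 ≤ Y t := fun t => (halfNorm_nonneg _ _ _).trans (Yge t)
  constructor
  · intro t ht
    have htT : t ∈ Icc T 0 := ⟨hTT.le.trans ht.1, ht.2⟩
    have b1 := intg t htT
    have b2 := mul_nonneg hc.le (Hi0 t htT)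
    have b3 : (T' - T) * Y t ≤ (t - T) * Y t :=
      mul_le_mul_of_nonneg_right (by linarith [ht.1]) (Y0 t)
    have b4 : Y t ≤ (1 + 3 * C) / (T' - T) * ∫ τ in T..0, e τ := by
      rw [div_mul_eq_mul_div, le_div_iff₀ hd]
      linarith
    have b5 := mul_nonneg (inv_nonneg.2 hc.le) hq
    refine ((Yge t).trans b4).trans ?_
    rw [mul_assoc _ (1 + c⁻¹), mul_comm (1 + c⁻¹), ← mul_assoc, mul_add, mul_one]
    linarith
  · intro k
    have h0T : (0 : ℝ) ∈ Icc T 0 := ⟨by linarith, le_rfl⟩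
    have b1 := intg 0 h0T
    have b2 : 0 ≤ (0 - T) * Y 0 := mul_nonneg (by linarith) (Y0 0)
    have cHT : Continuous fun τ => (τ - T) * H τ := by fun_prop
    have ck : Continuous fun t => halfNorm N r fun i => pd k (U i t) :=
      continuous_halfNorm N r fun i => (hU.smooth i).pd k
    have b3 : (T' - T) * ∫ t in T'..0, halfNorm N r (fun i => pd k (U i t))
        ≤ ∫ τ in T..0, (τ - T) * H τ := by
      rw [← intervalIntegral.integral_const_mul]
      refine (intervalIntegral.integral_mono_on hT' ((ck.const_mul _).intervalIntegrable _ _)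
        (cHT.intervalIntegrable _ _) fun τ hτ => ?_).trans ?_
      · exact mul_le_mul (by linarith [hτ.1]) (H1 k τ) (halfNorm_nonneg _ _ _)
          (by linarith [hτ.1])
      · refine intervalIntegral.integral_mono_interval hTT.le hT' le_rfl ?_
          (cHT.intervalIntegrable _ _)
        refine (ae_restrict_iff' measurableSet_Ioc).2 (Filter.Eventually.of_forall fun τ hτ => ?_)
        exact mul_nonneg (by linarith [hτ.1]) (H0 τ)
    have b4 : c * ((T' - T) * ∫ t in T'..0, halfNorm N r (fun i => pd k (U i t)))
        ≤ (1 + 3 * C) * ∫ τ in T..0, e τ :=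
      (mul_le_mul_of_nonneg_left b3 hc.le).trans (by linarith)
    have b5 : ∫ t in T'..0, halfNorm N r (fun i => pd k (U i t))
        ≤ c⁻¹ * ((1 + 3 * C) / (T' - T) * ∫ τ in T..0, e τ) := by
      rw [inv_mul_eq_div, le_div_iff₀ hc, div_mul_eq_mul_div, le_div_iff₀ hd]
      linarith
    refine b5.trans ?_
    rw [mul_assoc _ (1 + c⁻¹), mul_comm (1 + c⁻¹), ← mul_assoc, mul_add, mul_one]
    linarith

/-- Interior-in-the-tangential-directions regularity: all tangential derivatives are bounded in
`L^∞_t L²_x` on smaller half balls. -/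
lemma exists_tangential_energy (N : Fin d) {m : ℕ} (hm : m ≠ 0) {lam K : ℝ} (hlam : 0 < lam)
    (hK : 0 ≤ K) (s : Finset ι) (L : ι → List (Fin d)) (hL : ∀ a ∈ s, (L a).length = m)
    (l : List (Fin d)) (hl : ∀ k ∈ l, k ≠ N) {r T : ℝ} (hr : 0 < r) (hr2 : r < 2)
    (hT : -3 < T) (hT0 : T ≤ 0) :
    ∃ C, 0 ≤ C ∧ ∀ A : ι → ι → ℝ → Fin n → Fin n → ℝ,
      (∀ t, LHForm s L m lam fun a b => A a b t) → (∀ a b t i j, |A a b t i j| ≤ K) →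
      ∀ U, IsSol N m s L A U → ∀ t ∈ Icc T 0, halfNorm N r (fun i => pdl l (U i t))
          ≤ C * ∫ t in (-3)..0, halfNorm N 2 fun i => U i t := by
  have key : ∀ l : List (Fin d), (∀ k ∈ l, k ≠ N) → ∀ r T : ℝ, 0 < r → r < 2 → -3 < T → T ≤ 0 →
    ∃ C, 0 ≤ C ∧ ∀ A : ι → ι → ℝ → Fin n → Fin n → ℝ,
      (∀ t, LHForm s L m lam fun a b => A a b t) → (∀ a b t i j, |A a b t i j| ≤ K) →
      ∀ U, IsSol N m s L A U → IsSol N m s L A (fun i t => pdl l (U i t)) ∧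
        ∫ t in T..0, halfNorm N r (fun i => pdl l (U i t))
          ≤ C * ∫ t in (-3)..0, halfNorm N 2 fun i => U i t := by
    intro l
    induction l with
    | nil =>
      intro _ r T hr hr2 hT hT0
      refine ⟨1, zero_le_one, fun A _ _ U hU => ⟨hU, ?_⟩⟩
      have ce := continuous_halfNorm N 2 hU.smooth
      rw [one_mul]
      refine (intervalIntegral.integral_mono_on hT0
        ((continuous_halfNorm N r hU.smooth).intervalIntegrable _ _) (ce.intervalIntegrable _ _)
        fun t _ => ?_).trans (intervalIntegral.integral_mono_interval hT.le hT0 le_rfl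
          (Filter.Eventually.of_forall fun t => halfNorm_nonneg _ _ _) (ce.intervalIntegrable _ _))
      have cU2 : Continuous fun x => ∑ i, U i t x ^ 2 :=
        continuous_finsetSum _ fun i _ => (((hU.smooth i).slice t).continuous).pow 2
      exact setIntegral_le_of_subset (isOpen_bHalf N r).measurableSet (bHalf_mono N hr.le hr2.le)
        (integrableOn_bHalf N r cU2) (integrableOn_bHalf N 2 cU2) (isOpen_bHalf N 2).measurableSet
        (fun _ _ => le_rfl) fun x _ => Finset.sum_nonneg fun i _ => sq_nonneg _
    | cons k l ih =>
      intro hkl r T hr hr2 hT hT0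
      obtain ⟨C1, hC1, h1⟩ := ih (fun j hj => hkl j (List.mem_cons_of_mem _ hj)) ((r + 2) / 2)
        ((T - 3) / 2) (by linarith) (by linarith) (by linarith) (by linarith)
      obtain ⟨C2, hC2, h2⟩ := exists_local_energy (n := n) N hm hlam hK s L hL (r := r)
        (R := (r + 2) / 2) (T := (T - 3) / 2) (T' := T) hr (by linarith) (by linarith)
        (by linarith) (by linarith) hT0
      refine ⟨C2 * C1, by positivity, fun A hA hAK U hU => ?_⟩
      obtain ⟨s1, b1⟩ := h1 A hA hAK U hU
      refine ⟨s1.pd (hkl k List.mem_cons_self), ?_⟩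
      have b2 := (h2 A hA hAK _ s1).2 k
      rw [mul_assoc]
      exact b2.trans (mul_le_mul_of_nonneg_left b1 hC2)
  obtain ⟨C1, hC1, h1⟩ := key l hl ((r + 2) / 2)
    ((T - 3) / 2) (by linarith) (by linarith) (by linarith) (by linarith)
  obtain ⟨C2, hC2, h2⟩ := exists_local_energy (n := n) N hm hlam hK s L hL (r := r)
    (R := (r + 2) / 2) (T := (T - 3) / 2) (T' := T) hr (by linarith) (by linarith)
    (by linarith) (by linarith) hT0
  refine ⟨C2 * C1, by positivity, fun A hA hAK U hU t ht => ?_⟩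
  obtain ⟨s1, b1⟩ := h1 A hA hAK U hU
  have b2 := (h2 A hA hAK _ s1).1 t ht
  rw [mul_assoc]
  exact b2.trans (mul_le_mul_of_nonneg_left b1 hC2)

end LocalEnergy

section OneDim

/-- The squared `L²` norm on `[0, 2]`. -/
noncomputable def sqNorm (f : ℝ → ℝ) : ℝ := ∫ y in (0 : ℝ)..2, f y ^ 2

lemma sqNorm_nonneg (f : ℝ → ℝ) : 0 ≤ sqNorm f :=
  intervalIntegral.integral_nonneg (by norm_num) fun _ _ => sq_nonneg _

/-- Cauchy–Schwarz on an interval. -/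
lemma sq_intervalIntegral_mul_le {a b : ℝ} (hab : a ≤ b) {f g : ℝ → ℝ} (hf : Continuous f)
    (hg : Continuous g) :
    (∫ y in a..b, f y * g y) ^ 2 ≤ (∫ y in a..b, f y ^ 2) * ∫ y in a..b, g y ^ 2 := by
  have h : ∀ x : ℝ, 0 ≤ (∫ y in a..b, g y ^ 2) * (x * x) + (2 * ∫ y in a..b, f y * g y) * x
      + ∫ y in a..b, f y ^ 2 := fun x => by
    have : (∫ y in a..b, g y ^ 2) * (x * x) + (2 * ∫ y in a..b, f y * g y) * x
      + ∫ y in a..b, f y ^ 2 = ∫ y in a..b, (f y + x * g y) ^ 2 := by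
      have e : ∀ y, (f y + x * g y) ^ 2 = (x * x) * g y ^ 2 + (2 * x) * (f y * g y) + f y ^ 2 :=
        fun y => by ring
      simp only [e]
      have c1 : Continuous fun y => (x * x) * g y ^ 2 := by fun_prop
      have c2 : Continuous fun y => (2 * x) * (f y * g y) := by fun_prop
      have c3 : Continuous fun y => f y ^ 2 := by fun_prop
      have c12 : Continuous fun y => (x * x) * g y ^ 2 + (2 * x) * (f y * g y) := c1.add c2
      rw [intervalIntegral.integral_add (c12.intervalIntegrable _ _)
        (c3.intervalIntegrable _ _), intervalIntegral.integral_add (c1.intervalIntegrable _ _)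
        (c2.intervalIntegrable _ _), intervalIntegral.integral_const_mul,
        intervalIntegral.integral_const_mul]
      ring
    rw [this]
    exact intervalIntegral.integral_nonneg hab fun _ _ => sq_nonneg _
  have := discrim_le_zero h
  rw [discrim] at this
  linarith

lemma abs_integral_mul_le {f g : ℝ → ℝ} (hf : Continuous f) (hg : Continuous g) :
    |∫ y in (0 : ℝ)..2, f y * g y| ≤ √(sqNorm f) * √(sqNorm g) := by
  rw [← Real.sqrt_mul (sqNorm_nonneg f)]
  exact Real.abs_le_sqrt (sq_intervalIntegral_mul_le (by norm_num) hf hg)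

lemma sq_sub_le_of_hasDerivAt {f f' : ℝ → ℝ} (hd : ∀ y, HasDerivAt f (f' y) y)
    (hc : Continuous f') {z y h : ℝ} (hz : z ∈ Icc (0 : ℝ) 2) (hy : y ∈ Icc (0 : ℝ) 2)
    (hh : |y - z| ≤ h) : (f y - f z) ^ 2 ≤ h * sqNorm f' := by
  wlog hzy : z ≤ y generalizing y z
  · have := this hy hz (by rwa [abs_sub_comm]) (le_of_not_ge hzy)
    linarith [sq_abs (f y - f z), sq_abs (f z - f y), abs_sub_comm (f y) (f z),
      (by ring : (f y - f z) ^ 2 = (f z - f y) ^ 2)]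
  rw [abs_of_nonneg (by linarith)] at hh
  have e : f y - f z = ∫ x in z..y, 1 * f' x := by
    simp only [one_mul]
    rw [intervalIntegral.integral_eq_sub_of_hasDerivAt (fun x _ => hd x)
      (hc.intervalIntegrable _ _)]
  rw [e]
  refine (sq_intervalIntegral_mul_le hzy continuous_const hc).trans ?_
  have h1 : ∫ x in z..y, f' x ^ 2 ≤ sqNorm f' :=
    intervalIntegral.integral_mono_interval hz.1 hzy hy.2
      (Filter.Eventually.of_forall fun _ => sq_nonneg _) ((hc.pow 2).intervalIntegrable _ _)
  have h2 : ∫ x in z..y, (1 : ℝ) ^ 2 = y - z := by simp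
  rw [h2]
  exact mul_le_mul hh h1 (intervalIntegral.integral_nonneg hzy fun _ _ => sq_nonneg _)
    (by linarith)

lemma sq_le_sqNorm {f f' : ℝ → ℝ} (hd : ∀ y, HasDerivAt f (f' y) y)
    (hc : Continuous f') {h : ℝ} (h0 : 0 < h) (h1 : h ≤ 1) {y : ℝ} (hy : y ∈ Icc (0 : ℝ) 2) :
    f y ^ 2 ≤ 2 * h⁻¹ * sqNorm f + 2 * h * sqNorm f' := by
  have hcf : Continuous f := continuous_iff_continuousAt.2 fun y => (hd y).continuousAt
  obtain ⟨a, ha0, ha2, hay⟩ : ∃ a, 0 ≤ a ∧ a + h ≤ 2 ∧ y ∈ Icc a (a + h) := by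
    rcases le_total y 1 with h' | h'
    · exact ⟨y, hy.1, by linarith, le_rfl, by linarith⟩
    · exact ⟨y - h, by linarith, by linarith [hy.2], by linarith, by linarith⟩
  have key : ∀ z ∈ Icc a (a + h), f y ^ 2 ≤ 2 * f z ^ 2 + 2 * (h * sqNorm f') := fun z hz => by
    have := sq_sub_le_of_hasDerivAt hd hc (z := z) (y := y) (h := h)
      ⟨ha0.trans hz.1, hz.2.trans ha2⟩ hy
      (abs_le.2 ⟨by linarith [hay.1, hz.2], by linarith [hay.2, hz.1]⟩)
    have h2 : f y ^ 2 ≤ 2 * f z ^ 2 + 2 * (f y - f z) ^ 2 := by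
      linarith [sq_nonneg (f y - 2 * f z), (by ring : (f y - 2 * f z) ^ 2 =
        -f y ^ 2 + 2 * f z ^ 2 + 2 * (f y - f z) ^ 2)]
    linarith
  have c2 : Continuous fun z => 2 * f z ^ 2 := by fun_prop
  have c3 : Continuous fun z => 2 * f z ^ 2 + 2 * (h * sqNorm f') := by fun_prop
  have hI := intervalIntegral.integral_mono_on (μ := volume) (a := a) (b := a + h) (by linarith)
    (continuous_const.intervalIntegrable _ _)
    (c3.intervalIntegrable _ _) key
  rw [intervalIntegral.integral_add (c2.intervalIntegrable _ _)
    (continuous_const.intervalIntegrable _ _), intervalIntegral.integral_const,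
    intervalIntegral.integral_const, intervalIntegral.integral_const_mul] at hI
  have h3 : ∫ z in a..(a + h), f z ^ 2 ≤ sqNorm f :=
    intervalIntegral.integral_mono_interval ha0 (by linarith) ha2
      (Filter.Eventually.of_forall fun _ => sq_nonneg _) ((hcf.pow 2).intervalIntegrable _ _)
  simp only [smul_eq_mul, add_sub_cancel_left] at hI
  have h4 : h * f y ^ 2 ≤ h * (2 * h⁻¹ * sqNorm f + 2 * h * sqNorm f') := by
    have : h * (2 * h⁻¹ * sqNorm f + 2 * h * sqNorm f')
      = 2 * sqNorm f + h * (2 * (h * sqNorm f')) := by field_simp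
    linarith
  exact le_of_mul_le_mul_left h4 h0

lemma sqNorm_deriv_le {f f' f'' : ℝ → ℝ} (hd : ∀ y, HasDerivAt f (f' y) y)
    (hd' : ∀ y, HasDerivAt f' (f'' y) y) (hc : Continuous f'') {h : ℝ} (h0 : 0 < h) (h1 : h ≤ 1) :
    sqNorm f' ≤ 2050 * (h ^ 2)⁻¹ * sqNorm f + 2 * h ^ 2 * sqNorm f'' := by
  have hcf : Continuous f := continuous_iff_continuousAt.2 fun y => (hd y).continuousAt
  have hcf' : Continuous f' := continuous_iff_continuousAt.2 fun y => (hd' y).continuousAt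
  set a := sqNorm f with ha
  set b := sqNorm f' with hb
  set c := sqNorm f'' with hc'
  have ibp : b = f 2 * f' 2 - f 0 * f' 0 - ∫ y in (0 : ℝ)..2, f' y * f'' y * 0 + f y * f'' y := by
    have := intervalIntegral.integral_mul_deriv_eq_deriv_mul (a := 0) (b := 2)
      (fun x _ => hd' x) (fun x _ => hd x) (hc.intervalIntegrable _ _) (hcf'.intervalIntegrable _ _)
    rw [hb, sqNorm]
    simp only [pow_two, mul_zero, zero_add]
    rw [this]
    simp only [mul_comm]
  have cross : -(∫ y in (0 : ℝ)..2, f' y * f'' y * 0 + f y * f'' y)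
      ≤ (h ^ 2)⁻¹ / 2 * a + h ^ 2 / 2 * c := by
    have c1 : Continuous fun y => (h ^ 2)⁻¹ / 2 * f y ^ 2 := by fun_prop
    have c2 : Continuous fun y => h ^ 2 / 2 * f'' y ^ 2 := by fun_prop
    have c3 : Continuous fun y => -(f' y * f'' y * 0 + f y * f'' y) := by fun_prop
    rw [← intervalIntegral.integral_neg, ha, hc', sqNorm, sqNorm,
      ← intervalIntegral.integral_const_mul, ← intervalIntegral.integral_const_mul,
      ← intervalIntegral.integral_add (c1.intervalIntegrable _ _) (c2.intervalIntegrable _ _)]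
    refine intervalIntegral.integral_mono_on (by norm_num) (c3.intervalIntegrable _ _)
      ((c1.add c2).intervalIntegrable _ _) fun y _ => ?_
    have e : (h ^ 2)⁻¹ / 2 * f y ^ 2 + h ^ 2 / 2 * f'' y ^ 2 + f y * f'' y
        = (h⁻¹ * f y + h * f'' y) ^ 2 / 2 := by field_simp; ring
    have := sq_nonneg (h⁻¹ * f y + h * f'' y)
    linarith
  have bd : ∀ y ∈ Icc (0 : ℝ) 2, |f y * f' y|
      ≤ 512 * (h ^ 2)⁻¹ * a + b / 4 + h ^ 2 / 8 * c := fun y hy => by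
    have s1 := sq_le_sqNorm hd hcf' (h := h / 64) (by positivity) (by linarith) hy
    have s2 := sq_le_sqNorm hd' hc h0 h1 hy
    have s3 : |f y * f' y| ≤ 4 * h⁻¹ * f y ^ 2 + h / 16 * f' y ^ 2 := by
      have e1 : 4 * h⁻¹ * f y ^ 2 + h / 16 * f' y ^ 2 - f y * f' y
        = h⁻¹ * (2 * f y - h / 4 * f' y) ^ 2 := by field_simp; ring
      have e2 : 4 * h⁻¹ * f y ^ 2 + h / 16 * f' y ^ 2 + f y * f' y
        = h⁻¹ * (2 * f y + h / 4 * f' y) ^ 2 := by field_simp; ring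
      have p1 : 0 ≤ h⁻¹ * (2 * f y - h / 4 * f' y) ^ 2 := by positivity
      have p2 : 0 ≤ h⁻¹ * (2 * f y + h / 4 * f' y) ^ 2 := by positivity
      exact abs_le.2 ⟨by linarith, by linarith⟩
    have s4 := mul_le_mul_of_nonneg_left s1 (by positivity : 0 ≤ 4 * h⁻¹)
    have s5 := mul_le_mul_of_nonneg_left s2 (by positivity : 0 ≤ h / 16)
    have e4 : 4 * h⁻¹ * (2 * (h / 64)⁻¹ * a + 2 * (h / 64) * b)
      = 512 * (h ^ 2)⁻¹ * a + b / 8 := by field_simp; ring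
    have e5 : h / 16 * (2 * h⁻¹ * b + 2 * h * c) = b / 8 + h ^ 2 / 8 * c := by field_simp; ring
    rw [e4] at s4
    rw [e5] at s5
    linarith
  have b2 := (abs_le.1 (bd 2 (by norm_num))).2
  have b0 := (abs_le.1 (bd 0 (by norm_num))).1
  have hc0 : 0 ≤ h ^ 2 * c := mul_nonneg (by positivity) (sqNorm_nonneg _)
  have ha0 : 0 ≤ (h ^ 2)⁻¹ * a := mul_nonneg (by positivity) (sqNorm_nonneg _)
  linarith

/-- Interpolation on `[0, 2]`, scaled by a step `h ≤ 1`. -/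
lemma exists_sqNorm_iteratedDeriv_le (k : ℕ) : ∃ C, 0 ≤ C ∧ ∀ f : ℝ → ℝ, ContDiff ℝ k f →
    ∀ h, 0 < h → h ≤ 1 → ∀ i ≤ k,
      h ^ (2 * i) * sqNorm (iteratedDeriv i f)
        ≤ C * (sqNorm f + h ^ (2 * k) * sqNorm (iteratedDeriv k f)) := by
  set D : ℝ → ℝ := fun ε => 2050 * ((min 1 (√(ε / 2))) ^ 2)⁻¹ with hDdef
  have hD : ∀ ε, 0 < ε → 0 ≤ D ε := fun ε _ => by positivity
  have main : ∀ i ≤ k, ∃ C, 0 ≤ C ∧ ∀ f : ℝ → ℝ, ContDiff ℝ k f →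
    ∀ h, 0 < h → h ≤ 1 →
      h ^ (2 * i) * sqNorm (iteratedDeriv i f)
        ≤ C * (sqNorm f + h ^ (2 * k) * sqNorm (iteratedDeriv k f)) := by
    intro i hi
    rcases hi.lt_or_eq with hi | rfl
    · obtain ⟨C, hC, H⟩ := exists_interpolation hD k i hi 1 one_pos
      refine ⟨C + 1, by positivity, fun f hf h h0 h1 => ?_⟩
      have := H (fun j => h ^ (2 * j) * sqNorm (iteratedDeriv j f))
        (fun j => mul_nonneg (by positivity) (sqNorm_nonneg _)) fun j hj ε hε => ?_
      · simp only [mul_zero, pow_zero, one_mul, iteratedDeriv_zero] at this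
        have p1 := sqNorm_nonneg f
        have p2 : 0 ≤ C * (h ^ (2 * k) * sqNorm (iteratedDeriv k f)) :=
          mul_nonneg hC (mul_nonneg (by positivity) (sqNorm_nonneg _))
        linarith
      · set η := min 1 (√(ε / 2)) with hη
        have η0 : 0 < η := lt_min one_pos (Real.sqrt_pos.2 (by positivity))
        have η1 : η ≤ 1 := min_le_left _ _
        have η2 : 2 * η ^ 2 ≤ ε := by
          have := pow_le_pow_left₀ η0.le (min_le_right 1 (√(ε / 2))) 2
          rw [Real.sq_sqrt (by positivity)] at this
          linarith
        have hdd : ∀ l, l < k → ∀ y, HasDerivAt (iteratedDeriv l f) (iteratedDeriv (l + 1) f y) y :=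
          fun l hl y => by
            rw [iteratedDeriv_succ]
            exact ((hf.differentiable_iteratedDeriv l (by exact_mod_cast hl)) y).hasDerivAt
        have := sqNorm_deriv_le (hdd j (by omega)) (hdd (j + 1) (by omega))
          (hf.continuous_iteratedDeriv (j + 2) (by exact_mod_cast hj)) (h := h * η)
          (by positivity) (mul_le_one₀ h1 η0.le η1)
        have t := mul_le_mul_of_nonneg_left this (by positivity : 0 ≤ h ^ (2 * (j + 1)))
        refine t.trans (le_of_eq_of_le (b := 2 * η ^ 2 * (h ^ (2 * (j + 2)) *
          sqNorm (iteratedDeriv (j + 2) f)) + D ε * (h ^ (2 * j) * sqNorm (iteratedDeriv j f)))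
          ?_ ?_)
        · simp only [hDdef, ← hη]
          field_simp
          ring
        · have := mul_le_mul_of_nonneg_right η2 (mul_nonneg (by positivity : 0 ≤ h ^ (2 * (j + 2)))
            (sqNorm_nonneg (iteratedDeriv (j + 2) f)))
          linarith
    · refine ⟨1, zero_le_one, fun f _ h _ _ => ?_⟩
      have := sqNorm_nonneg f
      linarith
  choose! C hC H using main
  refine ⟨∑ i ∈ Finset.range (k + 1), C i, Finset.sum_nonneg fun i hi =>
    hC i (by simpa [Nat.lt_succ_iff] using hi), fun f hf h h0 h1 i hi => ?_⟩
  refine (H i hi f hf h h0 h1).trans (mul_le_mul_of_nonneg_right ?_ (add_nonneg (sqNorm_nonneg _)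
    (mul_nonneg (by positivity) (sqNorm_nonneg _))))
  exact Finset.single_le_sum (f := C) (fun i hi => hC i (by simpa [Nat.lt_succ_iff] using hi))
    (Finset.mem_range.2 (by omega))

end OneDim

section AbstractEigenbasis

variable {H : Type} [NormedAddCommGroup H] [InnerProductSpace ℝ H]

lemma eq_zero_of_pow_eq_sum (K : H →L[ℝ] H) (e : H) (hK : ∀ (h : H) (c : ℝ), K h = c • e → h = 0 ∧ c = 0) :
    ∀ (m : ℕ) (f : H) (c : Fin m → ℝ), (K ^ m) f = ∑ j : Fin m, c j • (K ^ (j : ℕ)) e → f = 0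
  | 0, f, c, h => by simpa using h
  | m + 1, f, c, h => by
    rw [Fin.sum_univ_succ] at h
    have h1 : K ((K ^ m) f - ∑ j : Fin m, c j.succ • (K ^ (j : ℕ)) e) = c 0 • e := by
      rw [map_sub, map_sum]
      have : K ((K ^ m) f) = (K ^ (m + 1)) f := by rw [pow_succ']; rfl
      rw [this, h]
      have : ∀ j : Fin m, K (c j.succ • (K ^ (j : ℕ)) e) = c j.succ • (K ^ ((j.succ : Fin (m+1)) : ℕ)) e := by
        intro j
        rw [map_smul, Fin.val_succ, pow_succ']; rfl
      simp_rw [this]; simp only [Fin.val_zero, pow_zero, one_apply_eq_self, add_sub_cancel_right]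
    have h2 := (hK _ _ h1).1
    exact eq_zero_of_pow_eq_sum K e hK m f (fun j => c j.succ) (sub_eq_zero.mp h2)

variable [CompleteSpace H]

/-- Spectral decomposition of `J ^ m ∘ Π ∘ (J†) ^ m`, with `Π` the projection onto the orthogonal
complement of the vectors `(J†) ^ j e`, `j < m`. -/
lemma exists_eigenbasis_of_adjoint (J K : H →L[ℝ] H)
    (hJK : ∀ f g, inner ℝ (J f) g = inner ℝ f (K g)) (hJ : IsCompactOperator J) (e : H)
    (hK : ∀ (h : H) (c : ℝ), K h = c • e → h = 0 ∧ c = 0) (m : ℕ) (hm : 1 ≤ m) :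
    ∃ (ι : Type) (b : HilbertBasis ι ℝ H) (μ : ι → ℝ), (∀ k, 0 < μ k) ∧
      ∀ k, ∃ c : Fin m → ℝ,
        μ k • b k = (J ^ m) ((K ^ m) (b k) - ∑ j : Fin m, c j • (K ^ (j : ℕ)) e) ∧
        ∀ j < m, inner ℝ ((K ^ j) e) ((K ^ m) (b k) - ∑ j : Fin m, c j • (K ^ (j : ℕ)) e) = 0 := by
  classical
  set P : Submodule ℝ H := Submodule.span ℝ (Set.range fun j : Fin m => (K ^ (j : ℕ)) e) with hP
  have hfd : FiniteDimensional ℝ P := FiniteDimensional.span_of_finite ℝ (Set.finite_range _)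
  set Q : H →L[ℝ] H := Pᗮ.starProjection with hQ
  set T : H →L[ℝ] H := (J ^ m) ∘L Q ∘L (K ^ m) with hTd
  have hpow : ∀ k f g, inner ℝ ((J ^ k) f) g = inner ℝ f ((K ^ k) g) := by
    intro k
    induction k with
    | zero => intro f g; simp
    | succ k ih =>
      intro f g
      have h1 : (J ^ (k + 1)) f = (J ^ k) (J f) := by rw [pow_succ]; rfl
      have h2 : (K ^ (k + 1)) g = K ((K ^ k) g) := by rw [pow_succ']; rfl
      rw [h1, h2, ih, hJK]
  have hQsymm : ∀ f g, inner ℝ (Q f) g = inner ℝ f (Q g) := fun f g =>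
    Submodule.inner_starProjection_left_eq_right _ f g
  have hTf : ∀ f, T f = (J ^ m) (Q ((K ^ m) f)) := fun f => rfl
  have hTsymm : (T : H →ₗ[ℝ] H).IsSymmetric := by
    intro f g
    simp only [ContinuousLinearMap.coe_coe, hTf]
    rw [hpow, hQsymm, ← real_inner_comm, ← hpow, real_inner_comm]
  have hTc : IsCompactOperator T := by
    obtain ⟨k, rfl⟩ : ∃ k, m = k + 1 := ⟨m - 1, by omega⟩
    have : T = J ∘L ((J ^ k) ∘L Q ∘L (K ^ (k + 1))) := by
      ext f
      rw [hTf, pow_succ' J]; rfl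
    rw [this]
    exact hJ.comp_clm _
  have hQf : ∀ g, ∃ c : Fin m → ℝ, Q g = g - ∑ j : Fin m, c j • (K ^ (j : ℕ)) e := by
    intro g
    have h1 : g - Q g ∈ P := by
      have := Submodule.starProjection_add_starProjection_orthogonal (K := P) g
      have h2 : g - Q g = P.starProjection g := by
        rw [hQ]; nth_rewrite 1 [← this]; abel
      rw [h2]; exact Submodule.starProjection_apply_mem _ _
    obtain ⟨c, hc⟩ := (Submodule.mem_span_range_iff_exists_fun ℝ).1 h1
    exact ⟨c, by rw [hc]; abel⟩
  have hQmem : ∀ g, ∀ j < m, inner ℝ ((K ^ j) e) (Q g) = 0 := by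
    intro g j hj
    have h1 : Q g ∈ Pᗮ := Submodule.starProjection_apply_mem _ _
    exact (Submodule.mem_orthogonal _ _).1 h1 _ (Submodule.subset_span ⟨⟨j, hj⟩, rfl⟩)
  have hQsq : ∀ g, inner ℝ (Q g) g = inner ℝ (Q g) (Q g) := by
    intro g
    obtain ⟨c, hc⟩ := hQf g
    have : inner ℝ (Q g) (g - Q g) = (0 : ℝ) := by
      have h1 : g - Q g = ∑ j : Fin m, c j • (K ^ (j : ℕ)) e := by rw [hc]; abel
      rw [h1, inner_sum]
      refine Finset.sum_eq_zero fun j _ => ?_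
      rw [inner_smul_right, real_inner_comm, hQmem _ _ j.2, mul_zero]
    rw [inner_sub_right] at this
    linarith
  have hpos : ∀ f, f ≠ 0 → (0 : ℝ) < inner ℝ (T f) f := by
    intro f hf
    rw [hTf, hpow, hQsq, real_inner_self_eq_norm_sq]
    have : Q ((K ^ m) f) ≠ 0 := by
      intro h0
      obtain ⟨c, hc⟩ := hQf ((K ^ m) f)
      rw [h0] at hc
      exact hf (eq_zero_of_pow_eq_sum K e hK m f c (sub_eq_zero.mp hc.symm))
    positivity
  have heig : ∀ μ v, v ∈ Module.End.eigenspace (T : H →ₗ[ℝ] H) μ → v ≠ 0 → 0 < μ := by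
    intro μ v hv hv0
    have h1 := hpos v hv0
    have h2 : T v = μ • v := Module.End.mem_eigenspace_iff.1 hv
    rw [h2, real_inner_smul_left] at h1
    exact pos_of_mul_pos_left h1 real_inner_self_nonneg
  have hfin : ∀ μ, FiniteDimensional ℝ (Module.End.eigenspace (T : H →ₗ[ℝ] H) μ) := by
    intro μ
    by_cases h : μ = 0
    · have : Module.End.eigenspace (T : H →ₗ[ℝ] H) μ = ⊥ := by
        rw [Submodule.eq_bot_iff]
        intro v hv
        by_contra h0
        exact absurd (heig μ v hv h0) (by simp [h])
      rw [this]; infer_instance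
    · exact ContinuousLinearMap.finite_dimensional_eigenspace hTc μ h
  let B : ∀ μ, OrthonormalBasis (Fin (Module.finrank ℝ (Module.End.eigenspace (T : H →ₗ[ℝ] H) μ))) ℝ
    (Module.End.eigenspace (T : H →ₗ[ℝ] H) μ) := fun μ => stdOrthonormalBasis ℝ _
  have hon := hTsymm.orthogonalFamily_eigenspaces.orthonormal_sigma_orthonormal
    (v_family := fun μ => B μ) (fun μ => (B μ).orthonormal)
  have hbot : (Submodule.span ℝ (Set.range (fun a : Σ μ, Fin (Module.finrank ℝ
      (Module.End.eigenspace (T : H →ₗ[ℝ] H) μ)) =>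
      (Module.End.eigenspace (T : H →ₗ[ℝ] H) a.1).subtypeₗᵢ (B a.1 a.2))))ᗮ = ⊥ := by
    rw [eq_bot_iff, ← ContinuousLinearMap.orthogonalComplement_iSup_eigenspaces_eq_bot hTc hTsymm]
    apply Submodule.orthogonal_le
    refine iSup_le fun μ v hv => ?_
    have h1 := (B μ).sum_repr ⟨v, hv⟩
    have h2 := congrArg (Module.End.eigenspace (T : H →ₗ[ℝ] H) μ).subtype h1
    rw [map_sum] at h2
    have h3 : v = (Module.End.eigenspace (T : H →ₗ[ℝ] H) μ).subtype ⟨v, hv⟩ := rfl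
    rw [h3, ← h2]
    refine Submodule.sum_mem _ fun i _ => ?_
    rw [map_smul]
    exact Submodule.smul_mem _ _ (Submodule.subset_span ⟨⟨μ, i⟩, rfl⟩)
  refine ⟨_, HilbertBasis.mkOfOrthogonalEqBot hon hbot, fun a => a.1, ?_, ?_⟩
  · intro a
    refine heig a.1 (B a.1 a.2) (B a.1 a.2).2 fun h => ?_
    have := (B a.1).orthonormal.ne_zero a.2
    exact this (by simpa using h)
  · intro a
    rw [HilbertBasis.coe_mkOfOrthogonalEqBot]
    have h2 : T (B a.1 a.2) = a.1 • ((B a.1 a.2 : Module.End.eigenspace (T : H →ₗ[ℝ] H) a.1) : H) :=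
      Module.End.mem_eigenspace_iff.1 (B a.1 a.2).2
    obtain ⟨c, hc⟩ := hQf ((K ^ m) (B a.1 a.2))
    refine ⟨c, ?_, fun j hj => ?_⟩
    · have := hTf (B a.1 a.2)
      rw [h2, hc] at this
      exact this
    · have := hQmem ((K ^ m) (B a.1 a.2)) j hj
      rw [hc] at this
      exact this

end AbstractEigenbasis

section IntegrationOperator

/-- Lebesgue measure on `(0, 2]`. -/
noncomputable abbrev vol2 : Measure ℝ := volume.restrict (Ioc (0 : ℝ) 2)

/-- The Hilbert space `L²(0, 2)`. -/
abbrev Hil2 : Type := Lp ℝ 2 vol2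

lemma abs_setIntegral_hil2_le (f : Hil2) {s : Set ℝ} (hs : MeasurableSet s) :
    |∫ y in s, f y ∂vol2| ≤ √(vol2.real s) * ‖f‖ := by
  rw [← L2.inner_indicatorConstLp_one (𝕜 := ℝ) hs (measure_ne_top _ _) f]
  refine (abs_real_inner_le_norm _ _).trans ?_
  rw [norm_indicatorConstLp (by norm_num) (by norm_num)]
  simp [Real.sqrt_eq_rpow]

lemma vol2_real_Ioc_le {a b : ℝ} (h : a ≤ b) : vol2.real (Ioc a b) ≤ b - a := by
  have : vol2.real (Ioc a b) ≤ volume.real (Ioc a b) :=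
    ENNReal.toReal_mono (by simp) (Measure.restrict_le_self _)
  simpa [h] using this

/-- The primitive of an element of `L²(0, 2)`. -/
noncomputable def prim2 (f : Hil2) (y : ℝ) : ℝ := ∫ s in Iic y, f s ∂vol2

lemma integrable_hil2 (f : Hil2) : Integrable f vol2 :=
  (Lp.memLp f).integrable (by norm_num)

lemma prim2_sub (f : Hil2) {y z : ℝ} (h : z ≤ y) :
    prim2 f y - prim2 f z = ∫ s in Ioc z y, f s ∂vol2 := by
  rw [prim2, prim2, ← Iic_union_Ioc_eq_Iic h, setIntegral_union (by
    rw [Set.disjoint_left]; intro x hx hx'; exact absurd hx'.1 (not_lt.2 hx)) measurableSet_Ioc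
    (integrable_hil2 f).integrableOn (integrable_hil2 f).integrableOn]
  ring

lemma abs_prim2_sub_le (f : Hil2) {y z : ℝ} (h : z ≤ y) :
    |prim2 f y - prim2 f z| ≤ √(y - z) * ‖f‖ := by
  rw [prim2_sub f h]
  refine (abs_setIntegral_hil2_le f measurableSet_Ioc).trans ?_
  gcongr
  exact vol2_real_Ioc_le h

lemma continuous_prim2 (f : Hil2) : Continuous (prim2 f) := by
  rw [continuous_iff_continuousAt]
  intro y
  rw [ContinuousAt, tendsto_iff_norm_sub_tendsto_zero]
  refine squeeze_zero (g := fun z => √|z - y| * ‖f‖) (fun _ => norm_nonneg _) (fun z => ?_) ?_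
  · rw [Real.norm_eq_abs]
    rcases le_total z y with h | h
    · rw [abs_sub_comm, abs_sub_comm z, abs_of_nonneg (sub_nonneg.2 h)]
      exact abs_prim2_sub_le f h
    · rw [abs_of_nonneg (sub_nonneg.2 h)]
      exact abs_prim2_sub_le f h
  · have : Continuous fun z => √|z - y| * ‖f‖ := by fun_prop
    simpa using this.tendsto y

lemma abs_prim2_le (f : Hil2) (y : ℝ) : |prim2 f y| ≤ √2 * ‖f‖ := by
  refine (abs_setIntegral_hil2_le f measurableSet_Iic).trans ?_
  gcongr
  calc vol2.real (Iic y) ≤ vol2.real univ := measureReal_mono (subset_univ _)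
    _ = 2 := by simp [Measure.real]

lemma memLp_prim2 (f : Hil2) : MemLp (prim2 f) 2 vol2 :=
  MemLp.of_bound (continuous_prim2 f).aestronglyMeasurable (√2 * ‖f‖)
    (.of_forall fun y => abs_prim2_le f y)

lemma prim2_add (f g : Hil2) (y : ℝ) : prim2 (f + g) y = prim2 f y + prim2 g y := by
  rw [prim2, prim2, prim2, ← integral_add (integrable_hil2 f).integrableOn
    (integrable_hil2 g).integrableOn]
  exact integral_congr_ae (ae_restrict_of_ae (Lp.coeFn_add f g))

lemma prim2_smul (c : ℝ) (f : Hil2) (y : ℝ) : prim2 (c • f) y = c * prim2 f y := by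
  rw [prim2, prim2, ← integral_const_mul]
  exact integral_congr_ae (ae_restrict_of_ae (Lp.coeFn_smul c f))

lemma norm_hil2_le_of_ae_bound (f : Hil2) {C : ℝ} (hC : 0 ≤ C) (h : ∀ᵐ y ∂vol2, |f y| ≤ C) :
    ‖f‖ ≤ √2 * C := by
  have := Lp.norm_le_of_ae_bound (f := f) hC (by simpa using h)
  refine this.trans (le_of_eq ?_)
  have h2 : measureUnivNNReal vol2 = 2 := by
    rw [measureUnivNNReal]; simp [ENNReal.toNNReal_ofNat]
  rw [h2, Real.sqrt_eq_rpow]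
  norm_num

/-- The integration operator on `L²(0, 2)`. -/
noncomputable def intOp : Hil2 →L[ℝ] Hil2 :=
  LinearMap.mkContinuous
    { toFun := fun f => (memLp_prim2 f).toLp
      map_add' := fun f g => by
        rw [← MemLp.toLp_add]
        exact MemLp.toLp_congr _ _ (.of_forall fun y => prim2_add f g y)
      map_smul' := fun c f => by
        rw [RingHom.id_apply, ← MemLp.toLp_const_smul]
        exact MemLp.toLp_congr _ _ (.of_forall fun y => prim2_smul c f y) } 2 fun f => by
    refine (norm_hil2_le_of_ae_bound _ (C := √2 * ‖f‖) (by positivity) ?_).trans (le_of_eq ?_)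
    · filter_upwards [MemLp.coeFn_toLp (memLp_prim2 f)] with y hy
      simp only [LinearMap.coe_mk, AddHom.coe_mk, hy]
      exact abs_prim2_le f y
    · rw [← mul_assoc, Real.mul_self_sqrt (by norm_num)]

lemma intOp_ae (f : Hil2) : intOp f =ᵐ[vol2] prim2 f := MemLp.coeFn_toLp (memLp_prim2 f)

/-- The indicator of a measurable set as an element of `L²(0, 2)`. -/
noncomputable def ind2 (s : Set ℝ) (hs : MeasurableSet s) : Hil2 :=
  indicatorConstLp 2 hs (measure_ne_top vol2 s) 1

lemma ind2_ae (s : Set ℝ) (hs : MeasurableSet s) : ind2 s hs =ᵐ[vol2] s.indicator fun _ => 1 :=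
  indicatorConstLp_coeFn

/-- A finite rank approximation of `intOp`. -/
noncomputable def stepOp (n : ℕ) : Hil2 →L[ℝ] Hil2 :=
  ∑ k ∈ Finset.range (2 * n), (innerSL ℝ (ind2 (Iic ((k : ℝ) / n)) measurableSet_Iic)).smulRight
    (ind2 (Ioc ((k : ℝ) / n) ((k + 1 : ℝ) / n)) measurableSet_Ioc)

lemma isCompactOperator_stepOp (n : ℕ) : IsCompactOperator (stepOp n) := by
  unfold stepOp
  induction (Finset.range (2 * n)) using Finset.induction_on with
  | empty => simpa using isCompactOperator_zero
  | insert k s hk ih =>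
    rw [Finset.sum_insert hk]
    refine IsCompactOperator.add ?_ ih
    have : IsCompactOperator (innerSL ℝ (ind2 (Iic ((k : ℝ) / n)) measurableSet_Iic)) :=
      isCompactOperator_of_locallyCompactSpace_dom _
    exact this.clm_comp (ContinuousLinearMap.toSpanSingleton ℝ _)

lemma stepOp_ae (n : ℕ) (f : Hil2) : stepOp n f =ᵐ[vol2] fun y => ∑ k ∈ Finset.range (2 * n),
    prim2 f ((k : ℝ) / n) * (Ioc ((k : ℝ) / n) ((k + 1 : ℝ) / n)).indicator (fun _ => 1) y := by
  have h1 : stepOp n f = ∑ k ∈ Finset.range (2 * n), prim2 f ((k : ℝ) / n) •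
      ind2 (Ioc ((k : ℝ) / n) ((k + 1 : ℝ) / n)) measurableSet_Ioc := by
    rw [stepOp, sum_apply]
    refine Finset.sum_congr rfl fun k _ => ?_
    rw [ContinuousLinearMap.smulRight_apply, innerSL_apply_apply, ind2,
      L2.inner_indicatorConstLp_one]
    rfl
  rw [h1]
  refine (Lp.coeFn_fun_finsetSum _ _).trans ?_
  have h2 : ∀ᵐ y ∂vol2, ∀ k ∈ Finset.range (2 * n), (prim2 f ((k : ℝ) / n) •
      ind2 (Ioc ((k : ℝ) / n) ((k + 1 : ℝ) / n)) measurableSet_Ioc : Hil2) y =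
      prim2 f ((k : ℝ) / n) * (Ioc ((k : ℝ) / n) ((k + 1 : ℝ) / n)).indicator (fun _ => 1) y := by
    rw [Finset.eventually_all]
    intro k _
    filter_upwards [Lp.coeFn_smul (prim2 f ((k : ℝ) / n))
      (ind2 (Ioc ((k : ℝ) / n) ((k + 1 : ℝ) / n)) measurableSet_Ioc), ind2_ae
      (Ioc ((k : ℝ) / n) ((k + 1 : ℝ) / n)) measurableSet_Ioc] with y h3 h4
    rw [h3, Pi.smul_apply, h4, smul_eq_mul]
  filter_upwards [h2] with y hy
  exact Finset.sum_congr rfl hy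

lemma norm_intOp_sub_stepOp_le (n : ℕ) (hn : 0 < n) : ‖intOp - stepOp n‖ ≤ √2 * √(1 / n) := by
  refine ContinuousLinearMap.opNorm_le_bound _ (by positivity) fun f => ?_
  rw [mul_assoc]
  refine norm_hil2_le_of_ae_bound _ (by positivity) ?_
  have hn' : (0 : ℝ) < n := by exact_mod_cast hn
  filter_upwards [intOp_ae f, stepOp_ae n f, Lp.coeFn_sub (intOp f) (stepOp n f),
    ae_restrict_mem measurableSet_Ioc] with y h1 h2 h3 hy
  rw [sub_apply, h3, Pi.sub_apply, h1, h2]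
  obtain ⟨k, hk⟩ : ∃ k : ℕ, (k : ℝ) < n * y ∧ n * y ≤ k + 1 := by
    have hpos : 0 < ⌈n * y⌉₊ := Nat.ceil_pos.2 (mul_pos hn' hy.1)
    refine ⟨⌈n * y⌉₊ - 1, ?_, ?_⟩
    · rw [Nat.cast_sub hpos]
      have := Nat.ceil_lt_add_one (mul_pos hn' hy.1).le
      push_cast; linarith
    · rw [Nat.cast_sub hpos]
      have := Nat.le_ceil (n * y)
      push_cast; linarith
  have hk2 : k < 2 * n := by
    have : (k : ℝ) < 2 * n := by
      have := mul_le_mul_of_nonneg_left hy.2 hn'.le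
      linarith
    exact_mod_cast this
  have hyk : y ∈ Ioc ((k : ℝ) / n) ((k + 1 : ℝ) / n) := by
    constructor
    · rw [div_lt_iff₀ hn']; linarith
    · rw [le_div_iff₀ hn']; linarith
  rw [Finset.sum_eq_single_of_mem k (Finset.mem_range.2 hk2)]
  · rw [Set.indicator_of_mem hyk, mul_one]
    refine (abs_prim2_sub_le f hyk.1.le).trans ?_
    gcongr
    have := hyk.2
    rw [add_div] at this
    linarith
  · intro l _ hl
    rw [Set.indicator_of_notMem, mul_zero]
    intro hyl
    have a1 := (div_lt_iff₀ hn').1 hyl.1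
    have a2 := (le_div_iff₀ hn').1 hyl.2
    have b1 : (l : ℝ) < k + 1 := by linarith
    have b2 : (k : ℝ) < l + 1 := by linarith
    have b1' : l < k + 1 := by exact_mod_cast b1
    have b2' : k < l + 1 := by exact_mod_cast b2
    omega

lemma isCompactOperator_intOp : IsCompactOperator intOp := by
  refine isCompactOperator_of_tendsto (l := Filter.atTop) (F := stepOp) ?_
    (.of_forall isCompactOperator_stepOp)
  rw [tendsto_iff_norm_sub_tendsto_zero]
  refine squeeze_zero' (g := fun n : ℕ => √2 * √(1 / n)) (.of_forall fun _ => norm_nonneg _) ?_ ?_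
  · filter_upwards [Filter.eventually_gt_atTop 0] with n hn
    rw [norm_sub_rev]
    exact norm_intOp_sub_stepOp_le n hn
  · have h1 : Filter.Tendsto (fun n : ℕ => (1 : ℝ) / n) Filter.atTop (𝓝 0) :=
      tendsto_one_div_atTop_nhds_zero_nat
    have h2 : Continuous fun x : ℝ => √2 * √x := by fun_prop
    have := (h2.tendsto 0).comp h1
    simpa [Function.comp_def] using this

end IntegrationOperator

section CoIntegration

/-- The constant function `1` in `L²(0, 2)`. -/
noncomputable def one2 : Hil2 := ind2 univ MeasurableSet.univ

lemma one2_ae : one2 =ᵐ[vol2] fun _ => (1 : ℝ) := by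
  filter_upwards [ind2_ae univ MeasurableSet.univ] with y hy
  rw [one2, hy, Set.indicator_univ]

/-- The adjoint of the integration operator. -/
noncomputable def coOp : Hil2 →L[ℝ] Hil2 :=
  (innerSL ℝ one2).smulRight one2 - intOp

lemma coOp_ae (f : Hil2) : coOp f =ᵐ[vol2] fun y => (∫ s, f s ∂vol2) - prim2 f y := by
  have h1 : coOp f = (∫ s, f s ∂vol2) • one2 - intOp f := by
    rw [coOp, sub_apply, ContinuousLinearMap.smulRight_apply, innerSL_apply_apply]
    nth_rewrite 1 [one2]
    rw [ind2, L2.inner_indicatorConstLp_one, setIntegral_univ]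
  rw [h1]
  filter_upwards [Lp.coeFn_sub ((∫ s, f s ∂vol2) • one2) (intOp f),
    Lp.coeFn_smul (∫ s, f s ∂vol2) one2, one2_ae, intOp_ae f] with y h1 h2 h3 h4
  rw [h1, Pi.sub_apply, h2, Pi.smul_apply, h3, h4, smul_eq_mul, mul_one]

lemma inner_intOp_left (f g : Hil2) : inner ℝ (intOp f) g = inner ℝ f (coOp g) := by
  rw [L2.inner_def, L2.inner_def]
  have e1 : ∫ y, inner ℝ (intOp f y) (g y) ∂vol2
      = ∫ y, ∫ s, (if s ≤ y then f s * g y else 0) ∂vol2 ∂vol2 := by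
    refine integral_congr_ae ?_
    filter_upwards [intOp_ae f] with y hy
    rw [hy, real_inner_comm, prim2, ← integral_indicator measurableSet_Iic]
    simp only [inner]
    rw [← integral_mul_const]
    refine integral_congr_ae (.of_forall fun s => ?_)
    by_cases h : s ≤ y <;> simp [h]
  have e2 : ∫ s, inner ℝ (f s) (coOp g s) ∂vol2
      = ∫ s, ∫ y, (if s ≤ y then f s * g y else 0) ∂vol2 ∂vol2 := by
    refine integral_congr_ae ?_
    filter_upwards [coOp_ae g] with s hs
    have h1 : (∫ s, g s ∂vol2) - prim2 g s = ∫ y in Ici s, g y ∂vol2 := by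
      have := integral_add_compl (μ := vol2) (measurableSet_Iio (a := s)) (integrable_hil2 g)
      rw [← this, prim2, setIntegral_congr_set (Iio_ae_eq_Iic (μ := vol2) (a := s)), compl_Iio]
      ring
    rw [hs, h1, ← integral_indicator measurableSet_Ici]
    simp only [inner]
    rw [← integral_mul_const]
    refine integral_congr_ae (.of_forall fun y => ?_)
    by_cases h : s ≤ y <;> simp [h, mul_comm]
  rw [e1, e2]
  refine integral_integral_swap (f := fun y s => if s ≤ y then f s * g y else 0) ?_
  have h0 := ((integrable_hil2 g).mul_prod (integrable_hil2 f)).indicator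
    (measurableSet_le measurable_snd measurable_fst : MeasurableSet {p : ℝ × ℝ | p.2 ≤ p.1})
  refine h0.congr (.of_forall fun p => ?_)
  by_cases h : p.2 ≤ p.1 <;> simp [Function.uncurry, Set.indicator, h, mul_comm]

lemma prim2_eq_intervalIntegral (f : Hil2) {y : ℝ} (hy : y ∈ Icc (0 : ℝ) 2) :
    prim2 f y = ∫ s in (0 : ℝ)..y, f s := by
  rw [prim2, Measure.restrict_restrict measurableSet_Iic, intervalIntegral.integral_of_le hy.1]
  congr 2
  ext x
  simp only [mem_inter_iff, mem_Iic, mem_Ioc]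
  constructor
  · rintro ⟨a, b, _⟩; exact ⟨b, a⟩
  · rintro ⟨a, b⟩; exact ⟨b, a, b.trans hy.2⟩

lemma eq_zero_of_coOp_eq (h : Hil2) (c : ℝ) (hc : coOp h = c • one2) : h = 0 ∧ c = 0 := by
  have h1 : ∀ᵐ y ∂vol2, (∫ s, h s ∂vol2) - prim2 h y = c := by
    filter_upwards [coOp_ae h, Lp.coeFn_smul c one2, one2_ae] with y a1 a2 a3
    rw [← a1, hc, a2, Pi.smul_apply, a3, smul_eq_mul, mul_one]
  have hcont := continuous_prim2 h
  have h2 : EqOn (fun y => (∫ s, h s ∂vol2) - prim2 h y) (fun _ => c) (Icc 0 2) := by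
    refine Measure.eqOn_Icc_of_ae_eq (μ := volume) (by norm_num) ?_ (by fun_prop) (by fun_prop)
    rw [← Measure.restrict_congr_set Ioc_ae_eq_Icc]
    exact h1
  have hz : prim2 h 0 = 0 := by
    rw [prim2_eq_intervalIntegral h ⟨le_rfl, by norm_num⟩, intervalIntegral.integral_same]
  have h2' : prim2 h 2 = ∫ s, h s ∂vol2 := by
    rw [prim2_eq_intervalIntegral h ⟨by norm_num, le_rfl⟩,
      intervalIntegral.integral_of_le (by norm_num)]
  have hc0 : c = 0 := by
    have := h2 (show (2 : ℝ) ∈ Icc (0 : ℝ) 2 from ⟨by norm_num, le_rfl⟩)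
    simp only [h2', sub_self] at this
    exact this.symm
  have hi : ∫ s, h s ∂vol2 = 0 := by
    have := h2 (show (0 : ℝ) ∈ Icc (0 : ℝ) 2 from ⟨le_rfl, by norm_num⟩)
    simp only [hz, sub_zero, hc0] at this
    exact this
  refine ⟨?_, hc0⟩
  have hp : ∀ y ∈ Icc (0 : ℝ) 2, ∫ s in (0 : ℝ)..y, h s = 0 := by
    intro y hy
    have := h2 hy
    simp only [hi, hc0] at this
    rw [← prim2_eq_intervalIntegral h hy]; linarith
  have hInt : IntervalIntegrable h volume 0 2 := by
    rw [intervalIntegrable_iff_integrableOn_Ioc_of_le (by norm_num)]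
    exact integrable_hil2 h
  refine (Lp.eq_zero_iff_ae_eq_zero).2 ?_
  rw [Filter.EventuallyEq, ae_restrict_iff' measurableSet_Ioc]
  have hne : ∀ᵐ y : ℝ, y ≠ 2 := by simp [ae_iff, measure_singleton]
  filter_upwards [hInt.ae_hasDerivAt_integral, hne] with y hy hy2 hym
  have hy' := hy (by rw [uIcc_of_le (by norm_num)]; exact ⟨hym.1.le, hym.2⟩) 0
    (by rw [uIcc_of_le (by norm_num)]; exact ⟨le_rfl, by norm_num⟩)
  have hz : HasDerivAt (fun x => ∫ t in (0 : ℝ)..x, h t) 0 y := by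
    refine (hasDerivAt_const y (0 : ℝ)).congr_of_eventuallyEq ?_
    filter_upwards [Ioo_mem_nhds hym.1 (lt_of_le_of_ne hym.2 hy2)] with x hx
    exact hp x ⟨hx.1.le, hx.2.le⟩
  exact hy'.unique hz

/-- Integration from `0`. -/
noncomputable def fwd (f : ℝ → ℝ) (y : ℝ) : ℝ := ∫ s in (0 : ℝ)..y, f s

/-- Integration up to `2`. -/
noncomputable def bwd (f : ℝ → ℝ) (y : ℝ) : ℝ := ∫ s in y..(2 : ℝ), f s

lemma hasDerivAt_fwd {f : ℝ → ℝ} (hf : Continuous f) (y : ℝ) : HasDerivAt (fwd f) (f y) y :=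
  intervalIntegral.integral_hasDerivAt_right (hf.intervalIntegrable _ _)
    (hf.stronglyMeasurableAtFilter _ _) hf.continuousAt

lemma hasDerivAt_bwd {f : ℝ → ℝ} (hf : Continuous f) (y : ℝ) : HasDerivAt (bwd f) (-f y) y :=
  intervalIntegral.integral_hasDerivAt_left (hf.intervalIntegrable _ _)
    (hf.stronglyMeasurableAtFilter _ _) hf.continuousAt

lemma deriv_fwd {f : ℝ → ℝ} (hf : Continuous f) : deriv (fwd f) = f :=
  funext fun y => (hasDerivAt_fwd hf y).deriv

lemma deriv_bwd {f : ℝ → ℝ} (hf : Continuous f) : deriv (bwd f) = -f :=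
  funext fun y => (hasDerivAt_bwd hf y).deriv

lemma contDiff_fwd {f : ℝ → ℝ} {k : ℕ} (hf : ContDiff ℝ k f) : ContDiff ℝ (k + 1 : ℕ) (fwd f) := by
  have : ((k + 1 : ℕ) : WithTop ℕ∞) = (k : WithTop ℕ∞) + 1 := by push_cast; rfl
  rw [this, contDiff_succ_iff_deriv]
  refine ⟨fun y => (hasDerivAt_fwd hf.continuous y).differentiableAt, ?_, ?_⟩
  · intro h; exact absurd h (by simp)
  · rwa [deriv_fwd hf.continuous]

lemma contDiff_bwd {f : ℝ → ℝ} {k : ℕ} (hf : ContDiff ℝ k f) : ContDiff ℝ (k + 1 : ℕ) (bwd f) := by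
  have : ((k + 1 : ℕ) : WithTop ℕ∞) = (k : WithTop ℕ∞) + 1 := by push_cast; rfl
  rw [this, contDiff_succ_iff_deriv]
  refine ⟨fun y => (hasDerivAt_bwd hf.continuous y).differentiableAt, ?_, ?_⟩
  · intro h; exact absurd h (by simp)
  · rw [deriv_bwd hf.continuous]; exact hf.neg

lemma contDiff_iterate_fwd {f : ℝ → ℝ} {k : ℕ} (hf : ContDiff ℝ k f) :
    ∀ j, ContDiff ℝ (k + j : ℕ) (fwd^[j] f)
  | 0 => by simpa using hf
  | j + 1 => by
    rw [Function.iterate_succ_apply']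
    exact contDiff_fwd (contDiff_iterate_fwd hf j)

lemma contDiff_iterate_bwd {f : ℝ → ℝ} {k : ℕ} (hf : ContDiff ℝ k f) :
    ∀ j, ContDiff ℝ (k + j : ℕ) (bwd^[j] f)
  | 0 => by simpa using hf
  | j + 1 => by
    rw [Function.iterate_succ_apply']
    exact contDiff_bwd (contDiff_iterate_bwd hf j)

lemma continuous_iterate_fwd {f : ℝ → ℝ} (hf : Continuous f) (j : ℕ) :
    Continuous (fwd^[j] f) :=
  (contDiff_iterate_fwd (k := 0) (by exact_mod_cast contDiff_zero.2 hf) j).continuous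

lemma continuous_iterate_bwd {f : ℝ → ℝ} (hf : Continuous f) (j : ℕ) :
    Continuous (bwd^[j] f) :=
  (contDiff_iterate_bwd (k := 0) (by exact_mod_cast contDiff_zero.2 hf) j).continuous

lemma iteratedDeriv_iterate_fwd {f : ℝ → ℝ} (hf : Continuous f) (k : ℕ) :
    ∀ j, iteratedDeriv j (fwd^[j + k] f) = fwd^[k] f
  | 0 => by simp
  | j + 1 => by
    rw [iteratedDeriv_succ', show j + 1 + k = (j + k) + 1 by ring, Function.iterate_succ_apply',
      deriv_fwd (continuous_iterate_fwd hf _)]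
    exact iteratedDeriv_iterate_fwd hf k j

lemma iteratedDeriv_iterate_bwd {f : ℝ → ℝ} (hf : Continuous f) :
    ∀ j, iteratedDeriv j (bwd^[j] f) = fun y => (-1) ^ j * f y
  | 0 => by simp
  | j + 1 => by
    rw [iteratedDeriv_succ', Function.iterate_succ_apply', deriv_bwd (continuous_iterate_bwd hf _)]
    ext y
    rw [iteratedDeriv_neg, iteratedDeriv_iterate_bwd hf j]
    ring

lemma iteratedDeriv_iterate_bwd_one {j m : ℕ} (h : j < m) :
    iteratedDeriv m (bwd^[j] fun _ => 1) = 0 := by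
  obtain ⟨k, rfl⟩ : ∃ k, m = (k + 1) + j := ⟨m - j - 1, by omega⟩
  rw [iteratedDeriv_eq_iterate, Function.iterate_add_apply, ← iteratedDeriv_eq_iterate (n := j),
    iteratedDeriv_iterate_bwd continuous_const, ← iteratedDeriv_eq_iterate, iteratedDeriv_succ']
  have : deriv (fun _ : ℝ => (-1 : ℝ) ^ j * 1) = fun _ => 0 := by ext y; simp
  rw [this]
  ext y
  simp

lemma intOp_ae_fwd {e : Hil2} {f : ℝ → ℝ} (h : e =ᵐ[vol2] f) : intOp e =ᵐ[vol2] fwd f := by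
  filter_upwards [intOp_ae e, ae_restrict_mem measurableSet_Ioc] with y hy hym
  rw [hy, prim2_eq_intervalIntegral e ⟨hym.1.le, hym.2⟩, fwd,
    intervalIntegral.integral_of_le hym.1.le, intervalIntegral.integral_of_le hym.1.le]
  exact integral_congr_ae (ae_restrict_of_ae_restrict_of_subset
    (Ioc_subset_Ioc_right hym.2) h)

lemma coOp_ae_bwd {e : Hil2} {f : ℝ → ℝ} (hf : Continuous f) (h : e =ᵐ[vol2] f) :
    coOp e =ᵐ[vol2] bwd f := by
  filter_upwards [coOp_ae e, ae_restrict_mem measurableSet_Ioc, intOp_ae e, intOp_ae_fwd h]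
    with y hy hym h1 h2
  rw [hy, ← h1, h2, integral_congr_ae h, bwd, fwd, ← intervalIntegral.integral_of_le (by norm_num),
    ← intervalIntegral.integral_add_adjacent_intervals (hf.intervalIntegrable 0 y)
    (hf.intervalIntegrable y 2)]
  ring

lemma intOp_pow_ae {e : Hil2} {f : ℝ → ℝ} (h : e =ᵐ[vol2] f) :
    ∀ j : ℕ, (intOp ^ j) e =ᵐ[vol2] fwd^[j] f
  | 0 => by simpa using h
  | j + 1 => by
    rw [Function.iterate_succ_apply', pow_succ']
    exact intOp_ae_fwd (intOp_pow_ae h j)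

lemma coOp_pow_ae {e : Hil2} {f : ℝ → ℝ} (hf : Continuous f) (h : e =ᵐ[vol2] f) :
    ∀ j : ℕ, (coOp ^ j) e =ᵐ[vol2] bwd^[j] f
  | 0 => by simpa using h
  | j + 1 => by
    rw [Function.iterate_succ_apply', pow_succ']
    exact coOp_ae_bwd (continuous_iterate_bwd hf j) (coOp_pow_ae hf h j)

lemma inner_hil2_eq {e e' : Hil2} {f f' : ℝ → ℝ} (h : e =ᵐ[vol2] f) (h' : e' =ᵐ[vol2] f') :
    inner ℝ e e' = ∫ y in (0 : ℝ)..2, f y * f' y := by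
  rw [L2.inner_def, intervalIntegral.integral_of_le (by norm_num)]
  refine integral_congr_ae ?_
  filter_upwards [h, h'] with y h1 h2
  rw [h1, h2]
  simp [inner, mul_comm]

end CoIntegration

/-- A complete orthonormal system of eigenfunctions of the Dirichlet realisation of
`(-1) ^ m * D ^ (2 * m)` on `(0, 2)`. -/
structure IsEigSys (m : ℕ) {ι : Type} (φ : ι → ℝ → ℝ) (lam : ι → ℝ) : Prop where
  smooth : ∀ k, ContDiff ℝ (2 * m : ℕ) (φ k)
  pos : ∀ k, 0 < lam k
  bc_zero : ∀ k, ∀ i < m, iteratedDeriv i (φ k) 0 = 0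
  bc_two : ∀ k, ∀ i < m, iteratedDeriv i (φ k) 2 = 0
  eig : ∀ k, ∀ y ∈ Icc (0 : ℝ) 2, iteratedDeriv (2 * m) (φ k) y = (-1) ^ m * lam k * φ k y
  orth : ∀ k l, k ≠ l → ∫ y in (0 : ℝ)..2, φ k y * φ l y = 0
  norm_one : ∀ k, ∫ y in (0 : ℝ)..2, φ k y * φ k y = 1
  parseval : ∀ w : ℝ → ℝ, Continuous w →
    HasSum (fun k => (∫ y in (0 : ℝ)..2, w y * φ k y) ^ 2) (sqNorm w)

lemma exists_regular_eigenfunction (m : ℕ) (hm : 1 ≤ m) (b : Hil2) (μ : ℝ) (hμ : 0 < μ)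
    (c : Fin m → ℝ)
    (h1 : μ • b = (intOp ^ m) ((coOp ^ m) b - ∑ j : Fin m, c j • (coOp ^ (j : ℕ)) one2))
    (h2 : ∀ j < m, inner ℝ ((coOp ^ j) one2)
      ((coOp ^ m) b - ∑ j : Fin m, c j • (coOp ^ (j : ℕ)) one2) = 0) :
    ∃ f : ℝ → ℝ, b =ᵐ[vol2] f ∧ ContDiff ℝ (2 * m : ℕ) f ∧
      (∀ i < m, iteratedDeriv i f 0 = 0) ∧ (∀ i < m, iteratedDeriv i f 2 = 0) ∧
      ∀ y ∈ Icc (0 : ℝ) 2, iteratedDeriv (2 * m) f y = (-1) ^ m * μ⁻¹ * f y := by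
  set g : Hil2 := (coOp ^ m) b - ∑ j : Fin m, c j • (coOp ^ (j : ℕ)) one2 with hg
  obtain ⟨n, rfl⟩ : ∃ n, m = n + 1 := ⟨m - 1, by omega⟩
  have hb : b = μ⁻¹ • (intOp ^ (n + 1)) g := by rw [← h1, smul_smul, inv_mul_cancel₀ hμ.ne', one_smul]
  -- a continuous representative of `b`
  obtain ⟨G, hG, hGb⟩ : ∃ G : ℝ → ℝ, Continuous G ∧ b =ᵐ[vol2] G := by
    refine ⟨fun y => μ⁻¹ * prim2 ((intOp ^ n) g) y, (continuous_prim2 _).const_mul _, ?_⟩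
    have e : (intOp ^ (n + 1)) g = intOp ((intOp ^ n) g) := by rw [pow_succ']; rfl
    rw [hb, e]
    filter_upwards [intOp_ae ((intOp ^ n) g), Lp.coeFn_smul μ⁻¹ (intOp ((intOp ^ n) g))]
      with y a1 a2
    rw [a2, Pi.smul_apply, a1, smul_eq_mul]
  set B : ℝ → ℝ := fun y => bwd^[n + 1] G y - ∑ j : Fin (n + 1), c j * bwd^[(j : ℕ)] (fun _ => 1) y
    with hB
  have hone : ContDiff ℝ ((n + 1 : ℕ) : WithTop ℕ∞) (fun _ : ℝ => (1 : ℝ)) := contDiff_const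
  have hp : ∀ j : ℕ, ContDiff ℝ (n + 1 : ℕ) (bwd^[j] fun _ => (1 : ℝ)) := fun j =>
    (contDiff_iterate_bwd hone j).of_le (by exact_mod_cast Nat.le_add_right _ _)
  have hR : ContDiff ℝ (n + 1 : ℕ) (bwd^[n + 1] G) := by
    have := contDiff_iterate_bwd (k := 0) (by exact_mod_cast contDiff_zero.2 hG) (n + 1)
    rwa [zero_add] at this
  have hS : ContDiff ℝ (n + 1 : ℕ) fun y => ∑ j : Fin (n + 1), c j * bwd^[(j : ℕ)] (fun _ => 1) y :=
    ContDiff.sum fun j _ => contDiff_const.mul (hp j)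
  have hBs : ContDiff ℝ (n + 1 : ℕ) B := hR.sub hS
  have hBc : Continuous B := hBs.continuous
  have hgB : g =ᵐ[vol2] B := by
    have a3 : ∀ᵐ y ∂vol2, ∀ j ∈ (Finset.univ : Finset (Fin (n + 1))),
        (c j • (coOp ^ (j : ℕ)) one2 : Hil2) y = c j * bwd^[(j : ℕ)] (fun _ => 1) y := by
      rw [Finset.eventually_all]
      intro j _
      filter_upwards [Lp.coeFn_smul (c j) ((coOp ^ (j : ℕ)) one2),
        coOp_pow_ae continuous_const one2_ae (j : ℕ)] with y b1 b2
      rw [b1, Pi.smul_apply, b2, smul_eq_mul]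
    filter_upwards [Lp.coeFn_sub ((coOp ^ (n + 1)) b)
      (∑ j : Fin (n + 1), c j • (coOp ^ (j : ℕ)) one2), coOp_pow_ae hG hGb (n + 1),
      Lp.coeFn_fun_finsetSum Finset.univ fun j : Fin (n + 1) => c j • (coOp ^ (j : ℕ)) one2, a3]
      with y a1 a2 a4 a5
    rw [hg, a1, Pi.sub_apply, a2, a4, hB]
    simp only
    congr 1
    exact Finset.sum_congr rfl a5
  set f : ℝ → ℝ := fun y => μ⁻¹ * fwd^[n + 1] B y with hf
  have hFs := contDiff_iterate_fwd hBs (n + 1)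
  have hfs : ContDiff ℝ (2 * (n + 1) : ℕ) f := by
    rw [two_mul]; exact contDiff_const.mul hFs
  have hbf : b =ᵐ[vol2] f := by
    rw [hb]
    filter_upwards [intOp_pow_ae hgB (n + 1), Lp.coeFn_smul μ⁻¹ ((intOp ^ (n + 1)) g)] with y a1 a2
    rw [a2, Pi.smul_apply, a1, smul_eq_mul]
  have hfG : EqOn f G (Icc 0 2) := by
    refine Measure.eqOn_Icc_of_ae_eq (μ := volume) (by norm_num) ?_ hfs.continuous.continuousOn
      hG.continuousOn
    rw [← Measure.restrict_congr_set Ioc_ae_eq_Icc]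
    exact hbf.symm.trans hGb
  have hder : ∀ j k, j + k = n + 1 → iteratedDeriv j f = fun y => μ⁻¹ * fwd^[k] B y := by
    intro j k hjk
    ext y
    rw [hf, ← hjk, iteratedDeriv_const_mul_field, iteratedDeriv_iterate_fwd hBc k j]
  refine ⟨f, hbf, hfs, ?_, ?_, ?_⟩
  · intro i hi
    obtain ⟨k, hk⟩ : ∃ k, i + (k + 1) = n + 1 := ⟨n - i, by omega⟩
    have e0 : fwd (fwd^[k] B) 0 = 0 := intervalIntegral.integral_same
    simp only [hder i (k + 1) hk, Function.iterate_succ_apply', e0, mul_zero]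
  · intro i hi
    obtain ⟨k, hk⟩ : ∃ k, i + (k + 1) = n + 1 := ⟨n - i, by omega⟩
    simp only [hder i (k + 1) hk, Function.iterate_succ_apply']
    have e1 : ∀ j (x y : Hil2), inner ℝ ((intOp ^ j) x) y = inner ℝ x ((coOp ^ j) y) := by
      intro j
      induction j with
      | zero => intro x y; simp
      | succ j ih =>
        intro x y
        have a1 : (intOp ^ (j + 1)) x = (intOp ^ j) (intOp x) := by rw [pow_succ]; rfl
        have a2 : (coOp ^ (j + 1)) y = coOp ((coOp ^ j) y) := by rw [pow_succ']; rfl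
        rw [a1, a2, ih, inner_intOp_left]
    have e2 := inner_hil2_eq (intOp_pow_ae hgB k) one2_ae
    rw [e1, real_inner_comm, h2 k (by omega)] at e2
    simp only [mul_one] at e2
    rw [fwd, ← e2, mul_zero]
  · intro y hy
    have e1 : iteratedDeriv (2 * (n + 1)) f = iteratedDeriv (n + 1) (fun y => μ⁻¹ * B y) := by
      have := hder (n + 1) 0 rfl
      simp only [Function.iterate_zero, id] at this
      rw [← this, two_mul, iteratedDeriv_eq_iterate, Function.iterate_add_apply,
        ← iteratedDeriv_eq_iterate (n := n + 1), ← iteratedDeriv_eq_iterate]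
    have e2 : iteratedDeriv (n + 1) B y = (-1) ^ (n + 1) * G y := by
      rw [hB, iteratedDeriv_fun_sub hR.contDiffAt hS.contDiffAt,
        iteratedDeriv_iterate_bwd hG, iteratedDeriv_fun_sum]
      · rw [Finset.sum_eq_zero, sub_zero]
        intro j _
        rw [iteratedDeriv_const_mul_field, iteratedDeriv_iterate_bwd_one j.2]
        simp
      · intro j _
        exact (contDiff_const.mul (hp j)).contDiffAt
    rw [e1, iteratedDeriv_const_mul_field, e2, hfG hy]
    ring

lemma exists_isEigSys (m : ℕ) (hm : 1 ≤ m) :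
    ∃ (ι : Type) (φ : ι → ℝ → ℝ) (lam : ι → ℝ), IsEigSys m φ lam := by
  obtain ⟨ι, b, μ, hμ, hb⟩ := exists_eigenbasis_of_adjoint intOp coOp inner_intOp_left
    isCompactOperator_intOp one2 eq_zero_of_coOp_eq m hm
  choose c h1 h2 using hb
  choose φ hφ hs h0 h2' he using fun k =>
    exists_regular_eigenfunction m hm (b k) (μ k) (hμ k) (c k) (h1 k) (h2 k)
  have hin : ∀ k l, inner ℝ (b k) (b l) = ∫ y in (0 : ℝ)..2, φ k y * φ l y := fun k l =>
    inner_hil2_eq (hφ k) (hφ l)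
  refine ⟨ι, φ, fun k => (μ k)⁻¹, hs, fun k => inv_pos.2 (hμ k), h0, h2', he, ?_, ?_, ?_⟩
  · intro k l hkl
    rw [← hin]
    exact b.orthonormal.2 hkl
  · intro k
    rw [← hin, real_inner_self_eq_norm_sq, b.orthonormal.1]; norm_num
  · intro w hw
    have hwm : MemLp w 2 vol2 := by
      obtain ⟨C, hC⟩ := isCompact_Icc.exists_bound_of_continuousOn (s := Icc (0 : ℝ) 2)
        hw.continuousOn
      refine MemLp.of_bound hw.aestronglyMeasurable C ?_
      filter_upwards [ae_restrict_mem measurableSet_Ioc] with y hy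
      exact hC y ⟨hy.1.le, hy.2⟩
    have hwa : hwm.toLp =ᵐ[vol2] w := MemLp.coeFn_toLp hwm
    have e := b.hasSum_inner_mul_inner hwm.toLp hwm.toLp
    rw [inner_hil2_eq hwa hwa] at e
    have e1 : sqNorm w = ∫ y in (0 : ℝ)..2, w y * w y := by
      simp only [sqNorm, pow_two]
    rw [e1]
    have e2 : (fun k => (∫ y in (0 : ℝ)..2, w y * φ k y) ^ 2)
        = fun k => inner ℝ hwm.toLp (b k) * inner ℝ (b k) hwm.toLp := by
      ext k
      rw [real_inner_comm hwm.toLp (b k), inner_hil2_eq hwa (hφ k), pow_two]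
    rw [e2]
    exact e

section Bernstein

variable {m : ℕ} {ι : Type} {φ : ι → ℝ → ℝ} {lam : ι → ℝ}

/-- A finite linear combination of the functions `φ k`. -/
noncomputable def eigComb (φ : ι → ℝ → ℝ) (F : Finset ι) (b : ι → ℝ) (y : ℝ) : ℝ :=
  ∑ k ∈ F, b k * φ k y

namespace IsEigSys

lemma contDiff_comb (h : IsEigSys m φ lam) (F : Finset ι) (b : ι → ℝ) :
    ContDiff ℝ (2 * m : ℕ) (eigComb φ F b) := by
  unfold eigComb
  exact ContDiff.sum fun k _ => contDiff_const.mul (h.smooth k)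

lemma iteratedDeriv_comb (h : IsEigSys m φ lam) (F : Finset ι) (b : ι → ℝ) {i : ℕ}
    (hi : i ≤ 2 * m) (y : ℝ) :
    iteratedDeriv i (eigComb φ F b) y = ∑ k ∈ F, b k * iteratedDeriv i (φ k) y := by
  unfold eigComb
  have hs : ∀ k, ContDiff ℝ i (φ k) := fun k => (h.smooth k).of_le (by exact_mod_cast hi)
  rw [iteratedDeriv_fun_sum fun k _ => (contDiff_const.mul (hs k)).contDiffAt]
  exact Finset.sum_congr rfl fun k _ => by rw [iteratedDeriv_const_mul_field]

lemma comb_bc_zero (h : IsEigSys m φ lam) (F : Finset ι) (b : ι → ℝ) {i : ℕ} (hi : i < m) :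
    iteratedDeriv i (eigComb φ F b) 0 = 0 := by
  rw [h.iteratedDeriv_comb F b (by omega)]
  exact Finset.sum_eq_zero fun k _ => by rw [h.bc_zero k i hi, mul_zero]

lemma comb_eig (h : IsEigSys m φ lam) (F : Finset ι) (b : ι → ℝ) {y : ℝ}
    (hy : y ∈ Icc (0 : ℝ) 2) : iteratedDeriv (2 * m) (eigComb φ F b) y
      = eigComb φ F (fun k => (-1) ^ m * lam k * b k) y := by
  rw [h.iteratedDeriv_comb F b le_rfl, eigComb]
  exact Finset.sum_congr rfl fun k _ => by rw [h.eig k y hy]; ring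

lemma continuous_fun (h : IsEigSys m φ lam) (k : ι) : Continuous (φ k) := (h.smooth k).continuous

lemma continuous_comb (h : IsEigSys m φ lam) (F : Finset ι) (b : ι → ℝ) :
    Continuous (eigComb φ F b) := (h.contDiff_comb F b).continuous

lemma integral_mul_comb (h : IsEigSys m φ lam) {w : ℝ → ℝ} (hw : Continuous w) (F : Finset ι)
    (b : ι → ℝ) : ∫ y in (0 : ℝ)..2, w y * eigComb φ F b y
      = ∑ k ∈ F, b k * ∫ y in (0 : ℝ)..2, w y * φ k y := by
  simp only [eigComb, Finset.mul_sum]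
  rw [intervalIntegral.integral_finsetSum fun k _ => by
    have := h.continuous_fun k
    exact Continuous.intervalIntegrable (by fun_prop) _ _]
  refine Finset.sum_congr rfl fun k _ => ?_
  rw [← intervalIntegral.integral_const_mul]
  congr 1; ext y; ring

open Classical in
lemma integral_comb_mul_fun (h : IsEigSys m φ lam) (F : Finset ι) (b : ι → ℝ) (k : ι) :
    ∫ y in (0 : ℝ)..2, φ k y * eigComb φ F b y = if k ∈ F then b k else 0 := by
  rw [h.integral_mul_comb (h.continuous_fun k)]
  by_cases hk : k ∈ F
  · rw [if_pos hk, Finset.sum_eq_single_of_mem k hk, h.norm_one, mul_one]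
    intro l _ hl
    rw [h.orth k l hl.symm, mul_zero]
  · rw [if_neg hk]
    refine Finset.sum_eq_zero fun l hl => ?_
    rw [h.orth k l (fun e => hk (e ▸ hl)), mul_zero]

lemma sqNorm_comb (h : IsEigSys m φ lam) (F : Finset ι) (b : ι → ℝ) :
    sqNorm (eigComb φ F b) = ∑ k ∈ F, b k ^ 2 := by
  have : sqNorm (eigComb φ F b) = ∫ y in (0 : ℝ)..2, eigComb φ F b y * eigComb φ F b y := by
    simp only [sqNorm, pow_two]
  rw [this, h.integral_mul_comb (h.continuous_comb F b)]
  refine Finset.sum_congr rfl fun k hk => ?_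
  have e : ∀ y, eigComb φ F b y * φ k y = φ k y * eigComb φ F b y := fun y => mul_comm _ _
  simp only [e]
  rw [h.integral_comb_mul_fun, if_pos hk, pow_two]

lemma sqNorm_comb_deriv (h : IsEigSys m φ lam) (F : Finset ι) (b : ι → ℝ) {X : ℝ}
    (hF : ∀ k ∈ F, lam k ≤ X) : sqNorm (iteratedDeriv (2 * m) (eigComb φ F b))
      ≤ X ^ 2 * ∑ k ∈ F, b k ^ 2 := by
  have e : sqNorm (iteratedDeriv (2 * m) (eigComb φ F b))
      = sqNorm (eigComb φ F (fun k => (-1) ^ m * lam k * b k)) := by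
    unfold sqNorm
    refine intervalIntegral.integral_congr fun y hy => ?_
    rw [uIcc_of_le (by norm_num)] at hy
    simp only [h.comb_eig F b hy]
  rw [e, h.sqNorm_comb, Finset.mul_sum]
  refine Finset.sum_le_sum fun k hk => ?_
  have h1 : ((-1 : ℝ) ^ m) ^ 2 = 1 := by rw [← pow_mul, mul_comm, pow_mul]; norm_num
  rw [mul_pow, mul_pow, h1, one_mul]
  have := pow_le_pow_left₀ (h.pos k).le (hF k hk) 2
  exact mul_le_mul_of_nonneg_right this (sq_nonneg _)

/-- Bernstein's inequality in `L²`. -/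
lemma exists_bernstein (m : ℕ) : ∃ C, 0 ≤ C ∧ ∀ {ι : Type} {φ : ι → ℝ → ℝ} {lam : ι → ℝ},
    IsEigSys m φ lam → ∀ (j : ℕ) (F : Finset ι), (∀ k ∈ F, lam k ≤ 2 ^ (4 * m * (j + 1))) →
      ∀ b : ι → ℝ, ∀ i ≤ 2 * m, sqNorm (iteratedDeriv i (eigComb φ F b))
        ≤ C * (2 ^ j) ^ (4 * i) * ∑ k ∈ F, b k ^ 2 := by
  obtain ⟨C, hC, hI⟩ := exists_sqNorm_iteratedDeriv_le (2 * m)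
  refine ⟨C * (1 + 2 ^ (8 * m)), by positivity, fun {ι φ lam} h j F hF b i hi => ?_⟩
  have hr : (0 : ℝ) < 2 ^ j := by positivity
  have h1 := hI _ (h.contDiff_comb F b) ((2 ^ j) ^ 2)⁻¹ (by positivity)
    (inv_le_one_of_one_le₀ (one_le_pow₀ (one_le_pow₀ (by norm_num)))) i hi
  have h2 := h.sqNorm_comb_deriv F b hF
  rw [h.sqNorm_comb] at h1
  set S := ∑ k ∈ F, b k ^ 2 with hS
  have hS0 : 0 ≤ S := Finset.sum_nonneg fun _ _ => sq_nonneg _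
  have e1 : ((((2 : ℝ) ^ j) ^ 2)⁻¹) ^ (2 * (2 * m)) * (2 ^ (4 * m * (j + 1))) ^ 2 = 2 ^ (8 * m) := by
    rw [inv_pow]
    have : ((2 : ℝ) ^ (4 * m * (j + 1))) ^ 2 = (((2 : ℝ) ^ j) ^ 2) ^ (2 * (2 * m)) * 2 ^ (8 * m) := by
      simp only [← pow_mul, ← pow_add]; congr 1; ring
    rw [this, ← mul_assoc, inv_mul_cancel₀ (by positivity), one_mul]
  have h3 : ((((2 : ℝ) ^ j) ^ 2)⁻¹) ^ (2 * (2 * m)) * sqNorm (iteratedDeriv (2 * m) (eigComb φ F b))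
      ≤ 2 ^ (8 * m) * S := by
    refine (mul_le_mul_of_nonneg_left h2 (by positivity)).trans (le_of_eq ?_)
    rw [← mul_assoc, e1]
  have h4 : ((((2 : ℝ) ^ j) ^ 2)⁻¹) ^ (2 * i) * sqNorm (iteratedDeriv i (eigComb φ F b))
      ≤ C * ((1 + 2 ^ (8 * m)) * S) := h1.trans (mul_le_mul_of_nonneg_left (by linarith) hC)
  rw [inv_pow, inv_mul_le_iff₀ (by positivity)] at h4
  refine h4.trans (le_of_eq ?_)
  rw [← pow_mul, show 2 * (2 * i) = 4 * i by ring]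
  ring

/-- Bernstein's inequality in the uniform norm. -/
lemma exists_bernstein_sup (m : ℕ) (hm : 1 ≤ m) : ∃ C, 0 ≤ C ∧
    ∀ {ι : Type} {φ : ι → ℝ → ℝ} {lam : ι → ℝ}, IsEigSys m φ lam →
      ∀ (j : ℕ) (F : Finset ι), (∀ k ∈ F, lam k ≤ 2 ^ (4 * m * (j + 1))) →
      ∀ b : ι → ℝ, ∀ i ≤ 2 * m, ∀ y ∈ Icc (0 : ℝ) 2, iteratedDeriv i (eigComb φ F b) y ^ 2
        ≤ C * (2 ^ j) ^ (4 * i + 2) * ∑ k ∈ F, b k ^ 2 := by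
  obtain ⟨C, hC, hB⟩ := exists_bernstein m
  have key : ∀ {ι : Type} {φ : ι → ℝ → ℝ} {lam : ι → ℝ}, IsEigSys m φ lam →
      ∀ (j : ℕ) (F : Finset ι), (∀ k ∈ F, lam k ≤ 2 ^ (4 * m * (j + 1))) →
      ∀ b : ι → ℝ, ∀ i < 2 * m, ∀ y ∈ Icc (0 : ℝ) 2, iteratedDeriv i (eigComb φ F b) y ^ 2
        ≤ 4 * C * (2 ^ j) ^ (4 * i + 2) * ∑ k ∈ F, b k ^ 2 := by
    intro ι φ lam h j F hF b i hi y hy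
    set a := eigComb φ F b with ha
    have hs := h.contDiff_comb F b
    have hd : ∀ y, HasDerivAt (iteratedDeriv i a) (iteratedDeriv (i + 1) a y) y := by
      intro y
      rw [iteratedDeriv_succ]
      exact ((hs.differentiable_iteratedDeriv i (by exact_mod_cast hi)) y).hasDerivAt
    have hc : Continuous (iteratedDeriv (i + 1) a) :=
      hs.continuous_iteratedDeriv (i + 1) (by exact_mod_cast hi)
    have h1 := sq_le_sqNorm hd hc (h := ((2 ^ j) ^ 2)⁻¹) (by positivity)
      (inv_le_one_of_one_le₀ (one_le_pow₀ (one_le_pow₀ (by norm_num)))) hy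
    have h2 := hB h j F hF b i hi.le
    have h3 := hB h j F hF b (i + 1) hi
    rw [← ha] at h2 h3
    set S := ∑ k ∈ F, b k ^ 2 with hS
    rw [inv_inv] at h1
    have h4 : 2 * (2 ^ j : ℝ) ^ 2 * sqNorm (iteratedDeriv i a)
        ≤ 2 * (2 ^ j : ℝ) ^ 2 * (C * (2 ^ j) ^ (4 * i) * S) :=
      mul_le_mul_of_nonneg_left h2 (by positivity)
    have h5 : 2 * ((2 ^ j : ℝ) ^ 2)⁻¹ * sqNorm (iteratedDeriv (i + 1) a)
        ≤ 2 * ((2 ^ j : ℝ) ^ 2)⁻¹ * (C * (2 ^ j) ^ (4 * (i + 1)) * S) :=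
      mul_le_mul_of_nonneg_left h3 (by positivity)
    have h6 : 2 * ((2 ^ j : ℝ) ^ 2)⁻¹ * (C * (2 ^ j) ^ (4 * (i + 1)) * S)
        = 2 * C * (2 ^ j) ^ (4 * i + 2) * S := by
      have hr : (2 ^ j : ℝ) ≠ 0 := by positivity
      field_simp
      ring
    have h7 : 2 * (2 ^ j : ℝ) ^ 2 * (C * (2 ^ j) ^ (4 * i) * S)
        = 2 * C * (2 ^ j) ^ (4 * i + 2) * S := by ring
    linarith
  refine ⟨4 * C * (2 ^ (4 * m)) ^ 2, by positivity, fun {ι φ lam} h j F hF b i hi y hy => ?_⟩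
  have hS0 : 0 ≤ ∑ k ∈ F, b k ^ 2 := Finset.sum_nonneg fun _ _ => sq_nonneg _
  rcases hi.lt_or_eq with hi | rfl
  · refine (key h j F hF b i hi y hy).trans ?_
    refine mul_le_mul_of_nonneg_right ?_ hS0
    refine mul_le_mul_of_nonneg_right ?_ (by positivity)
    have : (1 : ℝ) ≤ (2 ^ (4 * m)) ^ 2 := one_le_pow₀ (one_le_pow₀ (by norm_num))
    exact le_mul_of_one_le_right (by positivity) this
  · rw [h.comb_eig F b hy]
    have h1 := key h j F hF (fun k => (-1) ^ m * lam k * b k) 0 (by omega) y hy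
    rw [iteratedDeriv_zero] at h1
    refine h1.trans ?_
    have h2 : ∑ k ∈ F, ((-1) ^ m * lam k * b k) ^ 2
        ≤ (2 ^ (4 * m * (j + 1))) ^ 2 * ∑ k ∈ F, b k ^ 2 := by
      rw [Finset.mul_sum]
      refine Finset.sum_le_sum fun k hk => ?_
      have h1 : ((-1 : ℝ) ^ m) ^ 2 = 1 := by rw [← pow_mul, mul_comm, pow_mul]; norm_num
      rw [mul_pow, mul_pow, h1, one_mul]
      have := pow_le_pow_left₀ (h.pos k).le (hF k hk) 2
      exact mul_le_mul_of_nonneg_right this (sq_nonneg _)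
    refine (mul_le_mul_of_nonneg_left h2 (by positivity)).trans (le_of_eq ?_)
    have e : (2 : ℝ) ^ (4 * m * (j + 1)) = 2 ^ (4 * m) * (2 ^ j) ^ (4 * m) := by
      rw [← pow_mul, ← pow_add]; congr 1; ring
    rw [e]; ring

lemma finite_low (h : IsEigSys m φ lam) (hm : 1 ≤ m) (j : ℕ) :
    {k | lam k ≤ 2 ^ (4 * m * (j + 1))}.Finite := by
  obtain ⟨C, hC, hB⟩ := exists_bernstein_sup m hm
  have hcard : ∀ F : Finset ι, (∀ k ∈ F, lam k ≤ 2 ^ (4 * m * (j + 1))) →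
      (F.card : ℝ) ≤ 2 * (C * (2 ^ j) ^ 2) := by
    intro F hF
    have h1 : ∀ y ∈ Icc (0 : ℝ) 2, ∑ k ∈ F, φ k y ^ 2 ≤ C * (2 ^ j) ^ 2 := by
      intro y hy
      have h2 := hB h j F hF (fun k => φ k y) 0 (by omega) y hy
      rw [iteratedDeriv_zero] at h2
      have e : eigComb φ F (fun k => φ k y) y = ∑ k ∈ F, φ k y ^ 2 := by
        simp only [eigComb, pow_two]
      rw [e] at h2
      have h0 : 0 ≤ ∑ k ∈ F, φ k y ^ 2 := Finset.sum_nonneg fun _ _ => sq_nonneg _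
      rcases h0.eq_or_lt with h3 | h3
      · rw [← h3]; positivity
      · rw [pow_two] at h2
        simpa using le_of_mul_le_mul_right h2 h3
    have h2 : ∫ y in (0 : ℝ)..2, ∑ k ∈ F, φ k y ^ 2 = F.card := by
      rw [intervalIntegral.integral_finsetSum fun k _ => by
        have := h.continuous_fun k
        exact Continuous.intervalIntegrable (by fun_prop) _ _]
      have : ∀ k ∈ F, ∫ y in (0 : ℝ)..2, φ k y ^ 2 = 1 := fun k _ => by
        rw [← h.norm_one k]; simp only [pow_two]
      rw [Finset.sum_congr rfl this]; simp
    rw [← h2]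
    have h3 : ∫ y in (0 : ℝ)..2, ∑ k ∈ F, φ k y ^ 2 ≤ ∫ y in (0 : ℝ)..2, C * (2 ^ j) ^ 2 := by
      refine intervalIntegral.integral_mono_on (μ := volume) (by norm_num) ?_ ?_ h1
      · exact Continuous.intervalIntegrable
          (continuous_finsetSum _ fun k _ => (h.continuous_fun k).pow 2) _ _
      · exact continuous_const.intervalIntegrable _ _
    refine h3.trans (le_of_eq ?_)
    simp
    ring
  by_contra hinf
  obtain ⟨n, hn⟩ := exists_nat_gt (2 * (C * (2 ^ j) ^ 2))
  obtain ⟨F, hF, hFn⟩ := Set.Infinite.exists_subset_card_eq hinf n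
  have := hcard F fun k hk => hF hk
  rw [hFn] at this
  linarith

end IsEigSys

end Bernstein

section Source

lemma exists_bound_iteratedDeriv {θ : ℝ → ℝ} (hθ : ContDiff ℝ (⊤ : ℕ∞) θ) (N : ℕ) :
    ∃ B, 0 ≤ B ∧ ∀ i ≤ N, ∀ y ∈ Icc (0 : ℝ) 2, |iteratedDeriv i θ y| ≤ B := by
  have h : ∀ i, ∃ B, 0 ≤ B ∧ ∀ y ∈ Icc (0 : ℝ) 2, |iteratedDeriv i θ y| ≤ B := by
    intro i
    have hc : Continuous (iteratedDeriv i θ) :=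
      hθ.continuous_iteratedDeriv i (by exact_mod_cast le_top)
    obtain ⟨B, hB⟩ := (isCompact_Icc (a := (0 : ℝ)) (b := 2)).exists_bound_of_continuousOn
      hc.continuousOn
    exact ⟨B, (norm_nonneg _).trans (hB 0 (by simp)), fun y hy => hB y hy⟩
  choose B hB0 hB using h
  refine ⟨∑ i ∈ Finset.range (N + 1), B i, Finset.sum_nonneg fun i _ => hB0 i,
    fun i hi y hy => (hB i y hy).trans ?_⟩
  exact Finset.single_le_sum (f := B) (fun i _ => hB0 i) (Finset.mem_range.2 (by omega))

lemma sqNorm_mono {f g : ℝ → ℝ} (hf : Continuous f) (hg : Continuous g)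
    (h : ∀ y ∈ Icc (0 : ℝ) 2, f y ^ 2 ≤ g y ^ 2) : sqNorm f ≤ sqNorm g :=
  intervalIntegral.integral_mono_on (μ := volume) (by norm_num)
    ((hf.pow 2).intervalIntegrable _ _) ((hg.pow 2).intervalIntegrable _ _) h

lemma sqNorm_const_mul (c : ℝ) (f : ℝ → ℝ) : sqNorm (fun y => c * f y) = c ^ 2 * sqNorm f := by
  unfold sqNorm
  rw [← intervalIntegral.integral_const_mul]
  exact intervalIntegral.integral_congr fun y _ => by ring

lemma sqNorm_sum_le {κ : Type*} (s : Finset κ) {f : κ → ℝ → ℝ} (hf : ∀ i ∈ s, Continuous (f i)) :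
    sqNorm (fun y => ∑ i ∈ s, f i y) ≤ s.card * ∑ i ∈ s, sqNorm (f i) := by
  unfold sqNorm
  have hi : ∀ i ∈ s, IntervalIntegrable (fun y => f i y ^ 2) volume 0 2 := fun i h =>
    ((hf i h).pow 2).intervalIntegrable _ _
  rw [← intervalIntegral.integral_finsetSum hi, ← intervalIntegral.integral_const_mul]
  have c1 : Continuous fun y => (∑ i ∈ s, f i y) ^ 2 := (continuous_finsetSum s hf).pow 2
  have c2 : Continuous fun y => (s.card : ℝ) * ∑ i ∈ s, f i y ^ 2 :=
    continuous_const.mul (continuous_finsetSum s fun i h => (hf i h).pow 2)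
  exact intervalIntegral.integral_mono_on (μ := volume) (by norm_num)
    (c1.intervalIntegrable _ _) (c2.intervalIntegrable _ _)
    fun y _ => sq_sum_le_card_mul_sum_sq

/-- Leibniz estimate. -/
lemma exists_sqNorm_mul_le {θ : ℝ → ℝ} (hθ : ContDiff ℝ (⊤ : ℕ∞) θ) (N : ℕ) :
    ∃ C, 0 ≤ C ∧ ∀ (l : ℕ) (g : ℝ → ℝ), l ≤ N → ContDiff ℝ l g →
      sqNorm (iteratedDeriv l (θ * g))
        ≤ C * ∑ i ∈ Finset.range (l + 1), sqNorm (iteratedDeriv i g) := by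
  obtain ⟨B, hB0, hB⟩ := exists_bound_iteratedDeriv hθ N
  refine ⟨(N + 1) * (2 ^ N * B) ^ 2, by positivity, fun l g hl hg => ?_⟩
  have hθl : ContDiff ℝ l θ := hθ.of_le (by exact_mod_cast le_top)
  have e : iteratedDeriv l (θ * g) = fun y => ∑ i ∈ Finset.range (l + 1),
      (l.choose i : ℝ) * iteratedDeriv (l - i) θ y * iteratedDeriv i g y := by
    funext y
    rw [mul_comm θ g, iteratedDeriv_mul hg.contDiffAt hθl.contDiffAt]
    exact Finset.sum_congr rfl fun i _ => by ring
  have c1 : ∀ i, i ≤ l → Continuous (iteratedDeriv i θ) := fun i hi =>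
    hθl.continuous_iteratedDeriv i (by exact_mod_cast hi)
  have c2 : ∀ i, i ≤ l → Continuous (iteratedDeriv i g) := fun i hi =>
    hg.continuous_iteratedDeriv i (by exact_mod_cast hi)
  have c3 : ∀ i ∈ Finset.range (l + 1), Continuous fun y =>
      (l.choose i : ℝ) * iteratedDeriv (l - i) θ y * iteratedDeriv i g y := fun i hi =>
    (continuous_const.mul (c1 _ (Nat.sub_le _ _))).mul
      (c2 i (by have := Finset.mem_range.1 hi; omega))
  rw [e]
  refine (sqNorm_sum_le _ c3).trans ?_
  have hs : ∀ i ∈ Finset.range (l + 1), sqNorm (fun y =>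
      (l.choose i : ℝ) * iteratedDeriv (l - i) θ y * iteratedDeriv i g y)
        ≤ (2 ^ N * B) ^ 2 * sqNorm (iteratedDeriv i g) := fun i hi => by
    rw [← sqNorm_const_mul]
    have ci := c2 i (by have := Finset.mem_range.1 hi; omega)
    refine sqNorm_mono (c3 i hi) (continuous_const.mul ci) fun y hy => ?_
    rw [mul_pow, mul_pow (2 ^ N * B)]
    refine mul_le_mul_of_nonneg_right ?_ (sq_nonneg _)
    rw [← sq_abs, abs_mul]
    have a1 : |(l.choose i : ℝ)| ≤ 2 ^ N := by
      rw [abs_of_nonneg (by positivity)]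
      have h1 : l.choose i ≤ 2 ^ l := Nat.choose_le_two_pow _ _
      have h2 : 2 ^ l ≤ 2 ^ N := Nat.pow_le_pow_right (by norm_num) hl
      exact_mod_cast h1.trans h2
    have a2 := hB (l - i) (by omega) y hy
    gcongr
  refine (mul_le_mul_of_nonneg_left (Finset.sum_le_sum hs) (by positivity)).trans ?_
  rw [← Finset.mul_sum, Finset.card_range, ← mul_assoc]
  have : ((l + 1 : ℕ) : ℝ) ≤ N + 1 := by exact_mod_cast Nat.succ_le_succ hl
  have h0 : 0 ≤ ∑ i ∈ Finset.range (l + 1), sqNorm (iteratedDeriv i g) :=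
    Finset.sum_nonneg fun i _ => sqNorm_nonneg _
  gcongr

/-- Repeated integration by parts on `[0,2]`. -/
lemma integral_iteratedDeriv_mul (l : ℕ) : ∀ {f g : ℝ → ℝ}, ContDiff ℝ l f → ContDiff ℝ l g →
    (∀ i < l, iteratedDeriv i f 0 = 0 ∨ iteratedDeriv (l - 1 - i) g 0 = 0) →
    (∀ i < l, iteratedDeriv i f 2 = 0 ∨ iteratedDeriv (l - 1 - i) g 2 = 0) →
    ∫ y in (0 : ℝ)..2, iteratedDeriv l f y * g y
      = (-1) ^ l * ∫ y in (0 : ℝ)..2, f y * iteratedDeriv l g y := by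
  induction l with
  | zero => intro f g _ _ _ _; simp
  | succ l ih =>
    intro f g hf hg h0 h2
    have hd1 : ∀ y, HasDerivAt (iteratedDeriv l f) (iteratedDeriv (l + 1) f y) y := fun y => by
      rw [iteratedDeriv_succ]
      exact ((hf.differentiable_iteratedDeriv l (by exact_mod_cast Nat.lt_succ_self l)) y).hasDerivAt
    have hg1 : ContDiff ℝ 1 g := hg.of_le (by exact_mod_cast Nat.succ_le_succ (Nat.zero_le l))
    have hd2 : ∀ y, HasDerivAt g (deriv g y) y := fun y =>
      ((hg1.differentiable (by norm_num)) y).hasDerivAt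
    have hc1 : Continuous (iteratedDeriv (l + 1) f) :=
      hf.continuous_iteratedDeriv (l + 1) le_rfl
    have hc2 : Continuous (deriv g) := hg1.continuous_deriv (by norm_num)
    have hgl : ContDiff ℝ l (deriv g) := by
      have : ContDiff ℝ ((l : ℕ∞) + 1) g := by exact_mod_cast hg
      exact ((contDiff_succ_iff_deriv).1 (by exact_mod_cast hg)).2.2
    have e := intervalIntegral.integral_mul_deriv_eq_deriv_mul (a := (0 : ℝ)) (b := 2)
      (fun y _ => hd1 y) (fun y _ => hd2 y) (hc1.intervalIntegrable _ _)
      (hc2.intervalIntegrable _ _)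
    have b0 : iteratedDeriv l f 0 * g 0 = 0 := by
      rcases h0 l (Nat.lt_succ_self l) with h | h
      · rw [h, zero_mul]
      · have : iteratedDeriv 0 g 0 = 0 := by simpa using h
        rw [iteratedDeriv_zero] at this
        rw [this, mul_zero]
    have b2 : iteratedDeriv l f 2 * g 2 = 0 := by
      rcases h2 l (Nat.lt_succ_self l) with h | h
      · rw [h, zero_mul]
      · have : iteratedDeriv 0 g 2 = 0 := by simpa using h
        rw [iteratedDeriv_zero] at this
        rw [this, mul_zero]
    rw [b0, b2] at e
    have ih' := ih (f := f) (g := deriv g) (hf.of_le (by exact_mod_cast Nat.le_succ l)) hgl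
      (fun i hi => by
        rcases h0 i (by omega) with h | h
        · exact Or.inl h
        · refine Or.inr ?_
          rw [← iteratedDeriv_succ', show l - 1 - i + 1 = l + 1 - 1 - i by omega]
          exact h)
      (fun i hi => by
        rcases h2 i (by omega) with h | h
        · exact Or.inl h
        · refine Or.inr ?_
          rw [← iteratedDeriv_succ', show l - 1 - i + 1 = l + 1 - 1 - i by omega]
          exact h)
    rw [← iteratedDeriv_succ'] at ih'
    have e' : ∫ y in (0 : ℝ)..2, iteratedDeriv (l + 1) f y * g y
      = -∫ y in (0 : ℝ)..2, iteratedDeriv l f y * deriv g y := by linarith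
    rw [e', ih']
    ring

end Source

section Source2

lemma sqrt_le_of_le_mul_sq {X C p S : ℝ} (hC : 0 ≤ C) (hp : 0 ≤ p)
    (h : X ≤ C * p ^ 2 * S) : √X ≤ √C * p * √S := by
  have := Real.sqrt_le_sqrt h
  rwa [Real.sqrt_mul (by positivity), Real.sqrt_mul hC, Real.sqrt_sq hp] at this

lemma iteratedDeriv_mul_eq_zero {N : ℕ} {f g : ℝ → ℝ} {y : ℝ} (hf : ContDiff ℝ N f)
    (hg : ContDiff ℝ N g) (h : ∀ i ≤ N, iteratedDeriv i g y = 0) :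
    iteratedDeriv N (f * g) y = 0 := by
  rw [iteratedDeriv_mul hf.contDiffAt hg.contDiffAt]
  exact Finset.sum_eq_zero fun i _ => by rw [h _ (Nat.sub_le _ _), mul_zero]

lemma iteratedDeriv_mul_eq_zero_of_vanish {N : ℕ} {f g : ℝ → ℝ} {y ρ : ℝ}
    (hf : ∀ y, ρ ≤ y → f y = 0) (hy : ρ < y) : iteratedDeriv N (f * g) y = 0 := by
  have : (f * g) =ᶠ[𝓝 y] fun _ => (0 : ℝ) := by
    filter_upwards [lt_mem_nhds hy] with z hz
    simp [hf z hz.le]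
  rw [this.iteratedDeriv_eq]
  simp

namespace IsEigSys

lemma exists_high_bound (m : ℕ) {θ : ℝ → ℝ} (hθ : ContDiff ℝ (⊤ : ℕ∞) θ) {ρ : ℝ}
    (hρ : ρ < 2) (hθρ : ∀ y, ρ ≤ y → θ y = 0) {l : ℕ} (hl : l < 2 * m) :
    ∃ C, 0 ≤ C ∧ ∀ {ι : Type} {φ : ι → ℝ → ℝ} {lam : ι → ℝ}, IsEigSys m φ lam →
      ∀ g : ℝ → ℝ, ContDiff ℝ (2 * m : ℕ) g → (∀ i < m, iteratedDeriv i g 0 = 0) →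
      ∀ (j : ℕ) (F : Finset ι), (∀ k ∈ F, lam k ≤ 2 ^ (4 * m * (j + 1))) → ∀ b : ι → ℝ,
        |∫ y in (0 : ℝ)..2, θ y * iteratedDeriv l g y * eigComb φ F b y|
          ≤ C * √(sqNorm g) * ((2 : ℝ) ^ j) ^ (2 * l) * √(∑ k ∈ F, b k ^ 2) := by
  obtain ⟨C1, hC1, h1⟩ := exists_bernstein m
  obtain ⟨C2, hC2, h2⟩ := exists_sqNorm_mul_le hθ (2 * m)
  refine ⟨√(C2 * ((l + 1) * C1)), Real.sqrt_nonneg _, ?_⟩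
  intro ι φ lam h g hg hg0 j F hF b
  have hφ := h.contDiff_comb F b
  have hl' : (l : ℕ) ≤ 2 * m := hl.le
  have hθl : ∀ N : ℕ, ContDiff ℝ N θ := fun N => hθ.of_le (by exact_mod_cast le_top)
  have hle : ∀ i : ℕ, i ≤ 2 * m → ContDiff ℝ i (eigComb φ F b) := fun i hi =>
    hφ.of_le (by exact_mod_cast hi)
  have e : ∫ y in (0 : ℝ)..2, θ y * iteratedDeriv l g y * eigComb φ F b y
      = (-1) ^ l * ∫ y in (0 : ℝ)..2, g y * iteratedDeriv l (θ * eigComb φ F b) y := by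
    rw [← integral_iteratedDeriv_mul l (g := θ * eigComb φ F b)
      (hg.of_le (by exact_mod_cast hl')) ((hθl l).mul (hle l hl'))]
    · exact intervalIntegral.integral_congr fun y _ => by simp only [Pi.mul_apply]; ring
    · intro i hi
      by_cases him : i < m
      · exact Or.inl (hg0 i him)
      · refine Or.inr (iteratedDeriv_mul_eq_zero (hθl _) (hle _ (by omega)) fun i' hi' => ?_)
        exact h.comb_bc_zero F b (by omega)
    · intro i hi
      exact Or.inr (iteratedDeriv_mul_eq_zero_of_vanish hθρ hρ)
  have hc : Continuous (iteratedDeriv l (θ * eigComb φ F b)) :=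
    ((hθl l).mul (hle l hl')).continuous_iteratedDeriv l le_rfl
  rw [e, abs_mul, abs_pow, abs_neg, abs_one, one_pow, one_mul]
  refine (abs_integral_mul_le hg.continuous hc).trans ?_
  have hb : sqNorm (iteratedDeriv l (θ * eigComb φ F b))
      ≤ C2 * ((l + 1) * C1) * (((2 : ℝ) ^ j) ^ (2 * l)) ^ 2 * ∑ k ∈ F, b k ^ 2 := by
    refine (h2 l _ hl' (hle l hl')).trans ?_
    have : ∑ i ∈ Finset.range (l + 1), sqNorm (iteratedDeriv i (eigComb φ F b))
        ≤ ∑ i ∈ Finset.range (l + 1), C1 * ((2 : ℝ) ^ j) ^ (4 * l) * ∑ k ∈ F, b k ^ 2 := by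
      refine Finset.sum_le_sum fun i hi => ?_
      have hil : i ≤ l := by have := Finset.mem_range.1 hi; omega
      refine (h1 h j F hF b i (by omega)).trans ?_
      have h0 : 0 ≤ ∑ k ∈ F, b k ^ 2 := Finset.sum_nonneg fun _ _ => sq_nonneg _
      have h3 : ((2 : ℝ) ^ j) ^ (4 * i) ≤ ((2 : ℝ) ^ j) ^ (4 * l) :=
        pow_le_pow_right₀ (one_le_pow₀ (by norm_num)) (by omega)
      gcongr
    refine (mul_le_mul_of_nonneg_left this hC2).trans (le_of_eq ?_)
    rw [Finset.sum_const, Finset.card_range, nsmul_eq_mul]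
    push_cast
    ring
  have := sqrt_le_of_le_mul_sq (by positivity) (by positivity) hb
  calc _ ≤ √(sqNorm g) * (√(C2 * ((l + 1) * C1)) * ((2 : ℝ) ^ j) ^ (2 * l)
        * √(∑ k ∈ F, b k ^ 2)) := mul_le_mul_of_nonneg_left this (Real.sqrt_nonneg _)
    _ = _ := by ring

lemma exists_low_bound (m : ℕ) (hm : 1 ≤ m) {θ : ℝ → ℝ} (hθ : ContDiff ℝ (⊤ : ℕ∞) θ) {ρ : ℝ}
    (hρ : ρ < 2) (hθρ : ∀ y, ρ ≤ y → θ y = 0) {l : ℕ} (hl : l < 2 * m) :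
    ∃ C, 0 ≤ C ∧ ∀ {ι : Type} {φ : ι → ℝ → ℝ} {lam : ι → ℝ}, IsEigSys m φ lam →
      ∀ (i j : ℕ), i ≤ j → ∀ (G F : Finset ι), (∀ k ∈ G, lam k ≤ 2 ^ (4 * m * (i + 1))) →
      (∀ k ∈ F, 2 ^ (4 * m * j) ≤ lam k ∧ lam k ≤ 2 ^ (4 * m * (j + 1))) → ∀ a b : ι → ℝ,
        2 ^ j * |∫ y in (0 : ℝ)..2, θ y * iteratedDeriv l (eigComb φ G a) y * eigComb φ F b y|
          ≤ C * ((2 : ℝ) ^ i) ^ (4 * m - 1) * √(∑ k ∈ G, a k ^ 2) * √(∑ k ∈ F, b k ^ 2) := by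
  obtain ⟨C1, hC1, h1⟩ := exists_bernstein m
  obtain ⟨C2, hC2, h2⟩ := exists_sqNorm_mul_le hθ 1
  obtain ⟨C3, hC3, h3⟩ := exists_bernstein_sup m hm
  obtain ⟨B, hB0, hB⟩ := exists_bound_iteratedDeriv hθ 0
  refine ⟨B * √C3 * √C3 + √(C2 * (2 * C1)) * √C1, by positivity, ?_⟩
  intro ι φ lam h i j hij G F hG hF a b
  set p : ℝ := 2 ^ i with hp
  set r : ℝ := 2 ^ j with hr
  have hp1 : 1 ≤ p := one_le_pow₀ (by norm_num)
  have hr1 : 1 ≤ r := one_le_pow₀ (by norm_num)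
  have hpr : p ≤ r := pow_le_pow_right₀ (by norm_num) hij
  set Sa := ∑ k ∈ G, a k ^ 2 with hSa
  set Sb := ∑ k ∈ F, b k ^ 2 with hSb
  have hSa0 : 0 ≤ Sa := Finset.sum_nonneg fun _ _ => sq_nonneg _
  have hSb0 : 0 ≤ Sb := Finset.sum_nonneg fun _ _ => sq_nonneg _
  set b' : ι → ℝ := fun k => (-1) ^ m * (lam k)⁻¹ * b k with hb'
  set ψ := eigComb φ F b' with hψ
  set A := eigComb φ G a with hA
  have hAs : ContDiff ℝ (2 * m : ℕ) A := h.contDiff_comb G a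
  have hψs : ContDiff ℝ (2 * m : ℕ) ψ := h.contDiff_comb F b'
  have hSb' : ∑ k ∈ F, b' k ^ 2 ≤ ((r ^ (4 * m))⁻¹) ^ 2 * Sb := by
    rw [hSb, Finset.mul_sum]
    refine Finset.sum_le_sum fun k hk => ?_
    rw [hb']
    have e : ((-1 : ℝ) ^ m * (lam k)⁻¹ * b k) ^ 2 = ((lam k)⁻¹) ^ 2 * b k ^ 2 := by
      rw [mul_pow, mul_pow, ← pow_mul, mul_comm m 2, pow_mul]; norm_num
    simp only [e]
    refine mul_le_mul_of_nonneg_right ?_ (sq_nonneg _)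
    have h4 : r ^ (4 * m) ≤ lam k := by
      rw [hr, ← pow_mul, mul_comm j]; exact (hF k hk).1
    have h5 : (lam k)⁻¹ ≤ (r ^ (4 * m))⁻¹ := inv_anti₀ (by positivity) h4
    have h6 : 0 ≤ (lam k)⁻¹ := inv_nonneg.2 (h.pos k).le
    exact pow_le_pow_left₀ h6 h5 2
  have hFl : ∀ k ∈ F, lam k ≤ 2 ^ (4 * m * (j + 1)) := fun k hk => (hF k hk).2
  have hm1 : 4 * m = (4 * m - 1) + 1 := by omega
  -- the four factors
  have n1 : √(sqNorm (iteratedDeriv (2 * m - 1) ψ)) ≤ √C1 * (r ^ 2)⁻¹ * √Sb := by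
    refine sqrt_le_of_le_mul_sq hC1 (by positivity) ?_
    refine (h1 h j F hFl b' (2 * m - 1) (by omega)).trans ?_
    refine (mul_le_mul_of_nonneg_left hSb' (by positivity)).trans (le_of_eq ?_)
    have : r ^ (4 * (2 * m - 1)) * r ^ 4 = (r ^ (4 * m)) ^ 2 := by
      rw [← pow_add r, ← pow_mul r (4 * m) 2]; congr 1; omega
    have hr0 : r ≠ 0 := by positivity
    rw [inv_pow, ← this, ← hr]
    field_simp
  have n2 : |iteratedDeriv (2 * m - 1) ψ 0| ≤ √C3 * r⁻¹ * √Sb := by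
    rw [← Real.sqrt_sq_eq_abs]
    refine sqrt_le_of_le_mul_sq hC3 (by positivity) ?_
    refine (h3 h j F hFl b' (2 * m - 1) (by omega) 0 (by simp)).trans ?_
    refine (mul_le_mul_of_nonneg_left hSb' (by positivity)).trans (le_of_eq ?_)
    have : r ^ (4 * (2 * m - 1) + 2) * r ^ 2 = (r ^ (4 * m)) ^ 2 := by
      rw [← pow_add r, ← pow_mul r (4 * m) 2]; congr 1; omega
    have hr0 : r ≠ 0 := by positivity
    rw [inv_pow, ← this, ← hr]
    field_simp
  have n3 : |iteratedDeriv l A 0| ≤ √C3 * p ^ (4 * m - 1) * √Sa := by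
    rw [← Real.sqrt_sq_eq_abs]
    refine sqrt_le_of_le_mul_sq hC3 (by positivity) ?_
    refine (h3 h i G hG a l hl.le 0 (by simp)).trans ?_
    have : p ^ (4 * l + 2) ≤ (p ^ (4 * m - 1)) ^ 2 := by
      rw [← pow_mul p (4 * m - 1) 2]
      exact pow_le_pow_right₀ hp1 (by omega)
    gcongr
  set g := θ * iteratedDeriv l A with hg
  have hθ1 : ContDiff ℝ 1 θ := hθ.of_le (by exact_mod_cast le_top)
  have hA1 : ContDiff ℝ 1 (iteratedDeriv l A) := by
    rw [iteratedDeriv_eq_iterate]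
    exact (hAs.of_le (m := ((1 + l : ℕ) : WithTop ℕ∞)) (by exact_mod_cast (by omega))).iterate_deriv' 1 l
  have hg1 : ContDiff ℝ 1 g := hθ1.mul hA1
  have n4 : √(sqNorm (deriv g)) ≤ √(C2 * (2 * C1)) * p ^ (4 * m) * √Sa := by
    refine sqrt_le_of_le_mul_sq (by positivity) (by positivity) ?_
    have := h2 1 (iteratedDeriv l A) le_rfl hA1
    rw [iteratedDeriv_one] at this
    refine this.trans ?_
    rw [Finset.sum_range_succ, Finset.sum_range_one, iteratedDeriv_zero, iteratedDeriv_one,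
      ← iteratedDeriv_succ]
    have q1 := h1 h i G hG a l hl.le
    have q2 := h1 h i G hG a (l + 1) hl
    have q3 : p ^ (4 * l) ≤ (p ^ (4 * m)) ^ 2 := by
      rw [← pow_mul p (4 * m) 2]; exact pow_le_pow_right₀ hp1 (by omega)
    have q4 : p ^ (4 * (l + 1)) ≤ (p ^ (4 * m)) ^ 2 := by
      rw [← pow_mul p (4 * m) 2]; exact pow_le_pow_right₀ hp1 (by omega)
    have q5 : C1 * p ^ (4 * l) * Sa ≤ C1 * (p ^ (4 * m)) ^ 2 * Sa := by gcongr
    have q6 : C1 * p ^ (4 * (l + 1)) * Sa ≤ C1 * (p ^ (4 * m)) ^ 2 * Sa := by gcongr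
    have : sqNorm (iteratedDeriv l A) + sqNorm (iteratedDeriv (l + 1) A)
        ≤ 2 * C1 * (p ^ (4 * m)) ^ 2 * Sa := by linarith
    refine (mul_le_mul_of_nonneg_left this hC2).trans (le_of_eq (by ring))
  -- one integration by parts
  have hψd : ∀ y, HasDerivAt (iteratedDeriv (2 * m - 1) ψ) (iteratedDeriv (2 * m) ψ y) y := by
    intro y
    have e : iteratedDeriv (2 * m) ψ = deriv (iteratedDeriv (2 * m - 1) ψ) := by
      rw [← iteratedDeriv_succ]; congr 1; omega
    rw [e]
    exact ((hψs.differentiable_iteratedDeriv (2 * m - 1)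
      (by exact_mod_cast (by omega : 2 * m - 1 < 2 * m))) y).hasDerivAt
  have hψc : Continuous (iteratedDeriv (2 * m) ψ) := hψs.continuous_iteratedDeriv _ le_rfl
  have hψc1 : Continuous (iteratedDeriv (2 * m - 1) ψ) :=
    hψs.continuous_iteratedDeriv _ (by exact_mod_cast Nat.sub_le _ _)
  have hgd : ∀ y, HasDerivAt g (deriv g y) y := fun y =>
    ((hg1.differentiable (by norm_num)) y).hasDerivAt
  have hgc : Continuous (deriv g) := hg1.continuous_deriv (by norm_num)
  have e := intervalIntegral.integral_mul_deriv_eq_deriv_mul (a := (0 : ℝ)) (b := 2)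
    (fun y _ => hgd y) (fun y _ => hψd y) (hgc.intervalIntegrable _ _)
    (hψc.intervalIntegrable _ _)
  have e0 : ∫ y in (0 : ℝ)..2, θ y * iteratedDeriv l A y * eigComb φ F b y
      = ∫ y in (0 : ℝ)..2, g y * iteratedDeriv (2 * m) ψ y := by
    refine intervalIntegral.integral_congr fun y hy => ?_
    rw [uIcc_of_le (by norm_num)] at hy
    have : iteratedDeriv (2 * m) ψ y = eigComb φ F b y := by
      rw [hψ, h.comb_eig F b' hy]
      unfold eigComb
      refine Finset.sum_congr rfl fun k _ => ?_
      have hk := (h.pos k).ne'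
      have hs : ((-1 : ℝ) ^ m) * (-1) ^ m = 1 := by rw [← mul_pow]; norm_num
      rw [hb']
      dsimp only
      calc _ = ((-1 : ℝ) ^ m * (-1) ^ m) * (lam k * (lam k)⁻¹) * b k * φ k y := by ring
        _ = _ := by rw [hs, mul_inv_cancel₀ hk]; ring
    simp only [this, hg, Pi.mul_apply]
  have g2 : g 2 = 0 := by rw [hg, Pi.mul_apply, hθρ 2 hρ.le, zero_mul]
  have g0 : |g 0| ≤ B * |iteratedDeriv l A 0| := by
    rw [hg, Pi.mul_apply, abs_mul]
    have := hB 0 le_rfl 0 (by simp)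
    rw [iteratedDeriv_zero] at this
    exact mul_le_mul_of_nonneg_right this (abs_nonneg _)
  rw [e0, e, g2, zero_mul, zero_sub]
  have t1 := abs_integral_mul_le hgc hψc1
  have t2 : |-(g 0 * iteratedDeriv (2 * m - 1) ψ 0)
      - ∫ y in (0 : ℝ)..2, deriv g y * iteratedDeriv (2 * m - 1) ψ y|
      ≤ |g 0| * |iteratedDeriv (2 * m - 1) ψ 0| + √(sqNorm (deriv g))
        * √(sqNorm (iteratedDeriv (2 * m - 1) ψ)) := by
    refine (abs_sub _ _).trans ?_
    rw [abs_neg, abs_mul]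
    linarith
  refine (mul_le_mul_of_nonneg_left t2 (by positivity)).trans ?_
  have u1 : |g 0| * |iteratedDeriv (2 * m - 1) ψ 0|
      ≤ (B * (√C3 * p ^ (4 * m - 1) * √Sa)) * (√C3 * r⁻¹ * √Sb) := by
    refine mul_le_mul (g0.trans (mul_le_mul_of_nonneg_left n3 hB0)) n2 (abs_nonneg _)
      (by positivity)
  have u2 : √(sqNorm (deriv g)) * √(sqNorm (iteratedDeriv (2 * m - 1) ψ))
      ≤ (√(C2 * (2 * C1)) * p ^ (4 * m) * √Sa) * (√C1 * (r ^ 2)⁻¹ * √Sb) :=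
    mul_le_mul n4 n1 (Real.sqrt_nonneg _) (by positivity)
  have hr0 : 0 < r := by positivity
  have u3 : r * ((√(C2 * (2 * C1)) * p ^ (4 * m) * √Sa) * (√C1 * (r ^ 2)⁻¹ * √Sb))
      ≤ √(C2 * (2 * C1)) * √C1 * p ^ (4 * m - 1) * √Sa * √Sb := by
    have e1 : p ^ (4 * m) = p ^ (4 * m - 1) * p := by rw [← pow_succ, ← hm1]
    rw [e1]
    have e2 : r * ((√(C2 * (2 * C1)) * (p ^ (4 * m - 1) * p) * √Sa) * (√C1 * (r ^ 2)⁻¹ * √Sb))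
      = (p / r) * (√(C2 * (2 * C1)) * √C1 * p ^ (4 * m - 1) * √Sa * √Sb) := by
      field_simp
    rw [e2]
    exact mul_le_of_le_one_left (by positivity) ((div_le_one hr0).2 hpr)
  have u4 : r * ((B * (√C3 * p ^ (4 * m - 1) * √Sa)) * (√C3 * r⁻¹ * √Sb))
      = B * √C3 * √C3 * p ^ (4 * m - 1) * √Sa * √Sb := by
    calc _ = (r * r⁻¹) * (B * √C3 * √C3 * p ^ (4 * m - 1) * √Sa * √Sb) := by ring
      _ = _ := by rw [mul_inv_cancel₀ hr0.ne', one_mul]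
  have u5 := mul_le_mul_of_nonneg_left u1 hr0.le
  have u6 := mul_le_mul_of_nonneg_left u2 hr0.le
  rw [mul_add]
  calc _ ≤ B * √C3 * √C3 * p ^ (4 * m - 1) * √Sa * √Sb
        + √(C2 * (2 * C1)) * √C1 * p ^ (4 * m - 1) * √Sa * √Sb := by linarith
    _ = _ := by ring

end IsEigSys

end Source2

section Source3

/-- The coefficient of `w` along `φ k`. -/
noncomputable def coef {ι : Type} (φ : ι → ℝ → ℝ) (w : ℝ → ℝ) (k : ι) : ℝ :=
  ∫ y in (0 : ℝ)..2, w y * φ k y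

/-- Decay of order `σ` of the coefficients of `w`. -/
def CoefDecay {ι : Type} (m : ℕ) (φ : ι → ℝ → ℝ) (lam : ι → ℝ) (σ : ℕ) (D : ℝ) (w : ℝ → ℝ) :
    Prop :=
  ∀ (j : ℕ) (F : Finset ι), (∀ k ∈ F, 2 ^ (4 * m * j) ≤ lam k) →
    ((2 : ℝ) ^ j) ^ (2 * σ) * ∑ k ∈ F, coef φ w k ^ 2 ≤ D ^ 2

namespace IsEigSys

variable {m : ℕ} {ι : Type} {φ : ι → ℝ → ℝ} {lam : ι → ℝ}

lemma sum_coef_sq_le (h : IsEigSys m φ lam) {w : ℝ → ℝ} (hw : Continuous w) (F : Finset ι) :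
    ∑ k ∈ F, coef φ w k ^ 2 ≤ sqNorm w :=
  sum_le_hasSum F (fun _ _ => sq_nonneg _) (h.parseval w hw)

lemma sqNorm_le_of_sum_le (h : IsEigSys m φ lam) {w : ℝ → ℝ} (hw : Continuous w) {S : ℝ}
    (hS : ∀ F : Finset ι, ∑ k ∈ F, coef φ w k ^ 2 ≤ S) : sqNorm w ≤ S :=
  le_of_tendsto' (h.parseval w hw) hS

/-- The indices of eigenvalues at most `2 ^ (4 * m * (j + 1))`. -/
noncomputable def low (h : IsEigSys m φ lam) (hm : 1 ≤ m) (j : ℕ) : Finset ι :=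
  (h.finite_low hm j).toFinset

lemma mem_low (h : IsEigSys m φ lam) (hm : 1 ≤ m) {j : ℕ} {k : ι} :
    k ∈ h.low hm j ↔ lam k ≤ 2 ^ (4 * m * (j + 1)) := by
  simp [low]

lemma low_mono (h : IsEigSys m φ lam) (hm : 1 ≤ m) {i j : ℕ} (hij : i ≤ j) :
    h.low hm i ⊆ h.low hm j := fun k hk =>
  (h.mem_low hm).2 (((h.mem_low hm).1 hk).trans (pow_le_pow_right₀ (by norm_num) (by gcongr)))

lemma coef_sub_comb (h : IsEigSys m φ lam) {w : ℝ → ℝ} (hw : Continuous w) (F : Finset ι)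
    (b : ι → ℝ) (k : ι) [Decidable (k ∈ F)] :
    coef φ (w - eigComb φ F b) k = coef φ w k - if k ∈ F then b k else 0 := by
  have e := h.integral_comb_mul_fun F b k
  unfold coef
  have c1 : Continuous fun y => w y * φ k y := hw.mul (h.continuous_fun k)
  have c2 : Continuous fun y => φ k y * eigComb φ F b y :=
    (h.continuous_fun k).mul (h.continuous_comb F b)
  calc _ = ∫ y in (0 : ℝ)..2, (w y * φ k y - φ k y * eigComb φ F b y) :=
        intervalIntegral.integral_congr fun y _ => by simp only [Pi.sub_apply]; ring
    _ = _ := by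
        rw [intervalIntegral.integral_sub (c1.intervalIntegrable _ _) (c2.intervalIntegrable _ _), e]
        congr

lemma exists_source_bound (m : ℕ) (hm : 1 ≤ m) {θ : ℝ → ℝ} (hθ : ContDiff ℝ (⊤ : ℕ∞) θ) {ρ : ℝ}
    (hρ : ρ < 2) (hθρ : ∀ y, ρ ≤ y → θ y = 0) {l : ℕ} (hl : l < 2 * m) {σ : ℕ}
    (hσ : σ ≤ 4 * m) :
    ∃ C, 0 ≤ C ∧ ∀ {ι : Type} {φ : ι → ℝ → ℝ} {lam : ι → ℝ}, IsEigSys m φ lam →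
      ∀ w : ℝ → ℝ, ContDiff ℝ (2 * m : ℕ) w → (∀ i < m, iteratedDeriv i w 0 = 0) →
      ∀ D, 0 ≤ D → CoefDecay m φ lam σ D w → sqNorm w ≤ D ^ 2 →
      ∀ (j : ℕ) (F : Finset ι),
      (∀ k ∈ F, 2 ^ (4 * m * j) ≤ lam k ∧ lam k ≤ 2 ^ (4 * m * (j + 1))) → ∀ b : ι → ℝ,
        ((2 : ℝ) ^ j) ^ (σ + 1) * |∫ y in (0 : ℝ)..2, θ y * iteratedDeriv l w y * eigComb φ F b y|
          ≤ C * D * ((2 : ℝ) ^ j) ^ (4 * m) * √(∑ k ∈ F, b k ^ 2) := by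
  classical
  obtain ⟨C1, hC1, h1⟩ := exists_high_bound m hθ hρ hθρ hl
  obtain ⟨C2, hC2, h2⟩ := exists_low_bound m hm hθ hρ hθρ hl
  refine ⟨C1 + 2 * C2, by positivity, ?_⟩
  intro ι φ lam h w hw hw0 D hD hdec hwD j F hF b
  have hFl : ∀ k ∈ F, lam k ≤ 2 ^ (4 * m * (j + 1)) := fun k hk => (hF k hk).2
  set c := coef φ w with hc
  set r : ℝ := 2 ^ j with hr
  have hr1 : 1 ≤ r := one_le_pow₀ (by norm_num)
  have hr0 : 0 < r := by positivity
  set Sb := √(∑ k ∈ F, b k ^ 2) with hSb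
  have hSb0 : 0 ≤ Sb := Real.sqrt_nonneg _
  have hwc := hw.continuous
  have hθc := hθ.continuous
  have hcomb := h.continuous_comb F b
  -- high frequencies
  set g := w - eigComb φ (h.low hm j) c with hg
  have hgs : ContDiff ℝ (2 * m : ℕ) g := hw.sub (h.contDiff_comb _ _)
  have hlm : (l : WithTop ℕ∞) ≤ (2 * m : ℕ) := by exact_mod_cast hl.le
  have dsub : ∀ i ≤ 2 * m, ∀ y, iteratedDeriv i g y
      = iteratedDeriv i w y - iteratedDeriv i (eigComb φ (h.low hm j) c) y := fun i hi y =>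
    iteratedDeriv_sub (hw.of_le (by exact_mod_cast hi)).contDiffAt
      ((h.contDiff_comb _ _).of_le (by exact_mod_cast hi)).contDiffAt
  have hg0 : ∀ i < m, iteratedDeriv i g 0 = 0 := fun i hi => by
    rw [dsub i (by omega), hw0 i hi, h.comb_bc_zero _ _ hi, sub_zero]
  have hgn : √(sqNorm g) ≤ (r ^ σ)⁻¹ * D := by
    refine Real.sqrt_le_iff.2 ⟨by positivity, ?_⟩
    refine h.sqNorm_le_of_sum_le hgs.continuous fun G => ?_
    have e1 : ∀ k ∈ G, coef φ g k ^ 2 = if k ∉ h.low hm j then c k ^ 2 else 0 := fun k _ => by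
      rw [hg, h.coef_sub_comb hwc]
      by_cases hk : k ∈ h.low hm j <;> simp [hk, hc]
    rw [Finset.sum_congr rfl e1, ← Finset.sum_filter]
    have e2 := hdec j (G.filter fun k => k ∉ h.low hm j) fun k hk => by
      have := (Finset.mem_filter.1 hk).2
      rw [h.mem_low, not_le] at this
      exact (pow_le_pow_right₀ (by norm_num) (by gcongr; omega)).trans this.le
    have e3 : ((r ^ σ)⁻¹ * D) ^ 2 = (r ^ (2 * σ))⁻¹ * D ^ 2 := by
      rw [mul_pow, inv_pow, ← pow_mul r σ 2, mul_comm σ]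
    rw [e3, inv_mul_eq_div, le_div_iff₀ (by positivity), mul_comm]
    exact e2
  have high := h1 h g hgs hg0 j F hFl b
  have high' : r ^ (σ + 1) * |∫ y in (0 : ℝ)..2, θ y * iteratedDeriv l g y * eigComb φ F b y|
      ≤ C1 * D * r ^ (4 * m) * Sb := by
    have e1 : C1 * √(sqNorm g) * r ^ (2 * l) * Sb ≤ C1 * ((r ^ σ)⁻¹ * D) * r ^ (2 * l) * Sb := by
      gcongr
    have e2 := mul_le_mul_of_nonneg_left (high.trans e1) (by positivity : 0 ≤ r ^ (σ + 1))
    refine e2.trans ?_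
    have e3 : r ^ (σ + 1) * (C1 * ((r ^ σ)⁻¹ * D) * r ^ (2 * l) * Sb)
        = C1 * D * r ^ (2 * l + 1) * Sb := by
      rw [pow_succ r σ, pow_succ r (2 * l)]
      field_simp
    rw [e3]
    have : r ^ (2 * l + 1) ≤ r ^ (4 * m) := pow_le_pow_right₀ hr1 (by omega)
    gcongr
  -- low frequencies
  have piece : ∀ i ≤ j, ∀ G : Finset ι, (∀ k ∈ G, lam k ≤ 2 ^ (4 * m * (i + 1))) →
      ((2 : ℝ) ^ i) ^ (2 * σ) * ∑ k ∈ G, c k ^ 2 ≤ D ^ 2 →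
      r ^ (σ + 1) * |∫ y in (0 : ℝ)..2, θ y * iteratedDeriv l (eigComb φ G c) y * eigComb φ F b y|
        ≤ C2 * D * r ^ (4 * m) * Sb * (1 / 2) ^ i := by
    intro i hi G hG hGD
    set p : ℝ := 2 ^ i with hp
    have hp0 : 0 < p := by positivity
    have hpr : p ≤ r := pow_le_pow_right₀ (by norm_num) hi
    have e1 : √(∑ k ∈ G, c k ^ 2) ≤ (p ^ σ)⁻¹ * D := by
      refine Real.sqrt_le_iff.2 ⟨by positivity, ?_⟩
      have e3 : ((p ^ σ)⁻¹ * D) ^ 2 = (p ^ (2 * σ))⁻¹ * D ^ 2 := by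
        rw [mul_pow, inv_pow, ← pow_mul p σ 2, mul_comm σ]
      rw [e3, inv_mul_eq_div, le_div_iff₀ (by positivity), mul_comm]
      exact hGD
    have e2 := h2 h i j hi G F hG hF c b
    have e3 : C2 * p ^ (4 * m - 1) * √(∑ k ∈ G, c k ^ 2) * Sb
        ≤ C2 * p ^ (4 * m - 1) * ((p ^ σ)⁻¹ * D) * Sb := by gcongr
    have e4 := mul_le_mul_of_nonneg_left (e2.trans e3) (by positivity : 0 ≤ r ^ σ)
    rw [← mul_assoc, ← pow_succ] at e4
    refine e4.trans ?_
    have e5 : r ^ σ * p ^ (4 * m) ≤ r ^ (4 * m) * p ^ σ := by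
      obtain ⟨q, hq⟩ := Nat.exists_eq_add_of_le hσ
      rw [hq, pow_add, pow_add]
      have : p ^ q ≤ r ^ q := pow_le_pow_left₀ hp0.le hpr q
      calc r ^ σ * (p ^ σ * p ^ q) ≤ r ^ σ * (p ^ σ * r ^ q) := by gcongr
        _ = _ := by ring
    have e6 : ((1 : ℝ) / 2) ^ i = p⁻¹ := by rw [hp, one_div, inv_pow]
    have e7 : p ^ (4 * m) = p ^ (4 * m - 1) * p := by
      rw [← pow_succ]; congr 1; omega
    rw [e6]
    rw [e7] at e5
    have e8 : r ^ σ * (C2 * p ^ (4 * m - 1) * ((p ^ σ)⁻¹ * D) * Sb)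
        = C2 * D * Sb * ((p ^ σ)⁻¹ * p⁻¹) * (r ^ σ * (p ^ (4 * m - 1) * p)) := by
      field_simp
    rw [e8]
    refine (mul_le_mul_of_nonneg_left e5 (by positivity)).trans (le_of_eq ?_)
    field_simp
  have hcl : ∀ G : Finset ι, Continuous fun y =>
      θ y * iteratedDeriv l (eigComb φ G c) y * eigComb φ F b y := fun G =>
    (hθc.mul ((h.contDiff_comb G c).continuous_iteratedDeriv l hlm)).mul hcomb
  have lowb : ∀ J ≤ j, r ^ (σ + 1) *
      |∫ y in (0 : ℝ)..2, θ y * iteratedDeriv l (eigComb φ (h.low hm J) c) y * eigComb φ F b y|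
        ≤ C2 * D * r ^ (4 * m) * Sb * ∑ i ∈ Finset.range (J + 1), (1 / 2 : ℝ) ^ i := by
    intro J
    induction J with
    | zero =>
      intro hJ
      have := piece 0 hJ (h.low hm 0) (fun k hk => (h.mem_low hm).1 hk)
        (by simpa using (h.sum_coef_sq_le hwc _).trans hwD)
      simpa using this
    | succ J ih =>
      intro hJ
      have ih' := ih (by omega)
      have hsub := h.low_mono hm (Nat.le_succ J)
      have hp := piece (J + 1) hJ (h.low hm (J + 1) \ h.low hm J)
        (fun k hk => (h.mem_low hm).1 (Finset.mem_sdiff.1 hk).1)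
        (hdec (J + 1) _ fun k hk => by
          have := (Finset.mem_sdiff.1 hk).2
          rw [h.mem_low, not_le] at this
          exact this.le)
      have e : ∫ y in (0 : ℝ)..2,
          θ y * iteratedDeriv l (eigComb φ (h.low hm (J + 1)) c) y * eigComb φ F b y
          = (∫ y in (0 : ℝ)..2, θ y * iteratedDeriv l
              (eigComb φ (h.low hm (J + 1) \ h.low hm J) c) y * eigComb φ F b y)
          + ∫ y in (0 : ℝ)..2, θ y * iteratedDeriv l (eigComb φ (h.low hm J) c) y
              * eigComb φ F b y := by
        rw [← intervalIntegral.integral_add ((hcl _).intervalIntegrable _ _)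
          ((hcl _).intervalIntegrable _ _)]
        refine intervalIntegral.integral_congr fun y _ => ?_
        simp only [h.iteratedDeriv_comb _ _ hl.le]
        rw [← Finset.sum_sdiff hsub]
        ring
      rw [e, Finset.sum_range_succ, mul_add]
      have := abs_add_le (∫ y in (0 : ℝ)..2, θ y * iteratedDeriv l
              (eigComb φ (h.low hm (J + 1) \ h.low hm J) c) y * eigComb φ F b y)
          (∫ y in (0 : ℝ)..2, θ y * iteratedDeriv l (eigComb φ (h.low hm J) c) y
              * eigComb φ F b y)
      have := mul_le_mul_of_nonneg_left this (by positivity : 0 ≤ r ^ (σ + 1))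
      rw [mul_add] at this
      linarith
  have low' := lowb j le_rfl
  have hgeo := sum_geometric_two_le (j + 1)
  have low'' : r ^ (σ + 1) *
      |∫ y in (0 : ℝ)..2, θ y * iteratedDeriv l (eigComb φ (h.low hm j) c) y * eigComb φ F b y|
        ≤ 2 * C2 * D * r ^ (4 * m) * Sb := by
    refine low'.trans ?_
    refine (mul_le_mul_of_nonneg_left hgeo (by positivity)).trans (le_of_eq (by ring))
  have hcg : Continuous fun y => θ y * iteratedDeriv l g y * eigComb φ F b y :=
    (hθc.mul (hgs.continuous_iteratedDeriv l hlm)).mul hcomb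
  have e : ∫ y in (0 : ℝ)..2, θ y * iteratedDeriv l w y * eigComb φ F b y
      = (∫ y in (0 : ℝ)..2, θ y * iteratedDeriv l g y * eigComb φ F b y)
        + ∫ y in (0 : ℝ)..2, θ y * iteratedDeriv l (eigComb φ (h.low hm j) c) y
          * eigComb φ F b y := by
    rw [← intervalIntegral.integral_add (hcg.intervalIntegrable _ _)
      ((hcl _).intervalIntegrable _ _)]
    refine intervalIntegral.integral_congr fun y _ => ?_
    simp only [dsub l hl.le]
    ring
  rw [e]
  have := mul_le_mul_of_nonneg_left (abs_add_le
    (∫ y in (0 : ℝ)..2, θ y * iteratedDeriv l g y * eigComb φ F b y)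
    (∫ y in (0 : ℝ)..2, θ y * iteratedDeriv l (eigComb φ (h.low hm j) c) y * eigComb φ F b y))
    (by positivity : 0 ≤ r ^ (σ + 1))
  rw [mul_add] at this
  linarith

end IsEigSys

end Source3

section Normal

lemma exists_cutoff_line {a b : ℝ} (hab : a < b) : ∃ χ : ℝ → ℝ, ContDiff ℝ (⊤ : ℕ∞) χ ∧
    (∀ y, y ≤ a → χ y = 1) ∧ ∀ y, b ≤ y → χ y = 0 := by
  have h0 : 0 < b - a := by linarith
  refine ⟨fun y => Real.smoothTransition ((b - y) / (b - a)), ?_, ?_, ?_⟩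
  · exact Real.smoothTransition.contDiff.comp ((contDiff_const.sub contDiff_id).div_const _)
  · intro y hy
    exact Real.smoothTransition.one_of_one_le ((one_le_div h0).2 (by linarith))
  · intro y hy
    exact Real.smoothTransition.zero_of_nonpos
      (div_nonpos_of_nonpos_of_nonneg (by linarith) h0.le)

lemma iteratedDeriv_eq_zero_of_vanish {f : ℝ → ℝ} {ρ y : ℝ} (hf : ∀ y, ρ ≤ y → f y = 0)
    (hy : ρ < y) (N : ℕ) : iteratedDeriv N f y = 0 := by
  have : f =ᶠ[𝓝 y] fun _ => (0 : ℝ) := by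
    filter_upwards [lt_mem_nhds hy] with z hz
    exact hf z hz.le
  rw [this.iteratedDeriv_eq]
  simp

/-- Bounds on dyadic blocks sum up to bounds on tails. -/
lemma dyadic_tail_bound {ι : Type} {m : ℕ} (hm : 1 ≤ m) {lam : ι → ℝ} {f : ι → ℝ}
    (hf : ∀ k, 0 ≤ f k) {s : ℕ} (hs : 1 ≤ s) {X : ℝ} (hX : 0 ≤ X)
    (h : ∀ (j : ℕ) (F : Finset ι),
      (∀ k ∈ F, 2 ^ (4 * m * j) ≤ lam k ∧ lam k ≤ 2 ^ (4 * m * (j + 1))) →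
        ((2 : ℝ) ^ j) ^ (2 * s) * ∑ k ∈ F, f k ≤ X) (j : ℕ) (F : Finset ι)
    (hF : ∀ k ∈ F, 2 ^ (4 * m * j) ≤ lam k) :
    ((2 : ℝ) ^ j) ^ (2 * s) * ∑ k ∈ F, f k ≤ 2 * X := by
  classical
  have key : ∀ N j (F : Finset ι),
      (∀ k ∈ F, 2 ^ (4 * m * j) ≤ lam k ∧ lam k ≤ 2 ^ (4 * m * (j + N))) →
      ((2 : ℝ) ^ j) ^ (2 * s) * ∑ k ∈ F, f k ≤ 2 * X := by
    intro N
    induction N with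
    | zero =>
      intro j F hF
      have := h j F fun k hk => ⟨(hF k hk).1, (hF k hk).2.trans
        (pow_le_pow_right₀ (by norm_num) (by gcongr; omega))⟩
      linarith
    | succ N ih =>
      intro j F hF
      have h1 := h j (F.filter fun k => lam k ≤ 2 ^ (4 * m * (j + 1))) fun k hk =>
        ⟨(hF k (Finset.mem_filter.1 hk).1).1, (Finset.mem_filter.1 hk).2⟩
      have h2 := ih (j + 1) (F.filter fun k => ¬ lam k ≤ 2 ^ (4 * m * (j + 1))) fun k hk =>
        ⟨(not_le.1 (Finset.mem_filter.1 hk).2).le, by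
          have := (hF k (Finset.mem_filter.1 hk).1).2
          rwa [show j + 1 + N = j + (N + 1) by ring]⟩
      set S := ∑ k ∈ F.filter fun k => ¬ lam k ≤ 2 ^ (4 * m * (j + 1)), f k with hS
      have hS0 : 0 ≤ S := Finset.sum_nonneg fun k _ => hf k
      have h3 : 2 * (((2 : ℝ) ^ j) ^ (2 * s) * S) ≤ ((2 : ℝ) ^ (j + 1)) ^ (2 * s) * S := by
        rw [← mul_assoc]
        refine mul_le_mul_of_nonneg_right ?_ hS0
        rw [pow_succ, mul_pow, mul_comm]
        refine mul_le_mul_of_nonneg_left ?_ (by positivity)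
        calc (2 : ℝ) = 2 ^ 1 := by norm_num
          _ ≤ 2 ^ (2 * s) := pow_le_pow_right₀ (by norm_num) (by omega)
      rw [← Finset.sum_filter_add_sum_filter_not F fun k => lam k ≤ 2 ^ (4 * m * (j + 1)), mul_add]
      linarith
  have hb : ∃ N, ∀ k ∈ F, lam k ≤ 2 ^ (4 * m * (j + N)) := by
    obtain ⟨N, hN⟩ := pow_unbounded_of_one_lt (∑ k ∈ F, |lam k|) (by norm_num : (1 : ℝ) < 2)
    refine ⟨N, fun k hk => ?_⟩
    have h1 := Finset.single_le_sum (f := fun k => |lam k|) (fun i _ => abs_nonneg _) hk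
    have h2 : (2 : ℝ) ^ N ≤ 2 ^ (4 * m * (j + N)) := pow_le_pow_right₀ (by norm_num) (by nlinarith)
    linarith [le_abs_self (lam k)]
  obtain ⟨N, hN⟩ := hb
  exact key N j F fun k hk => ⟨hF k hk, hN k hk⟩

/-- Exponential decay for a differential inequality with damping. -/
lemma le_of_damped_inequality {Y Y' : ℝ → ℝ} (hd : ∀ t, HasDerivAt Y (Y' t) t)
    {a b t₀ t₁ : ℝ} (ha : 0 < a) (hab : t₀ ≤ t₁)
    (h : ∀ t ∈ Ioo t₀ t₁, Y' t ≤ -a * Y t + b) (hb : 0 ≤ b) :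
    Y t₁ ≤ Real.exp (-(a * (t₁ - t₀))) * |Y t₀| + b / a := by
  set Z : ℝ → ℝ := fun t => Real.exp (a * (t - t₀)) * (Y t - b / a) with hZ
  have hZd : ∀ t, HasDerivAt Z (Real.exp (a * (t - t₀)) * (a * (Y t - b / a) + Y' t)) t := by
    intro t
    have h1 : HasDerivAt (fun t => Real.exp (a * (t - t₀))) (Real.exp (a * (t - t₀)) * a) t := by
      have := (((hasDerivAt_id t).sub_const t₀).const_mul a).exp
      simpa using this
    have h2 := h1.mul ((hd t).sub_const (b / a))
    exact h2.congr_deriv (by ring)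
  have hmono : AntitoneOn Z (Icc t₀ t₁) := by
    refine antitoneOn_of_deriv_nonpos (convex_Icc _ _)
      (fun t _ => (hZd t).continuousAt.continuousWithinAt)
      (fun t _ => (hZd t).differentiableAt.differentiableWithinAt) fun t ht => ?_
    rw [interior_Icc] at ht
    rw [(hZd t).deriv]
    refine mul_nonpos_of_nonneg_of_nonpos (Real.exp_pos _).le ?_
    have := h t ht
    have e : a * (b / a) = b := by field_simp
    rw [mul_sub, e]
    linarith
  have h3 := hmono (left_mem_Icc.2 hab) (right_mem_Icc.2 hab) hab
  simp only [hZ, sub_self, mul_zero, Real.exp_zero, one_mul] at h3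
  have h4 : Y t₁ - b / a ≤ Real.exp (-(a * (t₁ - t₀))) * (Y t₀ - b / a) := by
    have e := Real.exp_pos (a * (t₁ - t₀))
    rw [Real.exp_neg, inv_mul_eq_div, le_div_iff₀ e]
    linarith
  have h5 : Real.exp (-(a * (t₁ - t₀))) * (Y t₀ - b / a)
      ≤ Real.exp (-(a * (t₁ - t₀))) * |Y t₀| := by
    refine mul_le_mul_of_nonneg_left ?_ (Real.exp_pos _).le
    have : 0 ≤ b / a := by positivity
    linarith [le_abs_self (Y t₀)]
  linarith

/-- A family of one-dimensional parabolic systems in the normal variable, coupled through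
lower-order terms. -/
structure NormalSys (m n : ℕ) {Q E : Type} [Fintype E] (jj : E → ℕ) (sh : E → Q → Q)
    (lam₀ K₀ : ℝ) (Cq : Q → ℝ → ℝ) (A : ℝ → Fin n → Fin n → ℝ) (B : E → ℝ → Fin n → Fin n → ℝ)
    (v : Q → Fin n → ℝ → ℝ → ℝ) (M : ℝ) : Prop where
  smooth : ∀ q i, ContDiff ℝ (⊤ : ℕ∞) fun p : ℝ × ℝ => v q i p.1 p.2
  ell : ∀ t (ξ : Fin n → ℝ), lam₀ * ∑ i, ξ i ^ 2 ≤ ∑ i, ∑ j, A t i j * ξ i * ξ j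
  bdA : ∀ t i j, |A t i j| ≤ K₀
  bdB : ∀ e t i j, |B e t i j| ≤ K₀
  bc : ∀ t ∈ Ioo (-3 : ℝ) 0, ∀ q i, ∀ k < m, iteratedDeriv k (v q i t) 0 = 0
  eqn : ∀ᵐ t, t ∈ Ioo (-3 : ℝ) 0 → ∀ y ∈ Ioo (0 : ℝ) (6 / 5), ∀ q i,
    deriv (fun τ => v q i τ y) t
      = -((-1) ^ m * ∑ j, A t i j * iteratedDeriv (2 * m) (v q j t) y)
        + ∑ e, ∑ j, B e t i j * iteratedDeriv (jj e) (v (sh e q) j t) y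
  M_nonneg : 0 ≤ M
  energy : ∀ q i, ∀ T ∈ Ioo (-3 : ℝ) 0, ∀ t ∈ Ico T 0,
    ∫ y in (0 : ℝ)..(6 / 5), v q i t y ^ 2 ≤ Cq q T * M

lemma sqNorm_cut_le {χ f : ℝ → ℝ} (hχ : Continuous χ) (hf : Continuous f)
    (hχ0 : ∀ y, 6 / 5 ≤ y → χ y = 0) {B : ℝ} (hB : ∀ y ∈ Icc (0 : ℝ) 2, |χ y| ≤ B) :
    sqNorm (fun y => χ y * f y) ≤ B ^ 2 * ∫ y in (0 : ℝ)..(6 / 5), f y ^ 2 := by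
  unfold sqNorm
  have c : Continuous fun y => (χ y * f y) ^ 2 := (hχ.mul hf).pow 2
  rw [← intervalIntegral.integral_add_adjacent_intervals (b := 6 / 5)
    (c.intervalIntegrable _ _) (c.intervalIntegrable _ _)]
  have e : ∫ y in (6 / 5 : ℝ)..2, (χ y * f y) ^ 2 = 0 := by
    rw [intervalIntegral.integral_congr (g := fun _ => (0 : ℝ)), intervalIntegral.integral_zero]
    intro y hy
    rw [uIcc_of_le (by norm_num)] at hy
    simp [hχ0 y hy.1]
  rw [e, add_zero, ← intervalIntegral.integral_const_mul]
  have c2 : Continuous fun y => B ^ 2 * f y ^ 2 := continuous_const.mul (hf.pow 2)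
  refine intervalIntegral.integral_mono_on (μ := volume) (by norm_num)
    (c.intervalIntegrable _ _) (c2.intervalIntegrable _ _) fun y hy => ?_
  rw [mul_pow]
  refine mul_le_mul_of_nonneg_right ?_ (sq_nonneg _)
  rw [← sq_abs]
  exact pow_le_pow_left₀ (abs_nonneg _) (hB y ⟨hy.1, hy.2.trans (by norm_num)⟩) 2

namespace IsEigSys

/-- Source bound for a function known only through its cut-off. -/
lemma exists_source_bound_cut (m : ℕ) (hm : 1 ≤ m) {θ χ : ℝ → ℝ} (hθ : ContDiff ℝ (⊤ : ℕ∞) θ)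
    {ρ ρ' : ℝ} (hρ : ρ < 2) (hθρ : ∀ y, ρ ≤ y → θ y = 0) (hχ : ContDiff ℝ (⊤ : ℕ∞) χ)
    (hχρ : ∀ y, y ≤ ρ' → χ y = 1) (hρρ' : ρ < ρ') {l : ℕ} (hl : l < 2 * m) {σ : ℕ}
    (hσ : σ ≤ 4 * m) :
    ∃ C, 0 ≤ C ∧ ∀ {ι : Type} {φ : ι → ℝ → ℝ} {lam : ι → ℝ}, IsEigSys m φ lam →
      ∀ f : ℝ → ℝ, ContDiff ℝ (2 * m : ℕ) f → (∀ i < m, iteratedDeriv i f 0 = 0) →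
      ∀ D, 0 ≤ D → CoefDecay m φ lam σ D (fun y => χ y * f y) →
      sqNorm (fun y => χ y * f y) ≤ D ^ 2 →
      ∀ (j : ℕ) (F : Finset ι),
      (∀ k ∈ F, 2 ^ (4 * m * j) ≤ lam k ∧ lam k ≤ 2 ^ (4 * m * (j + 1))) → ∀ b : ι → ℝ,
        |∫ y in (0 : ℝ)..2, θ y * iteratedDeriv l f y * eigComb φ F b y|
          ≤ C * (D * ((2 : ℝ) ^ j) ^ (4 * m) / ((2 : ℝ) ^ j) ^ (σ + 1)) * √(∑ k ∈ F, b k ^ 2) := by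
  obtain ⟨C, hC, h1⟩ := exists_source_bound m hm hθ hρ hθρ hl hσ
  refine ⟨C, hC, fun {ι φ lam} h f hf hf0 D hD hdec hn j F hF b => ?_⟩
  have hχN : ∀ N : ℕ, ContDiff ℝ N χ := fun N => hχ.of_le (by exact_mod_cast le_top)
  have hw : ContDiff ℝ (2 * m : ℕ) (fun y => χ y * f y) := (hχN (2 * m)).mul hf
  have hw0 : ∀ i < m, iteratedDeriv i (fun y => χ y * f y) 0 = 0 := fun i hi =>
    iteratedDeriv_mul_eq_zero (hχN i)
      (hf.of_le (by exact_mod_cast (by omega : i ≤ 2 * m))) fun i' hi' => hf0 i' (by omega)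
  have := h1 h _ hw hw0 D hD hdec hn j F hF b
  have e : ∫ y in (0 : ℝ)..2, θ y * iteratedDeriv l f y * eigComb φ F b y
      = ∫ y in (0 : ℝ)..2, θ y * iteratedDeriv l (fun y => χ y * f y) y * eigComb φ F b y := by
    refine intervalIntegral.integral_congr fun y _ => ?_
    by_cases hy : y < ρ'
    · have : (fun y => χ y * f y) =ᶠ[𝓝 y] f := by
        filter_upwards [gt_mem_nhds hy] with z hz
        rw [hχρ z (le_of_lt hz), one_mul]
      simp only [this.iteratedDeriv_eq]
    · simp only [hθρ y (by linarith), zero_mul]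
  rw [e]
  set r : ℝ := 2 ^ j
  have hr : 0 < r ^ (σ + 1) := by positivity
  rw [← mul_div_assoc, div_mul_eq_mul_div, le_div_iff₀ hr, mul_comm]
  refine this.trans (le_of_eq (by ring))

variable {m : ℕ} {ι : Type} {φ : ι → ℝ → ℝ} {lam : ι → ℝ}

/-- Commuting the cut-off with the principal part. -/
lemma integral_cut_deriv_mul_comb (h : IsEigSys m φ lam) {χ f : ℝ → ℝ}
    (hχ : ContDiff ℝ (⊤ : ℕ∞) χ) {ρ : ℝ} (hρ : ρ < 2) (hχρ : ∀ y, ρ ≤ y → χ y = 0)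
    (hf : ContDiff ℝ (2 * m : ℕ) f) (hf0 : ∀ i < m, iteratedDeriv i f 0 = 0) (F : Finset ι)
    (b : ι → ℝ) :
    (-1) ^ m * ∫ y in (0 : ℝ)..2, χ y * iteratedDeriv (2 * m) f y * eigComb φ F b y
      = (∑ k ∈ F, lam k * b k * coef φ (fun y => χ y * f y) k)
        - (-1) ^ m * ∑ i ∈ Finset.range (2 * m), ((2 * m).choose i : ℝ)
          * ∫ y in (0 : ℝ)..2, iteratedDeriv (2 * m - i) χ y * iteratedDeriv i f y
            * eigComb φ F b y := by
  have hχN : ∀ N : ℕ, ContDiff ℝ N χ := fun N => hχ.of_le (by exact_mod_cast le_top)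
  have hw : ContDiff ℝ (2 * m : ℕ) (f * χ) := hf.mul (hχN _)
  have hcomb := h.contDiff_comb F b
  have hcc := h.continuous_comb F b
  have e1 : ∫ y in (0 : ℝ)..2, iteratedDeriv (2 * m) (f * χ) y * eigComb φ F b y
      = (-1) ^ m * ∑ k ∈ F, lam k * b k * coef φ (fun y => χ y * f y) k := by
    rw [integral_iteratedDeriv_mul (2 * m) hw hcomb]
    · have : ∫ y in (0 : ℝ)..2, (f * χ) y * iteratedDeriv (2 * m) (eigComb φ F b) y
          = ∫ y in (0 : ℝ)..2, (f * χ) y * eigComb φ F (fun k => (-1) ^ m * lam k * b k) y := by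
        refine intervalIntegral.integral_congr fun y hy => ?_
        rw [uIcc_of_le (by norm_num)] at hy
        simp only [h.comb_eig F b hy]
      rw [this, h.integral_mul_comb hw.continuous, Finset.mul_sum, Finset.mul_sum]
      have hs : ((-1 : ℝ)) ^ (2 * m) = 1 := by rw [pow_mul]; norm_num
      refine Finset.sum_congr rfl fun k _ => ?_
      have : ∫ y in (0 : ℝ)..2, (f * χ) y * φ k y = coef φ (fun y => χ y * f y) k :=
        intervalIntegral.integral_congr fun y _ => by simp only [Pi.mul_apply]; ring
      rw [this, hs]
      ring
    · intro i hi
      by_cases him : i < m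
      · left
        rw [mul_comm]
        exact iteratedDeriv_mul_eq_zero (hχN i)
          (hf.of_le (by exact_mod_cast (by omega : i ≤ 2 * m))) fun i' hi' => hf0 i' (by omega)
      · exact Or.inr (h.comb_bc_zero F b (by omega))
    · intro i hi
      left
      rw [mul_comm]
      exact iteratedDeriv_mul_eq_zero_of_vanish hχρ hρ
  have c1 : ∀ i, i ≤ 2 * m → Continuous (iteratedDeriv i f) := fun i hi =>
    hf.continuous_iteratedDeriv i (by exact_mod_cast hi)
  have c2 : ∀ i, Continuous (iteratedDeriv i χ) := fun i =>
    (hχN i).continuous_iteratedDeriv i le_rfl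
  have c3 : ∀ i ∈ Finset.range (2 * m), Continuous fun y => ((2 * m).choose i : ℝ)
      * (iteratedDeriv (2 * m - i) χ y * iteratedDeriv i f y * eigComb φ F b y) := fun i hi =>
    continuous_const.mul (((c2 _).mul (c1 i (Finset.mem_range.1 hi).le)).mul hcc)
  have c4 : Continuous fun y => χ y * iteratedDeriv (2 * m) f y * eigComb φ F b y :=
    (hχ.continuous.mul (c1 _ le_rfl)).mul hcc
  have e2 : ∫ y in (0 : ℝ)..2, iteratedDeriv (2 * m) (f * χ) y * eigComb φ F b y
      = (∑ i ∈ Finset.range (2 * m), ((2 * m).choose i : ℝ)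
          * ∫ y in (0 : ℝ)..2, iteratedDeriv (2 * m - i) χ y * iteratedDeriv i f y
            * eigComb φ F b y)
        + ∫ y in (0 : ℝ)..2, χ y * iteratedDeriv (2 * m) f y * eigComb φ F b y := by
    simp_rw [← intervalIntegral.integral_const_mul]
    rw [← intervalIntegral.integral_finsetSum fun i hi => (c3 i hi).intervalIntegrable _ _,
      ← intervalIntegral.integral_add
        ((continuous_finsetSum _ c3).intervalIntegrable _ _) (c4.intervalIntegrable _ _)]
    refine intervalIntegral.integral_congr fun y _ => ?_
    simp only [iteratedDeriv_mul hf.contDiffAt (hχN (2 * m)).contDiffAt,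
      Finset.sum_range_succ, Nat.choose_self, Nat.sub_self, iteratedDeriv_zero, add_mul,
      Finset.sum_mul]
    congr 1
    · exact Finset.sum_congr rfl fun i _ => by ring
    · push_cast; ring
  have hs : ((-1 : ℝ) ^ m) * (-1) ^ m = 1 := by rw [← mul_pow]; norm_num
  rw [e1] at e2
  set X := ∑ k ∈ F, lam k * b k * coef φ (fun y => χ y * f y) k
  have e3 := congrArg (fun x => (-1 : ℝ) ^ m * x) e2
  simp only [mul_add, ← mul_assoc ((-1 : ℝ) ^ m) ((-1) ^ m), hs, one_mul] at e3
  linarith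

end IsEigSys

end Normal

section Chain

variable {m n : ℕ} {Q E : Type} [Fintype E] {jj : E → ℕ} {sh : E → Q → Q} {lam₀ K₀ : ℝ}
  {Cq : Q → ℝ → ℝ} {A : ℝ → Fin n → Fin n → ℝ} {B : E → ℝ → Fin n → Fin n → ℝ}
  {v : Q → Fin n → ℝ → ℝ → ℝ} {M : ℝ}

namespace NormalSys

lemma contDiff_slice (hv : NormalSys m n jj sh lam₀ K₀ Cq A B v M) (q : Q) (i : Fin n) (t : ℝ) :
    ContDiff ℝ (⊤ : ℕ∞) (v q i t) :=
  (hv.smooth q i).comp (contDiff_const.prodMk contDiff_id)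

lemma exists_time_deriv (hv : NormalSys m n jj sh lam₀ K₀ Cq A B v M) (q : Q) (i : Fin n) :
    Continuous (Function.uncurry fun t y => deriv (fun τ => v q i τ y) t) ∧
      ∀ t y, HasDerivAt (fun τ => v q i τ y) (deriv (fun τ => v q i τ y) t) t := by
  have hs := hv.smooth q i
  have hd : ∀ t y, HasDerivAt (fun τ => v q i τ y)
      (fderiv ℝ (fun p : ℝ × ℝ => v q i p.1 p.2) (t, y) (1, 0)) t := fun t y => by
    have h1 : HasFDerivAt (fun p : ℝ × ℝ => v q i p.1 p.2) _ (t, y) :=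
      ((hs.differentiable (by simp)) (t, y)).hasFDerivAt
    have h2 : HasDerivAt (fun τ : ℝ => (τ, y)) ((1 : ℝ), (0 : ℝ)) t :=
      (hasDerivAt_id t).prodMk (hasDerivAt_const t y)
    exact h1.comp_hasDerivAt t h2
  constructor
  · have e : (Function.uncurry fun t y => deriv (fun τ => v q i τ y) t)
        = fun p : ℝ × ℝ => fderiv ℝ (fun p : ℝ × ℝ => v q i p.1 p.2) p (1, 0) := by
      funext p
      exact (hd p.1 p.2).deriv
    rw [e]
    exact (hs.continuous_fderiv (by simp)).clm_apply continuous_const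
  · intro t y
    rw [(hd t y).deriv]
    exact hd t y

lemma exists_block_dissipation (m n : ℕ) (hm : 1 ≤ m) {Q E : Type} [Fintype E] (jj : E → ℕ)
    (hjj : ∀ e, jj e < 2 * m) (sh : E → Q → Q) (lam₀ K₀ : ℝ) (Cq : Q → ℝ → ℝ) {χ χ' : ℝ → ℝ}
    {ρ ρ' : ℝ} (hχ : ContDiff ℝ (⊤ : ℕ∞) χ) (hχρ : ∀ y, ρ ≤ y → χ y = 0)
    (hχ' : ContDiff ℝ (⊤ : ℕ∞) χ') (hχ'ρ : ∀ y, y ≤ ρ' → χ' y = 1) (hρρ' : ρ < ρ')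
    (hρ' : ρ' < 6 / 5) {σ : ℕ} (hσ : σ ≤ 4 * m) (hlam₀ : 0 ≤ lam₀) :
    ∃ C, 0 ≤ C ∧ ∀ (A : ℝ → Fin n → Fin n → ℝ) (B : E → ℝ → Fin n → Fin n → ℝ)
      (v : Q → Fin n → ℝ → ℝ → ℝ) (M : ℝ), NormalSys m n jj sh lam₀ K₀ Cq A B v M →
      ∀ {ι : Type} {φ : ι → ℝ → ℝ} {lam : ι → ℝ}, IsEigSys m φ lam →
      ∀ (q : Q), ∀ t ∈ Ioo (-3 : ℝ) 0,
      (∀ y ∈ Ioo (0 : ℝ) (6 / 5), ∀ i, deriv (fun τ => v q i τ y) t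
        = -((-1) ^ m * ∑ j, A t i j * iteratedDeriv (2 * m) (v q j t) y)
          + ∑ e, ∑ j, B e t i j * iteratedDeriv (jj e) (v (sh e q) j t) y) →
      ∀ D, 0 ≤ D →
      (∀ q', (q' = q ∨ ∃ e, q' = sh e q) → ∀ j,
        CoefDecay m φ lam σ D (fun y => χ' y * v q' j t y) ∧
        sqNorm (fun y => χ' y * v q' j t y) ≤ D ^ 2) →
      ∀ (j : ℕ) (F : Finset ι),
      (∀ k ∈ F, 2 ^ (4 * m * j) ≤ lam k ∧ lam k ≤ 2 ^ (4 * m * (j + 1))) →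
        ∑ i, ∫ y in (0 : ℝ)..2, χ y * deriv (fun τ => v q i τ y) t
            * eigComb φ F (coef φ fun y => χ y * v q i t y) y
          ≤ -(lam₀ * ((2 : ℝ) ^ j) ^ (4 * m)
              * ∑ i, ∑ k ∈ F, coef φ (fun y => χ y * v q i t y) k ^ 2)
            + C * (D * ((2 : ℝ) ^ j) ^ (4 * m) / ((2 : ℝ) ^ j) ^ (σ + 1))
              * √(∑ i, ∑ k ∈ F, coef φ (fun y => χ y * v q i t y) k ^ 2) := by
  have hρm1 : ρ < (ρ + ρ') / 2 := by linarith
  have hρm2 : (ρ + ρ') / 2 < ρ' := by linarith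
  have hρm3 : (ρ + ρ') / 2 < 2 := by linarith
  have hρ2 : ρ < 2 := by linarith
  have hθ : ∀ N, ContDiff ℝ (⊤ : ℕ∞) (iteratedDeriv N χ) := fun N => by
    rw [iteratedDeriv_eq_iterate]
    exact hχ.iterate_deriv N
  have hex : ∀ N l : ℕ, ∃ C, 0 ≤ C ∧ (l < 2 * m → ∀ {ι : Type} {φ : ι → ℝ → ℝ} {lam : ι → ℝ},
      IsEigSys m φ lam → ∀ f : ℝ → ℝ, ContDiff ℝ (2 * m : ℕ) f →
      (∀ i < m, iteratedDeriv i f 0 = 0) →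
      ∀ D, 0 ≤ D → CoefDecay m φ lam σ D (fun y => χ' y * f y) →
      sqNorm (fun y => χ' y * f y) ≤ D ^ 2 → ∀ (j : ℕ) (F : Finset ι),
      (∀ k ∈ F, 2 ^ (4 * m * j) ≤ lam k ∧ lam k ≤ 2 ^ (4 * m * (j + 1))) → ∀ b : ι → ℝ,
        |∫ y in (0 : ℝ)..2, iteratedDeriv N χ y * iteratedDeriv l f y * eigComb φ F b y|
          ≤ C * (D * ((2 : ℝ) ^ j) ^ (4 * m) / ((2 : ℝ) ^ j) ^ (σ + 1))
            * √(∑ k ∈ F, b k ^ 2)) := by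
    intro N l
    by_cases hl : l < 2 * m
    · obtain ⟨C, hC, h⟩ := IsEigSys.exists_source_bound_cut m hm (hθ N) hρm3
        (fun y hy => iteratedDeriv_eq_zero_of_vanish hχρ (by linarith) N) hχ' hχ'ρ hρm2 hl hσ
      exact ⟨C, hC, fun _ => h⟩
    · exact ⟨0, le_rfl, fun h => absurd h hl⟩
  choose c hc0 hc using hex
  set CR : ℝ := ∑ l ∈ Finset.range (2 * m), ((2 * m).choose l : ℝ) * c (2 * m - l) l with hCR
  have hCR0 : 0 ≤ CR := Finset.sum_nonneg fun l _ => mul_nonneg (by positivity) (hc0 _ _)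
  set CS : ℝ := ∑ e, c 0 (jj e) with hCS
  have hCS0 : 0 ≤ CS := Finset.sum_nonneg fun e _ => hc0 _ _
  refine ⟨n * (n * (|K₀| * CR + |K₀| * CS)), by positivity, ?_⟩
  intro A B v M hv ι φ lam h q t ht heq D hD hdec j F hF
  set r : ℝ := 2 ^ j with hr
  set a : Fin n → ι → ℝ := fun i => coef φ fun y => χ y * v q i t y with ha
  set Y := ∑ i, ∑ k ∈ F, a i k ^ 2 with hY
  set X := D * r ^ (4 * m) / r ^ (σ + 1) with hX
  have hX0 : 0 ≤ X := by positivity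
  have hsm : ∀ q i, ContDiff ℝ (2 * m : ℕ) (v q i t) := fun q i =>
    have h' : ∀ N : ℕ, ContDiff ℝ N (v q i t) := fun N =>
      (hv.contDiff_slice q i t).of_le (by exact_mod_cast le_top)
    h' (2 * m)
  have hbc := hv.bc t ht
  have hsq : ∀ i, √(∑ k ∈ F, a i k ^ 2) ≤ √Y := fun i => Real.sqrt_le_sqrt
    (Finset.single_le_sum (f := fun i => ∑ k ∈ F, a i k ^ 2)
      (fun i _ => Finset.sum_nonneg fun _ _ => sq_nonneg _) (Finset.mem_univ i))
  set R : Fin n → Fin n → ℝ := fun i i' => ∑ l ∈ Finset.range (2 * m), ((2 * m).choose l : ℝ)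
    * ∫ y in (0 : ℝ)..2, iteratedDeriv (2 * m - l) χ y * iteratedDeriv l (v q i' t) y
      * eigComb φ F (a i) y with hR
  set S : E → Fin n → Fin n → ℝ := fun e i i' => ∫ y in (0 : ℝ)..2, χ y
    * iteratedDeriv (jj e) (v (sh e q) i' t) y * eigComb φ F (a i) y with hS
  have hRb : ∀ i i', |R i i'| ≤ CR * X * √Y := fun i i' => by
    rw [hR, hCR, Finset.sum_mul, Finset.sum_mul]
    refine (Finset.abs_sum_le_sum_abs _ _).trans (Finset.sum_le_sum fun l hl => ?_)
    rw [abs_mul, abs_of_nonneg (by positivity : (0 : ℝ) ≤ ((2 * m).choose l : ℝ)), mul_assoc,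
      mul_assoc]
    refine mul_le_mul_of_nonneg_left ?_ (by positivity)
    have := hc (2 * m - l) l (Finset.mem_range.1 hl) h (v q i' t) (hsm q i')
      (fun k hk => hbc q i' k hk) D hD (hdec q (Or.inl rfl) i').1 (hdec q (Or.inl rfl) i').2 j F hF
      (a i)
    rw [mul_assoc] at this
    exact this.trans (mul_le_mul_of_nonneg_left (mul_le_mul_of_nonneg_left (hsq i) hX0)
      (hc0 _ _))
  have hSb : ∀ e i i', |S e i i'| ≤ c 0 (jj e) * X * √Y := fun e i i' => by
    have := hc 0 (jj e) (hjj e) h (v (sh e q) i' t) (hsm _ i')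
      (fun k hk => hbc _ i' k hk) D hD (hdec _ (Or.inr ⟨e, rfl⟩) i').1
      (hdec _ (Or.inr ⟨e, rfl⟩) i').2 j F hF (a i)
    rw [iteratedDeriv_zero] at this
    exact this.trans (mul_le_mul_of_nonneg_left (hsq i) (mul_nonneg (hc0 _ _) hX0))
  -- the equation tested against the block
  have hcc : ∀ i, Continuous (eigComb φ F (a i)) := fun i => h.continuous_comb F _
  have c2 : ∀ q i l, Continuous (iteratedDeriv l (v q i t)) := fun q i l =>
    (hv.contDiff_slice q i t).continuous_iteratedDeriv l (by exact_mod_cast le_top)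
  have hterm : ∀ i, ∫ y in (0 : ℝ)..2, χ y * deriv (fun τ => v q i τ y) t * eigComb φ F (a i) y
      = -(∑ i', A t i i' * ((∑ k ∈ F, lam k * a i k * a i' k) - (-1) ^ m * R i i'))
        + ∑ e, ∑ i', B e t i i' * S e i i' := by
    intro i
    have e1 : ∫ y in (0 : ℝ)..2, χ y * deriv (fun τ => v q i τ y) t * eigComb φ F (a i) y
        = ∫ y in (0 : ℝ)..2, (-(∑ i', A t i i' * ((-1) ^ m *
            (χ y * iteratedDeriv (2 * m) (v q i' t) y * eigComb φ F (a i) y)))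
          + ∑ e, ∑ i', B e t i i' *
            (χ y * iteratedDeriv (jj e) (v (sh e q) i' t) y * eigComb φ F (a i) y)) := by
      refine intervalIntegral.integral_congr_ae (Filter.Eventually.of_forall fun y hy => ?_)
      rw [uIoc_of_le (by norm_num)] at hy
      by_cases hy' : y < 6 / 5
      · rw [heq y ⟨hy.1, hy'⟩ i, mul_add, add_mul]
        congr 1
        · rw [mul_neg, neg_mul, Finset.mul_sum, Finset.mul_sum, Finset.sum_mul]
          exact congrArg _ (Finset.sum_congr rfl fun i' _ => by ring)
        · rw [Finset.mul_sum, Finset.sum_mul]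
          refine Finset.sum_congr rfl fun e _ => ?_
          rw [Finset.mul_sum, Finset.sum_mul]
          exact Finset.sum_congr rfl fun i' _ => by ring
      · simp [hχρ y (by linarith)]
    have k1 : ∀ i', Continuous fun y => A t i i' * ((-1) ^ m *
            (χ y * iteratedDeriv (2 * m) (v q i' t) y * eigComb φ F (a i) y)) := fun i' =>
      continuous_const.mul (continuous_const.mul ((hχ.continuous.mul (c2 _ _ _)).mul (hcc i)))
    have k2 : ∀ e i', Continuous fun y => B e t i i' *
            (χ y * iteratedDeriv (jj e) (v (sh e q) i' t) y * eigComb φ F (a i) y) := fun e i' =>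
      continuous_const.mul ((hχ.continuous.mul (c2 _ _ _)).mul (hcc i))
    have k1s : Continuous fun y => -(∑ i', A t i i' * ((-1) ^ m *
            (χ y * iteratedDeriv (2 * m) (v q i' t) y * eigComb φ F (a i) y))) :=
      (continuous_finsetSum _ fun i' _ => k1 i').neg
    have k2e : ∀ e, Continuous fun y => ∑ i', B e t i i' *
            (χ y * iteratedDeriv (jj e) (v (sh e q) i' t) y * eigComb φ F (a i) y) := fun e =>
      continuous_finsetSum _ fun i' _ => k2 e i'
    have k2s : Continuous fun y => ∑ e, ∑ i', B e t i i' *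
            (χ y * iteratedDeriv (jj e) (v (sh e q) i' t) y * eigComb φ F (a i) y) :=
      continuous_finsetSum _ fun e _ => k2e e
    rw [e1, intervalIntegral.integral_add (k1s.intervalIntegrable _ _)
      (k2s.intervalIntegrable _ _), intervalIntegral.integral_neg,
      intervalIntegral.integral_finsetSum fun i' _ => (k1 i').intervalIntegrable _ _,
      intervalIntegral.integral_finsetSum fun e _ => (k2e e).intervalIntegrable _ _]
    congr 1
    · congr 1
      refine Finset.sum_congr rfl fun i' _ => ?_
      rw [intervalIntegral.integral_const_mul, intervalIntegral.integral_const_mul,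
        h.integral_cut_deriv_mul_comb hχ hρ2 hχρ (hsm q i') (fun k hk => hbc q i' k hk)]
    · refine Finset.sum_congr rfl fun e _ => ?_
      rw [intervalIntegral.integral_finsetSum fun i' _ => (k2 e i').intervalIntegrable _ _]
      exact Finset.sum_congr rfl fun i' _ => by rw [intervalIntegral.integral_const_mul]
  -- coercivity
  have hcoer : lam₀ * r ^ (4 * m) * Y
      ≤ ∑ i, ∑ i', A t i i' * ∑ k ∈ F, lam k * a i k * a i' k := by
    have e1 : ∑ i, ∑ i', A t i i' * ∑ k ∈ F, lam k * a i k * a i' k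
        = ∑ k ∈ F, lam k * ∑ i, ∑ i', A t i i' * a i k * a i' k := by
      simp only [Finset.mul_sum]
      rw [Finset.sum_comm (s := F)]
      refine Finset.sum_congr rfl fun i _ => ?_
      rw [Finset.sum_comm (s := F)]
      exact Finset.sum_congr rfl fun i' _ => Finset.sum_congr rfl fun k _ => by ring
    rw [e1, hY, Finset.sum_comm, Finset.mul_sum]
    refine Finset.sum_le_sum fun k hk => ?_
    have h1 := hv.ell t fun i => a i k
    have h2 : r ^ (4 * m) ≤ lam k := by
      rw [hr, ← pow_mul, mul_comm j]; exact (hF k hk).1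
    have h3 : 0 ≤ ∑ i, a i k ^ 2 := Finset.sum_nonneg fun _ _ => sq_nonneg _
    calc lam₀ * r ^ (4 * m) * ∑ i, a i k ^ 2 = r ^ (4 * m) * (lam₀ * ∑ i, a i k ^ 2) := by ring
      _ ≤ lam k * (lam₀ * ∑ i, a i k ^ 2) :=
          mul_le_mul_of_nonneg_right h2 (mul_nonneg hlam₀ h3)
      _ ≤ _ := mul_le_mul_of_nonneg_left h1 (h.pos k).le
  have habs : ∀ {x y z w : ℝ}, |x| ≤ w → |y| ≤ z → x * y ≤ |w| * z := fun {x y z w} hx hy => by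
    refine (le_abs_self _).trans ?_
    rw [abs_mul]
    exact mul_le_mul (hx.trans (le_abs_self _)) hy (abs_nonneg _) (abs_nonneg _)
  have hK : ∀ i i', A t i i' * ((-1) ^ m * R i i') ≤ |K₀| * (CR * X * √Y) := fun i i' => by
    refine habs (hv.bdA t i i') ?_
    rw [abs_mul, abs_pow, abs_neg, abs_one, one_pow, one_mul]
    exact hRb i i'
  have hrow : ∀ i, ∫ y in (0 : ℝ)..2, χ y * deriv (fun τ => v q i τ y) t * eigComb φ F (a i) y
      ≤ -(∑ i', A t i i' * ∑ k ∈ F, lam k * a i k * a i' k)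
        + n * ((|K₀| * CR + |K₀| * CS) * (X * √Y)) := by
    intro i
    rw [hterm i]
    have e1 : ∑ i', A t i i' * ((∑ k ∈ F, lam k * a i k * a i' k) - (-1) ^ m * R i i')
        = (∑ i', A t i i' * ∑ k ∈ F, lam k * a i k * a i' k)
          - ∑ i', A t i i' * ((-1) ^ m * R i i') := by
      rw [← Finset.sum_sub_distrib]
      exact Finset.sum_congr rfl fun i' _ => by ring
    have e2 : ∑ i', A t i i' * ((-1) ^ m * R i i') ≤ n * (|K₀| * (CR * X * √Y)) := by
      refine (Finset.sum_le_sum fun i' _ => hK i i').trans (le_of_eq ?_)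
      rw [Finset.sum_const, Finset.card_univ, Fintype.card_fin, nsmul_eq_mul]
    have e3 : ∑ e, ∑ i', B e t i i' * S e i i' ≤ n * (|K₀| * (CS * X * √Y)) := by
      have : ∀ e, ∑ i', B e t i i' * S e i i' ≤ n * (|K₀| * (c 0 (jj e) * X * √Y)) := fun e => by
        refine (Finset.sum_le_sum fun i' _ => habs (hv.bdB e t i i') (hSb e i i')).trans
          (le_of_eq ?_)
        rw [Finset.sum_const, Finset.card_univ, Fintype.card_fin, nsmul_eq_mul]
      refine (Finset.sum_le_sum fun e _ => this e).trans (le_of_eq ?_)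
      rw [← Finset.mul_sum, ← Finset.mul_sum, hCS, Finset.sum_mul, Finset.sum_mul]
    rw [e1]
    linarith
  refine (Finset.sum_le_sum fun i _ => hrow i).trans ?_
  rw [Finset.sum_add_distrib, Finset.sum_neg_distrib, Finset.sum_const, Finset.card_univ,
    Fintype.card_fin, nsmul_eq_mul]
  linarith

end NormalSys

end Chain

section Chain

lemma le_of_block_inequality {Y Y' : ℝ → ℝ} (hd : ∀ t, HasDerivAt Y (Y' t) t)
    (hY' : Continuous Y') (hY : ∀ t, 0 ≤ Y t) {a X t₀ t₁ : ℝ} (ha : 0 < a) (ht : t₀ ≤ t₁)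
    (h : ∀ᵐ t, t ∈ Ioo t₀ t₁ → Y' t ≤ 2 * (-(a * Y t) + X * √(Y t))) :
    Y t₁ ≤ Real.exp (-(a * (t₁ - t₀))) * Y t₀ + X ^ 2 / a ^ 2 := by
  have hc : Continuous Y := continuous_iff_continuousAt.2 fun t => (hd t).continuousAt
  have hb : 0 ≤ X ^ 2 / a := by positivity
  have key := nonpos_of_ae_nonpos (f := fun t => Y' t + a * Y t - X ^ 2 / a)
    ((hY'.add (continuous_const.mul hc)).sub continuous_const) (a := t₀) (b := t₁) (by
      filter_upwards [h] with t h1 h2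
      have h3 := h1 h2
      have h4 : Y t = √(Y t) ^ 2 := (Real.sq_sqrt (hY t)).symm
      have h5 : 2 * (X * √(Y t)) ≤ a * Y t + X ^ 2 / a := by
        have h6 : 0 ≤ (a * √(Y t) - X) ^ 2 / a := by positivity
        have h7 : (a * √(Y t) - X) ^ 2 / a = a * √(Y t) ^ 2 - 2 * (X * √(Y t)) + X ^ 2 / a := by
          field_simp
          ring
        rw [h7, ← h4] at h6
        linarith
      linarith)
  have := le_of_damped_inequality hd ha ht (b := X ^ 2 / a)
    (fun t h1 => by have := key t h1; linarith) hb
  rw [abs_of_nonneg (hY _), div_div, ← pow_two] at this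
  exact this

lemma exp_neg_le_div_pow {x : ℝ} (hx : 0 < x) (N : ℕ) :
    Real.exp (-x) ≤ N.factorial / x ^ N := by
  have h := Real.pow_div_factorial_le_exp x hx.le N
  have h1 : 0 < x ^ N / N.factorial := by positivity
  rw [Real.exp_neg, ← inv_div]
  exact inv_anti₀ h1 h

lemma CoefDecay.mono {ι : Type} {m : ℕ} {φ : ι → ℝ → ℝ} {lam : ι → ℝ} {σ : ℕ} {D D' : ℝ}
    {w : ℝ → ℝ} (h : CoefDecay m φ lam σ D w) (hD : D ^ 2 ≤ D' ^ 2) :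
    CoefDecay m φ lam σ D' w := fun j F hF => (h j F hF).trans hD

namespace IsEigSys

variable {m : ℕ} {ι : Type} {φ : ι → ℝ → ℝ} {lam : ι → ℝ}

lemma hasDerivAt_coef (h : IsEigSys m φ lam) {χ : ℝ → ℝ} (hχ : Continuous χ) {G G' : ℝ → ℝ → ℝ}
    (hG : Continuous (Function.uncurry G)) (hG' : Continuous (Function.uncurry G'))
    (hd : ∀ t y, HasDerivAt (fun τ => G τ y) (G' t y) t) (k : ι) (t : ℝ) :
    HasDerivAt (fun τ => coef φ (fun y => χ y * G τ y) k)
      (coef φ (fun y => χ y * G' t y) k) t := by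
  have h1 := hasDerivAt_integral_compact (ν := volume.restrict (Ioc (0 : ℝ) 2))
    (isCompact_Icc (a := (0 : ℝ)) (b := 2)) measurableSet_Icc
    (G := fun t y => χ y * G t y * φ k y) (G' := fun t y => χ y * G' t y * φ k y)
    (((hχ.comp continuous_snd).mul hG).mul ((h.continuous_fun k).comp continuous_snd))
    (((hχ.comp continuous_snd).mul hG').mul ((h.continuous_fun k).comp continuous_snd))
    (fun t y => ((hd t y).const_mul (χ y)).mul_const (φ k y)) t
  have e : (volume.restrict (Ioc (0 : ℝ) 2)).restrict (Icc 0 2) = volume.restrict (Ioc 0 2) := by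
    rw [Measure.restrict_restrict measurableSet_Icc, inter_eq_right.2 Ioc_subset_Icc_self]
  simp only [e] at h1
  simp only [coef, intervalIntegral.integral_of_le (zero_le_two (α := ℝ))]
  exact h1

lemma continuous_coef (h : IsEigSys m φ lam) {χ : ℝ → ℝ} (hχ : Continuous χ) {G : ℝ → ℝ → ℝ}
    (hG : Continuous (Function.uncurry G)) (k : ι) :
    Continuous fun t => coef φ (fun y => χ y * G t y) k := by
  unfold coef
  exact intervalIntegral.continuous_parametric_intervalIntegral_of_continuous'
    (((hχ.comp continuous_snd).mul hG).mul ((h.continuous_fun k).comp continuous_snd)) _ _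

end IsEigSys

variable {m n : ℕ} {Q E : Type} [Fintype E] {jj : E → ℕ} {sh : E → Q → Q} {lam₀ K₀ : ℝ}
  {Cq : Q → ℝ → ℝ} {A : ℝ → Fin n → Fin n → ℝ} {B : E → ℝ → Fin n → Fin n → ℝ}
  {v : Q → Fin n → ℝ → ℝ → ℝ} {M : ℝ}

/-- Decay of order `σ` of the coefficients of cut-offs of solutions of normal systems. -/
def ChainBound (m n : ℕ) {Q E : Type} [Fintype E] (jj : E → ℕ) (sh : E → Q → Q)
    (lam₀ K₀ : ℝ) (Cq : Q → ℝ → ℝ) (σ : ℕ) : Prop :=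
  ∀ (q : Q) (χ : ℝ → ℝ) (ρ T : ℝ), ContDiff ℝ (⊤ : ℕ∞) χ → ρ < 6 / 5 →
    (∀ y, ρ ≤ y → χ y = 0) → T ∈ Ioo (-3 : ℝ) 0 → ∃ C, 0 ≤ C ∧
    ∀ (A : ℝ → Fin n → Fin n → ℝ) (B : E → ℝ → Fin n → Fin n → ℝ)
      (v : Q → Fin n → ℝ → ℝ → ℝ) (M : ℝ), NormalSys m n jj sh lam₀ K₀ Cq A B v M →
      ∀ {ι : Type} {φ : ι → ℝ → ℝ} {lam : ι → ℝ}, IsEigSys m φ lam → ∀ t ∈ Ico T 0, ∀ i,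
        CoefDecay m φ lam σ √(C * M) fun y => χ y * v q i t y

lemma NormalSys.sqNorm_cut_le (hv : NormalSys m n jj sh lam₀ K₀ Cq A B v M) {χ : ℝ → ℝ}
    (hχ : Continuous χ) (hχ0 : ∀ y, 6 / 5 ≤ y → χ y = 0) {b : ℝ}
    (hb : ∀ y ∈ Icc (0 : ℝ) 2, |χ y| ≤ b) {T t : ℝ} (hT : T ∈ Ioo (-3 : ℝ) 0) (ht : t ∈ Ico T 0)
    (q : Q) (i : Fin n) : sqNorm (fun y => χ y * v q i t y) ≤ b ^ 2 * |Cq q T| * M := by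
  refine (_root_.sqNorm_cut_le hχ (hv.contDiff_slice q i t).continuous hχ0 hb).trans ?_
  rw [mul_assoc]
  exact mul_le_mul_of_nonneg_left ((hv.energy q i T hT t ht).trans
    (mul_le_mul_of_nonneg_right (le_abs_self _) hv.M_nonneg)) (sq_nonneg _)

lemma chainBound_zero : ChainBound m n jj sh lam₀ K₀ Cq 0 := by
  intro q χ ρ T hχ hρ hχρ hT
  obtain ⟨b, hb0, hb⟩ := exists_bound_iteratedDeriv hχ 0
  refine ⟨b ^ 2 * |Cq q T|, by positivity, fun A B v M hv ι φ lam h t ht i j F _ => ?_⟩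
  have hM := hv.M_nonneg
  rw [Real.sq_sqrt (by positivity), mul_zero, pow_zero, one_mul]
  have hb' : ∀ y ∈ Icc (0 : ℝ) 2, |χ y| ≤ b := fun y hy => by
    have := hb 0 le_rfl y hy
    rwa [iteratedDeriv_zero] at this
  exact (h.sum_coef_sq_le (hχ.continuous.mul (hv.contDiff_slice q i t).continuous) F).trans
    (hv.sqNorm_cut_le hχ.continuous (fun y hy => hχρ y (by linarith)) hb' hT ht q i)

lemma chainBound_succ_block (hm : 1 ≤ m) (hjj : ∀ e, jj e < 2 * m) (hlam₀ : 0 < lam₀) {σ : ℕ}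
    (hσ : σ ≤ 4 * m) (hch : ChainBound m n jj sh lam₀ K₀ Cq σ) (q : Q) {χ : ℝ → ℝ} {ρ T : ℝ}
    (hχ : ContDiff ℝ (⊤ : ℕ∞) χ) (hρ : ρ < 6 / 5) (hχρ : ∀ y, ρ ≤ y → χ y = 0)
    (hT : T ∈ Ioo (-3 : ℝ) 0) : ∃ C, 0 ≤ C ∧
    ∀ (A : ℝ → Fin n → Fin n → ℝ) (B : E → ℝ → Fin n → Fin n → ℝ)
      (v : Q → Fin n → ℝ → ℝ → ℝ) (M : ℝ), NormalSys m n jj sh lam₀ K₀ Cq A B v M →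
      ∀ {ι : Type} {φ : ι → ℝ → ℝ} {lam : ι → ℝ}, IsEigSys m φ lam → ∀ t ∈ Ico T 0,
      ∀ (j : ℕ) (F : Finset ι),
      (∀ k ∈ F, 2 ^ (4 * m * j) ≤ lam k ∧ lam k ≤ 2 ^ (4 * m * (j + 1))) →
      ((2 : ℝ) ^ j) ^ (2 * (σ + 1)) * ∑ i, ∑ k ∈ F, coef φ (fun y => χ y * v q i t y) k ^ 2
        ≤ C * M := by
  set ρ' : ℝ := ρ + (6 / 5 - ρ) / 3 with hρ'
  set ρ'' : ℝ := ρ + 2 * (6 / 5 - ρ) / 3 with hρ''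
  have h1 : ρ < ρ' := by linarith
  have h2 : ρ' < ρ'' := by linarith
  have h3 : ρ'' < 6 / 5 := by linarith
  obtain ⟨χ', hχ's, hχ'1, hχ'0⟩ := exists_cutoff_line h2
  set T' : ℝ := (T - 3) / 2 with hT'
  have hT'' : T' ∈ Ioo (-3 : ℝ) 0 := ⟨by linarith [hT.1], by linarith [hT.2]⟩
  have hs0 : 0 < T - T' := by linarith [hT.1]
  obtain ⟨C₁, hC₁, hdiss⟩ := NormalSys.exists_block_dissipation m n hm jj hjj sh lam₀ K₀ Cq hχ hχρ
    hχ's hχ'1 h1 (h2.trans h3) hσ hlam₀.le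
  choose c hc0 hc using fun q' => hch q' χ' ρ'' T' hχ's h3 hχ'0 hT''
  obtain ⟨b', hb'0, hb'⟩ := exists_bound_iteratedDeriv hχ's 0
  obtain ⟨b, hb0, hb⟩ := exists_bound_iteratedDeriv hχ 0
  replace hb : ∀ y ∈ Icc (0 : ℝ) 2, |χ y| ≤ b := fun y hy => by
    have := hb 0 le_rfl y hy
    rwa [iteratedDeriv_zero] at this
  replace hb' : ∀ y ∈ Icc (0 : ℝ) 2, |χ' y| ≤ b' := fun y hy => by
    have := hb' 0 le_rfl y hy
    rwa [iteratedDeriv_zero] at this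
  set g : Q → ℝ := fun q' => c q' + b' ^ 2 * |Cq q' T'| with hg
  have hg0 : ∀ q', 0 ≤ g q' := fun q' => add_nonneg (hc0 q') (by positivity)
  set G : ℝ := g q + ∑ e, g (sh e q) with hG
  have hGs : 0 ≤ ∑ e, g (sh e q) := Finset.sum_nonneg fun e _ => hg0 _
  have hG0 : 0 ≤ G := add_nonneg (hg0 q) hGs
  set C₂ : ℝ := (σ + 1).factorial / (lam₀ * (T - T')) ^ (σ + 1) with hC₂
  have hC₂0 : 0 ≤ C₂ := by positivity
  refine ⟨C₂ * (n * (b ^ 2 * |Cq q T'|)) + C₁ ^ 2 * G / lam₀ ^ 2, by positivity, ?_⟩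
  intro A B v M hv ι φ lam h t ht j F hF
  have hM := hv.M_nonneg
  set r : ℝ := 2 ^ j with hr
  have hr1 : 1 ≤ r := one_le_pow₀ (by norm_num)
  have hr0 : 0 < r := by linarith
  set D : ℝ := √(G * M) with hD
  have hD2 : D ^ 2 = G * M := Real.sq_sqrt (by positivity)
  have hdec : ∀ τ ∈ Ico T' 0, ∀ q', (q' = q ∨ ∃ e, q' = sh e q) → ∀ i,
      CoefDecay m φ lam σ D (fun y => χ' y * v q' i τ y) ∧
        sqNorm (fun y => χ' y * v q' i τ y) ≤ D ^ 2 := by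
    intro τ hτ q' hq' i
    have hgG : g q' ≤ G := by
      rcases hq' with rfl | ⟨e, rfl⟩
      · linarith
      · have := Finset.single_le_sum (f := fun e => g (sh e q)) (fun e _ => hg0 _)
          (Finset.mem_univ e)
        linarith [hg0 q]
    have hgM : g q' * M ≤ D ^ 2 := hD2 ▸ mul_le_mul_of_nonneg_right hgG hM
    have hx : 0 ≤ b' ^ 2 * |Cq q' T'| := by positivity
    have hx1 : c q' * M ≤ g q' * M := mul_le_mul_of_nonneg_right (by linarith) hM
    have hx2 : b' ^ 2 * |Cq q' T'| * M ≤ g q' * M :=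
      mul_le_mul_of_nonneg_right (by linarith [hc0 q']) hM
    refine ⟨(hc q' A B v M hv h τ hτ i).mono ?_, ?_⟩
    · rw [Real.sq_sqrt (mul_nonneg (hc0 q') hM)]
      linarith
    · exact (hv.sqNorm_cut_le hχ's.continuous (fun y hy => hχ'0 y (by linarith)) hb' hT'' hτ
        q' i).trans (by linarith)
  set Y : ℝ → ℝ := fun t => ∑ i, ∑ k ∈ F, coef φ (fun y => χ y * v q i t y) k ^ 2 with hY
  set Y' : ℝ → ℝ := fun t => ∑ i, ∑ k ∈ F, 2 * coef φ (fun y => χ y * v q i t y) k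
    * coef φ (fun y => χ y * deriv (fun τ => v q i τ y) t) k with hY'
  have hGc : ∀ i, Continuous (Function.uncurry (v q i)) := fun i => (hv.smooth q i).continuous
  have hYd : ∀ t, HasDerivAt Y (Y' t) t := fun t => by
    refine HasDerivAt.fun_sum fun i _ => HasDerivAt.fun_sum fun k _ => ?_
    exact ((h.hasDerivAt_coef hχ.continuous (hGc i) (hv.exists_time_deriv q i).1
      (hv.exists_time_deriv q i).2 k t).fun_pow 2).congr_deriv (by simp)
  have hYc : Continuous Y' := continuous_finsetSum _ fun i _ => continuous_finsetSum _ fun k _ =>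
    (continuous_const.mul (h.continuous_coef hχ.continuous (hGc i) k)).mul
      (h.continuous_coef hχ.continuous (hv.exists_time_deriv q i).1 k)
  have hY0 : ∀ t, 0 ≤ Y t := fun t => Finset.sum_nonneg fun i _ => Finset.sum_nonneg fun k _ =>
    sq_nonneg _
  have hYe : ∀ t, Y' t = 2 * ∑ i, ∫ y in (0 : ℝ)..2, χ y * deriv (fun τ => v q i τ y) t
      * eigComb φ F (coef φ fun y => χ y * v q i t y) y := fun t => by
    rw [Finset.mul_sum]
    refine Finset.sum_congr rfl fun i _ => ?_
    have hc' : Continuous fun y => χ y * deriv (fun τ => v q i τ y) t :=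
      hχ.continuous.mul ((hv.exists_time_deriv q i).1.comp
        (continuous_const.prodMk continuous_id))
    rw [h.integral_mul_comb hc', Finset.mul_sum]
    exact Finset.sum_congr rfl fun k _ => by rw [mul_assoc]; rfl
  have ha : 0 < lam₀ * r ^ (4 * m) := by positivity
  have hmain := le_of_block_inequality hYd hYc hY0 ha (t₀ := T') (t₁ := t) (by linarith [ht.1])
    (X := C₁ * (D * r ^ (4 * m) / r ^ (σ + 1))) (by
      filter_upwards [hv.eqn] with τ h4 h5
      have h6 : τ ∈ Ioo (-3 : ℝ) 0 := ⟨by linarith [h5.1, hT''.1], by linarith [h5.2, ht.2]⟩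
      rw [hYe]
      refine mul_le_mul_of_nonneg_left ?_ zero_le_two
      exact hdiss A B v M hv h q τ h6 (fun y hy i => h4 h6 y hy q i) D (Real.sqrt_nonneg _)
        (hdec τ ⟨h5.1.le, h6.2⟩) j F hF)
  have hYT : Y T' ≤ n * (b ^ 2 * |Cq q T'|) * M := by
    have : ∀ i, ∑ k ∈ F, coef φ (fun y => χ y * v q i T' y) k ^ 2 ≤ b ^ 2 * |Cq q T'| * M :=
      fun i => (h.sum_coef_sq_le
        (hχ.continuous.mul (hv.contDiff_slice q i T').continuous) F).trans
        (hv.sqNorm_cut_le hχ.continuous (fun y hy => hχρ y (by linarith)) hb hT''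
          ⟨le_rfl, hT''.2⟩ q i)
    refine (Finset.sum_le_sum fun i _ => this i).trans (le_of_eq ?_)
    rw [Finset.sum_const, Finset.card_univ, Fintype.card_fin, nsmul_eq_mul]
    ring
  have hrp : r ^ (2 * (σ + 1)) ≤ (r ^ (4 * m)) ^ (σ + 1) := by
    rw [← pow_mul r (4 * m) (σ + 1)]
    exact pow_le_pow_right₀ hr1 (Nat.mul_le_mul_right _ (by omega))
  have hexp : r ^ (2 * (σ + 1)) * Real.exp (-(lam₀ * r ^ (4 * m) * (t - T'))) ≤ C₂ := by
    have hx : 0 < lam₀ * (T - T') * r ^ (4 * m) := by positivity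
    have hle : lam₀ * (T - T') * r ^ (4 * m) ≤ lam₀ * r ^ (4 * m) * (t - T') := by
      rw [mul_right_comm]
      exact mul_le_mul_of_nonneg_left (by linarith [ht.1]) ha.le
    have h4 : Real.exp (-(lam₀ * r ^ (4 * m) * (t - T')))
        ≤ (σ + 1).factorial / (lam₀ * (T - T') * r ^ (4 * m)) ^ (σ + 1) :=
      (Real.exp_le_exp.2 (neg_le_neg hle)).trans (exp_neg_le_div_pow hx _)
    calc _ ≤ (r ^ (4 * m)) ^ (σ + 1)
          * ((σ + 1).factorial / (lam₀ * (T - T') * r ^ (4 * m)) ^ (σ + 1)) :=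
          mul_le_mul hrp h4 (Real.exp_nonneg _) (by positivity)
      _ = C₂ := by
          rw [hC₂, mul_pow (lam₀ * (T - T')) (r ^ (4 * m))]
          field_simp
  have hlast : r ^ (2 * (σ + 1)) * ((C₁ * (D * r ^ (4 * m) / r ^ (σ + 1))) ^ 2
      / (lam₀ * r ^ (4 * m)) ^ 2) = C₁ ^ 2 * G / lam₀ ^ 2 * M := by
    have e1 : r ^ (2 * (σ + 1)) = (r ^ (σ + 1)) ^ 2 := by
      rw [← pow_mul r (σ + 1) 2, mul_comm 2]
    rw [e1, mul_pow C₁, div_pow, mul_pow D, mul_pow lam₀, hD2]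
    field_simp
  calc r ^ (2 * (σ + 1)) * Y t
      ≤ r ^ (2 * (σ + 1)) * (Real.exp (-(lam₀ * r ^ (4 * m) * (t - T'))) * Y T'
        + (C₁ * (D * r ^ (4 * m) / r ^ (σ + 1))) ^ 2 / (lam₀ * r ^ (4 * m)) ^ 2) :=
        mul_le_mul_of_nonneg_left hmain (by positivity)
    _ = r ^ (2 * (σ + 1)) * Real.exp (-(lam₀ * r ^ (4 * m) * (t - T'))) * Y T'
        + C₁ ^ 2 * G / lam₀ ^ 2 * M := by rw [mul_add, hlast]; ring
    _ ≤ C₂ * (n * (b ^ 2 * |Cq q T'|) * M) + C₁ ^ 2 * G / lam₀ ^ 2 * M :=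
        add_le_add (mul_le_mul hexp hYT (hY0 _) hC₂0) le_rfl
    _ = _ := by ring

lemma chainBound_succ (hm : 1 ≤ m) (hjj : ∀ e, jj e < 2 * m) (hlam₀ : 0 < lam₀) {σ : ℕ}
    (hσ : σ ≤ 4 * m) (hch : ChainBound m n jj sh lam₀ K₀ Cq σ) :
    ChainBound m n jj sh lam₀ K₀ Cq (σ + 1) := by
  intro q χ ρ T hχ hρ hχρ hT
  obtain ⟨C, hC, h1⟩ := chainBound_succ_block hm hjj hlam₀ hσ hch q hχ hρ hχρ hT
  refine ⟨2 * C, by positivity, fun A B v M hv ι φ lam h t ht i j F hF => ?_⟩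
  have hM := hv.M_nonneg
  rw [Real.sq_sqrt (by positivity), mul_assoc]
  refine dyadic_tail_bound hm (fun k => sq_nonneg (coef φ (fun y => χ y * v q i t y) k))
    (by omega) (mul_nonneg hC hM) (fun j F hF => ?_) j F hF
  refine le_trans (mul_le_mul_of_nonneg_left ?_ (by positivity)) (h1 A B v M hv h t ht j F hF)
  exact Finset.single_le_sum
    (f := fun i => ∑ k ∈ F, coef φ (fun y => χ y * v q i t y) k ^ 2)
    (fun i _ => Finset.sum_nonneg fun _ _ => sq_nonneg _) (Finset.mem_univ i)

lemma chainBound (hm : 1 ≤ m) (hjj : ∀ e, jj e < 2 * m) (hlam₀ : 0 < lam₀) :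
    ChainBound m n jj sh lam₀ K₀ Cq (4 * m + 1) := by
  have : ∀ σ, σ ≤ 4 * m + 1 → ChainBound m n jj sh lam₀ K₀ Cq σ := fun σ => by
    induction σ with
    | zero => exact fun _ => chainBound_zero
    | succ σ ih => exact fun hs => chainBound_succ hm hjj hlam₀ (by omega) (ih (by omega))
  exact this _ le_rfl

end Chain

section EndLp

open Filter

lemma eLpNorm_le_of_sup_of_sqNorm {f : ℝ → ℝ} (hf : Continuous f) {X s p : ℝ} (hX : 0 ≤ X)
    (hs : 0 < s) (hp : 2 < p) (h1 : ∀ y ∈ Icc (0 : ℝ) 2, f y ^ 2 ≤ X ^ 2)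
    (h2 : sqNorm f ≤ X ^ 2 * s ^ 2) :
    eLpNorm f (ENNReal.ofReal p) (volume.restrict (Ioc (0 : ℝ) 2))
      ≤ ENNReal.ofReal (X * s ^ (2 / p)) := by
  have hp0 : 0 < p := by linarith
  have hle : ∀ y ∈ Icc (0 : ℝ) 2, |f y| ≤ X := fun y hy => abs_le_of_sq_le_sq (h1 y hy) hX
  have hmem : MemLp f (ENNReal.ofReal p) (volume.restrict (Ioc (0 : ℝ) 2)) := by
    refine MemLp.of_bound hf.aestronglyMeasurable X ?_
    exact (ae_restrict_iff' measurableSet_Ioc).2 (Eventually.of_forall fun y hy => by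
      rw [Real.norm_eq_abs]; exact hle y ⟨hy.1.le, hy.2⟩)
  rw [hmem.eLpNorm_eq_integral_rpow_norm (by simpa using hp0) ENNReal.ofReal_ne_top,
    ENNReal.toReal_ofReal hp0.le]
  refine ENNReal.ofReal_le_ofReal ?_
  have key : ∫ y in Ioc (0 : ℝ) 2, ‖f y‖ ^ p ≤ X ^ p * s ^ 2 := by
    rw [← intervalIntegral.integral_of_le zero_le_two]
    have hXp : X ^ p = X ^ (p - 2) * X ^ 2 := by
      rw [← Real.rpow_natCast X 2, ← Real.rpow_add_of_nonneg hX (by linarith) (by norm_num)]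
      congr 1
      push_cast
      ring
    have c1 : Continuous fun y => ‖f y‖ ^ p :=
      hf.norm.rpow_const fun _ => Or.inr hp0.le
    have c2 : Continuous fun y => X ^ (p - 2) * f y ^ 2 := continuous_const.mul (hf.pow 2)
    calc ∫ y in (0 : ℝ)..2, ‖f y‖ ^ p ≤ ∫ y in (0 : ℝ)..2, X ^ (p - 2) * f y ^ 2 := by
          refine intervalIntegral.integral_mono_on (μ := volume) zero_le_two
            (c1.intervalIntegrable _ _) (c2.intervalIntegrable _ _) fun y hy => ?_
          have e : ‖f y‖ ^ p = ‖f y‖ ^ (p - 2) * f y ^ 2 := by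
            rw [← sq_abs, ← Real.norm_eq_abs, ← Real.rpow_natCast ‖f y‖ 2,
              ← Real.rpow_add_of_nonneg (norm_nonneg _) (by linarith) (by norm_num)]
            congr 1
            push_cast
            ring
          rw [e]
          exact mul_le_mul_of_nonneg_right
            (Real.rpow_le_rpow (norm_nonneg _) (hle y hy) (by linarith)) (sq_nonneg _)
      _ = X ^ (p - 2) * sqNorm f := by rw [intervalIntegral.integral_const_mul, sqNorm]
      _ ≤ X ^ (p - 2) * (X ^ 2 * s ^ 2) :=
          mul_le_mul_of_nonneg_left h2 (Real.rpow_nonneg hX _)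
      _ = X ^ p * s ^ 2 := by rw [hXp, mul_assoc]
  calc _ ≤ (X ^ p * s ^ 2) ^ p⁻¹ := Real.rpow_le_rpow
        (integral_nonneg fun _ => Real.rpow_nonneg (norm_nonneg _) _) key (by positivity)
    _ = X * s ^ (2 / p) := by
        rw [Real.mul_rpow (by positivity) (by positivity), ← Real.rpow_mul hX,
          mul_inv_cancel₀ hp0.ne', Real.rpow_one, ← Real.rpow_natCast s 2, ← Real.rpow_mul hs.le]
        norm_num [div_eq_mul_inv]

lemma eLpNorm_two_restrict_Ioc {f : ℝ → ℝ} (hf : Continuous f) :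
    eLpNorm f 2 (volume.restrict (Ioc (0 : ℝ) 2)) = ENNReal.ofReal √(sqNorm f) := by
  have hmem : MemLp f 2 (volume.restrict (Ioc (0 : ℝ) 2)) := by
    obtain ⟨b, hb⟩ := (isCompact_Icc (a := (0 : ℝ)) (b := 2)).exists_bound_of_continuousOn
      hf.continuousOn
    refine MemLp.of_bound hf.aestronglyMeasurable b ?_
    exact (ae_restrict_iff' measurableSet_Ioc).2 (Eventually.of_forall fun y hy =>
      hb y ⟨hy.1.le, hy.2⟩)
  rw [hmem.eLpNorm_eq_integral_rpow_norm (by norm_num) (by norm_num), Real.sqrt_eq_rpow, sqNorm,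
    intervalIntegral.integral_of_le zero_le_two]
  norm_num

namespace IsEigSys

lemma exists_eLpNorm_block_le (m : ℕ) (hm : 1 ≤ m) {p : ℝ} (hp : 2 < p) :
    ∃ C, 0 ≤ C ∧ ∀ {ι : Type} {φ : ι → ℝ → ℝ} {lam : ι → ℝ}, IsEigSys m φ lam →
      ∀ (j : ℕ) (F : Finset ι), (∀ k ∈ F, lam k ≤ 2 ^ (4 * m * (j + 1))) →
      ∀ (b : ι → ℝ) (D : ℝ), 0 ≤ D →
      ((2 : ℝ) ^ j) ^ (2 * (4 * m + 1)) * ∑ k ∈ F, b k ^ 2 ≤ D ^ 2 → ∀ l ≤ 2 * m,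
        eLpNorm (iteratedDeriv l (eigComb φ F b)) (ENNReal.ofReal p)
          (volume.restrict (Ioc (0 : ℝ) 2)) ≤ ENNReal.ofReal (C * D * ((2 : ℝ)⁻¹ ^ (2 / p)) ^ j) := by
  obtain ⟨C₁, hC₁, h1⟩ := exists_bernstein m
  obtain ⟨C₂, hC₂, h2⟩ := exists_bernstein_sup m hm
  refine ⟨√(C₁ + C₂), Real.sqrt_nonneg _, fun {ι φ lam} h j F hF b D hD hb l hl => ?_⟩
  set r : ℝ := 2 ^ j with hr
  have hr1 : 1 ≤ r := one_le_pow₀ (by norm_num)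
  have hr0 : 0 < r := by linarith
  set S := ∑ k ∈ F, b k ^ 2 with hS
  have hS0 : 0 ≤ S := Finset.sum_nonneg fun _ _ => sq_nonneg _
  have hX : (√(C₁ + C₂) * D) ^ 2 = (C₁ + C₂) * D ^ 2 := by
    rw [mul_pow, Real.sq_sqrt (by positivity)]
  have hc : Continuous (iteratedDeriv l (eigComb φ F b)) :=
    (h.contDiff_comb F b).continuous_iteratedDeriv l (by exact_mod_cast hl)
  have e : ((2 : ℝ)⁻¹ ^ (2 / p)) ^ j = (r⁻¹) ^ (2 / p) := by
    rw [hr, ← inv_pow, ← Real.rpow_natCast, ← Real.rpow_mul (by norm_num),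
      ← Real.rpow_natCast (2⁻¹ : ℝ) j, ← Real.rpow_mul (by norm_num), mul_comm]
  rw [e]
  refine eLpNorm_le_of_sup_of_sqNorm hc (by positivity) (by positivity) hp (fun y hy => ?_) ?_
  · have h3 : r ^ (4 * l + 2) * S ≤ D ^ 2 := (mul_le_mul_of_nonneg_right
      (pow_le_pow_right₀ hr1 (by omega)) hS0).trans hb
    have h4 := h2 h j F hF b l hl y hy
    rw [mul_assoc] at h4
    have h5 : C₂ * (r ^ (4 * l + 2) * S) ≤ C₂ * D ^ 2 := mul_le_mul_of_nonneg_left h3 hC₂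
    have h6 : 0 ≤ C₁ * D ^ 2 := by positivity
    rw [hX]
    linarith
  · have h3 : r ^ (4 * l) * S ≤ D ^ 2 * r⁻¹ ^ 2 := by
      rw [inv_pow, ← div_eq_mul_inv, le_div_iff₀ (by positivity)]
      refine le_trans ?_ hb
      rw [mul_right_comm, ← pow_add r (4 * l) 2]
      exact mul_le_mul_of_nonneg_right (pow_le_pow_right₀ hr1 (by omega)) hS0
    have h4 := h1 h j F hF b l hl
    rw [mul_assoc] at h4
    have h5 : C₁ * (r ^ (4 * l) * S) ≤ C₁ * (D ^ 2 * r⁻¹ ^ 2) := mul_le_mul_of_nonneg_left h3 hC₁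
    have h6 : 0 ≤ C₂ * (D ^ 2 * r⁻¹ ^ 2) := by positivity
    rw [hX, mul_assoc]
    linarith

lemma exists_eLpNorm_low_le (m : ℕ) (hm : 1 ≤ m) {p : ℝ} (hp : 2 < p) :
    ∃ C, 0 ≤ C ∧ ∀ {ι : Type} {φ : ι → ℝ → ℝ} {lam : ι → ℝ} (h : IsEigSys m φ lam)
      (w : ℝ → ℝ), Continuous w → ∀ D, 0 ≤ D → CoefDecay m φ lam (4 * m + 1) D w →
      sqNorm w ≤ D ^ 2 → ∀ l ≤ 2 * m, ∀ J,
        eLpNorm (iteratedDeriv l (eigComb φ (h.low hm J) (coef φ w))) (ENNReal.ofReal p)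
          (volume.restrict (Ioc (0 : ℝ) 2)) ≤ ENNReal.ofReal (C * D) := by
  classical
  obtain ⟨C, hC, hb⟩ := exists_eLpNorm_block_le m hm hp
  set θ : ℝ := (2 : ℝ)⁻¹ ^ (2 / p) with hθ
  have hθ0 : 0 ≤ θ := by positivity
  have hθ1 : θ < 1 := Real.rpow_lt_one (by norm_num) (by norm_num) (by positivity)
  refine ⟨C * (1 - θ)⁻¹, mul_nonneg hC (inv_nonneg.2 (by linarith)), ?_⟩
  intro ι φ lam h w hw D hD hdec hn l hl J
  have hpp : 1 ≤ ENNReal.ofReal p := by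
    rw [← ENNReal.ofReal_one]
    exact ENNReal.ofReal_le_ofReal (by linarith)
  have key : eLpNorm (iteratedDeriv l (eigComb φ (h.low hm J) (coef φ w))) (ENNReal.ofReal p)
      (volume.restrict (Ioc (0 : ℝ) 2))
      ≤ ENNReal.ofReal (∑ j ∈ Finset.range (J + 1), C * D * θ ^ j) := by
    induction J with
    | zero =>
      rw [zero_add, Finset.sum_range_one]
      refine hb h 0 _ (fun k hk => (h.mem_low hm).1 hk) _ D hD ?_ l hl
      rw [pow_zero, one_pow, one_mul]
      exact (h.sum_coef_sq_le hw _).trans hn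
    | succ J ih =>
      set F := h.low hm (J + 1) \ h.low hm J with hF
      have hblk : ∀ k ∈ F, 2 ^ (4 * m * (J + 1)) ≤ lam k ∧ lam k ≤ 2 ^ (4 * m * (J + 1 + 1)) := by
        intro k hk
        rw [hF, Finset.mem_sdiff, h.mem_low hm, h.mem_low hm] at hk
        exact ⟨(not_le.1 hk.2).le, hk.1⟩
      have hsplit : iteratedDeriv l (eigComb φ (h.low hm (J + 1)) (coef φ w))
          = iteratedDeriv l (eigComb φ F (coef φ w))
            + iteratedDeriv l (eigComb φ (h.low hm J) (coef φ w)) := by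
        funext y
        rw [Pi.add_apply, h.iteratedDeriv_comb _ _ hl, h.iteratedDeriv_comb _ _ hl,
          h.iteratedDeriv_comb _ _ hl, hF, Finset.sum_sdiff (h.low_mono hm (Nat.le_succ J))]
      have hc : ∀ G, Continuous (iteratedDeriv l (eigComb φ G (coef φ w))) := fun G =>
        (h.contDiff_comb G _).continuous_iteratedDeriv l (by exact_mod_cast hl)
      rw [hsplit, Finset.sum_range_succ, ENNReal.ofReal_add
        (Finset.sum_nonneg fun j _ => by positivity) (by positivity), add_comm (ENNReal.ofReal _)]
      exact (eLpNorm_add_le (hc _).aestronglyMeasurable (hc _).aestronglyMeasurable hpp).trans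
        (add_le_add (hb h (J + 1) F (fun k hk => (hblk k hk).2) _ D hD
          (hdec (J + 1) F fun k hk => (hblk k hk).1) l hl) ih)
  refine key.trans (ENNReal.ofReal_le_ofReal ?_)
  rw [← Finset.mul_sum, mul_right_comm]
  refine mul_le_mul_of_nonneg_right (mul_le_mul_of_nonneg_left ?_ hC) hD
  rw [← tsum_geometric_of_lt_one hθ0 hθ1]
  exact (summable_geometric_of_lt_one hθ0 hθ1).sum_le_tsum _ fun j _ => pow_nonneg hθ0 j

variable {m : ℕ} {ι : Type} {φ : ι → ℝ → ℝ} {lam : ι → ℝ}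

lemma tendsto_sqNorm_sub_low (h : IsEigSys m φ lam) (hm : 1 ≤ m) {w : ℝ → ℝ} (hw : Continuous w) :
    Tendsto (fun J => sqNorm (w - eigComb φ (h.low hm J) (coef φ w))) atTop (𝓝 0) := by
  classical
  have hlow : Tendsto (h.low hm) atTop atTop := tendsto_atTop_finset_of_monotone
    (fun i j hij => h.low_mono hm hij) fun k => by
      obtain ⟨N, hN⟩ := pow_unbounded_of_one_lt (lam k) (by norm_num : (1 : ℝ) < 2)
      refine ⟨N, (h.mem_low hm).2 (hN.le.trans (pow_le_pow_right₀ (by norm_num) ?_))⟩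
      calc N ≤ N + 1 := Nat.le_succ N
        _ = 1 * (N + 1) := (one_mul _).symm
        _ ≤ _ := Nat.mul_le_mul_right _ (by omega)
  have hlim : Tendsto (fun J => sqNorm w - ∑ k ∈ h.low hm J, coef φ w k ^ 2) atTop (𝓝 0) := by
    have h1 : Tendsto (fun J => ∑ k ∈ h.low hm J, coef φ w k ^ 2) atTop (𝓝 (sqNorm w)) :=
      (show Tendsto (fun F : Finset ι => ∑ k ∈ F, coef φ w k ^ 2) atTop (𝓝 (sqNorm w)) from
        h.parseval w hw).comp hlow
    have := h1.const_sub (sqNorm w)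
    rwa [sub_self] at this
  refine squeeze_zero (fun J => sqNorm_nonneg _) (fun J => ?_) hlim
  refine h.sqNorm_le_of_sum_le (hw.sub (h.continuous_comb _ _)) fun F => ?_
  have e : ∑ k ∈ F, coef φ (w - eigComb φ (h.low hm J) (coef φ w)) k ^ 2
      = ∑ k ∈ F \ h.low hm J, coef φ w k ^ 2 := by
    rw [Finset.sdiff_eq_filter, Finset.sum_filter]
    refine Finset.sum_congr rfl fun k _ => ?_
    rw [h.coef_sub_comb hw]
    by_cases hk : k ∈ h.low hm J <;> simp [hk]
  rw [e, le_sub_iff_add_le, ← Finset.sum_union Finset.sdiff_disjoint]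
  exact h.sum_coef_sq_le hw _

lemma coef_iteratedDeriv (h : IsEigSys m φ lam) {w : ℝ → ℝ} (hw : ContDiff ℝ (2 * m : ℕ) w)
    (h0 : ∀ i < m, iteratedDeriv i w 0 = 0) (h2 : ∀ i < m, iteratedDeriv i w 2 = 0) (k : ι) :
    coef φ (iteratedDeriv (2 * m) w) k = (-1) ^ m * lam k * coef φ w k := by
  unfold coef
  rw [integral_iteratedDeriv_mul (2 * m) hw (h.smooth k)
    (fun i hi => by
      by_cases him : i < m
      · exact Or.inl (h0 i him)
      · exact Or.inr (h.bc_zero k _ (by omega)))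
    (fun i hi => by
      by_cases him : i < m
      · exact Or.inl (h2 i him)
      · exact Or.inr (h.bc_two k _ (by omega))), pow_mul, neg_one_sq, one_pow, one_mul,
    ← intervalIntegral.integral_const_mul]
  refine intervalIntegral.integral_congr fun y hy => ?_
  rw [uIcc_of_le zero_le_two] at hy
  simp only [h.eig k y hy]
  ring

lemma tendsto_sqNorm_iteratedDeriv_sub_low (h : IsEigSys m φ lam) (hm : 1 ≤ m) {w : ℝ → ℝ}
    (hw : ContDiff ℝ (2 * m : ℕ) w) (h0 : ∀ i < m, iteratedDeriv i w 0 = 0)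
    (h2 : ∀ i < m, iteratedDeriv i w 2 = 0) {l : ℕ} (hl : l ≤ 2 * m) :
    Tendsto (fun J => sqNorm (iteratedDeriv l (w - eigComb φ (h.low hm J) (coef φ w))))
      atTop (𝓝 0) := by
  obtain ⟨C, hC, hI⟩ := exists_sqNorm_iteratedDeriv_le (2 * m)
  have hg : Continuous (iteratedDeriv (2 * m) w) := hw.continuous_iteratedDeriv _ le_rfl
  have hlim := ((h.tendsto_sqNorm_sub_low hm hw.continuous).add
    (h.tendsto_sqNorm_sub_low hm hg)).const_mul C
  rw [add_zero, mul_zero] at hlim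
  refine squeeze_zero (fun J => sqNorm_nonneg _) (fun J => ?_) hlim
  have hc := h.contDiff_comb (h.low hm J) (coef φ w)
  have h3 := hI (w - eigComb φ (h.low hm J) (coef φ w)) (hw.sub hc) 1 one_pos le_rfl l hl
  rw [one_pow, one_pow, one_mul, one_mul] at h3
  refine h3.trans (le_of_eq ?_)
  congr 2
  refine intervalIntegral.integral_congr fun y hy => ?_
  rw [uIcc_of_le zero_le_two] at hy
  have e : eigComb φ (h.low hm J) (fun k => (-1) ^ m * lam k * coef φ w k) y
      = eigComb φ (h.low hm J) (coef φ (iteratedDeriv (2 * m) w)) y :=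
    Finset.sum_congr rfl fun k _ => by rw [h.coef_iteratedDeriv hw h0 h2]
  simp only [Pi.sub_apply]
  rw [iteratedDeriv_sub hw.contDiffAt hc.contDiffAt, h.comb_eig _ _ hy, e]

/-- `L_p` bound for the derivatives of a function with decaying coefficients. -/
lemma exists_eLpNorm_le (m : ℕ) (hm : 1 ≤ m) {p : ℝ} (hp : 2 < p) :
    ∃ C, 0 ≤ C ∧ ∀ {ι : Type} {φ : ι → ℝ → ℝ} {lam : ι → ℝ}, IsEigSys m φ lam →
      ∀ w : ℝ → ℝ, ContDiff ℝ (2 * m : ℕ) w → (∀ i < m, iteratedDeriv i w 0 = 0) →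
      (∀ i < m, iteratedDeriv i w 2 = 0) → ∀ D, 0 ≤ D → CoefDecay m φ lam (4 * m + 1) D w →
      sqNorm w ≤ D ^ 2 → ∀ l ≤ 2 * m,
        eLpNorm (iteratedDeriv l w) (ENNReal.ofReal p) (volume.restrict (Ioc (0 : ℝ) 2))
          ≤ ENNReal.ofReal (C * D) := by
  obtain ⟨C, hC, hb⟩ := exists_eLpNorm_low_le m hm hp
  refine ⟨C, hC, fun {ι φ lam} h w hw h0 h2 D hD hdec hn l hl => ?_⟩
  set f : ℕ → ℝ → ℝ := fun J => iteratedDeriv l (eigComb φ (h.low hm J) (coef φ w)) with hf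
  have hc : ∀ J, Continuous (f J) := fun J =>
    (h.contDiff_comb _ _).continuous_iteratedDeriv l (by exact_mod_cast hl)
  have hwc : Continuous (iteratedDeriv l w) := hw.continuous_iteratedDeriv l (by exact_mod_cast hl)
  have hmeas : TendstoInMeasure (volume.restrict (Ioc (0 : ℝ) 2)) f atTop (iteratedDeriv l w) := by
    refine tendstoInMeasure_of_tendsto_eLpNorm (p := 2) two_ne_zero
      (fun J => (hc J).aestronglyMeasurable) hwc.aestronglyMeasurable ?_
    have e : ∀ J, eLpNorm (f J - iteratedDeriv l w) 2 (volume.restrict (Ioc (0 : ℝ) 2))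
        = ENNReal.ofReal √(sqNorm (iteratedDeriv l (w - eigComb φ (h.low hm J) (coef φ w)))) := by
      intro J
      rw [eLpNorm_two_restrict_Ioc ((hc J).sub hwc)]
      congr 2
      refine intervalIntegral.integral_congr fun y _ => ?_
      have hl' : ContDiff ℝ l w := hw.of_le (by exact_mod_cast hl)
      have hc' : ContDiff ℝ l (eigComb φ (h.low hm J) (coef φ w)) :=
        (h.contDiff_comb _ _).of_le (by exact_mod_cast hl)
      simp only [Pi.sub_apply]
      rw [iteratedDeriv_sub hl'.contDiffAt hc'.contDiffAt]
      ring
    simp only [e]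
    have := (h.tendsto_sqNorm_iteratedDeriv_sub_low hm hw h0 h2 hl).sqrt
    rw [Real.sqrt_zero] at this
    have := ENNReal.tendsto_ofReal this
    rwa [ENNReal.ofReal_zero] at this
  obtain ⟨ns, -, hns⟩ := hmeas.exists_seq_tendsto_ae
  refine (Lp.eLpNorm_lim_le_liminf_eLpNorm (fun J => (hc (ns J)).aestronglyMeasurable) _
    hns).trans ?_
  refine liminf_le_of_le (by isBoundedDefault) fun b hb' => ?_
  obtain ⟨J, hJ⟩ := hb'.exists
  exact hJ.trans (hb h w hw.continuous D hD hdec hn l hl (ns J))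

end IsEigSys

lemma exists_eLpNorm_normalSys_le {m n : ℕ} {Q E : Type} [Fintype E] {jj : E → ℕ}
    {sh : E → Q → Q} {lam₀ K₀ : ℝ} {Cq : Q → ℝ → ℝ} (hm : 1 ≤ m) (hjj : ∀ e, jj e < 2 * m)
    (hlam₀ : 0 < lam₀) {p : ℝ} (hp : 2 < p) (q : Q) {T : ℝ} (hT : T ∈ Ioo (-3 : ℝ) 0) :
    ∃ C, 0 ≤ C ∧ ∀ (A : ℝ → Fin n → Fin n → ℝ) (B : E → ℝ → Fin n → Fin n → ℝ)
      (v : Q → Fin n → ℝ → ℝ → ℝ) (M : ℝ), NormalSys m n jj sh lam₀ K₀ Cq A B v M →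
      ∀ t ∈ Ico T 0, ∀ i, ∀ l ≤ 2 * m,
        eLpNorm (iteratedDeriv l (v q i t)) (ENNReal.ofReal p) (volume.restrict (Ioo (0 : ℝ) 1))
          ≤ ENNReal.ofReal (C * √M) := by
  obtain ⟨χ, hχ, hχ1, hχ0⟩ := exists_cutoff_line (a := 1) (b := 11 / 10) (by norm_num)
  obtain ⟨ι, φ, lam, h⟩ := exists_isEigSys m hm
  obtain ⟨C₁, hC₁, h1⟩ := chainBound (n := n) (sh := sh) (K₀ := K₀) (Cq := Cq) hm hjj hlam₀ q χ
    (11 / 10) T hχ (by norm_num) hχ0 hT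
  obtain ⟨C₂, hC₂, h2⟩ := IsEigSys.exists_eLpNorm_le m hm hp
  obtain ⟨b, hb0, hb⟩ := exists_bound_iteratedDeriv hχ 0
  replace hb : ∀ y ∈ Icc (0 : ℝ) 2, |χ y| ≤ b := fun y hy => by
    have := hb 0 le_rfl y hy
    rwa [iteratedDeriv_zero] at this
  set G : ℝ := C₁ + b ^ 2 * |Cq q T| with hG
  refine ⟨C₂ * √G, by positivity, fun A B v M hv t ht i l hl => ?_⟩
  have hM := hv.M_nonneg
  have hs : ∀ N : ℕ, ContDiff ℝ N (v q i t) := fun N =>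
    (hv.contDiff_slice q i t).of_le (by exact_mod_cast le_top)
  have hχN : ∀ N : ℕ, ContDiff ℝ N χ := fun N => hχ.of_le (by exact_mod_cast le_top)
  have ht3 : t ∈ Ioo (-3 : ℝ) 0 := ⟨hT.1.trans_le ht.1, ht.2⟩
  have hD : √(G * M) ^ 2 = G * M := Real.sq_sqrt (by positivity)
  have hx : 0 ≤ b ^ 2 * |Cq q T| * M := by positivity
  have hx1 : 0 ≤ C₁ * M := by positivity
  have key := h2 h (fun y => χ y * v q i t y) ((hχN _).mul (hs _))
    (fun k hk => iteratedDeriv_mul_eq_zero (hχN k) (hs k)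
      fun k' hk' => hv.bc t ht3 q i k' (by omega))
    (fun k _ => iteratedDeriv_eq_zero_of_vanish (ρ := 11 / 10)
      (fun y hy => by rw [hχ0 y hy, zero_mul]) (by norm_num) k) √(G * M) (Real.sqrt_nonneg _)
    ((h1 A B v M hv h t ht i).mono (by
      rw [Real.sq_sqrt (by positivity), hD, hG, add_mul]
      linarith))
    ((hv.sqNorm_cut_le hχ.continuous (fun y hy => hχ0 y (by linarith)) hb hT ht q i).trans (by
      rw [hD, hG, add_mul]
      linarith)) l hl
  rw [Real.sqrt_mul (by positivity), ← mul_assoc] at key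
  refine le_trans (le_of_eq_of_le ?_ (eLpNorm_mono_measure _
    (Measure.restrict_mono (fun y hy => ⟨hy.1, by linarith [hy.2]⟩ : Ioo (0 : ℝ) 1 ⊆ Ioc 0 2)
      le_rfl))) key
  refine eLpNorm_congr_ae ((ae_restrict_iff' measurableSet_Ioo).2
    (Eventually.of_forall fun y hy => ?_))
  have : (fun y => χ y * v q i t y) =ᶠ[𝓝 y] v q i t := by
    filter_upwards [gt_mem_nhds hy.2] with z hz
    rw [hχ1 z (le_of_lt hz), one_mul]
  exact this.symm.iteratedDeriv_eq l

end EndLp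

section TangentialSobolev

variable {d : ℕ}

lemma sq_le_integral_centered {f f' : ℝ → ℝ} (hd : ∀ y, HasDerivAt f (f' y) y)
    (hc : Continuous f') {δ : ℝ} (h0 : 0 < δ) (h1 : δ ≤ 1) (c : ℝ) :
    f c ^ 2 ≤ 2 * δ⁻¹ * ((∫ y in (c - δ)..(c + δ), f y ^ 2) + ∫ y in (c - δ)..(c + δ), f' y ^ 2) := by
  have hg : ∀ y, HasDerivAt (fun y => f (c + δ * (y - 1))) (δ * f' (c + δ * (y - 1))) y := fun y => by
    have e : HasDerivAt (fun y : ℝ => c + δ * (y - 1)) δ y :=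
      ((((hasDerivAt_id y).sub_const 1).const_mul δ).const_add c).congr_deriv (by ring)
    exact ((hd _).comp y e).congr_deriv (by ring)
  have key := sq_le_sqNorm hg (by fun_prop) one_pos le_rfl (y := 1) (by norm_num)
  have sub : ∀ g : ℝ → ℝ, ∫ y in (0 : ℝ)..2, g (c + δ * (y - 1))
      = δ⁻¹ * ∫ y in (c - δ)..(c + δ), g y := fun g => by
    have e : (fun y => g (c + δ * (y - 1))) = fun y => g (δ * y + (c - δ)) := by
      ext y; congr 1; ring
    rw [e, intervalIntegral.integral_comp_mul_add g h0.ne']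
    rw [smul_eq_mul]
    congr 2 <;> ring
  have e1 : sqNorm (fun y => f (c + δ * (y - 1))) = δ⁻¹ * ∫ y in (c - δ)..(c + δ), f y ^ 2 :=
    sub fun y => f y ^ 2
  have e2 : sqNorm (fun y => δ * f' (c + δ * (y - 1)))
      = δ ^ 2 * (δ⁻¹ * ∫ y in (c - δ)..(c + δ), f' y ^ 2) := by
    rw [← sub fun y => f' y ^ 2, ← intervalIntegral.integral_const_mul]
    simp only [sqNorm, mul_pow]
  have h2 : 0 ≤ δ⁻¹ * ∫ y in (c - δ)..(c + δ), f' y ^ 2 :=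
    mul_nonneg (inv_nonneg.2 h0.le)
      (intervalIntegral.integral_nonneg (by linarith) fun _ _ => sq_nonneg _)
  have h3 : δ ^ 2 * (δ⁻¹ * ∫ y in (c - δ)..(c + δ), f' y ^ 2)
      ≤ 1 * (δ⁻¹ * ∫ y in (c - δ)..(c + δ), f' y ^ 2) :=
    mul_le_mul_of_nonneg_right (pow_le_one₀ h0.le h1) h2
  simp only [e1, e2, sub_self, mul_zero, add_zero, inv_one, mul_one] at key
  linarith

lemma hasDerivAt_comp_update {g : (Fin d → ℝ) → ℝ} (hg : ContDiff ℝ (⊤ : ℕ∞) g)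
    (x : Fin d → ℝ) (k : Fin d) (y : ℝ) :
    HasDerivAt (fun y => g (Function.update x k y)) (pd k g (Function.update x k y)) y :=
  ((hg.differentiable (by simp) _).hasFDerivAt).comp_hasDerivAt y (hasDerivAt_update x k y)

/-- The square of a real function, with values in `ℝ≥0∞`. -/
noncomputable def ennSq (f : (Fin d → ℝ) → ℝ) : (Fin d → ℝ) → ENNReal :=
  fun x => ENNReal.ofReal (f x ^ 2)

lemma measurable_ennSq {f : (Fin d → ℝ) → ℝ} (hf : Continuous f) : Measurable (ennSq f) :=
  (hf.pow 2).measurable.ennreal_ofReal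

lemma ennSq_le_lintegral {g : (Fin d → ℝ) → ℝ} (hg : ContDiff ℝ (⊤ : ℕ∞) g) {δ : ℝ} (h0 : 0 < δ)
    (h1 : δ ≤ 1) (x : Fin d → ℝ) (k : Fin d) :
    ennSq g x ≤ ENNReal.ofReal (2 * δ⁻¹) *
      ((∫⁻ y in Ioc (x k - δ) (x k + δ), ennSq g (Function.update x k y))
        + ∫⁻ y in Ioc (x k - δ) (x k + δ), ennSq (pd k g) (Function.update x k y)) := by
  have cu : Continuous fun y => Function.update x k y := continuous_const.update k continuous_id
  have conv : ∀ f : (Fin d → ℝ) → ℝ, Continuous f →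
      ∫⁻ y in Ioc (x k - δ) (x k + δ), ennSq f (Function.update x k y)
        = ENNReal.ofReal (∫ y in (x k - δ)..(x k + δ), f (Function.update x k y) ^ 2) :=
    fun f hf => by
      rw [intervalIntegral.integral_of_le (by linarith), ofReal_integral_eq_lintegral_ofReal]
      · rfl
      · exact (((hf.comp cu).pow 2).integrableOn_Icc).mono_set Ioc_subset_Icc_self
      · exact Filter.Eventually.of_forall fun _ => sq_nonneg _
  have n : ∀ f : (Fin d → ℝ) → ℝ, 0 ≤ ∫ y in (x k - δ)..(x k + δ), f (Function.update x k y) ^ 2 :=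
    fun f => intervalIntegral.integral_nonneg (by linarith) fun _ _ => sq_nonneg _
  rw [conv g hg.continuous, conv _ (hg.pd k).continuous, ← ENNReal.ofReal_add (n _) (n _),
    ← ENNReal.ofReal_mul (by positivity)]
  refine ENNReal.ofReal_le_ofReal ?_
  have := sq_le_integral_centered (fun y => hasDerivAt_comp_update hg x k y)
    ((hg.pd k).continuous.comp cu) h0 h1 (x k)
  simpa using this

/-- Integration in `y` over `(0, 6/5)` in the normal variable and over `(x_k - δ, x_k + δ]` in the
tangential ones. -/
noncomputable def boxMeasure (N : Fin d) (δ : ℝ) (x : Fin d → ℝ) (k : Fin d) : Measure ℝ :=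
  if k = N then volume.restrict (Ioo 0 (6 / 5)) else volume.restrict (Ioc (x k - δ) (x k + δ))

instance (N : Fin d) (δ : ℝ) (x : Fin d → ℝ) (k : Fin d) : SigmaFinite (boxMeasure N δ x k) := by
  unfold boxMeasure
  split_ifs <;> infer_instance

lemma lmarginal_ennSq_le (N : Fin d) {δ : ℝ} (h0 : 0 < δ) (h1 : δ ≤ 1) (x : Fin d → ℝ)
    (ks : List (Fin d)) (hN : N ∉ ks) (hks : ks.Nodup) {g : (Fin d → ℝ) → ℝ}
    (hg : ContDiff ℝ (⊤ : ℕ∞) g) :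
    lmarginal (boxMeasure N δ x) {N} (ennSq g) x ≤ ENNReal.ofReal (2 * δ⁻¹) ^ ks.length *
      (ks.sublists'.map fun l =>
        lmarginal (boxMeasure N δ x) (insert N ks.toFinset) (ennSq (pdl l g)) x).sum := by
  induction ks with
  | nil => simp
  | cons k ks ih =>
    rw [List.nodup_cons] at hks
    rw [List.mem_cons, not_or] at hN
    refine (ih hN.2 hks.2).trans ?_
    have hkS : k ∉ insert N ks.toFinset := by simp [Ne.symm hN.1, hks.1]
    have eS : insert N (k :: ks).toFinset = insert k (insert N ks.toFinset) := by
      rw [List.toFinset_cons, Finset.insert_comm]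
    have step : ∀ f : (Fin d → ℝ) → ℝ, ContDiff ℝ (⊤ : ℕ∞) f →
        lmarginal (boxMeasure N δ x) (insert N ks.toFinset) (ennSq f) x ≤ ENNReal.ofReal (2 * δ⁻¹) *
          (lmarginal (boxMeasure N δ x) (insert k (insert N ks.toFinset)) (ennSq f) x
          + lmarginal (boxMeasure N δ x) (insert k (insert N ks.toFinset)) (ennSq (pd k f)) x) := by
      intro f hf
      rw [lmarginal_insert' _ (measurable_ennSq hf.continuous) hkS,
        lmarginal_insert' _ (measurable_ennSq (hf.pd k).continuous) hkS]
      have hb : boxMeasure N δ x k = volume.restrict (Ioc (x k - δ) (x k + δ)) :=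
        if_neg (Ne.symm hN.1)
      unfold lmarginal
      rw [← lintegral_add_left, ← lintegral_const_mul']
      · refine lintegral_mono fun y => ?_
        have e : (Function.updateFinset x (insert N ks.toFinset) y) k = x k := by
          simp only [Function.updateFinset, dif_neg hkS]
        have := ennSq_le_lintegral hf h0 h1 (Function.updateFinset x (insert N ks.toFinset) y) k
        rwa [e, ← hb] at this
      · exact ENNReal.ofReal_ne_top
      · have h2 : Measurable fun p : (Fin d → ℝ) × ℝ => ennSq f (Function.update p.1 k p.2) :=
          (measurable_ennSq hf.continuous).comp measurable_update'
        exact (h2.lintegral_prod_right').comp measurable_updateFinset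
    rw [List.length_cons, pow_succ, mul_assoc, List.sublists'_cons, List.map_append,
      List.sum_append, List.map_map, eS]
    gcongr
    have hsum : ∀ ls : List (List (Fin d)), (ls.map fun l =>
        lmarginal (boxMeasure N δ x) (insert N ks.toFinset) (ennSq (pdl l g)) x).sum
        ≤ ENNReal.ofReal (2 * δ⁻¹) * ((ls.map fun l => lmarginal (boxMeasure N δ x)
          (insert k (insert N ks.toFinset)) (ennSq (pdl l g)) x).sum
          + (ls.map fun l => lmarginal (boxMeasure N δ x)
          (insert k (insert N ks.toFinset)) (ennSq (pdl (k :: l) g)) x).sum) := by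
      intro ls
      induction ls with
      | nil => simp
      | cons l ls ih' =>
        simp only [List.map_cons, List.sum_cons]
        refine (add_le_add (step _ (hg.pdl l)) ih').trans (le_of_eq ?_)
        simp only [pdl_cons]
        ring
    exact hsum _

end TangentialSobolev

section NormalSlices

variable {d n : ℕ}

lemma updated_mem_bHalf {N : Fin d} {δ : ℝ} (hδ : d * δ ^ 2 ≤ 1 / 5)
    {x z : Fin d → ℝ} (hxs : ∑ j, x j ^ 2 < 1) (hN : z N ∈ Ioo (0 : ℝ) (6 / 5))
    (hz : ∀ k ≠ N, z k ∈ Ioc (x k - δ) (x k + δ)) : z ∈ bHalf N (19 / 10) := by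
  refine ⟨hN.1, ?_⟩
  have h1 : ∀ j, z j ^ 2 ≤ 3 / 2 * x j ^ 2 + 3 * δ ^ 2 + if j = N then (6 / 5 : ℝ) ^ 2 else 0 := by
    intro j
    by_cases hj : j = N
    · subst hj
      have := pow_le_pow_left₀ hN.1.le hN.2.le 2
      rw [if_pos rfl]
      linarith [sq_nonneg (x j), sq_nonneg δ]
    · have := hz j hj
      have h2 : |z j - x j| ≤ δ := abs_le.2 ⟨by linarith [this.1], by linarith [this.2]⟩
      have h3 : (z j - x j) ^ 2 ≤ δ ^ 2 := sq_le_sq' (by linarith [(abs_le.1 h2).1]) (abs_le.1 h2).2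
      rw [if_neg hj]
      nlinarith [sq_nonneg (x j - 2 * (z j - x j))]
  refine (Finset.sum_le_sum fun j _ => h1 j).trans_lt ?_
  rw [Finset.sum_add_distrib, Finset.sum_add_distrib, ← Finset.mul_sum]
  simp only [Finset.sum_const, Finset.card_univ, Fintype.card_fin, nsmul_eq_mul,
    Finset.sum_ite_eq', Finset.mem_univ, if_true]
  linarith

lemma lmarginal_univ_ennSq_le {N : Fin d} {δ : ℝ} (hδ : d * δ ^ 2 ≤ 1 / 5)
    {x : Fin d → ℝ} (hxs : ∑ j, x j ^ 2 < 1) {V : Fin n → (Fin d → ℝ) → ℝ}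
    (hV : ∀ i, Continuous (V i)) (i : Fin n) :
    lmarginal (boxMeasure N δ x) Finset.univ (ennSq (V i)) x
      ≤ ENNReal.ofReal (halfNorm N (19 / 10) V) := by
  rw [lmarginal_univ]
  have cs : Continuous fun x => ∑ i, V i x ^ 2 := continuous_finsetSum _ fun i _ => (hV i).pow 2
  have e : Measure.pi (boxMeasure N δ x) = volume.restrict (univ.pi fun k =>
      if k = N then Ioo (0 : ℝ) (6 / 5) else Ioc (x k - δ) (x k + δ)) := by
    rw [volume_pi, Measure.restrict_pi_pi]
    congr 1
    ext k : 1
    unfold boxMeasure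
    split_ifs <;> rfl
  rw [e]
  refine (lintegral_mono_set (t := bHalf N (19 / 10)) fun z hz => ?_).trans ?_
  · refine updated_mem_bHalf hδ hxs ?_ fun k hk => ?_
    · simpa using hz N (mem_univ _)
    · simpa [hk] using hz k (mem_univ _)
  · unfold halfNorm
    rw [ofReal_integral_eq_lintegral_ofReal (integrableOn_bHalf N _ cs)
      (Filter.Eventually.of_forall fun _ => Finset.sum_nonneg fun _ _ => sq_nonneg _)]
    exact lintegral_mono fun z => ENNReal.ofReal_le_ofReal
      (Finset.single_le_sum (f := fun i => V i z ^ 2) (fun _ _ => sq_nonneg _) (Finset.mem_univ i))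

lemma integral_sq_normal_le {N : Fin d} {δ : ℝ} (h0 : 0 < δ) (h1 : δ ≤ 1) (hδ : d * δ ^ 2 ≤ 1 / 5)
    {x : Fin d → ℝ} (hxs : ∑ j, x j ^ 2 < 1) {V : Fin n → (Fin d → ℝ) → ℝ}
    (hV : ∀ i, ContDiff ℝ (⊤ : ℕ∞) (V i)) (i : Fin n) :
    ∫ y in (0 : ℝ)..(6 / 5), V i (Function.update x N y) ^ 2
      ≤ (2 * δ⁻¹) ^ ((List.finRange d).filter (· ≠ N)).length *
        (((List.finRange d).filter (· ≠ N)).sublists'.map fun l =>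
          halfNorm N (19 / 10) fun i => pdl l (V i)).sum := by
  set ks := (List.finRange d).filter (· ≠ N) with hks
  have key := lmarginal_ennSq_le N h0 h1 x ks (by simp [hks]) ((List.nodup_finRange d).filter _) (hV i)
  have eS : insert N ks.toFinset = Finset.univ := by
    ext k
    by_cases hk : k = N <;> simp [hks, hk]
  have cu : Continuous fun y => Function.update x N y := continuous_const.update N continuous_id
  rw [lmarginal_singleton, eS] at key
  have e1 : ∫⁻ y, ennSq (V i) (Function.update x N y) ∂boxMeasure N δ x N
      = ENNReal.ofReal (∫ y in (0 : ℝ)..(6 / 5), V i (Function.update x N y) ^ 2) := by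
    have hb : boxMeasure N δ x N = volume.restrict (Ioo 0 (6 / 5)) := if_pos rfl
    rw [intervalIntegral.integral_of_le (by norm_num), integral_Ioc_eq_integral_Ioo,
      ofReal_integral_eq_lintegral_ofReal, hb]
    · rfl
    · exact ((((hV i).continuous.comp cu).pow 2).integrableOn_Icc).mono_set Ioo_subset_Icc_self
    · exact Filter.Eventually.of_forall fun _ => sq_nonneg _
  have nn : ∀ ls : List (List (Fin d)), 0 ≤ (ls.map fun l =>
      halfNorm N (19 / 10) fun i => pdl l (V i)).sum := fun ls =>
    List.sum_nonneg fun a ha => by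
      obtain ⟨l, -, rfl⟩ := List.mem_map.1 ha
      exact halfNorm_nonneg _ _ _
  have hsum : ∀ ls : List (List (Fin d)), (ls.map fun l =>
      lmarginal (boxMeasure N δ x) Finset.univ (ennSq (pdl l (V i))) x).sum
      ≤ ENNReal.ofReal (ls.map fun l => halfNorm N (19 / 10) fun i => pdl l (V i)).sum := by
    intro ls
    induction ls with
    | nil => simp
    | cons l ls ih =>
      simp only [List.map_cons, List.sum_cons]
      rw [ENNReal.ofReal_add (halfNorm_nonneg _ _ _) (nn ls)]
      exact add_le_add (lmarginal_univ_ennSq_le hδ hxs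
        (fun i => ((hV i).pdl l).continuous) i) ih
  beta_reduce at key
  rw [e1] at key
  have := key.trans (mul_le_mul_right (hsum _) _)
  rw [← ENNReal.ofReal_pow (by positivity), ← ENNReal.ofReal_mul (by positivity)] at this
  exact (ENNReal.ofReal_le_ofReal_iff (mul_nonneg (by positivity) (nn _))).1 this

variable {ι : Type*}

lemma IsSol.pdl {N : Fin d} {m : ℕ} {s : Finset ι} {L : ι → List (Fin d)}
    {A : ι → ι → ℝ → Fin n → Fin n → ℝ} {U : Fin n → ℝ → (Fin d → ℝ) → ℝ}
    (h : IsSol N m s L A U) {l : List (Fin d)} (hl : ∀ k ∈ l, k ≠ N) :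
    IsSol N m s L A fun i t => pdl l (U i t) := by
  induction l with
  | nil => exact h
  | cons k l ih =>
    rw [List.forall_mem_cons] at hl
    exact (ih hl.2).pd hl.1

lemma exists_integral_sq_slice_le (N : Fin d) {m : ℕ} (hm : m ≠ 0) {lam K : ℝ} (hlam : 0 < lam)
    (hK : 0 ≤ K) (s : Finset ι) (L : ι → List (Fin d)) (hL : ∀ a ∈ s, (L a).length = m)
    (q : List (Fin d)) (hq : ∀ k ∈ q, k ≠ N) (T : ℝ) :
    ∃ C, 0 ≤ C ∧ (T ∈ Ioo (-3 : ℝ) 0 → ∀ A : ι → ι → ℝ → Fin n → Fin n → ℝ,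
      (∀ t, LHForm s L m lam fun a b => A a b t) → (∀ a b t i j, |A a b t i j| ≤ K) →
      ∀ U, IsSol N m s L A U → ∀ x : Fin d → ℝ, ∑ j, x j ^ 2 < 1 → ∀ i, ∀ t ∈ Ico T 0,
        ∫ y in (0 : ℝ)..(6 / 5), _root_.pdl q (U i t) (Function.update x N y) ^ 2
          ≤ C * ∫ t in (-3)..0, halfNorm N 2 fun i => U i t) := by
  by_cases hT : T ∈ Ioo (-3 : ℝ) 0
  swap
  · exact ⟨0, le_rfl, fun h => absurd h hT⟩
  have hdp : 0 < (d : ℝ) := Nat.cast_pos.2 N.pos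
  obtain ⟨δ, h0, h1, hδ⟩ : ∃ δ : ℝ, 0 < δ ∧ δ ≤ 1 ∧ d * δ ^ 2 ≤ 1 / 5 := by
    have hd1 : (1 : ℝ) ≤ d := by exact_mod_cast N.pos
    refine ⟨1 / (3 * d), by positivity, ?_, ?_⟩
    · rw [div_le_one (by positivity)]; linarith
    · have e : (d : ℝ) * (1 / (3 * d)) ^ 2 = 1 / (9 * d) := by field_simp; norm_num
      rw [e, div_le_div_iff₀ (by positivity) (by positivity)]
      linarith
  set ks := (List.finRange d).filter (· ≠ N) with hks
  have hks' : ∀ l ∈ ks.sublists', ∀ k ∈ l ++ q, k ≠ N := fun l hl k hk => by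
    rcases List.mem_append.1 hk with h | h
    · have := (List.mem_sublists'.1 hl).subset h
      simpa [hks] using this
    · exact hq k h
  have hsum : ∀ ls : List (List (Fin d)), (∀ l ∈ ls, ∀ k ∈ l ++ q, k ≠ N) →
      ∃ C, 0 ≤ C ∧ ∀ A : ι → ι → ℝ → Fin n → Fin n → ℝ,
      (∀ t, LHForm s L m lam fun a b => A a b t) → (∀ a b t i j, |A a b t i j| ≤ K) →
      ∀ U, IsSol N m s L A U → ∀ t ∈ Ico T 0,
        (ls.map fun l => halfNorm N (19 / 10) fun i => _root_.pdl l (_root_.pdl q (U i t))).sum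
          ≤ C * ∫ t in (-3)..0, halfNorm N 2 fun i => U i t := by
    intro ls
    induction ls with
    | nil => exact fun _ => ⟨0, le_rfl, fun A _ _ U _ t _ => by simp⟩
    | cons l ls ih =>
      intro h
      rw [List.forall_mem_cons] at h
      obtain ⟨C₁, hC₁, h₁⟩ := ih h.2
      obtain ⟨C₂, hC₂, h₂⟩ := exists_tangential_energy (n := n) N hm hlam hK s L hL (l ++ q) h.1
        (r := 19 / 10) (by norm_num) (by norm_num) hT.1 hT.2.le
      refine ⟨C₂ + C₁, add_nonneg hC₂ hC₁, fun A hA hb U hU t ht => ?_⟩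
      rw [List.map_cons, List.sum_cons, add_mul]
      refine add_le_add ?_ (h₁ A hA hb U hU t ht)
      have := h₂ A hA hb U hU t ⟨ht.1, ht.2.le⟩
      simpa only [pdl_append] using this
  obtain ⟨C, hC, h⟩ := hsum ks.sublists' hks'
  refine ⟨(2 * δ⁻¹) ^ ks.length * C, by positivity, fun _ A hA hb U hU x hx i t ht => ?_⟩
  refine (integral_sq_normal_le h0 h1 hδ hx (V := fun i => _root_.pdl q (U i t))
    (fun i => ((hU.smooth i).slice t).pdl q) i).trans ?_
  rw [mul_assoc]
  exact mul_le_mul_of_nonneg_left (h A hA hb U hU t ht) (by positivity)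

end NormalSlices

section NormalSystem

variable {d n : ℕ}

lemma iteratedDeriv_comp_update {g : (Fin d → ℝ) → ℝ} (hg : ContDiff ℝ (⊤ : ℕ∞) g)
    (x : Fin d → ℝ) (N : Fin d) (k : ℕ) :
    iteratedDeriv k (fun y => g (Function.update x N y))
      = fun y => pdl (List.replicate k N) g (Function.update x N y) := by
  induction k with
  | zero => simp
  | succ k ih =>
    rw [iteratedDeriv_succ, ih, List.replicate_succ]
    ext y
    exact (hasDerivAt_comp_update (hg.pdl _) x N y).deriv

lemma perm_replicate_append_filter (N : Fin d) (l : List (Fin d)) :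
    l.Perm (List.replicate (l.count N) N ++ l.filter (· ≠ N)) := by
  rw [List.perm_iff_count]
  intro k
  rw [List.count_append, List.count_replicate]
  by_cases hk : k = N
  · subst hk
    simp [List.count_eq_zero_of_not_mem]
  · rw [List.count_filter (by simpa using hk)]
    simp [Ne.symm hk]

/-- Lists of tangential directions. -/
abbrev TangList (N : Fin d) : Type := {l : List (Fin d) // ∀ k ∈ l, k ≠ N}

/-- Prepend the tangential entries of a list. -/
def TangList.prepend {N : Fin d} (l : List (Fin d)) (q : TangList N) : TangList N :=
  ⟨l.filter (· ≠ N) ++ q.1, fun k hk => by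
    rcases List.mem_append.1 hk with h | h
    · simpa using (List.mem_filter.1 h).2
    · exact q.2 k h⟩

lemma pdl_eq_replicate_prepend {N : Fin d} {f : (Fin d → ℝ) → ℝ} (hf : ContDiff ℝ (⊤ : ℕ∞) f)
    (l : List (Fin d)) (q : TangList N) :
    pdl l (pdl q.1 f) = pdl (List.replicate (l.count N) N) (pdl (q.prepend l).1 f) := by
  rw [← pdl_append, ← pdl_append, TangList.prepend, ← List.append_assoc]
  exact pdl_perm hf ((perm_replicate_append_filter N l).append_right _)

lemma prod_map_single (N : Fin d) (l : List (Fin d)) :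
    (l.map (Pi.single N (1 : ℝ) : Fin d → ℝ)).prod = if ∀ k ∈ l, k = N then 1 else 0 := by
  induction l with
  | nil => simp
  | cons k l ih =>
    rw [List.map_cons, List.prod_cons, ih]
    by_cases hk : k = N
    · subst hk; simp
    · simp [hk]

lemma count_append_lt {N : Fin d} {m : ℕ} {l l' : List (Fin d)} (hl : l.length = m)
    (hl' : l'.length = m) (h : ¬((∀ k ∈ l, k = N) ∧ ∀ k ∈ l', k = N)) :
    (l ++ l').count N < 2 * m := by
  refine lt_of_le_of_ne (List.count_le_length.trans ?_) fun e => h ?_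
  · rw [List.length_append, hl, hl']; omega
  · have e2 : (l ++ l').count N = (l ++ l').length := by
      rw [e, List.length_append, hl, hl']; omega
    rw [List.count_eq_length] at e2
    exact ⟨fun k hk => (e2 k (List.mem_append_left _ hk)).symm,
      fun k hk => (e2 k (List.mem_append_right _ hk)).symm⟩

variable {ι : Type}

open Classical in
/-- Pairs of indices for which both derivatives are purely normal. -/
noncomputable def normalPairs (N : Fin d) (s : Finset ι) (L : ι → List (Fin d)) : Finset (ι × ι) :=
  (s ×ˢ s).filter fun p => (∀ k ∈ L p.1, k = N) ∧ ∀ k ∈ L p.2, k = N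

open Classical in
/-- Pairs of indices involving some tangential derivative. -/
noncomputable def mixedPairs (N : Fin d) (s : Finset ι) (L : ι → List (Fin d)) : Finset (ι × ι) :=
  (s ×ˢ s).filter fun p => ¬((∀ k ∈ L p.1, k = N) ∧ ∀ k ∈ L p.2, k = N)

lemma sum_normalPairs_add_sum_mixedPairs (N : Fin d) (s : Finset ι) (L : ι → List (Fin d))
    (f : ι → ι → ℝ) :
    ∑ p ∈ normalPairs N s L, f p.1 p.2 + ∑ p : mixedPairs N s L, f p.1.1 p.1.2
      = ∑ a ∈ s, ∑ b ∈ s, f a b := by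
  classical
  rw [Finset.sum_coe_sort (mixedPairs N s L) fun p => f p.1 p.2, ← Finset.sum_product']
  exact Finset.sum_filter_add_sum_filter_not _ _ _

lemma LHForm.normal {N : Fin d} {s : Finset ι} {L : ι → List (Fin d)} {m : ℕ} {lam : ℝ}
    {B : ι → ι → Fin n → Fin n → ℝ} (h : LHForm s L m lam B) (ξ : Fin n → ℝ) :
    lam * ∑ i, ξ i ^ 2 ≤ ∑ i, ∑ j, (∑ p ∈ normalPairs N s L, B p.1 p.2 i j) * ξ i * ξ j := by
  have key := h ξ (Pi.single N 1)
  have e1 : ∑ k, (Pi.single N (1 : ℝ) : Fin d → ℝ) k ^ 2 = 1 := by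
    rw [Finset.sum_eq_single N]
    · simp
    · intro k _ hk; simp [hk]
    · simp
  rw [e1, one_pow, mul_one] at key
  refine key.trans (le_of_eq ?_)
  rw [← Finset.sum_product', normalPairs, ← Finset.sum_filter_add_sum_filter_not (s ×ˢ s)
    (fun p => (∀ k ∈ L p.1, k = N) ∧ ∀ k ∈ L p.2, k = N)]
  have e2 : ∑ p ∈ (s ×ˢ s).filter (fun p => ¬((∀ k ∈ L p.1, k = N) ∧ ∀ k ∈ L p.2, k = N)),
      ∑ i, ∑ j, B p.1 p.2 i j * ξ i * ξ j * (((L p.1).map (Pi.single N (1 : ℝ) : Fin d → ℝ)).prod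
        * ((L p.2).map (Pi.single N (1 : ℝ) : Fin d → ℝ)).prod) = 0 :=
    Finset.sum_eq_zero fun p hp => by
      have hp' := (Finset.mem_filter.1 hp).2
      have : ((L p.1).map (Pi.single N (1 : ℝ) : Fin d → ℝ)).prod
        * ((L p.2).map (Pi.single N (1 : ℝ) : Fin d → ℝ)).prod = 0 := by
        rw [prod_map_single, prod_map_single]
        rcases not_and_or.1 hp' with h | h <;> simp [h]
      simp [this]
  rw [e2, add_zero]
  calc _ = ∑ p ∈ (s ×ˢ s).filter (fun p => (∀ k ∈ L p.1, k = N) ∧ ∀ k ∈ L p.2, k = N),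
      ∑ i, ∑ j, B p.1 p.2 i j * ξ i * ξ j := Finset.sum_congr rfl fun p hp => by
        have hp' := (Finset.mem_filter.1 hp).2
        rw [prod_map_single, prod_map_single, if_pos hp'.1, if_pos hp'.2]
        simp
    _ = _ := by
        rw [Finset.sum_comm]
        refine Finset.sum_congr rfl fun i _ => ?_
        rw [Finset.sum_comm]
        refine Finset.sum_congr rfl fun j _ => ?_
        rw [Finset.sum_mul, Finset.sum_mul]

lemma IsSol.normalSys {N : Fin d} {m : ℕ} {lam K : ℝ} (hK : 0 ≤ K) {s : Finset ι}
    {L : ι → List (Fin d)} (hL : ∀ a ∈ s, (L a).length = m)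
    {A : ι → ι → ℝ → Fin n → Fin n → ℝ} (hA : ∀ t, LHForm s L m lam fun a b => A a b t)
    (hb : ∀ a b t i j, |A a b t i j| ≤ K) {U : Fin n → ℝ → (Fin d → ℝ) → ℝ}
    (hU : IsSol N m s L A U) {x : Fin d → ℝ} (hxN : x N = 0) (hx : ∑ j, x j ^ 2 < 1)
    {Cq : TangList N → ℝ → ℝ}
    (hC : ∀ (q : TangList N) T, T ∈ Ioo (-3 : ℝ) 0 → ∀ i, ∀ t ∈ Ico T 0,
        ∫ y in (0 : ℝ)..(6 / 5), _root_.pdl q.1 (U i t) (Function.update x N y) ^ 2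
          ≤ Cq q T * ∫ t in (-3)..0, halfNorm N 2 fun i => U i t) :
    NormalSys m n (Q := TangList N) (E := mixedPairs N s L)
      (fun e => (L e.1.1 ++ L e.1.2).count N) (fun e => TangList.prepend (L e.1.1 ++ L e.1.2))
      lam (((normalPairs N s L).card + 1) * K) Cq
      (fun t i j => ∑ p ∈ normalPairs N s L, A p.1 p.2 t i j)
      (fun e t i j => -((-1) ^ m * A e.1.1 e.1.2 t i j))
      (fun q i t y => _root_.pdl q.1 (U i t) (Function.update x N y))
      (∫ t in (-3)..0, halfNorm N 2 fun i => U i t) where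
  smooth q i := by
    have h : ContDiff ℝ (⊤ : ℕ∞) fun p : ℝ × ℝ => (p.1, Function.update x N p.2) :=
      contDiff_fst.prodMk ((contDiff_update _ x N).comp contDiff_snd)
    exact ContDiff.comp (g := fun p : ℝ × (Fin d → ℝ) => _root_.pdl q.1 (U i p.1) p.2)
      ((hU.smooth i).pdl q.1) h
  ell t ξ := (hA t).normal ξ
  bdA t i j := by
    refine (Finset.abs_sum_le_sum_abs _ _).trans ((Finset.sum_le_card_nsmul _ _ K
      fun p _ => hb _ _ _ _ _).trans ?_)
    rw [nsmul_eq_mul]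
    linarith
  bdB e t i j := by
    rw [abs_neg, abs_mul, abs_pow, abs_neg, abs_one, one_pow, one_mul]
    refine (hb _ _ _ _ _).trans ?_
    have : 0 ≤ ((normalPairs N s L).card : ℝ) * K := by positivity
    linarith
  bc t ht q i k hk := by
    rw [iteratedDeriv_comp_update (((hU.smooth i).slice t).pdl q.1)]
    have e : Function.update x N 0 = x := by rw [← hxN, Function.update_eq_self]
    beta_reduce
    rw [e]
    exact (hU.pdl q.2).bc t ht x hxN (hx.trans (by norm_num)) i _ (by simpa using hk)
  eqn := by
    have h : ∀ᵐ t, ∀ q : TangList N, t ∈ Ioo (-3 : ℝ) 0 → ∀ x ∈ bHalf N 2, ∀ i,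
        deriv (fun τ => _root_.pdl q.1 (U i τ) x) t = -((-1) ^ m * ∑ a ∈ s, ∑ b ∈ s, ∑ j,
          A a b t i j * _root_.pdl (L a ++ L b) (_root_.pdl q.1 (U j t)) x) :=
      ae_all_iff.2 fun q => (hU.pdl q.2).eqn
    filter_upwards [h] with t ht htm y hy q i
    have hmem : Function.update x N y ∈ bHalf N 2 := by
      refine ⟨by simpa using hy.1, ?_⟩
      have h1 : ∑ j, Function.update x N y j ^ 2 ≤ ∑ j, (x j ^ 2 + if j = N then y ^ 2 else 0) := by
        refine Finset.sum_le_sum fun j _ => ?_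
        by_cases hj : j = N
        · subst hj; simp [sq_nonneg]
        · simp [hj]
      rw [Finset.sum_add_distrib] at h1
      simp only [Finset.sum_ite_eq', Finset.mem_univ, if_true] at h1
      have h2 := pow_le_pow_left₀ hy.1.le hy.2.le 2
      linarith
    rw [ht q htm _ hmem i, ← sum_normalPairs_add_sum_mixedPairs N s L, mul_add, neg_add]
    congr 1
    · congr 2
      rw [Finset.sum_comm]
      refine Finset.sum_congr rfl fun j _ => ?_
      rw [Finset.sum_mul]
      refine Finset.sum_congr rfl fun p hp => ?_
      have hp' := (Finset.mem_filter.1 hp).2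
      have hps := Finset.mem_product.1 (Finset.mem_filter.1 hp).1
      rw [iteratedDeriv_comp_update (((hU.smooth j).slice t).pdl q.1)]
      have e : L p.1 ++ L p.2 = List.replicate (2 * m) N := by
        rw [List.eq_replicate_iff]
        refine ⟨by rw [List.length_append, hL _ hps.1, hL _ hps.2]; omega, fun k hk => ?_⟩
        rcases List.mem_append.1 hk with h | h
        · exact hp'.1 k h
        · exact hp'.2 k h
      rw [e]
    · rw [Finset.mul_sum, ← Finset.sum_neg_distrib]
      refine Finset.sum_congr rfl fun e _ => ?_
      rw [Finset.mul_sum, ← Finset.sum_neg_distrib]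
      refine Finset.sum_congr rfl fun j _ => ?_
      rw [iteratedDeriv_comp_update (((hU.smooth j).slice t).pdl _),
        pdl_eq_replicate_prepend ((hU.smooth j).slice t)]
      ring
  M_nonneg := intervalIntegral.integral_nonneg (by norm_num) fun _ _ => halfNorm_nonneg _ _ _
  energy q i T hT t ht := hC q T hT i t ht

lemma exists_eLpNorm_slice_le (N : Fin d) {m : ℕ} (hm : 1 ≤ m) {lam K : ℝ} (hlam : 0 < lam)
    (hK : 0 ≤ K) (s : Finset ι) (L : ι → List (Fin d)) (hL : ∀ a ∈ s, (L a).length = m)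
    {p : ℝ} (hp : 2 < p) (l : List (Fin d)) (hl : l.length ≤ 2 * m) {T : ℝ}
    (hT : T ∈ Ioo (-3 : ℝ) 0) :
    ∃ C, 0 ≤ C ∧ ∀ A : ι → ι → ℝ → Fin n → Fin n → ℝ,
      (∀ t, LHForm s L m lam fun a b => A a b t) → (∀ a b t i j, |A a b t i j| ≤ K) →
      ∀ U, IsSol N m s L A U → ∀ x : Fin d → ℝ, x N = 0 → ∑ j, x j ^ 2 < 1 → ∀ t ∈ Ico T 0, ∀ i,
        eLpNorm (fun y => pdl l (U i t) (Function.update x N y)) (ENNReal.ofReal p)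
          (volume.restrict (Ioo (0 : ℝ) 1))
          ≤ ENNReal.ofReal (C * √(∫ t in (-3)..0, halfNorm N 2 fun i => U i t)) := by
  choose Cq hCq0 hCq using fun (q : TangList N) T =>
    exists_integral_sq_slice_le (n := n) N (by omega : m ≠ 0) hlam hK s L hL q.1 q.2 T
  obtain ⟨C, hC, h⟩ := exists_eLpNorm_normalSys_le (n := n) (Q := TangList N)
    (E := mixedPairs N s L)
    (jj := fun e => (L e.1.1 ++ L e.1.2).count N)
    (sh := fun e => TangList.prepend (L e.1.1 ++ L e.1.2)) (lam₀ := lam)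
    (K₀ := ((normalPairs N s L).card + 1) * K) (Cq := Cq) hm (fun e => by
      have he := Finset.mem_filter.1 e.2
      have hes := Finset.mem_product.1 he.1
      exact count_append_lt (hL _ hes.1) (hL _ hes.2) he.2) hlam hp
      (TangList.prepend l ⟨[], by simp⟩) hT
  refine ⟨C, hC, fun A hA hb U hU x hxN hx t ht i => ?_⟩
  have key := h _ _ _ _ (hU.normalSys hK hL hA hb hxN hx (Cq := Cq) fun q T hT i t ht =>
    hCq q T hT A hA hb U hU x hx i t ht) t ht i (l.count N) (List.count_le_length.trans hl)
  rw [iteratedDeriv_comp_update (((hU.smooth i).slice t).pdl _),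
    ← pdl_eq_replicate_prepend ((hU.smooth i).slice t)] at key
  exact key

end NormalSystem

section SliceIntegration

variable {d n : ℕ}

lemma sum_sq_update_zero_le (x : Fin d → ℝ) (N : Fin d) :
    ∑ j, Function.update x N 0 j ^ 2 ≤ ∑ j, x j ^ 2 :=
  Finset.sum_le_sum fun j _ => by
    by_cases hj : j = N
    · subst hj; simp [sq_nonneg]
    · simp [hj]

lemma abs_lt_one_of_sum_sq {x : Fin d → ℝ} (hx : ∑ j, x j ^ 2 < 1) (k : Fin d) : |x k| < 1 := by
  rw [← sq_lt_one_iff_abs_lt_one]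
  exact (Finset.single_le_sum (f := fun j => x j ^ 2) (fun _ _ => sq_nonneg _)
    (Finset.mem_univ k)).trans_lt hx

lemma setLIntegral_bHalf_le (N : Fin d) {g : (Fin d → ℝ) → ENNReal} (hg : Measurable g)
    {B : ENNReal} (hB : ∀ x : Fin d → ℝ, x N = 0 → ∑ j, x j ^ 2 < 1 →
      ∫⁻ y in Ioo (0 : ℝ) 1, g (Function.update x N y) ≤ B) :
    ∫⁻ x in bHalf N 1, g x ≤ 2 ^ d * B := by
  set μ : Fin d → Measure ℝ := fun _ => volume.restrict (Ioo (-1) 1) with hμ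
  have mS : MeasurableSet (bHalf N 1) := (isOpen_bHalf N 1).measurableSet
  have mG : Measurable ((bHalf N 1).indicator g) := hg.indicator mS
  have hsub : bHalf N 1 ⊆ univ.pi fun _ => Ioo (-1 : ℝ) 1 := fun x hx k _ => by
    have := abs_lt_one_of_sum_sq (by simpa using hx.2) k
    exact ⟨(abs_lt.1 this).1, (abs_lt.1 this).2⟩
  have e : ∫⁻ x in bHalf N 1, g x = ∫⁻ x, (bHalf N 1).indicator g x ∂Measure.pi μ := by
    have : Measure.pi μ = volume.restrict (univ.pi fun _ => Ioo (-1 : ℝ) 1) := by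
      rw [volume_pi, Measure.restrict_pi_pi]
    rw [this, lintegral_indicator mS, Measure.restrict_restrict mS, inter_eq_self_of_subset_left hsub]
  have inner : ∀ x : Fin d → ℝ,
      ∫⁻ y, (bHalf N 1).indicator g (Function.update x N y) ∂μ N ≤ B := fun x => by
    by_cases hx : ∑ j, Function.update x N 0 j ^ 2 < 1
    · refine le_trans ?_ (hB (Function.update x N 0) (by simp) hx)
      simp only [Function.update_idem]
      rw [← lintegral_indicator (s := Ioo (0 : ℝ) 1) measurableSet_Ioo]
      refine (lintegral_mono' Measure.restrict_le_self le_rfl).trans (lintegral_mono fun y => ?_)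
      by_cases hy : Function.update x N y ∈ bHalf N 1
      · have h1 := abs_lt_one_of_sum_sq (x := Function.update x N y) (by simpa using hy.2) N
        have h2 := hy.1
        simp only [Function.update_self] at h1 h2
        rw [indicator_of_mem hy, indicator_of_mem (show y ∈ Ioo 0 1 from ⟨h2, (abs_lt.1 h1).2⟩)]
      · rw [indicator_of_notMem hy]; exact zero_le
    · have : ∀ y, (bHalf N 1).indicator g (Function.update x N y) = 0 := fun y =>
        indicator_of_notMem (fun hy => hx (by
          have h1 := sum_sq_update_zero_le (Function.update x N y) N
          rw [Function.update_idem] at h1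
          exact h1.trans_lt (by simpa using hy.2))) _
      simp [this]
  have eu : (Finset.univ : Finset (Fin d)) = insert N (Finset.univ.erase N) := by
    rw [Finset.insert_erase (Finset.mem_univ N)]
  have e2 := congrFun (lmarginal_univ (μ := μ) (f := (bHalf N 1).indicator g)) 0
  rw [e]
  refine le_trans (le_of_eq e2.symm) ?_
  rw [eu, lmarginal_insert' _ mG (by simp)]
  unfold lmarginal
  refine (lintegral_mono fun y => inner _).trans ?_
  rw [lintegral_const, Measure.pi_univ, mul_comm]
  gcongr
  have hm : ∀ i : (Finset.univ.erase N : Finset (Fin d)), μ i univ = 2 := fun i => by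
    simp only [hμ, Measure.restrict_apply_univ, Real.volume_Ioo]
    norm_num
  rw [Finset.prod_congr rfl fun i _ => hm i, Finset.prod_const, Finset.card_univ, Fintype.card_coe]
  exact pow_le_pow_right₀ (by norm_num) ((Finset.card_le_univ _).trans (by simp))

lemma setLIntegral_Ioo_prod (a b : ℝ) (N : Fin d) (r : ℝ) {g : ℝ × (Fin d → ℝ) → ENNReal}
    (hg : Measurable g) :
    ∫⁻ p in Ioo a b ×ˢ bHalf N r, g p = ∫⁻ t in Ioo a b, ∫⁻ x in bHalf N r, g (t, x) := by
  rw [Measure.volume_eq_prod, ← Measure.prod_restrict, lintegral_prod _ hg.aemeasurable]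

lemma eLpNorm_prod_le_of_slices (N : Fin d) {f : ℝ × (Fin d → ℝ) → ℝ} (hf : Continuous f) {p : ℝ}
    (hp : 1 ≤ p) {B : ENNReal}
    (hB : ∀ t ∈ Ioo (-1 : ℝ) 0, ∀ x : Fin d → ℝ, x N = 0 → ∑ j, x j ^ 2 < 1 →
      eLpNorm (fun y => f (t, Function.update x N y)) (ENNReal.ofReal p)
        (volume.restrict (Ioo (0 : ℝ) 1)) ≤ B) :
    eLpNorm f (ENNReal.ofReal p) (volume.restrict (Ioo (-1) 0 ×ˢ bHalf N 1)) ≤ 2 ^ d * B := by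
  have p0 : 0 < p := by linarith
  have hp0 : ENNReal.ofReal p ≠ 0 := (ENNReal.ofReal_pos.2 p0).ne'
  have hpt : ENNReal.ofReal p ≠ ⊤ := ENNReal.ofReal_ne_top
  have tp : (ENNReal.ofReal p).toReal = p := ENNReal.toReal_ofReal p0.le
  have mg : Measurable fun z : ℝ × (Fin d → ℝ) => ‖f z‖ₑ ^ p :=
    (hf.measurable.enorm).pow_const p
  have h1 : ∀ t ∈ Ioo (-1 : ℝ) 0, ∫⁻ x in bHalf N 1, ‖f (t, x)‖ₑ ^ p ≤ 2 ^ d * B ^ p := by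
    intro t ht
    refine setLIntegral_bHalf_le N (mg.comp measurable_prodMk_left) fun x hx hxs => ?_
    have := hB t ht x hx hxs
    rw [eLpNorm_eq_lintegral_rpow_enorm_toReal hp0 hpt, tp, one_div] at this
    exact (ENNReal.rpow_inv_le_iff p0).1 this
  rw [eLpNorm_eq_lintegral_rpow_enorm_toReal hp0 hpt, tp, one_div, ENNReal.rpow_inv_le_iff p0,
    setLIntegral_Ioo_prod _ _ _ _ mg]
  refine (setLIntegral_mono' measurableSet_Ioo h1).trans ?_
  rw [setLIntegral_const, Real.volume_Ioo, ENNReal.mul_rpow_of_nonneg _ _ p0.le]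
  have : ENNReal.ofReal (0 - -1) = 1 := by norm_num
  rw [this, mul_one]
  gcongr
  rw [← ENNReal.rpow_natCast, ← ENNReal.rpow_mul]
  refine ENNReal.rpow_le_rpow_of_exponent_le (by norm_num) ?_
  have : (0 : ℝ) ≤ d := Nat.cast_nonneg d
  exact le_mul_of_one_le_right this hp

end SliceIntegration

section Coordinates

variable {d n : ℕ}

/-- The scalar component `w_k` as a function of time and of the coordinates of the space point. -/
def flat (w : ℝ × EuclideanSpace ℝ (Fin d) → EuclideanSpace ℝ (Fin n)) (k : Fin n) (t : ℝ)
    (x : Fin d → ℝ) : ℝ := w (t, WithLp.toLp 2 x) k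

/-- The list of directions attached to a multi-index. -/
def dirList (γ : Fin d → ℕ) : List (Fin d) :=
  (List.finRange d).flatMap fun i => List.replicate (γ i) i

lemma count_dirList (γ : Fin d → ℕ) (k : Fin d) : (dirList γ).count k = γ k := by
  rw [dirList, List.count_flatMap, List.sum_map_eq_nsmul_single k]
  · simp [List.count_eq_one_of_mem (List.nodup_finRange d) (List.mem_finRange k)]
  · intro i hi _
    simp [List.count_replicate, hi]

lemma length_dirList (γ : Fin d → ℕ) : (dirList γ).length = ∑ i, γ i := by
  simp [dirList, List.length_flatMap, Fin.sum_univ_def]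

lemma prod_map_dirList (γ : Fin d → ℕ) (η : Fin d → ℝ) :
    ((dirList γ).map η).prod = ∏ k, η k ^ γ k := by
  have : ∀ l : List (Fin d), ((l.flatMap fun i => List.replicate (γ i) i).map η).prod
      = (l.map fun k => η k ^ γ k).prod := fun l => by
    induction l with
    | nil => rfl
    | cons i l ih => simp [List.flatMap_cons, ih]
  rw [dirList, this, Fin.prod_univ_def]

lemma dirList_add_perm (α β : Fin d → ℕ) : (dirList (α + β)).Perm (dirList α ++ dirList β) := by
  rw [List.perm_iff_count]
  intro k
  simp [List.count_append, count_dirList]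

variable {w : ℝ × EuclideanSpace ℝ (Fin d) → EuclideanSpace ℝ (Fin n)}

lemma contDiff_flat (hw : ContDiff ℝ (⊤ : ℕ∞) w) (k : Fin n) : SmoothST (flat w k) := by
  have h1 : ContDiff ℝ (⊤ : ℕ∞) fun p : ℝ × (Fin d → ℝ) =>
      ((p.1, WithLp.toLp 2 p.2) : ℝ × EuclideanSpace ℝ (Fin d)) :=
    contDiff_fst.prodMk ((PiLp.contDiff_toLp).comp contDiff_snd)
  exact (contDiff_piLp_apply 2).comp (hw.comp h1)

lemma contDiff_pder (hw : ContDiff ℝ (⊤ : ℕ∞) w) (i : Fin d) : ContDiff ℝ (⊤ : ℕ∞) (pder i w) := by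
  have e : pder i w = fun p => fderiv ℝ w p (0, EuclideanSpace.single i 1) := by
    ext1 p
    have h1 : HasFDerivAt (fun y : EuclideanSpace ℝ (Fin d) => (p.1, y))
        (ContinuousLinearMap.inr ℝ ℝ (EuclideanSpace ℝ (Fin d))) p.2 := hasFDerivAt_prodMk_right _ _
    have h2 := ((hw.differentiable (by simp) (p.1, p.2)).hasFDerivAt).comp p.2 h1
    rw [pder]
    erw [h2.fderiv]
    rfl
  rw [e]
  exact (hw.fderiv_right (m := (⊤ : ℕ∞)) (by simp)).clm_apply contDiff_const

lemma flat_pder (hw : ContDiff ℝ (⊤ : ℕ∞) w) (i : Fin d) (k : Fin n) (t : ℝ) :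
    flat (pder i w) k t = pd i (flat w k t) := by
  ext x
  have h0 : DifferentiableAt ℝ (fun y => w (t, y)) (WithLp.toLp 2 x) :=
    (hw.comp (contDiff_const.prodMk contDiff_id)).differentiable (by simp) _
  have h1 : HasFDerivAt (fun x : Fin d → ℝ => (WithLp.toLp 2 x : EuclideanSpace ℝ (Fin d)))
      ((PiLp.continuousLinearEquiv 2 ℝ fun _ : Fin d => ℝ).symm :
        (Fin d → ℝ) →L[ℝ] EuclideanSpace ℝ (Fin d)) x :=
    (PiLp.continuousLinearEquiv 2 ℝ fun _ : Fin d => ℝ).symm.hasFDerivAt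
  have h2 : HasFDerivAt (fun x : Fin d → ℝ => w (t, WithLp.toLp 2 x)) _ x :=
    h0.hasFDerivAt.comp x h1
  have h3 := ((EuclideanSpace.proj k : EuclideanSpace ℝ (Fin n) →L[ℝ] ℝ).hasFDerivAt).comp x h2
  rw [pd]
  erw [h3.fderiv]
  rfl

lemma contDiff_iterate_pder (hw : ContDiff ℝ (⊤ : ℕ∞) w) (i : Fin d) (r : ℕ) :
    ContDiff ℝ (⊤ : ℕ∞) ((pder i)^[r] w) := by
  induction r with
  | zero => exact hw
  | succ r ih => rw [Function.iterate_succ_apply']; exact contDiff_pder ih i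

lemma flat_iterate_pder (hw : ContDiff ℝ (⊤ : ℕ∞) w) (i : Fin d) (r : ℕ) (k : Fin n) (t : ℝ) :
    flat ((pder i)^[r] w) k t = pdl (List.replicate r i) (flat w k t) := by
  induction r with
  | zero => rfl
  | succ r ih =>
    rw [Function.iterate_succ_apply', flat_pder (contDiff_iterate_pder hw i r), ih]
    rfl

lemma contDiff_Dmul (hw : ContDiff ℝ (⊤ : ℕ∞) w) (γ : Fin d → ℕ) :
    ContDiff ℝ (⊤ : ℕ∞) (Dmul γ w) := by
  unfold Dmul
  induction List.finRange d with
  | nil => exact hw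
  | cons i l ih => exact contDiff_iterate_pder ih i _

lemma flat_Dmul (hw : ContDiff ℝ (⊤ : ℕ∞) w) (γ : Fin d → ℕ) (k : Fin n) (t : ℝ) :
    flat (Dmul γ w) k t = pdl (dirList γ) (flat w k t) := by
  have : ∀ l : List (Fin d), ContDiff ℝ (⊤ : ℕ∞) (l.foldr (fun i v => (pder i)^[γ i] v) w) ∧
      flat (l.foldr (fun i v => (pder i)^[γ i] v) w) k t
        = pdl (l.flatMap fun i => List.replicate (γ i) i) (flat w k t) := fun l => by
    induction l with
    | nil => exact ⟨hw, rfl⟩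
    | cons i l ih =>
      refine ⟨contDiff_iterate_pder ih.1 i _, ?_⟩
      rw [List.foldr_cons, flat_iterate_pder ih.1, ih.2, List.flatMap_cons, pdl_append]
  exact (this _).2

lemma tder_apply (hw : ContDiff ℝ (⊤ : ℕ∞) w) (k : Fin n) (t : ℝ) (x : Fin d → ℝ) :
    tder w (t, WithLp.toLp 2 x) k = deriv (fun τ => flat w k τ x) t := by
  have h0 : DifferentiableAt ℝ (fun s => w (s, WithLp.toLp 2 x)) t :=
    (hw.comp (contDiff_id.prodMk contDiff_const)).differentiable (by simp) _
  have := ((EuclideanSpace.proj k : EuclideanSpace ℝ (Fin n) →L[ℝ] ℝ).hasFDerivAt).comp_hasDerivAt t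
    h0.hasDerivAt
  exact this.deriv.symm

/-- Coordinates on the space variable. -/
def toEuclid (p : ℝ × (Fin d → ℝ)) : ℝ × EuclideanSpace ℝ (Fin d) := (p.1, WithLp.toLp 2 p.2)

lemma measurePreserving_toEuclid : MeasurePreserving (toEuclid (d := d)) :=
  (MeasurePreserving.id (volume : Measure ℝ)).prod (PiLp.volume_preserving_toLp (Fin d))

lemma toEuclid_preimage_QCylP (m : ℕ) (N : Fin d) {r : ℝ} (hr : 0 < r) :
    toEuclid ⁻¹' QCylP d m N r 0 = Ioo (-r ^ (2 * m)) 0 ×ˢ bHalf N r := by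
  ext p
  have h : ‖(WithLp.toLp 2 p.2 : EuclideanSpace ℝ (Fin d))‖ < r ↔ ∑ j, p.2 j ^ 2 < r ^ 2 := by
    rw [EuclideanSpace.norm_eq, Real.sqrt_lt' hr]
    simp
  simp only [QCylP, QCyl, toEuclid, mem_preimage, mem_ofPred_eq, mem_prod, Prod.fst_zero,
    Prod.snd_zero, zero_sub, mem_ball_zero_iff, h, bHalf]
  tauto

lemma measurableSet_QCylP (m : ℕ) (N : Fin d) (r : ℝ) (X : ℝ × EuclideanSpace ℝ (Fin d)) :
    MeasurableSet (QCylP d m N r X) :=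
  (measurableSet_Ioo.prod measurableSet_ball).inter
    (isOpen_lt continuous_const (by fun_prop : Continuous fun p : ℝ × EuclideanSpace ℝ (Fin d) =>
      p.2 N)).measurableSet

lemma measurePreserving_toEuclid_restrict (m : ℕ) (N : Fin d) {r : ℝ} (hr : 0 < r) :
    MeasurePreserving toEuclid (volume.restrict (Ioo (-r ^ (2 * m)) 0 ×ˢ bHalf N r))
      (volume.restrict (QCylP d m N r 0)) := by
  rw [← toEuclid_preimage_QCylP m N hr]
  exact measurePreserving_toEuclid.restrict_preimage (measurableSet_QCylP m N r 0)

end Coordinates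

section Reduction

variable {d n : ℕ} {u : ℝ × EuclideanSpace ℝ (Fin d) → EuclideanSpace ℝ (Fin n)}

lemma length_dirList_of_mem {m : ℕ} {α : Fin d → ℕ} (h : α ∈ MIdx d m) :
    (dirList α).length = m := by
  rw [length_dirList]
  exact (Finset.mem_filter.1 h).2

lemma LegHad.lhForm {m : ℕ} {lam : ℝ} {B : (Fin d → ℕ) → (Fin d → ℕ) → Fin n → Fin n → ℝ}
    (h : LegHad d n m lam B) : LHForm (MIdx d m) dirList m lam B := fun ξ η => by
  simpa only [prod_map_dirList] using h ξ η

lemma pdl_eq_zero_of_flat {N : Fin d} {g : (Fin d → ℝ) → ℝ} {R : ℝ}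
    (h : ∀ x, x N = 0 → ∑ j, x j ^ 2 < R → g x = 0)
    (hg : ContDiff ℝ (⊤ : ℕ∞) g) {l : List (Fin d)} (hl : ∀ k ∈ l, k ≠ N) :
    ∀ x, x N = 0 → ∑ j, x j ^ 2 < R → pdl l g x = 0 := by
  induction l with
  | nil => exact h
  | cons k l ih =>
    rw [List.forall_mem_cons] at hl
    intro x hx hxs
    have h1 := hasDerivAt_comp_update (hg.pdl l) x k (x k)
    rw [Function.update_eq_self] at h1
    have hev : (fun y => pdl l g (Function.update x k y)) =ᶠ[𝓝 (x k)] fun _ => 0 := by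
      have c : Continuous fun y => ∑ j, Function.update x k y j ^ 2 := by
        have cu : Continuous fun y => Function.update x k y :=
          continuous_const.update k continuous_id
        exact continuous_finsetSum _ fun j _ => ((continuous_apply j).comp cu).pow 2
      filter_upwards [(isOpen_lt c continuous_const).mem_nhds
        (show x k ∈ {y | ∑ j, Function.update x k y j ^ 2 < R} by simpa using hxs)] with y hy
      exact ih hl.2 _ (by rw [Function.update_of_ne hl.1.symm, hx]) hy
    rw [pdl_cons, ← h1.deriv, hev.deriv_eq, deriv_const]

lemma neg_two_pow_le {m : ℕ} (hm : 1 ≤ m) : -(2 : ℝ) ^ (2 * m) ≤ -3 := by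
  have : (2 : ℝ) ^ 2 ≤ 2 ^ (2 * m) := pow_le_pow_right₀ (by norm_num) (by omega)
  linarith

lemma isSol_flat {m : ℕ} (hm : 1 ≤ m) (N : Fin d)
    {A : (Fin d → ℕ) → (Fin d → ℕ) → ℝ → Fin n → Fin n → ℝ} (hu : ContDiff ℝ (⊤ : ℕ∞) u)
    (heq : ∀ᵐ p ∂(volume.restrict (QCylP d m N 2 0)), ∀ i,
        tder u p i + (-1 : ℝ) ^ m * ∑ α ∈ MIdx d m, ∑ β ∈ MIdx d m, ∑ j,
          A α β p.1 i j * Dmul (α + β) u p j = 0)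
    (hbc : ∀ q ∈ QCyl d m 2 (0 : ℝ × EuclideanSpace ℝ (Fin d)), q.2 N = 0 →
        ∀ k < m, (pder N)^[k] u q = 0) :
    IsSol N m (MIdx d m) dirList A (flat u) where
  smooth i := contDiff_flat hu i
  eqn := by
    have h1 := (measurePreserving_toEuclid_restrict m N two_pos).quasiMeasurePreserving.ae heq
    rw [Measure.volume_eq_prod, ← Measure.prod_restrict] at h1
    have h2 := Measure.ae_ae_of_ae_prod h1
    rw [ae_restrict_iff' measurableSet_Ioo] at h2
    filter_upwards [h2] with t ht htm x hx i
    have h3 := ht ⟨(neg_two_pow_le hm).trans_lt htm.1, htm.2⟩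
    have h4 : (fun x => deriv (fun τ => flat u i τ x) t) =ᵐ[volume.restrict (bHalf N 2)]
        fun x => -((-1) ^ m * ∑ a ∈ MIdx d m, ∑ b ∈ MIdx d m, ∑ j,
          A a b t i j * pdl (dirList a ++ dirList b) (flat u j t) x) := by
      filter_upwards [h3] with x hx
      have := hx i
      simp only [toEuclid, tder_apply hu] at this
      have e : ∀ α β j, Dmul (α + β) u (t, WithLp.toLp 2 x) j
          = pdl (dirList α ++ dirList β) (flat u j t) x := fun α β j => by
        rw [← pdl_perm ((contDiff_flat hu j).slice t) (dirList_add_perm α β), ← flat_Dmul hu]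
        rfl
      simp only [e] at this
      linarith
    refine Measure.eqOn_open_of_ae_eq h4 (isOpen_bHalf N 2) ?_ ?_ hx
    · exact ((contDiff_flat hu i).dt.slice t).continuous.continuousOn
    · refine Continuous.continuousOn (Continuous.neg (continuous_const.mul
        (continuous_finsetSum _ fun a _ => continuous_finsetSum _ fun b _ =>
          continuous_finsetSum _ fun j _ => continuous_const.mul ?_)))
      exact (((contDiff_flat hu j).slice t).pdl _).continuous
  bc t ht x hx hxs i l hl := by
    have hs := (contDiff_flat hu i).slice t
    rw [pdl_perm hs ((perm_replicate_append_filter N l).trans List.perm_append_comm), pdl_append]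
    refine pdl_eq_zero_of_flat (R := 2 ^ 2) (fun x hx hxs => ?_) (hs.pdl _)
      (fun k hk => by simpa using (List.mem_filter.1 hk).2) x hx hxs
    rw [← flat_iterate_pder hu]
    have hq : (t, (WithLp.toLp 2 x : EuclideanSpace ℝ (Fin d))) ∈ QCyl d m 2 0 := by
      refine ⟨⟨?_, ht.2⟩, ?_⟩
      · have := neg_two_pow_le hm
        simp only [Prod.fst_zero, zero_sub]
        linarith [ht.1]
      · simp only [Prod.snd_zero, mem_ball_zero_iff]
        rw [EuclideanSpace.norm_eq, Real.sqrt_lt' two_pos]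
        simpa using hxs
    have := hbc _ hq (by simpa using hx) (l.count N) (List.count_le_length.trans_lt hl)
    simp [flat, this]

lemma integral_halfNorm_flat_le {m : ℕ} (hm : 1 ≤ m) (N : Fin d) (hu : ContDiff ℝ (⊤ : ℕ∞) u) :
    √(∫ t in (-3)..0, halfNorm N 2 fun i => flat u i t) ≤ L2Norm (QCylP d m N 2 0) u := by
  have mp := measurePreserving_toEuclid_restrict (d := d) m N two_pos
  have hcu : Continuous fun p : ℝ × (Fin d → ℝ) => u (toEuclid p) :=
    hu.continuous.comp (continuous_fst.prodMk ((PiLp.continuous_toLp 2 _).comp continuous_snd))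
  have hfin : eLpNorm u 2 (volume.restrict (QCylP d m N 2 0)) < ⊤ := by
    rw [← eLpNorm_comp_measurePreserving hu.continuous.aestronglyMeasurable mp]
    have hK : IsCompact (Icc (-(2 : ℝ) ^ (2 * m)) 0 ×ˢ {x : Fin d → ℝ | ∑ j, x j ^ 2 ≤ 2 ^ 2}) :=
      isCompact_Icc.prod (isCompact_sumSq_le _)
    have hsub : Ioo (-(2 : ℝ) ^ (2 * m)) 0 ×ˢ bHalf N 2 ⊆
        Icc (-(2 : ℝ) ^ (2 * m)) 0 ×ˢ {x : Fin d → ℝ | ∑ j, x j ^ 2 ≤ 2 ^ 2} :=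
      prod_mono Ioo_subset_Icc_self fun x hx => hx.2.le
    have h2 : MemLp (u ∘ toEuclid) 2
        (volume.restrict (Ioo (-(2 : ℝ) ^ (2 * m)) 0 ×ˢ bHalf N 2)) :=
      (memLp_two_iff_integrable_sq_norm hcu.aestronglyMeasurable).2
        (((hcu.norm.pow 2).continuousOn.integrableOn_compact hK).mono_set hsub)
    exact h2.eLpNorm_lt_top
  refine Real.sqrt_le_iff.2 ⟨ENNReal.toReal_nonneg, ?_⟩
  rw [L2Norm, ← ENNReal.toReal_pow]
  refine (ENNReal.ofReal_le_iff_le_toReal (ENNReal.pow_lt_top hfin).ne).1 ?_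
  rw [← eLpNorm_comp_measurePreserving hu.continuous.aestronglyMeasurable mp]
  have sq : ∀ t x, ENNReal.ofReal (∑ i, flat u i t x ^ 2) = ‖u (toEuclid (t, x))‖ₑ ^ (2 : ℝ) :=
    fun t x => by
      rw [ENNReal.rpow_ofNat, ← ofReal_norm, ← ENNReal.ofReal_pow (norm_nonneg _),
        EuclideanSpace.norm_sq_eq]
      simp [flat, toEuclid]
  have cs : ∀ t, Continuous fun x => ∑ i, flat u i t x ^ 2 := fun t =>
    continuous_finsetSum _ fun i _ => ((contDiff_flat hu i).slice t).continuous.pow 2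
  have e1 : ENNReal.ofReal (∫ t in (-3)..0, halfNorm N 2 fun i => flat u i t)
      = ∫⁻ p in Ioo (-3 : ℝ) 0 ×ˢ bHalf N 2, ‖u (toEuclid p)‖ₑ ^ (2 : ℝ) := by
    rw [setLIntegral_Ioo_prod _ _ _ _ (hcu.measurable.enorm.pow_const _),
      intervalIntegral.integral_of_le (by norm_num), integral_Ioc_eq_integral_Ioo,
      ofReal_integral_eq_lintegral_ofReal]
    · refine lintegral_congr fun t => ?_
      rw [halfNorm, ofReal_integral_eq_lintegral_ofReal (integrableOn_bHalf N 2 (cs t))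
        (Filter.Eventually.of_forall fun _ => Finset.sum_nonneg fun _ _ => sq_nonneg _)]
      exact lintegral_congr fun x => sq t x
    · exact ((continuous_halfNorm N 2 fun i => contDiff_flat hu i).integrableOn_Icc).mono_set
        Ioo_subset_Icc_self
    · exact Filter.Eventually.of_forall fun _ => halfNorm_nonneg _ _ _
  have e2 : eLpNorm (u ∘ toEuclid) 2 (volume.restrict (Ioo (-(2 : ℝ) ^ (2 * m)) 0 ×ˢ bHalf N 2)) ^ 2
      = ∫⁻ p in Ioo (-(2 : ℝ) ^ (2 * m)) 0 ×ˢ bHalf N 2, ‖u (toEuclid p)‖ₑ ^ (2 : ℝ) := by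
    rw [eLpNorm_eq_lintegral_rpow_enorm_toReal (by norm_num) (by norm_num), ENNReal.toReal_ofNat,
      ← ENNReal.rpow_natCast, ← ENNReal.rpow_mul]
    norm_num
  rw [e1, e2]
  exact lintegral_mono_set (prod_mono (Ioo_subset_Ioo_left (neg_two_pow_le hm)) subset_rfl)

lemma norm_le_sum_abs (v : EuclideanSpace ℝ (Fin n)) : ‖v‖ ≤ ∑ i, |v i| := by
  rw [EuclideanSpace.norm_eq]
  refine Real.sqrt_le_iff.2 ⟨Finset.sum_nonneg fun _ _ => abs_nonneg _, ?_⟩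
  simp only [Real.norm_eq_abs]
  exact Finset.sum_sq_le_sq_sum_of_nonneg fun _ _ => abs_nonneg _

end Reduction

section FinalEstimate

variable {d n : ℕ}

lemma exists_eLpNorm_Dmul_le (n : ℕ) {m : ℕ} (hm : 1 ≤ m) (N : Fin d) {K lam pp : ℝ} (hK : 0 ≤ K)
    (hlam : 0 < lam) (hp : 2 < pp) (γ : Fin d → ℕ) (hγ : ∑ i, γ i ≤ 2 * m) :
    ∃ C, 0 ≤ C ∧ ∀ A : (Fin d → ℕ) → (Fin d → ℕ) → ℝ → Fin n → Fin n → ℝ,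
      (∀ α β t i j, |A α β t i j| ≤ K) → (∀ t : ℝ, LegHad d n m lam (fun α β => A α β t)) →
      ∀ u : ℝ × EuclideanSpace ℝ (Fin d) → EuclideanSpace ℝ (Fin n), ContDiff ℝ (⊤ : ℕ∞) u →
      IsSol N m (MIdx d m) dirList A (flat u) →
      eLpNorm (Dmul γ u) (ENNReal.ofReal pp) (volume.restrict (QCylP d m N 1 0))
        ≤ ENNReal.ofReal (C * L2Norm (QCylP d m N 2 0) u) := by
  obtain ⟨C, hC, h⟩ := exists_eLpNorm_slice_le (n := n) N hm hlam hK (MIdx d m) dirList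
    (fun a ha => length_dirList_of_mem ha) hp (dirList γ) (by rwa [length_dirList])
    (T := -1) (by norm_num)
  refine ⟨n * (2 ^ d * C), by positivity, fun A hA hLH u hu hsol => ?_⟩
  have hL2 : 0 ≤ L2Norm (QCylP d m N 2 0) u := ENNReal.toReal_nonneg
  have hcD : Continuous (Dmul γ u) := (contDiff_Dmul hu γ).continuous
  have hci : ∀ i, Continuous fun p => Dmul γ u p i := fun i => by fun_prop
  have comp : ∀ i, eLpNorm (fun p => Dmul γ u p i) (ENNReal.ofReal pp)
      (volume.restrict (QCylP d m N 1 0))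
      ≤ ENNReal.ofReal (2 ^ d * C * L2Norm (QCylP d m N 2 0) u) := fun i => by
    have mp := measurePreserving_toEuclid_restrict (d := d) m N one_pos
    rw [← eLpNorm_comp_measurePreserving (hci i).aestronglyMeasurable mp, one_pow, mul_assoc,
      ENNReal.ofReal_mul (by positivity), ENNReal.ofReal_pow (by norm_num), ENNReal.ofReal_ofNat]
    refine eLpNorm_prod_le_of_slices N ((hci i).comp
      (continuous_fst.prodMk ((PiLp.continuous_toLp 2 _).comp continuous_snd))) (by linarith)
      fun t ht x hx hxs => ?_
    have e : (fun y => ((fun p => Dmul γ u p i) ∘ toEuclid) (t, Function.update x N y))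
        = fun y => pdl (dirList γ) (flat u i t) (Function.update x N y) := by
      rw [← flat_Dmul hu]
      rfl
    change eLpNorm (fun y => ((fun p => Dmul γ u p i) ∘ toEuclid) (t, Function.update x N y)) _ _ ≤ _
    rw [e]
    refine (h A (fun t => (hLH t).lhForm) hA (flat u) hsol x hx hxs t ⟨ht.1.le, ht.2⟩ i).trans
      (ENNReal.ofReal_le_ofReal ?_)
    exact mul_le_mul_of_nonneg_left (integral_halfNorm_flat_le hm N hu) hC
  have p1 : 1 ≤ ENNReal.ofReal pp := ENNReal.one_le_ofReal.2 (by linarith)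
  calc _ ≤ eLpNorm (fun p => ∑ i, |Dmul γ u p i|) (ENNReal.ofReal pp)
        (volume.restrict (QCylP d m N 1 0)) := eLpNorm_mono_real fun p => norm_le_sum_abs _
    _ ≤ ∑ i, eLpNorm (fun p => |Dmul γ u p i|) (ENNReal.ofReal pp)
        (volume.restrict (QCylP d m N 1 0)) := by
        rw [← Finset.sum_fn]
        exact eLpNorm_sum_le (fun i _ => (hci i).abs.aestronglyMeasurable) p1
    _ ≤ ∑ _ : Fin n, ENNReal.ofReal (2 ^ d * C * L2Norm (QCylP d m N 2 0) u) :=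
        Finset.sum_le_sum fun i _ => by
          refine le_trans (le_of_eq ?_) (comp i)
          exact eLpNorm_norm fun p => Dmul γ u p i
    _ = _ := by
        rw [Finset.sum_const, Finset.card_univ, Fintype.card_fin, nsmul_eq_mul,
          mul_assoc (n : ℝ), ENNReal.ofReal_mul (Nat.cast_nonneg n), ENNReal.ofReal_natCast]

lemma abs_apply_le_norm (v : EuclideanSpace ℝ (Fin n)) (i : Fin n) : |v i| ≤ ‖v‖ :=
  PiLp.norm_apply_le v i

lemma norm_tder_le {m : ℕ} {K : ℝ} (hK : 0 ≤ K)
    {A : (Fin d → ℕ) → (Fin d → ℕ) → ℝ → Fin n → Fin n → ℝ} (hA : ∀ α β t i j, |A α β t i j| ≤ K)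
    {u : ℝ × EuclideanSpace ℝ (Fin d) → EuclideanSpace ℝ (Fin n)}
    {p : ℝ × EuclideanSpace ℝ (Fin d)} (heq : ∀ i,
        tder u p i + (-1 : ℝ) ^ m * ∑ α ∈ MIdx d m, ∑ β ∈ MIdx d m, ∑ j,
          A α β p.1 i j * Dmul (α + β) u p j = 0) :
    ‖tder u p‖ ≤ ∑ q ∈ MIdx d m ×ˢ MIdx d m, n * (n * K) * ‖Dmul (q.1 + q.2) u p‖ := by
  have h1 : ∀ i, |tder u p i|
      ≤ ∑ q ∈ MIdx d m ×ˢ MIdx d m, n * K * ‖Dmul (q.1 + q.2) u p‖ := fun i => by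
    have e : tder u p i = -((-1 : ℝ) ^ m * ∑ q ∈ MIdx d m ×ˢ MIdx d m, ∑ j,
        A q.1 q.2 p.1 i j * Dmul (q.1 + q.2) u p j) := by
      rw [Finset.sum_product]
      linarith [heq i]
    rw [e, abs_neg, abs_mul, abs_pow, abs_neg, abs_one, one_pow, one_mul]
    refine (Finset.abs_sum_le_sum_abs _ _).trans (Finset.sum_le_sum fun q _ => ?_)
    refine (Finset.abs_sum_le_sum_abs _ _).trans ((Finset.sum_le_card_nsmul _ _
      (K * ‖Dmul (q.1 + q.2) u p‖) fun j _ => ?_).trans (le_of_eq ?_))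
    · rw [abs_mul]
      exact mul_le_mul (hA _ _ _ _ _) (abs_apply_le_norm _ j) (abs_nonneg _) hK
    · rw [Finset.card_univ, Fintype.card_fin, nsmul_eq_mul, mul_assoc]
  refine (norm_le_sum_abs _).trans ((Finset.sum_le_card_nsmul _ _ _ fun i _ => h1 i).trans
    (le_of_eq ?_))
  rw [Finset.card_univ, Fintype.card_fin, nsmul_eq_mul, Finset.mul_sum]
  exact Finset.sum_congr rfl fun q _ => by ring

lemma eLpNorm_tder_le {m : ℕ} (N : Fin d) {K : ℝ} (hK : 0 ≤ K) {pp : ℝ} (hp : 1 ≤ pp)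
    {A : (Fin d → ℕ) → (Fin d → ℕ) → ℝ → Fin n → Fin n → ℝ} (hA : ∀ α β t i j, |A α β t i j| ≤ K)
    {u : ℝ × EuclideanSpace ℝ (Fin d) → EuclideanSpace ℝ (Fin n)} (hu : ContDiff ℝ (⊤ : ℕ∞) u)
    (heq : ∀ᵐ p ∂(volume.restrict (QCylP d m N 2 0)), ∀ i,
        tder u p i + (-1 : ℝ) ^ m * ∑ α ∈ MIdx d m, ∑ β ∈ MIdx d m, ∑ j,
          A α β p.1 i j * Dmul (α + β) u p j = 0) :
    eLpNorm (tder u) (ENNReal.ofReal pp) (volume.restrict (QCylP d m N 1 0))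
      ≤ ∑ q ∈ MIdx d m ×ˢ MIdx d m, ENNReal.ofReal (n * (n * K)) *
        eLpNorm (Dmul (q.1 + q.2) u) (ENNReal.ofReal pp) (volume.restrict (QCylP d m N 1 0)) := by
  have hsub : QCylP d m N 1 0 ⊆ QCylP d m N 2 0 := fun p hp => by
    refine ⟨⟨⟨lt_of_le_of_lt ?_ hp.1.1.1, hp.1.1.2⟩, ball_subset_ball (by norm_num) hp.1.2⟩, hp.2⟩
    have : (1 : ℝ) ^ (2 * m) ≤ 2 ^ (2 * m) := pow_le_pow_left₀ zero_le_one (by norm_num) _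
    linarith
  have h1 : ∀ᵐ p ∂(volume.restrict (QCylP d m N 1 0)), ‖tder u p‖
      ≤ ∑ q ∈ MIdx d m ×ˢ MIdx d m, n * (n * K) * ‖Dmul (q.1 + q.2) u p‖ :=
    (ae_restrict_of_ae_restrict_of_subset hsub heq).mono fun p hp => norm_tder_le hK hA hp
  refine (eLpNorm_mono_ae_real h1).trans ?_
  rw [← Finset.sum_fn]
  refine (eLpNorm_sum_le (fun q _ => ?_) (ENNReal.one_le_ofReal.2 hp)).trans
    (Finset.sum_le_sum fun q _ => ?_)
  · exact (continuous_const.mul (contDiff_Dmul hu _).continuous.norm).aestronglyMeasurable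
  · have hc : (0 : ℝ) ≤ n * (n * K) := by positivity
    refine (eLpNorm_const_smul_le (c := (n * (n * K) : ℝ))
      (f := fun p => ‖Dmul (q.1 + q.2) u p‖)).trans (le_of_eq ?_)
    rw [Real.enorm_eq_ofReal hc, eLpNorm_norm]

end FinalEstimate

theorem statement_8 (d n m : ℕ) (hd : 1 ≤ d) (hn : 1 ≤ n) (hm : 1 ≤ m)
    (iN : Fin d) (hiN : (iN : ℕ) = d - 1)
    (K lam pp : ℝ) (hK : 0 ≤ K) (hlam : 0 < lam) (hp : 2 < pp) :
    ∃ C : ℝ, 0 < C ∧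
      ∀ A : (Fin d → ℕ) → (Fin d → ℕ) → ℝ → Fin n → Fin n → ℝ,
      (∀ α β i j, Measurable fun t => A α β t i j) →
      (∀ α β t i j, |A α β t i j| ≤ K) →
      (∀ t : ℝ, LegHad d n m lam (fun α β => A α β t)) →
      ∀ u : ℝ × EuclideanSpace ℝ (Fin d) → EuclideanSpace ℝ (Fin n),
      ContDiff ℝ (⊤ : ℕ∞) u →
      (∀ᵐ p ∂(volume.restrict (QCylP d m iN 2 0)), ∀ i,
        tder u p i + (-1 : ℝ) ^ m * ∑ α ∈ MIdx d m, ∑ β ∈ MIdx d m, ∑ j,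
          A α β p.1 i j * Dmul (α + β) u p j = 0) →
      (∀ q ∈ QCyl d m 2 (0 : ℝ × EuclideanSpace ℝ (Fin d)), q.2 iN = 0 →
        ∀ k < m, (pder iN)^[k] u q = 0) →
      (eLpNorm (tder u) (ENNReal.ofReal pp) (volume.restrict (QCylP d m iN 1 0))).toReal
        + ∑ γ ∈ MIdxLe d (2 * m),
            (eLpNorm (Dmul γ u) (ENNReal.ofReal pp)
              (volume.restrict (QCylP d m iN 1 0))).toReal
        ≤ C * L2Norm (QCylP d m iN 2 0) u := by
  have hex : ∀ γ : Fin d → ℕ, ∃ C, 0 ≤ C ∧ (∑ i, γ i ≤ 2 * m →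
      ∀ A : (Fin d → ℕ) → (Fin d → ℕ) → ℝ → Fin n → Fin n → ℝ,
      (∀ α β t i j, |A α β t i j| ≤ K) → (∀ t : ℝ, LegHad d n m lam (fun α β => A α β t)) →
      ∀ u : ℝ × EuclideanSpace ℝ (Fin d) → EuclideanSpace ℝ (Fin n), ContDiff ℝ (⊤ : ℕ∞) u →
      IsSol iN m (MIdx d m) dirList A (flat u) →
      eLpNorm (Dmul γ u) (ENNReal.ofReal pp) (volume.restrict (QCylP d m iN 1 0))
        ≤ ENNReal.ofReal (C * L2Norm (QCylP d m iN 2 0) u)) := fun γ => by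
    by_cases hγ : ∑ i, γ i ≤ 2 * m
    · obtain ⟨C, hC, h⟩ := exists_eLpNorm_Dmul_le n hm iN hK hlam hp γ hγ
      exact ⟨C, hC, fun _ => h⟩
    · exact ⟨0, le_rfl, fun h => absurd h hγ⟩
  choose C hC h using hex
  refine ⟨∑ q ∈ MIdx d m ×ˢ MIdx d m, n * (n * K) * C (q.1 + q.2)
    + ∑ γ ∈ MIdxLe d (2 * m), C γ + 1, ?_, fun A _ hA hLH u hu heq hbc => ?_⟩
  · have h1 : 0 ≤ ∑ q ∈ MIdx d m ×ˢ MIdx d m, n * (n * K) * C (q.1 + q.2) :=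
      Finset.sum_nonneg fun q _ => mul_nonneg (by positivity) (hC _)
    have h2 : 0 ≤ ∑ γ ∈ MIdxLe d (2 * m), C γ := Finset.sum_nonneg fun γ _ => hC γ
    linarith
  have hsol := isSol_flat hm iN hu heq hbc
  have hL2 : 0 ≤ L2Norm (QCylP d m iN 2 0) u := ENNReal.toReal_nonneg
  have hD : ∀ γ, ∑ i, γ i ≤ 2 * m → (eLpNorm (Dmul γ u) (ENNReal.ofReal pp)
      (volume.restrict (QCylP d m iN 1 0))).toReal ≤ C γ * L2Norm (QCylP d m iN 2 0) u :=
    fun γ hγ => ENNReal.toReal_le_of_le_ofReal (mul_nonneg (hC γ) hL2) (h γ hγ A hA hLH u hu hsol)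
  have hq : ∀ q ∈ MIdx d m ×ˢ MIdx d m, ∑ i, (q.1 + q.2) i ≤ 2 * m := fun q hq => by
    have hq' := Finset.mem_product.1 hq
    have h1 := (Finset.mem_filter.1 hq'.1).2
    have h2 := (Finset.mem_filter.1 hq'.2).2
    simp only [Pi.add_apply, Finset.sum_add_distrib, h1, h2]
    omega
  have hT : (eLpNorm (tder u) (ENNReal.ofReal pp) (volume.restrict (QCylP d m iN 1 0))).toReal
      ≤ (∑ q ∈ MIdx d m ×ˢ MIdx d m, n * (n * K) * C (q.1 + q.2))
        * L2Norm (QCylP d m iN 2 0) u := by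
    have c0 : (0 : ℝ) ≤ n * (n * K) := by positivity
    refine ENNReal.toReal_le_of_le_ofReal (mul_nonneg (Finset.sum_nonneg fun q _ =>
      mul_nonneg c0 (hC _)) hL2) ((eLpNorm_tder_le iN hK (by linarith) hA hu heq).trans ?_)
    rw [Finset.sum_mul, ENNReal.ofReal_sum_of_nonneg fun q _ =>
      mul_nonneg (mul_nonneg c0 (hC _)) hL2]
    refine Finset.sum_le_sum fun q hqm => ?_
    rw [mul_assoc, ENNReal.ofReal_mul c0]
    exact mul_le_mul_right (h _ (hq q hqm) A hA hLH u hu hsol) _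
  have hS : ∑ γ ∈ MIdxLe d (2 * m), (eLpNorm (Dmul γ u) (ENNReal.ofReal pp)
      (volume.restrict (QCylP d m iN 1 0))).toReal
      ≤ (∑ γ ∈ MIdxLe d (2 * m), C γ) * L2Norm (QCylP d m iN 2 0) u := by
    rw [Finset.sum_mul]
    exact Finset.sum_le_sum fun γ hγ => hD γ (Finset.mem_filter.1 hγ).2
  rw [add_mul, add_mul, one_mul]
  linarith
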